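/- The group of compactly supported, area-preserving homeomorphisms of the open unit disc is not a simple group (the Simplicity Conjecture): there exists a normal subgroup of this group that is neither trivial nor the whole group. -/

import Mathlib

open MeasureTheory

/-- The open unit disc in `ℝ²`. -/
def Disc : Set (EuclideanSpace ℝ (Fin 2)) := Metric.ball 0 1

/-- Two-dimensional Lebesgue measure on the open unit disc, obtained by restricting
(Lebesgue) volume to the subtype. -/
noncomputable def discMeasure : Measure ↥Disc :=
  Measure.comap Subtype.val volume

/-- Membership in `G = Homeo_c(D², μ_std)`: a bijection of the open unit disc which is a
homeomorphism (it and its inverse are continuous), preserves Lebesgue measure, and is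
compactly supported. -/
def IsCptAreaPresHomeo (f : Equiv.Perm ↥Disc) : Prop :=
  Continuous ⇑f ∧ Continuous ⇑f.symm ∧
    MeasurePreserving ⇑f discMeasure discMeasure ∧
    ∃ K : Set ↥Disc, IsCompact K ∧ ∀ x ∉ K, f x = x

set_option linter.unusedSectionVars false

namespace Braid

open Matrix Topology Filter ComplexConjugate

section Words

variable {ι R : Type*} [DecidableEq ι] [Fintype ι] [CommRing R]

/-- The matrix of the map `z_a ↦ t z_a + (1 - t) z_b`. -/
def rotM (t : R) (a b : ι) : Matrix ι ι R := Matrix.of fun i k =>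
  if i = a then t * (1 : Matrix ι ι R) a k + (1 - t) * (1 : Matrix ι ι R) b k
  else (1 : Matrix ι ι R) i k

theorem rotM_mulVec (t : R) (a b : ι) (z : ι → R) (i : ι) :
    (rotM t a b *ᵥ z) i = if i = a then t * z a + (1 - t) * z b else z i := by
  have h : ∀ i, ∑ k, (1 : Matrix ι ι R) i k * z k = z i := fun i => by
    simpa [Matrix.mulVec, dotProduct] using congrFun (Matrix.one_mulVec z) i
  by_cases hi : i = a
  · simp [rotM, Matrix.mulVec, dotProduct, hi, add_mul, mul_assoc, Finset.sum_add_distrib,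
      ← Finset.mul_sum, h]
  · simp [rotM, Matrix.mulVec, dotProduct, hi, h]

theorem rotM_mul (t s : R) (h : t * s = 1) (a b : ι) : rotM t a b * rotM s a b = 1 := by
  refine Matrix.toLin'.injective (LinearMap.ext fun z => funext fun i => ?_)
  rw [Matrix.toLin'_apply, Matrix.toLin'_apply, ← Matrix.mulVec_mulVec, Matrix.one_mulVec,
    rotM_mulVec]
  simp only [rotM_mulVec]
  by_cases hi : i = a
  · subst hi
    by_cases hb : b = i
    · subst hb; simp; ring
    · simp only [if_true, hb, if_false]
      linear_combination (z i - z b) * h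
  · simp [hi]

def rot (τ : Rˣ) (a b : ι) : GL ι R :=
  ⟨rotM τ a b, rotM ↑τ⁻¹ a b, rotM_mul _ _ (by simp) a b, rotM_mul _ _ (by simp) a b⟩

theorem rot_mulVec (τ : Rˣ) (a b : ι) (z : ι → R) (i : ι) :
    ((rot τ a b).1 *ᵥ z) i = if i = a then τ * z a + (1 - τ) * z b else z i :=
  rotM_mulVec _ _ _ _ _

theorem rot_inv_mulVec (τ : Rˣ) (a b : ι) (z : ι → R) (i : ι) :
    ((rot τ a b)⁻¹.1 *ᵥ z) i =
      if i = a then ((τ⁻¹ : Rˣ) : R) * z a + (1 - ((τ⁻¹ : Rˣ) : R)) * z b else z i :=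
  rotM_mulVec _ _ _ _ _

/-- Action of the elementary exchange of the adjacent labels `a` (left) and `b` (right). -/
noncomputable def el (τ : Rˣ) (U : ι → ℝ) (a b : ι) : GL ι R :=
  if U a < U b then rot τ a b else (rot τ b a)⁻¹

inductive Wd (τ : Rˣ) (U : ι → ℝ) (P : ι → ι → Prop) : List ι → List ι → GL ι R → Prop
  | refl (l) : Wd τ U P l l 1
  | swap (a b l) : P a b → Wd τ U P (a :: b :: l) (b :: a :: l) (el τ U a b)
  | cons (x) {l l' T} : Wd τ U P l l' T → Wd τ U P (x :: l) (x :: l') T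
  | trans {l l' l'' T T'} : Wd τ U P l l' T → Wd τ U P l' l'' T' → Wd τ U P l l'' (T' * T)

variable {τ : Rˣ} {U U' : ι → ℝ} {P P' : ι → ι → Prop} {l l' l'' : List ι} {T T' : GL ι R}

theorem Wd.perm (h : Wd τ U P l l' T) : l.Perm l' := by
  induction h with
  | refl l => exact List.Perm.refl l
  | swap a b l _ => exact List.Perm.swap b a l
  | cons x _ ih => exact ih.cons x
  | trans _ _ h1 h2 => exact h1.trans h2

theorem Wd.mem (h : Wd τ U P l l' T) (S : Subgroup (GL ι R)) (hS : ∀ a b, P a b → el τ U a b ∈ S) :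
    T ∈ S := by
  induction h with
  | refl l => exact S.one_mem
  | swap a b l h => exact hS a b h
  | cons x _ ih => exact ih
  | trans _ _ h1 h2 => exact S.mul_mem h2 h1

theorem Wd.mono (h : Wd τ U P l l' T) (hP : ∀ a b, P a b → P' a b)
    (hU : ∀ a b, P a b → (U a < U b ↔ U' a < U' b)) : Wd τ U' P' l l' T := by
  induction h with
  | refl l => exact .refl l
  | swap a b l h =>
    have : el τ U a b = el τ U' a b := by simp [el, hU a b h]
    rw [this]; exact .swap a b l (hP a b h)
  | cons x _ ih => exact ih.cons x
  | trans _ _ h1 h2 => exact h1.trans h2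

theorem Wd.move (b : ι) (l1 l2 : List ι) (hP : ∀ a ∈ l1, P a b) :
    ∃ T : GL ι R, Wd τ U P (l1 ++ b :: l2) (b :: (l1 ++ l2)) T := by
  induction l1 with
  | nil => exact ⟨1, .refl _⟩
  | cons a l1 ih =>
    obtain ⟨T, hT⟩ := ih fun a ha => hP a (List.mem_cons_of_mem _ ha)
    exact ⟨_, (hT.cons a).trans (.swap a b _ (hP a List.mem_cons_self))⟩

theorem Wd.exists (l l' : List ι) (h : l.Perm l')
    (hP : ∀ a b, [a, b].Sublist l → [b, a].Sublist l' → P a b) :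
    ∃ T : GL ι R, Wd τ U P l l' T := by
  induction l' generalizing l with
  | nil => rw [h.eq_nil]; exact ⟨1, .refl _⟩
  | cons b t ih =>
    have hb : b ∈ l := h.mem_iff.2 List.mem_cons_self
    obtain ⟨l1, l2, rfl⟩ := List.append_of_mem hb
    have hp : (l1 ++ l2).Perm t := by
      have := List.perm_middle.symm.trans h
      exact List.perm_cons b |>.1 this
    obtain ⟨T, hT⟩ := ih (l1 ++ l2) hp fun a c h1 h2 =>
      hP a c (h1.trans ((List.Sublist.refl l1).append (List.sublist_cons_self b l2)))
        (h2.trans (List.sublist_cons_self b t))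
    obtain ⟨T', hT'⟩ := Wd.move (τ := τ) (U := U) (P := P) b l1 l2 fun a ha => by
      refine hP a b ?_ ?_
      · have : [a, b] = [a] ++ [b] := rfl
        rw [this]
        exact (List.singleton_sublist.2 ha).append (by simp)
      · exact (List.singleton_sublist.2 (hp.subset (List.mem_append_left _ ha))).cons_cons b
    exact ⟨_, hT'.trans (hT.cons b)⟩

/-- Colour obtained from `w` at height `h` by passing under the higher labels of the list. -/
noncomputable def pass (τ : Rˣ) (U : ι → ℝ) (z : ι → R) (h : ℝ) : List ι → R → R
  | [], w => w
  | x :: l, w => pass τ U z h l (if h < U x then τ * w + (1 - τ) * z x else w)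

/-- Colours transported to the far right. -/
noncomputable def flow (τ : Rˣ) (U : ι → ℝ) (z : ι → R) (j : ι) : List ι → R
  | [] => z j
  | x :: l => if x = j then pass τ U z (U j) l (z j) else flow τ U z j l

theorem el_mulVec_of_lt {a b : ι} (h : U a < U b) (z : ι → R) (i : ι) :
    ((el τ U a b).1 *ᵥ z) i = if i = a then τ * z a + (1 - τ) * z b else z i := by
  rw [el, if_pos h, rot_mulVec]

theorem el_mulVec_of_not_lt {a b : ι} (h : ¬ U a < U b) (z : ι → R) (i : ι) :
    ((el τ U a b).1 *ᵥ z) i =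
      if i = b then ((τ⁻¹ : Rˣ) : R) * z b + (1 - ((τ⁻¹ : Rˣ) : R)) * z a else z i := by
  rw [el, if_neg h, rot_inv_mulVec]

theorem Wd.apply_notMem (h : Wd τ U P l l' T) (z : ι → R) {j : ι} (hj : j ∉ l) :
    (T.1 *ᵥ z) j = z j := by
  induction h generalizing z with
  | refl l => simp
  | swap a b l h =>
    simp only [List.mem_cons, not_or] at hj
    by_cases hab : U a < U b
    · rw [el_mulVec_of_lt hab, if_neg hj.1]
    · rw [el_mulVec_of_not_lt hab, if_neg hj.2.1]
  | cons x _ ih => exact ih z fun h => hj (List.mem_cons_of_mem _ h)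
  | trans h1 _ ih1 ih2 =>
    rw [Units.val_mul, ← Matrix.mulVec_mulVec, ih2 _ (fun h => hj (h1.perm.mem_iff.2 h)), ih1 _ hj]

theorem pass_congr {z z' : ι → R} {h : ℝ} {l : List ι} (hz : ∀ x ∈ l, h < U x → z x = z' x) (w : R) :
    pass τ U z h l w = pass τ U z' h l w := by
  induction l generalizing w with
  | nil => rfl
  | cons x l ih =>
    simp only [pass]
    rw [ih fun y hy => hz y (List.mem_cons_of_mem _ hy)]
    split_ifs with hx
    · rw [hz x List.mem_cons_self hx]
    · rfl

theorem pass_injective (z : ι → R) (h : ℝ) (l : List ι) : Function.Injective (pass τ U z h l) := by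
  induction l with
  | nil => exact Function.injective_id
  | cons x l ih =>
    intro w w' hw
    simp only [pass] at hw
    have := ih hw
    split_ifs at this with hx
    · exact τ.isUnit.mul_left_cancel (add_right_cancel this)
    · exact this

theorem Wd.pass_eq (h : Wd τ U P l l' T) (hl : l.Nodup) (hU : ∀ a b, P a b → U a ≠ U b)
    (z : ι → R) (H : ℝ) (w : R) :
    pass τ U (T.1 *ᵥ z) H l' w = pass τ U z H l w := by
  induction h generalizing z w with
  | refl l => simp
  | swap a b l hP =>
    have hab : a ≠ b := by rintro rfl; simp at hl
    have hal : a ∉ l := by simp at hl; tauto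
    have hbl : b ∉ l := by simp at hl; tauto
    simp only [pass]
    rw [pass_congr (z' := z)]
    swap
    · intro x hx _
      exact (Wd.swap a b [] hP).apply_notMem z (by simp; constructor <;> (rintro rfl; contradiction))
    congr 1
    by_cases h : U a < U b
    · simp only [el_mulVec_of_lt h, if_true, hab.symm, if_false]
      by_cases h1 : H < U a
      · simp only [h1, h1.trans h, if_true]; ring
      · by_cases h2 : H < U b <;> simp [h1, h2]
    · have h' : U b < U a := lt_of_le_of_ne (not_lt.1 h) (hU a b hP).symm
      simp only [el_mulVec_of_not_lt h, if_true, hab, if_false]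
      by_cases h1 : H < U b
      · simp only [h1, h1.trans h', if_true]
        have := τ.mul_inv
        linear_combination (1 - (τ:R)) * (z b - z a) * this
      · by_cases h2 : H < U a <;> simp [h1, h2]
  | cons x h ih =>
    simp only [pass]
    rw [ih (List.nodup_cons.1 hl).2, h.apply_notMem z (List.nodup_cons.1 hl).1]
  | trans h1 _ ih1 ih2 =>
    rw [Units.val_mul, ← Matrix.mulVec_mulVec, ih2 (h1.perm.nodup_iff.1 hl), ih1 hl]

theorem flow_congr {z z' : ι → R} {l : List ι} {j : ι} (hj : z j = z' j)
    (hz : ∀ x ∈ l, U j < U x → z x = z' x) : flow τ U z j l = flow τ U z' j l := by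
  induction l with
  | nil => exact hj
  | cons x l ih =>
    simp only [flow]
    rw [ih fun y hy => hz y (List.mem_cons_of_mem _ hy), hj,
      pass_congr fun y hy => hz y (List.mem_cons_of_mem _ hy)]

theorem Wd.flow_eq (h : Wd τ U P l l' T) (hl : l.Nodup) (hU : ∀ a b, P a b → U a ≠ U b)
    (z : ι → R) {j : ι} (hj : j ∈ l) :
    flow τ U (T.1 *ᵥ z) j l' = flow τ U z j l := by
  induction h generalizing z with
  | refl l => simp
  | swap a b l hP =>
    have hab : a ≠ b := by rintro rfl; simp at hl
    have hal : a ∉ l := by simp at hl; tauto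
    have hbl : b ∉ l := by simp at hl; tauto
    have key : ∀ H w, pass τ U ((el τ U a b).1 *ᵥ z) H l w = pass τ U z H l w := by
      intro H w
      apply pass_congr
      intro x hx _
      exact (Wd.swap a b [] hP).apply_notMem z (by simp; constructor <;> (rintro rfl; contradiction))
    have keyf : j ≠ a → j ≠ b → flow τ U ((el τ U a b).1 *ᵥ z) j l = flow τ U z j l := by
      intro hja hjb
      have hz : ((el τ U a b).1 *ᵥ z) j = z j :=
        (Wd.swap a b [] hP).apply_notMem z (by simp; tauto)
      exact flow_congr hz fun x hx _ => (Wd.swap a b [] hP).apply_notMem z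
        (by simp; constructor <;> (rintro rfl; contradiction))
    simp only [flow]
    by_cases hja : a = j
    · subst hja
      simp only [hab.symm, if_true, if_false, key]
      simp only [pass]
      congr 1
      by_cases h : U a < U b
      · simp [el_mulVec_of_lt h, h]
      · simp [el_mulVec_of_not_lt h, h, hab]
    · by_cases hjb : b = j
      · subst hjb
        simp only [hab, if_true, if_false, key]
        simp only [pass, key]
        congr 1
        by_cases h : U a < U b
        · simp [el_mulVec_of_lt h, h.le, hab.symm]
        · have h' : U b < U a := lt_of_le_of_ne (not_lt.1 h) (hU a b hP).symm
          simp only [el_mulVec_of_not_lt h, h', if_true, hab, if_false]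
          linear_combination (z b - z a) * τ.mul_inv
      · simp only [hja, hjb, if_false]
        exact keyf (Ne.symm hja) (Ne.symm hjb)
  | cons x h ih =>
    simp only [flow]
    by_cases hx : x = j
    · subst hx
      simp only [if_true]
      rw [h.pass_eq (List.nodup_cons.1 hl).2 hU, h.apply_notMem z (List.nodup_cons.1 hl).1]
    · simp only [hx, if_false]
      exact ih (List.nodup_cons.1 hl).2 _ ((List.mem_cons.1 hj).resolve_left (Ne.symm hx))
  | trans h1 _ ih1 ih2 =>
    rw [Units.val_mul, ← Matrix.mulVec_mulVec, ih2 (h1.perm.nodup_iff.1 hl) _ (h1.perm.mem_iff.1 hj),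
      ih1 hl _ hj]

theorem flow_injective (hl : ∀ j, j ∈ l) {z z' : ι → R}
    (h : ∀ j, flow τ U z j l = flow τ U z' j l) : z = z' := by
  classical
  by_contra hne
  have hs : (Finset.univ.filter fun j => z j ≠ z' j).Nonempty := by
    by_contra h0
    rw [Finset.not_nonempty_iff_eq_empty, Finset.filter_eq_empty_iff] at h0
    exact hne (funext fun j => not_not.1 (h0 (Finset.mem_univ j)))
  obtain ⟨j, hj, hmax⟩ := Finset.exists_max_image _ U hs
  rw [Finset.mem_filter] at hj
  have heq : ∀ x, U j < U x → z x = z' x := fun x hx => by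
    by_contra hc
    exact absurd (hmax x (by simpa using hc)) (not_le.2 hx)
  have hf := h j
  have : ∀ l : List ι, j ∈ l → flow τ U z j l = flow τ U z' j l → z j = z' j := by
    intro l
    induction l with
    | nil => simp
    | cons x l ih =>
      intro hm hfl
      simp only [flow] at hfl
      by_cases hx : x = j
      · simp only [hx, if_true] at hfl
        rw [pass_congr fun y _ => heq y] at hfl
        exact pass_injective _ _ _ hfl
      · simp only [hx, if_false] at hfl
        exact ih ((List.mem_cons.1 hm).resolve_left (Ne.symm hx)) hfl
  exact hj.2 (this l (hl j) hf)

theorem Wd.unique (h : Wd τ U P l l' T) (h' : Wd τ U P' l l' T') (hl : l.Nodup)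
    (hm : ∀ j, j ∈ l) (hU : ∀ a b, P a b → U a ≠ U b) (hU' : ∀ a b, P' a b → U a ≠ U b) :
    T = T' := by
  refine Units.ext (Matrix.toLin'.injective (LinearMap.ext fun z => ?_))
  rw [Matrix.toLin'_apply, Matrix.toLin'_apply]
  refine flow_injective (τ := τ) (U := U) (l := l') (fun j => h.perm.mem_iff.1 (hm j)) fun j => ?_
  rw [h.flow_eq hl hU z (hm j), h'.flow_eq hl hU' z (hm j)]

end Words

section Config

variable {ι R : Type*} [DecidableEq ι] [Fintype ι] [CommRing R]

/-- Lexicographic comparison of the positions of two labels. -/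
noncomputable def key (x : ℂ) : ℝ ×ₗ ℝ := toLex (x.re, x.im)

theorem key_injective : Function.Injective key := fun x y h => by
  have := toLex.injective h
  exact Complex.ext (congrArg Prod.fst this) (congrArg Prod.snd this)

theorem key_lt {x y : ℂ} : key x < key y ↔ x.re < y.re ∨ x.re = y.re ∧ x.im < y.im := by
  simp [key, Prod.Lex.toLex_lt_toLex]

theorem re_le_of_key_lt {x y : ℂ} (h : key x < key y) : x.re ≤ y.re := by
  rcases key_lt.1 h with h | h
  · exact h.le
  · exact h.1.le

/-- The labels in lexicographic order. -/
noncomputable def ord (X : ι → ℂ) : List ι :=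
  Finset.univ.toList.insertionSort fun a b => key (X a) ≤ key (X b)

theorem ord_perm (X : ι → ℂ) : (ord X).Perm Finset.univ.toList := List.perm_insertionSort _ _

theorem mem_ord (X : ι → ℂ) (j : ι) : j ∈ ord X := by
  rw [(ord_perm X).mem_iff]; simp

theorem ord_nodup (X : ι → ℂ) : (ord X).Nodup := by
  rw [(ord_perm X).nodup_iff]; exact Finset.nodup_toList _

theorem ord_pairwise_le (X : ι → ℂ) : (ord X).Pairwise fun a b => key (X a) ≤ key (X b) := by
  have : Std.Total (fun a b => key (X a) ≤ key (X b)) := ⟨fun a b => le_total _ _⟩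
  have : IsTrans ι (fun a b => key (X a) ≤ key (X b)) := ⟨fun a b c h1 h2 => le_trans h1 h2⟩
  exact List.pairwise_insertionSort _ _

theorem ord_pairwise {X : ι → ℂ} (hX : Function.Injective X) :
    (ord X).Pairwise fun a b => key (X a) < key (X b) :=
  (List.Pairwise.and (ord_pairwise_le X) (ord_nodup X)).imp fun h =>
    lt_of_le_of_ne h.1 fun he => h.2 (hX (key_injective he))

/-- The pairs exchanged between two configurations. -/
def Inv (X X' : ι → ℂ) (a b : ι) : Prop := key (X a) < key (X b) ∧ key (X' b) < key (X' a)

variable (τ : Rˣ)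

theorem exists_wd (U : ι → ℝ) {X X' : ι → ℂ} (hX : Function.Injective X)
    (hX' : Function.Injective X') : ∃ T : GL ι R, Wd τ U (Inv X X') (ord X) (ord X') T := by
  refine Wd.exists _ _ ((ord_perm X).trans (ord_perm X').symm) fun a b h1 h2 => ⟨?_, ?_⟩
  · simpa using (ord_pairwise hX).sublist h1
  · simpa using (ord_pairwise hX').sublist h2

open Classical in
/-- Elementary transport between two nearby configurations. -/
noncomputable def tr (X X' : ι → ℂ) : GL ι R :=
  if h : Function.Injective X ∧ Function.Injective X' then
    (exists_wd τ (fun a => (X a).im) h.1 h.2).choose else 1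

theorem tr_wd {X X' : ι → ℂ} (hX : Function.Injective X) (hX' : Function.Injective X') :
    Wd τ (fun a => (X a).im) (Inv X X') (ord X) (ord X') (tr τ X X') := by
  rw [tr, dif_pos ⟨hX, hX'⟩]
  exact (exists_wd τ _ hX hX').choose_spec

/-- `X` is injective with all distances larger than `8 ρ`. -/
def Sep (ρ : ℝ) (X : ι → ℂ) : Prop := 0 ≤ ρ ∧ ∀ a b, a ≠ b → 8 * ρ < dist (X a) (X b)

theorem Sep.injective {ρ : ℝ} {X : ι → ℂ} (h : Sep ρ X) : Function.Injective X := fun a b hab => by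
  by_contra hne
  have := h.2 a b hne
  rw [hab, dist_self] at this
  linarith [h.1]

theorem Sep.im_lt_iff {ρ : ℝ} {X X' X'' : ι → ℂ} (h : Sep ρ X) (h1 : ∀ c, dist (X c) (X' c) ≤ ρ)
    (h2 : ∀ c, dist (X c) (X'' c) ≤ ρ) {a b : ι} (hab : Inv X X' a b) :
    ((X a).im < (X b).im ↔ (X'' a).im < (X'' b).im) ∧ (X a).im ≠ (X b).im := by
  have hne : a ≠ b := by rintro rfl; exact lt_irrefl _ hab.1
  have hs := h.2 a b hne
  have e1 := re_le_of_key_lt hab.1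
  have e2 := re_le_of_key_lt hab.2
  have re_le : ∀ c, ∀ Y : ι → ℂ, dist (X c) (Y c) ≤ ρ →
      |(X c).re - (Y c).re| ≤ ρ ∧ |(X c).im - (Y c).im| ≤ ρ := fun c Y hY =>
    ⟨by rw [← Complex.sub_re]; exact (Complex.abs_re_le_norm _).trans (by rwa [← dist_eq_norm]),
     by rw [← Complex.sub_im]; exact (Complex.abs_im_le_norm _).trans (by rwa [← dist_eq_norm])⟩
  have ha := abs_le.1 (re_le a X' (h1 a)).1
  have hb := abs_le.1 (re_le b X' (h1 b)).1
  have ha' := abs_le.1 (re_le a X'' (h2 a)).2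
  have hb' := abs_le.1 (re_le b X'' (h2 b)).2
  have hn : dist (X a) (X b) ≤ |(X a).re - (X b).re| + |(X a).im - (X b).im| := by
    rw [dist_eq_norm]
    simpa using Complex.norm_le_abs_re_add_abs_im (X a - X b)
  have hre : |(X a).re - (X b).re| ≤ 2 * ρ := abs_le.2 ⟨by linarith, by linarith⟩
  have him : 6 * ρ < |(X a).im - (X b).im| := by linarith
  have h0 := h.1
  rcases lt_abs.1 him with h' | h'
  · exact ⟨⟨fun _ => by linarith, fun _ => by linarith⟩, by intro h; linarith⟩
  · exact ⟨⟨fun _ => by linarith, fun _ => by linarith⟩, by intro h; linarith⟩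

theorem tr_mul {ρ : ℝ} {X X' X'' : ι → ℂ} (h : Sep ρ X) (h' : Sep ρ X') (h'' : Sep ρ X'')
    (d1 : ∀ c, dist (X c) (X' c) ≤ ρ) (d2 : ∀ c, dist (X' c) (X'' c) ≤ ρ)
    (d3 : ∀ c, dist (X c) (X'' c) ≤ ρ) : tr τ X' X'' * tr τ X X' = tr τ X X'' := by
  have w1 := (tr_wd τ h.injective h'.injective).mono (P' := fun a b => (X a).im ≠ (X b).im)
    (fun a b hab => (h.im_lt_iff d1 d1 hab).2) (fun _ _ _ => Iff.rfl)
  have w2 := (tr_wd τ h'.injective h''.injective).mono (P' := fun a b => (X a).im ≠ (X b).im)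
    (U' := fun a => (X a).im)
    (fun a b hab => by
      have d1' : ∀ c, dist (X' c) (X c) ≤ ρ := fun c => by rw [dist_comm]; exact d1 c
      have e1 := h'.im_lt_iff d2 d1' hab
      rcases lt_or_gt_of_ne e1.2 with h | h
      · exact (e1.1.1 h).ne
      · intro he
        have d : Inv X' X'' a b := hab
        have hne : a ≠ b := by rintro rfl; exact lt_irrefl _ hab.1
        have k1 : |(X' a).im - (X a).im| ≤ ρ := by
          rw [← Complex.sub_im]; exact (Complex.abs_im_le_norm _).trans (by rw [← dist_eq_norm]; exact d1' a)
        have k2 : |(X' b).im - (X b).im| ≤ ρ := by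
          rw [← Complex.sub_im]; exact (Complex.abs_im_le_norm _).trans (by rw [← dist_eq_norm]; exact d1' b)
        have k3 : |(X' a).re - (X'' a).re| ≤ ρ := by
          rw [← Complex.sub_re]; exact (Complex.abs_re_le_norm _).trans (by rw [← dist_eq_norm]; exact d2 a)
        have k4 : |(X' b).re - (X'' b).re| ≤ ρ := by
          rw [← Complex.sub_re]; exact (Complex.abs_re_le_norm _).trans (by rw [← dist_eq_norm]; exact d2 b)
        have hn : dist (X' a) (X' b) ≤ |(X' a).re - (X' b).re| + |(X' a).im - (X' b).im| := by
          rw [dist_eq_norm]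
          simpa using Complex.norm_le_abs_re_add_abs_im (X' a - X' b)
        have e1 := re_le_of_key_lt hab.1
        have e2 := re_le_of_key_lt hab.2
        rw [abs_le] at k1 k2 k3 k4
        have hre : |(X' a).re - (X' b).re| ≤ 2 * ρ := abs_le.2 ⟨by linarith, by linarith⟩
        have him : |(X' a).im - (X' b).im| ≤ 2 * ρ := abs_le.2 ⟨by linarith, by linarith⟩
        linarith [h'.2 a b hne, h'.1])
    (fun a b hab => (h'.im_lt_iff d2 (fun c => by rw [dist_comm]; exact d1 c) hab).1)
  exact (w1.trans w2).unique (tr_wd τ h.injective h''.injective) (ord_nodup X) (mem_ord X)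
    (fun _ _ h => h) (fun a b hab => (h.im_lt_iff d3 d3 hab).2)

theorem tr_self {ρ : ℝ} {X : ι → ℂ} (h : Sep ρ X) : tr τ X X = 1 := by
  have d : ∀ c, dist (X c) (X c) ≤ ρ := fun c => by simp [h.1]
  have := tr_mul τ h h h d d d
  exact mul_eq_left.1 this

/-- `F` is parallel for the transport along the family of configurations `X` on `K`. -/
def IsTransport {E : Type*} [TopologicalSpace E] (K : Set E) (X : E → ι → ℂ) (F : E → GL ι R) :
    Prop :=
  ∀ k ∈ K, ∀ᶠ k' in 𝓝[K] k, F k' = tr τ (X k) (X k') * F k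

theorem exists_sep {E : Type*} [TopologicalSpace E] {K : Set E} (hK : IsCompact K)
    {X : E → ι → ℂ} (hX : ContinuousOn X K) (hi : ∀ k ∈ K, Function.Injective (X k)) :
    ∃ ρ > 0, ∀ k ∈ K, Sep ρ (X k) := by
  classical
  have h : ∀ a b, ∃ s > 0, a ≠ b → ∀ k ∈ K, 8 * s < dist (X k a) (X k b) := by
    intro a b
    by_cases hab : a = b
    · exact ⟨1, one_pos, fun h => absurd hab h⟩
    rcases K.eq_empty_or_nonempty with rfl | hne
    · exact ⟨1, one_pos, by simp⟩
    have hc : ContinuousOn (fun k => dist (X k a) (X k b)) K :=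
      continuous_dist.comp_continuousOn ((continuousOn_pi.1 hX a).prodMk (continuousOn_pi.1 hX b))
    obtain ⟨k0, hk0, hmin⟩ := hK.exists_isMinOn hne hc
    have hpos : 0 < dist (X k0 a) (X k0 b) := dist_pos.2 fun he => hab (hi k0 hk0 he)
    exact ⟨dist (X k0 a) (X k0 b) / 16, by positivity, fun _ k hk =>
      by have := isMinOn_iff.1 hmin k hk; linarith⟩
  choose s hs hs' using h
  refine ⟨if h : Nonempty (ι × ι) then Finset.univ.inf' (Finset.univ_nonempty_iff.2 h)
    (fun p : ι × ι => s p.1 p.2) else 1, ?_, ?_⟩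
  · split_ifs with h
    · rw [gt_iff_lt, Finset.lt_inf'_iff]; exact fun p _ => hs _ _
    · exact one_pos
  · intro k hk
    split_ifs with h
    · refine ⟨(Finset.le_inf'_iff _ _).2 fun p _ => (hs _ _).le, fun a b hab => ?_⟩
      refine lt_of_le_of_lt ?_ (hs' a b hab k hk)
      have := Finset.inf'_le (fun p : ι × ι => s p.1 p.2) (Finset.mem_univ (a, b))
      linarith
    · exact ⟨zero_le_one, fun a => absurd ⟨(a, a)⟩ h⟩

theorem exists_near {E : Type*} [PseudoMetricSpace E] {K : Set E} (hK : IsCompact K)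
    {X : E → ι → ℂ} (hX : ContinuousOn X K) (hi : ∀ k ∈ K, Function.Injective (X k)) :
    ∃ ρ > 0, ∃ δ > 0, (∀ k ∈ K, Sep ρ (X k)) ∧
      ∀ k ∈ K, ∀ k' ∈ K, dist k k' < δ → ∀ c, dist (X k c) (X k' c) ≤ ρ := by
  obtain ⟨ρ, hρ, hs⟩ := exists_sep hK hX hi
  have hu := hK.uniformContinuousOn_of_continuous hX
  obtain ⟨δ, hδ, h⟩ := Metric.uniformContinuousOn_iff.1 hu ρ hρ
  exact ⟨ρ, hρ, δ, hδ, hs, fun k hk k' hk' hd c =>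
    (dist_le_pi_dist _ _ c).trans (h k hk k' hk' hd).le⟩

/-- A local cocycle on a compact convex set with values in a group is a coboundary. -/
theorem exists_potential {Γ : Type*} [Group Γ] {E : Type*} [NormedAddCommGroup E]
    [NormedSpace ℝ E] {K : Set E} (hK : IsCompact K) (hc : Convex ℝ K) {c : E → E → Γ} {δ : ℝ}
    (hδ : 0 < δ) (hcs : ∀ k ∈ K, c k k = 1)
    (hcc : ∀ k ∈ K, ∀ k' ∈ K, ∀ k'' ∈ K, dist k k' < δ → dist k' k'' < δ → dist k k'' < δ →
      c k' k'' * c k k' = c k k'') :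
    ∃ F : E → Γ, ∀ k ∈ K, ∀ k' ∈ K, dist k k' < δ / 2 → F k' = c k k' * F k := by
  rcases K.eq_empty_or_nonempty with rfl | ⟨k0, hk0⟩
  · exact ⟨1, by simp⟩
  obtain ⟨D, hD⟩ := hK.isBounded.exists_norm_le
  have hD' : 0 ≤ D := (norm_nonneg _).trans (hD k0 hk0)
  obtain ⟨n, hn⟩ := exists_nat_gt (4 * D / δ)
  have hn0 : (0:ℝ) < n := lt_of_le_of_lt (by positivity) hn
  set p : E → ℕ → E := fun k i => k0 + ((i:ℝ) / n) • (k - k0) with hp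
  have hpK : ∀ k ∈ K, ∀ i ≤ n, p k i ∈ K := fun k hk i hin =>
    hc.add_smul_sub_mem hk0 hk ⟨by positivity, by
      rw [div_le_one hn0]; exact_mod_cast hin⟩
  let F : E → ℕ → Γ := fun k i => Nat.rec 1 (fun i g => c (p k i) (p k (i + 1)) * g) i
  have hstep : ∀ k ∈ K, ∀ i, dist (p k i) (p k (i+1)) ≤ δ / 2 := by
    intro k hk i
    rw [dist_eq_norm]
    have : p k i - p k (i+1) = (-(1 / n : ℝ)) • (k - k0) := by
      simp only [hp]; push_cast
      rw [add_sub_add_left_eq_sub, ← sub_smul]; congr 1; ring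
    rw [this, norm_smul, norm_neg, Real.norm_of_nonneg (by positivity)]
    have h1 : ‖k - k0‖ ≤ 2 * D := (norm_sub_le _ _).trans (by linarith [hD k hk, hD k0 hk0])
    have h2 : 4 * D < n * δ := by rwa [div_lt_iff₀ hδ] at hn
    calc 1 / (n:ℝ) * ‖k - k0‖ ≤ 1 / n * (2 * D) := by gcongr
      _ ≤ δ / 2 := by rw [one_div, inv_mul_le_iff₀ hn0]; linarith
  have key : ∀ k ∈ K, ∀ k' ∈ K, dist k k' < δ / 2 → ∀ i ≤ n,
      F k' i = c (p k i) (p k' i) * F k i := by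
    intro k hk k' hk' hkk i
    have hpp : ∀ i ≤ n, dist (p k i) (p k' i) < δ / 2 := by
      intro i hi
      have : p k i - p k' i = ((i:ℝ) / n) • (k - k') := by
        simp only [hp]; rw [add_sub_add_left_eq_sub, ← smul_sub]; congr 1; abel
      rw [dist_eq_norm, this, norm_smul, Real.norm_of_nonneg (by positivity), ← dist_eq_norm]
      have : (i:ℝ) / n ≤ 1 := by rw [div_le_one hn0]; exact_mod_cast hi
      exact lt_of_le_of_lt (mul_le_of_le_one_left dist_nonneg this) hkk
    induction i with
    | zero =>
      intro _
      have h0 : c (p k 0) (p k' 0) = 1 := by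
        simp only [hp]; simp; exact hcs k0 hk0
      simp only [F, h0]; simp
    | succ i ih =>
      intro hin
      have hin' : i ≤ n := by omega
      have a1 := hpK k hk i hin'
      have a2 := hpK k hk (i+1) hin
      have a3 := hpK k' hk' i hin'
      have a4 := hpK k' hk' (i+1) hin
      have b1 := hstep k hk i
      have b2 := hstep k' hk' i
      have b3 := hpp i hin'
      have b4 := hpp (i+1) hin
      have t := dist_triangle (p k i) (p k' i) (p k' (i+1))
      change c (p k' i) (p k' (i+1)) * F k' i = _ * (c (p k i) (p k (i+1)) * F k i)
      rw [ih hin', ← mul_assoc, hcc _ a1 _ a3 _ a4 (by linarith) (by linarith) (by linarith),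
        ← mul_assoc, hcc _ a1 _ a2 _ a4 (by linarith) (by linarith) (by linarith)]
  have hpn : ∀ k, p k n = k := fun k => by simp [hp, hn0.ne']
  refine ⟨fun k => F k n, fun k hk k' hk' hkk => ?_⟩
  have := key k hk k' hk' hkk n le_rfl
  rwa [hpn, hpn] at this

theorem exists_transport {E : Type*} [NormedAddCommGroup E] [NormedSpace ℝ E] {K : Set E}
    (hK : IsCompact K) (hc : Convex ℝ K) {X : E → ι → ℂ} (hX : ContinuousOn X K)
    (hi : ∀ k ∈ K, Function.Injective (X k)) : ∃ F : E → GL ι R, IsTransport τ K X F := by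
  rcases K.eq_empty_or_nonempty with rfl | ⟨k0, hk0⟩
  · exact ⟨1, by simp [IsTransport]⟩
  obtain ⟨ρ, hρ, δ, hδ, hs, hd⟩ := exists_near hK hX hi
  obtain ⟨F, hF⟩ := exists_potential hK hc (c := fun k k' => tr τ (X k) (X k')) hδ
    (fun k hk => tr_self τ (hs k hk))
    (fun k hk k' hk' k'' hk'' h1 h2 h3 => tr_mul τ (hs k hk) (hs k' hk') (hs k'' hk'')
      (hd _ hk _ hk' h1) (hd _ hk' _ hk'' h2) (hd _ hk _ hk'' h3))
  refine ⟨F, fun k hk => ?_⟩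
  filter_upwards [self_mem_nhdsWithin,
    mem_nhdsWithin_of_mem_nhds (Metric.ball_mem_nhds k (half_pos hδ))] with k' hk' hb
  exact hF k hk k' hk' (by rw [dist_comm]; exact hb)

section Transport

variable {τ} {E : Type*} [TopologicalSpace E] {K : Set E} {X : E → ι → ℂ} {F G : E → GL ι R}

theorem const_of_locally {α : Type*} (hK : IsPreconnected K) (f : E → α)
    (h : ∀ k ∈ K, ∀ᶠ k' in 𝓝[K] k, f k' = f k) {k k' : E} (hk : k ∈ K) (hk' : k' ∈ K) :
    f k' = f k := by
  let : TopologicalSpace α := ⊥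
  have : DiscreteTopology α := ⟨rfl⟩
  refine hK.constant (f := f) (fun x hx => ?_) hk' hk
  rw [ContinuousWithinAt, nhds_discrete, tendsto_pure]
  exact h x hx

theorem IsTransport.comp {E' : Type*} [TopologicalSpace E'] {K' : Set E'} (h : IsTransport τ K X F)
    {p : E' → E} (hp : ContinuousOn p K') (hm : Set.MapsTo p K' K) :
    IsTransport τ K' (fun e => X (p e)) (fun e => F (p e)) := fun k hk =>
  ((hp k hk).tendsto_nhdsWithin hm).eventually (h (p k) (hm hk))

theorem IsTransport.mono {K' : Set E} (h : IsTransport τ K X F) (hm : K' ⊆ K) :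
    IsTransport τ K' X F := h.comp continuousOn_id hm

theorem IsTransport.congr {X' : E → ι → ℂ} (h : IsTransport τ K X F) (hm : ∀ k ∈ K, X k = X' k) :
    IsTransport τ K X' F := fun k hk => by
  filter_upwards [h k hk, self_mem_nhdsWithin] with k' h1 h2
  rw [h1, hm k hk, hm k' h2]

theorem IsTransport.unique (hK : IsPreconnected K) (h : IsTransport τ K X F)
    (h' : IsTransport τ K X G) {k k' : E} (hk : k ∈ K) (hk' : k' ∈ K) :
    F k' * (F k)⁻¹ = G k' * (G k)⁻¹ := by
  have := const_of_locally hK (fun k => (F k)⁻¹ * G k) (fun k hk => by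
    filter_upwards [h k hk, h' k hk] with k' h1 h2
    rw [h1, h2]; group) hk hk'
  have h2 : G k' = F k' * ((F k)⁻¹ * G k) := by rw [← this]; group
  rw [h2]; group

theorem IsTransport.mem (hK : IsPreconnected K) (h : IsTransport τ K X F) (S : Subgroup (GL ι R))
    (hS : ∀ k ∈ K, ∀ᶠ k' in 𝓝[K] k, tr τ (X k) (X k') ∈ S) {k k' : E} (hk : k ∈ K) (hk' : k' ∈ K) :
    F k' * (F k)⁻¹ ∈ S := by
  have := const_of_locally hK (fun k => (QuotientGroup.mk ((F k)⁻¹) : GL ι R ⧸ S)) (fun k hk => by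
    filter_upwards [h k hk, hS k hk] with k' h1 h2
    rw [h1, QuotientGroup.eq]
    simpa using h2) hk hk'
  rw [QuotientGroup.eq] at this
  simpa using this

end Transport

end Config

section Form

variable {ι : Type*} [DecidableEq ι] [Fintype ι]

/-- Dual action of a transport matrix. -/
noncomputable def act (T : GL ι ℂ) (v : ι → ℂ) : ι → ℂ := v ᵥ* T⁻¹.1

theorem act_mul (T T' : GL ι ℂ) (v : ι → ℂ) : act (T' * T) v = act T' (act T v) := by
  simp only [act, _root_.mul_inv_rev, Units.val_mul, Matrix.vecMul_vecMul]

@[simp] theorem act_one (v : ι → ℂ) : act 1 v = v := by simp [act]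

theorem act_inv_act (T : GL ι ℂ) (v : ι → ℂ) : act T⁻¹ (act T v) = v := by
  rw [← act_mul]; simp

theorem act_act_inv (T : GL ι ℂ) (v : ι → ℂ) : act T (act T⁻¹ v) = v := by
  rw [← act_mul]; simp

theorem act_add (T : GL ι ℂ) (v w : ι → ℂ) : act T (v + w) = act T v + act T w :=
  Matrix.add_vecMul _ _ _

theorem act_sub (T : GL ι ℂ) (v w : ι → ℂ) : act T (v - w) = act T v - act T w :=
  Matrix.sub_vecMul _ _ _

theorem act_smul (T : GL ι ℂ) (c : ℂ) (v : ι → ℂ) : act T (c • v) = c • act T v :=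
  Matrix.smul_vecMul _ _ _

theorem act_dotProduct (T : GL ι ℂ) (v z : ι → ℂ) : act T v ⬝ᵥ (T.1 *ᵥ z) = v ⬝ᵥ z := by
  rw [act, ← Matrix.dotProduct_mulVec, Matrix.mulVec_mulVec]; simp

theorem rotM_vecMul {t : ℂ} {a b : ι} (hab : a ≠ b) (v : ι → ℂ) (k : ι) :
    (v ᵥ* rotM t a b) k =
      if k = a then t * v a else if k = b then v b + (1 - t) * v a else v k := by
  have h : ∀ k, (v ᵥ* rotM t a b) k = v ⬝ᵥ (rotM t a b *ᵥ Pi.single k 1) := fun k => by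
    rw [Matrix.dotProduct_mulVec, dotProduct_single_one]
  rw [h]
  have h2 : rotM t a b *ᵥ Pi.single k 1 = Pi.single k 1 +
      (if k = a then (t - 1) else if k = b then (1 - t) else 0) • Pi.single a 1 := by
    ext i
    rw [rotM_mulVec]
    simp only [Pi.add_apply, Pi.smul_apply, Pi.single_apply, smul_eq_mul]
    by_cases hi : i = a
    · subst hi
      by_cases h1 : k = i
      · subst h1; simp [hab.symm]
      · by_cases h2 : k = b
        · subst h2; simp [hab, hab.symm]
        · simp [h1, h2, Ne.symm h1, Ne.symm h2]
    · simp [hi]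
  rw [h2, dotProduct_add, dotProduct_smul]
  simp only [dotProduct_single_one]
  by_cases h1 : k = a
  · subst h1; simp; ring
  · by_cases h2 : k = b
    · subst h2; simp [h1]
    · simp [h1, h2]

/-- Compatibility of the rotation parameter `τ` and the skew coefficient `ε`. -/
def Compat (τ : ℂˣ) (ε : ℝ) : Prop :=
  conj (τ : ℂ) * τ = 1 ∧ Complex.I * ε * (τ + 1) = τ - 1

noncomputable def listSum (l : List ι) (v : ι → ℂ) : ℂ := (l.map v).sum

/-- The skew-hermitian part on an ordered list plus the standard form. -/
noncomputable def listForm (ε : ℝ) (v w : ι → ℂ) : List ι → ℂ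
  | [] => 0
  | x :: l => conj (v x) * w x -
      Complex.I * ε * (conj (v x) * listSum l w - conj (listSum l v) * w x) + listForm ε v w l

theorem listSum_congr {l : List ι} {v v' : ι → ℂ} (h : ∀ x ∈ l, v x = v' x) :
    listSum l v = listSum l v' := by
  rw [listSum, listSum, List.map_congr_left h]

theorem listForm_congr (ε : ℝ) {l : List ι} {v v' w w' : ι → ℂ} (h : ∀ x ∈ l, v x = v' x)
    (h' : ∀ x ∈ l, w x = w' x) : listForm ε v w l = listForm ε v' w' l := by
  induction l with
  | nil => rfl
  | cons x l ih =>
    simp only [List.mem_cons, forall_eq_or_imp] at h h'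
    simp only [listForm]
    rw [ih h.2 h'.2, h.1, h'.1, listSum_congr h.2, listSum_congr h'.2]

variable {τ : ℂˣ} {ε : ℝ} {U : ι → ℝ} {P : ι → ι → Prop} {l l' : List ι} {T : GL ι ℂ}

theorem el_act_of_lt {a b : ι} (hab : a ≠ b) (h : U a < U b) (v : ι → ℂ) (k : ι) :
    act (el τ U a b) v k = if k = a then ((τ⁻¹ : ℂˣ) : ℂ) * v a
      else if k = b then v b + (1 - ((τ⁻¹ : ℂˣ) : ℂ)) * v a else v k := by
  rw [act, el, if_pos h]; exact rotM_vecMul hab v k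

theorem el_act_of_not_lt {a b : ι} (hab : a ≠ b) (h : ¬ U a < U b) (v : ι → ℂ) (k : ι) :
    act (el τ U a b) v k = if k = b then (τ : ℂ) * v b
      else if k = a then v a + (1 - (τ : ℂ)) * v b else v k := by
  rw [act, el, if_neg h, inv_inv]; exact rotM_vecMul hab.symm v k

theorem el_act_of_ne {a b k : ι} (hab : a ≠ b) (ha : k ≠ a) (hb : k ≠ b) (v : ι → ℂ) :
    act (el τ U a b) v k = v k := by
  by_cases h : U a < U b
  · rw [el_act_of_lt hab h]; simp [ha, hb]
  · rw [el_act_of_not_lt hab h]; simp [ha, hb]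

theorem Wd.act_notMem (h : Wd τ U P l l' T) (hl : l.Nodup) (v : ι → ℂ) {j : ι} (hj : j ∉ l) :
    act T v j = v j := by
  induction h generalizing v with
  | refl l => simp
  | swap a b l h =>
    simp only [List.mem_cons, not_or] at hj
    exact el_act_of_ne (by rintro rfl; simp at hl) hj.1 hj.2.1 v
  | cons x _ ih =>
    exact ih (List.nodup_cons.1 hl).2 v fun h => hj (List.mem_cons_of_mem _ h)
  | trans h1 _ ih1 ih2 =>
    rw [act_mul, ih2 (h1.perm.nodup_iff.1 hl) _ (fun h => hj (h1.perm.mem_iff.2 h)), ih1 hl _ hj]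

theorem Wd.listSum_act (h : Wd τ U P l l' T) (hl : l.Nodup) (v : ι → ℂ) :
    listSum l' (act T v) = listSum l v := by
  induction h generalizing v with
  | refl l => simp
  | swap a b l h =>
    have hab : a ≠ b := by rintro rfl; simp at hl
    have hal : a ∉ l := by simp at hl; tauto
    have hbl : b ∉ l := by simp at hl; tauto
    have := listSum_congr (l := l) (v := act (el τ U a b) v) (v' := v) fun x hx =>
      el_act_of_ne hab (by rintro rfl; contradiction) (by rintro rfl; contradiction) v
    simp only [listSum, List.map_cons, List.sum_cons] at this ⊢
    rw [this]
    by_cases h : U a < U b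
    · simp only [el_act_of_lt hab h, if_true, hab.symm, if_false]; ring
    · simp only [el_act_of_not_lt hab h, if_true, hab, if_false]; ring
  | cons x h ih =>
    have := ih (List.nodup_cons.1 hl).2 v
    simp only [listSum, List.map_cons, List.sum_cons] at this ⊢
    rw [this, h.act_notMem (List.nodup_cons.1 hl).2 _ (List.nodup_cons.1 hl).1]
  | trans h1 _ ih1 ih2 => rw [act_mul, ih2 (h1.perm.nodup_iff.1 hl), ih1 hl]

theorem Wd.listForm_act (hτ : Compat τ ε) (h : Wd τ U P l l' T) (hl : l.Nodup) (v w : ι → ℂ) :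
    listForm ε (act T v) (act T w) l' = listForm ε v w l := by
  induction h generalizing v w with
  | refl l => simp
  | swap a b l h =>
    have hab : a ≠ b := by rintro rfl; simp at hl
    have hal : a ∉ l := by simp at hl; tauto
    have hbl : b ∉ l := by simp at hl; tauto
    have key : ∀ v : ι → ℂ, ∀ x ∈ l, act (el τ U a b) v x = v x := fun v x hx =>
      el_act_of_ne hab (by rintro rfl; contradiction) (by rintro rfl; contradiction) v
    simp only [listForm]
    rw [listForm_congr ε (key v) (key w)]
    have e1 := listSum_congr (key v)
    have e2 := listSum_congr (key w)
    simp only [listSum, List.map_cons, List.sum_cons] at e1 e2 ⊢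
    rw [e1, e2]
    have hc : conj (τ : ℂ) = ((τ⁻¹ : ℂˣ) : ℂ) := by
      have := hτ.1
      rw [Units.val_inv_eq_inv_val]; exact eq_inv_of_mul_eq_one_left this
    have h0 : (τ : ℂ) * ((τ⁻¹ : ℂˣ) : ℂ) = 1 := τ.mul_inv
    have h1 := hτ.2
    have hc' : conj (((τ⁻¹ : ℂˣ) : ℂ)) = τ := by rw [← hc]; simp
    by_cases h : U a < U b
    · simp only [el_act_of_lt hab h, if_true, hab.symm, if_false, map_add, map_mul, map_sub,
        map_one, hc']
      generalize ((τ⁻¹ : ℂˣ) : ℂ) = s at *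
      generalize (τ : ℂ) = t at *
      have h1' : Complex.I * ε * (1 + s) = 1 - s := by
        linear_combination s * h1 + (1 - Complex.I * ε) * h0
      have h2 : Complex.I * ε * (t - s) = t + s - 2 := by
        linear_combination h1 + (-1 : ℂ) * h1'
      linear_combination conj (v a) * w a * (2 * h0 + h2) - conj (v b) * w a * h1' + conj (v a) * w b * h1
    · simp only [el_act_of_not_lt hab h, if_true, hab, if_false, map_add, map_mul, map_sub,
        map_one, hc]
      generalize ((τ⁻¹ : ℂˣ) : ℂ) = s at *
      generalize (τ : ℂ) = t at *
      have h1' : Complex.I * ε * (1 + s) = 1 - s := by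
        linear_combination s * h1 + (1 - Complex.I * ε) * h0
      have h2 : Complex.I * ε * (t - s) = t + s - 2 := by
        linear_combination h1 + (-1 : ℂ) * h1'
      linear_combination conj (v b) * w b * (2 * h0 + h2) - conj (v b) * w a * h1' + conj (v a) * w b * h1
  | cons x h ih =>
    simp only [listForm]
    rw [ih (List.nodup_cons.1 hl).2, h.act_notMem (List.nodup_cons.1 hl).2 _ (List.nodup_cons.1 hl).1,
      h.act_notMem (List.nodup_cons.1 hl).2 _ (List.nodup_cons.1 hl).1,
      h.listSum_act (List.nodup_cons.1 hl).2, h.listSum_act (List.nodup_cons.1 hl).2]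
  | trans h1 _ ih1 ih2 => rw [act_mul, act_mul, ih2 (h1.perm.nodup_iff.1 hl), ih1 hl]

/-- The sign of the order of two points. -/
noncomputable def sg (x y : ℂ) : ℂ := if key x < key y then 1 else if key y < key x then -1 else 0

theorem sg_comm (x y : ℂ) : sg y x = - sg x y := by
  unfold sg
  rcases lt_trichotomy (key x) (key y) with h | h | h
  · simp [h, h.not_gt]
  · simp [h]
  · simp [h, h.not_gt]

theorem conj_sg (x y : ℂ) : conj (sg x y) = sg x y := by
  unfold sg; split_ifs <;> simp

/-- The hermitian form of a configuration. -/
noncomputable def form (ε : ℝ) (X : ι → ℂ) (v w : ι → ℂ) : ℂ :=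
  ∑ j, conj (v j) * w j - Complex.I * ε * ∑ j, ∑ k, sg (X j) (X k) * (conj (v j) * w k)

theorem listForm_eq {X : ι → ℂ} (hl : l.Pairwise fun a b => key (X a) < key (X b)) (v w : ι → ℂ) :
    listForm ε v w l = listSum l (fun j => conj (v j) * w j) - Complex.I * ε *
      listSum l fun j => listSum l fun k => sg (X j) (X k) * (conj (v j) * w k) := by
  induction l with
  | nil => simp [listForm, listSum]
  | cons x l ih =>
    rw [List.pairwise_cons] at hl
    rw [listForm, ih hl.2]
    have e1 : listSum l (fun k => sg (X x) (X k) * (conj (v x) * w k)) = conj (v x) * listSum l w := by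
      rw [listSum_congr (v' := fun k => conj (v x) * w k) fun k hk => by simp [sg, hl.1 k hk]]
      simp [listSum, List.sum_map_mul_left]
    have e2 : listSum l (fun j => sg (X j) (X x) * (conj (v j) * w x)) =
        - (conj (listSum l v) * w x) := by
      rw [listSum_congr (v' := fun j => conj (v j) * (- w x)) fun k hk => by
        rw [sg_comm, sg, if_pos (hl.1 k hk)]; ring]
      rw [listSum, List.sum_map_mul_right]
      simp [listSum, map_list_sum, Function.comp_def]
    have e3 : sg (X x) (X x) = 0 := by simp [sg]
    simp only [listSum, List.map_cons, List.sum_cons, List.sum_map_add] at e1 e2 ⊢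
    rw [e1, e2, e3]; ring

theorem listSum_ord (X : ι → ℂ) (v : ι → ℂ) : listSum (ord X) v = ∑ j, v j := by
  rw [listSum, ((ord_perm X).map v).sum_eq, Finset.sum_map_toList]

theorem listForm_ord {X : ι → ℂ} (hX : Function.Injective X) (v w : ι → ℂ) :
    listForm ε v w (ord X) = form ε X v w := by
  rw [listForm_eq (ord_pairwise hX), form]
  simp only [listSum_ord]

theorem form_tr (hτ : Compat τ ε) {X X' : ι → ℂ} (hX : Function.Injective X)
    (hX' : Function.Injective X') (v w : ι → ℂ) :
    form ε X' (act (tr τ X X') v) (act (tr τ X X') w) = form ε X v w := by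
  rw [← listForm_ord hX, ← listForm_ord hX']
  exact (tr_wd τ hX hX').listForm_act hτ (ord_nodup X) v w

theorem sum_tr {X X' : ι → ℂ} (hX : Function.Injective X)
    (hX' : Function.Injective X') (v : ι → ℂ) :
    ∑ j, act (tr τ X X') v j = ∑ j, v j := by
  rw [← listSum_ord X', ← listSum_ord X v]
  exact (tr_wd τ hX hX').listSum_act (ord_nodup X) v

variable {E : Type*} [TopologicalSpace E] {K : Set E} {X : E → ι → ℂ} {F : E → GL ι ℂ}

theorem IsTransport.form (hτ : Compat τ ε) (hK : IsPreconnected K) (h : IsTransport τ K X F)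
    (hi : ∀ k ∈ K, Function.Injective (X k)) {k k' : E} (hk : k ∈ K) (hk' : k' ∈ K) (v w : ι → ℂ) :
    form ε (X k') (act (F k' * (F k)⁻¹) v) (act (F k' * (F k)⁻¹) w) = form ε (X k) v w := by
  have := const_of_locally hK (fun e => Braid.form ε (X e) (act (F e) (act (F k)⁻¹ v))
    (act (F e) (act (F k)⁻¹ w))) (fun k hk => by
      filter_upwards [h k hk, self_mem_nhdsWithin] with k' h1 h2
      rw [h1, act_mul, act_mul, form_tr hτ (hi k hk) (hi k' h2)]) hk hk'
  rw [act_mul, act_mul, this, act_act_inv, act_act_inv]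

theorem IsTransport.sum (hK : IsPreconnected K) (h : IsTransport τ K X F)
    (hi : ∀ k ∈ K, Function.Injective (X k)) {k k' : E} (hk : k ∈ K) (hk' : k' ∈ K) (v : ι → ℂ) :
    ∑ j, act (F k' * (F k)⁻¹) v j = ∑ j, v j := by
  have := const_of_locally hK (fun e => ∑ j, act (F e) (act (F k)⁻¹ v) j) (fun k hk => by
      filter_upwards [h k hk, self_mem_nhdsWithin] with k' h1 h2
      rw [h1, act_mul, sum_tr (hi k hk) (hi k' h2)]) hk hk'
  rw [act_mul, this, act_act_inv]

end Form

section Locality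

variable {ι : Type*} [DecidableEq ι] [Fintype ι]

/-- Transports that do not change the colour of `j`. -/
def fixCol (j : ι) : Subgroup (GL ι ℂ) where
  carrier := {T | ∀ z, (T.1 *ᵥ z) j = z j}
  one_mem' := fun z => by simp
  mul_mem' {S T} hS hT := fun z => by
    rw [Units.val_mul, ← Matrix.mulVec_mulVec, hS, hT]
  inv_mem' {T} hT := fun z => by
    rw [← hT (T⁻¹.1 *ᵥ z), Matrix.mulVec_mulVec]; simp

/-- Transports preserving the colourings that vanish on `S`. -/
def vanCol (S : Set ι) : Subgroup (GL ι ℂ) where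
  carrier := {T | ∀ z : ι → ℂ, (∀ i ∈ S, z i = 0) →
    (∀ i ∈ S, (T.1 *ᵥ z) i = 0) ∧ (∀ i ∈ S, (T⁻¹.1 *ᵥ z) i = 0)}
  one_mem' := fun z hz => by simpa using hz
  mul_mem' {A B} hA hB := fun z hz => by
    rw [_root_.mul_inv_rev, Units.val_mul, Units.val_mul, ← Matrix.mulVec_mulVec,
      ← Matrix.mulVec_mulVec]
    exact ⟨(hA _ (hB z hz).1).1, (hB _ (hA z hz).2).2⟩
  inv_mem' {T} hT := fun z hz => by rw [inv_inv]; exact (hT z hz).symm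

theorem el_mem_fixCol {τ : ℂˣ} {U : ι → ℝ} {a b j : ι} (h1 : j = a → U b ≤ U a)
    (h2 : j = b → U a < U b) : el τ U a b ∈ fixCol j := by
  intro z
  by_cases h : U a < U b
  · rw [el_mulVec_of_lt h, if_neg fun hj => absurd h (not_lt.2 (h1 hj))]
  · rw [el_mulVec_of_not_lt h, if_neg fun hj => h (h2 hj)]

theorem rot_mem_vanCol {τ : ℂˣ} {S : Set ι} {a b : ι} (ha : a ∈ S) (hb : b ∈ S) :
    rot τ a b ∈ vanCol S := by
  intro z hz
  refine ⟨fun i hi => ?_, fun i hi => ?_⟩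
  · rw [rot_mulVec, hz a ha, hz b hb, hz i hi]; simp
  · rw [rot_inv_mulVec, hz a ha, hz b hb, hz i hi]; simp

theorem el_mem_vanCol {τ : ℂˣ} {U : ι → ℝ} {S : Set ι} {a b : ι} (ha : a ∈ S) (hb : b ∈ S) :
    el τ U a b ∈ vanCol S := by
  rw [el]; split_ifs
  · exact rot_mem_vanCol ha hb
  · exact (vanCol S).inv_mem (rot_mem_vanCol hb ha)

theorem tr_mem {τ : ℂˣ} {X X' : ι → ℂ} (S : Subgroup (GL ι ℂ)) (hX : Function.Injective X)
    (hX' : Function.Injective X')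
    (h : ∀ a b, Inv X X' a b → el τ (fun a => (X a).im) a b ∈ S) : tr τ X X' ∈ S :=
  (tr_wd τ hX hX').mem S h

/-- Isotopies of the plane supported in a disc. -/
structure IsIso (R : ℝ) (Φ : ℝ → ℂ → ℂ) : Prop where
  cont : Continuous (Function.uncurry Φ)
  inj : ∀ s, Function.Injective (Φ s)
  supp : ∀ s x, R ≤ ‖x‖ → Φ s x = x

theorem IsIso.norm_lt {R : ℝ} {Φ : ℝ → ℂ → ℂ} (h : IsIso R Φ) {s : ℝ} {x : ℂ} (hx : ‖x‖ < R) :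
    ‖Φ s x‖ < R := by
  by_contra hc
  have := h.inj s (h.supp s _ (not_lt.1 hc))
  rw [this] at hc
  exact hc hx

theorem exists_gap (A : ι → ℝ) (c : ℝ) : ∃ g > 0, ∀ i, A i < c → A i < c - g := by
  have h : ∀ i, ∃ g > 0, ∀ g' ≤ g, A i < c → A i < c - g' := fun i => by
    by_cases hi : A i < c
    · exact ⟨(c - A i) / 2, by linarith, fun g' hg _ => by linarith⟩
    · exact ⟨1, one_pos, fun _ _ h => absurd h hi⟩
  choose g hg hg' using h
  rcases isEmpty_or_nonempty ι with h | h
  · exact ⟨1, one_pos, fun i => h.elim i⟩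
  · refine ⟨Finset.univ.inf' Finset.univ_nonempty g, ?_, fun i => hg' i _ ?_⟩
    · rw [gt_iff_lt, Finset.lt_inf'_iff]; exact fun i _ => hg i
    · exact Finset.inf'_le _ (Finset.mem_univ i)

theorem locality {τ : ℂˣ} {R δ : ℝ} {Φ : ℝ → ℂ → ℂ} (hΦ : IsIso R Φ) (h0 : ∀ x, Φ 0 x = x)
    {X : ι → ℂ} (hX : Function.Injective X) {F : ℝ → GL ι ℂ}
    (hF : IsTransport τ (Set.Icc 0 1) (fun s i => Φ s (X i)) F)
    (hδ : ∀ x, ‖Φ 1 x - x‖ ≤ δ) {j k : ι} (hjk : δ < |(Φ 1 (X k)).re - (X j).re|) :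
    act (F 1 * (F 0)⁻¹) (Pi.single j 1) k = 0 := by
  obtain ⟨R', hR', hXR⟩ : ∃ R' : ℝ, R ≤ R' ∧ ∀ i, ‖X i‖ ≤ R' := by
    refine ⟨max R ‖X‖, le_max_left _ _, fun i => (norm_le_pi_norm X i).trans (le_max_right _ _)⟩
  have hR0 : 0 ≤ R' := (norm_nonneg _).trans (hXR j)
  have hΦR : ∀ s i, ‖Φ s (X i)‖ ≤ R' := fun s i => by
    by_cases h : ‖X i‖ < R
    · exact (hΦ.norm_lt h).le.trans hR'
    · rw [hΦ.supp s _ (not_lt.1 h)]; exact hXR i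
  set u1 : ℝ := 2 * R' + 1 with hu1
  obtain ⟨g1, hg1, hgap1⟩ := exists_gap (fun i => (X i).re) (X j).re
  obtain ⟨g2, hg2, hgap2⟩ := exists_gap (fun i => (Φ 1 (X i)).re) ((X j).re - δ)
  have hu1' : 0 < u1 := by linarith
  obtain ⟨ν, hν, hν1, hν2⟩ : ∃ ν > 0, ν * u1 ≤ g1 ∧ ν * u1 ≤ g2 :=
    ⟨min g1 g2 / u1, by positivity, by rw [div_mul_cancel₀ _ hu1'.ne']; exact min_le_left _ _,
      by rw [div_mul_cancel₀ _ hu1'.ne']; exact min_le_right _ _⟩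
  have hd0 : 0 ≤ δ := (norm_nonneg _).trans (hδ 0)
  let ray : ℝ → ℂ := fun u => ⟨(X j).re - ν * u, (X j).im + u⟩
  have hray : Continuous ray := by
    have : ray = fun u : ℝ => X j + u * (Complex.I - ν) := by
      funext u; apply Complex.ext <;> simp [ray]; ring
    rw [this]; fun_prop
  let B : ℝ → ι → ℂ := fun u i => if i = j then ray u else X i
  let Y : ℝ × ℝ → ι → ℂ := fun p i => Φ p.1 (B p.2 i)
  let K : Set (ℝ × ℝ) := Set.Icc 0 1 ×ˢ Set.Icc 0 u1
  have hYj : ∀ s u, Y (s, u) j = Φ s (ray u) := fun s u => by simp [Y, B]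
  have hYi : ∀ s u i, i ≠ j → Y (s, u) i = Φ s (X i) := fun s u i hi => by simp [Y, B, hi]
  have hray0 : ray 0 = X j := by apply Complex.ext <;> simp [ray]
  have hBinj : ∀ u ∈ Set.Icc 0 u1, Function.Injective (B u) := by
    intro u hu
    have hne : ∀ i, i ≠ j → ray u ≠ X i := by
      intro i hi he
      have hre : (X j).re - ν * u = (X i).re := congrArg Complex.re he
      rcases eq_or_lt_of_le hu.1 with h | h
      · subst h; rw [hray0] at he; exact hi (hX he).symm
      · have h3 : (X i).re < (X j).re := by have := mul_pos hν h; linarith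
        have h4 := hgap1 i h3
        have : ν * u ≤ ν * u1 := by gcongr; exact hu.2
        linarith
    intro a b hab
    by_cases ha : a = j <;> by_cases hb : b = j
    · rw [ha, hb]
    · simp only [B, ha, hb, if_true, if_false] at hab; exact absurd hab (hne b hb)
    · simp only [B, ha, hb, if_true, if_false] at hab; exact absurd hab.symm (hne a ha)
    · simp only [B, ha, hb, if_false] at hab; exact hX hab
  have hYinj : ∀ p ∈ K, Function.Injective (Y p) := fun p hp =>
    (hΦ.inj p.1).comp (hBinj p.2 hp.2)
  have hYc : Continuous Y := by
    refine continuous_pi fun i => ?_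
    by_cases hi : i = j
    · subst hi
      have : (fun p : ℝ × ℝ => Y p i) = fun p => Function.uncurry Φ (p.1, ray p.2) := by
        funext p; exact hYj p.1 p.2
      rw [this]; exact hΦ.cont.comp (by fun_prop)
    · have : (fun p : ℝ × ℝ => Y p i) = fun p => Function.uncurry Φ (p.1, X i) := by
        funext p; exact hYi p.1 p.2 i hi
      rw [this]; exact hΦ.cont.comp (by fun_prop)
  obtain ⟨G, hG⟩ := exists_transport τ (K := K) (X := Y) (isCompact_Icc.prod isCompact_Icc)
    ((convex_Icc _ _).prod (convex_Icc _ _)) hYc.continuousOn hYinj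
  have i0 : (0:ℝ) ∈ Set.Icc (0:ℝ) 1 := by simp
  have i1 : (1:ℝ) ∈ Set.Icc (0:ℝ) 1 := by simp
  have iu : (0:ℝ) ∈ Set.Icc (0:ℝ) u1 := ⟨le_rfl, hu1'.le⟩
  have iu1 : u1 ∈ Set.Icc (0:ℝ) u1 := ⟨hu1'.le, le_rfl⟩
  have hY0 : ∀ s, Y (s, 0) = fun i => Φ s (X i) := fun s => by
    funext i
    by_cases hi : i = j
    · rw [hi, hYj, hray0]
    · exact hYi s 0 i hi
  have hFG : F 1 * (F 0)⁻¹ = G (1, 0) * (G (0, 0))⁻¹ := by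
    have hG' : IsTransport τ (Set.Icc 0 1) (fun s i => Φ s (X i)) (fun s => G (s, 0)) :=
      (hG.comp (p := fun s : ℝ => (s, (0:ℝ))) (by fun_prop) fun s hs => ⟨hs, iu⟩).congr
        fun s _ => hY0 s
    exact hF.unique isPreconnected_Icc hG' i0 i1
  -- the leg at time one
  let S : Set ι := {i | |(Φ 1 (X i)).re - (X j).re| ≤ δ}
  have hjS : j ∈ S := by
    have := (Complex.abs_re_le_norm _).trans (hδ (X j))
    simpa [S] using this
  have hrayre : ∀ u ∈ Set.Icc 0 u1, (X j).re - ν * u1 ≤ (ray u).re ∧ (ray u).re ≤ (X j).re := by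
    intro u hu
    have h1 : ν * u ≤ ν * u1 := by gcongr; exact hu.2
    have h2 : 0 ≤ ν * u := mul_nonneg hν.le hu.1
    exact ⟨by simp only [ray]; linarith, by simp only [ray]; linarith⟩
  have hrayre1 : ∀ u ∈ Set.Icc 0 u1, (X j).re - ν * u1 - δ ≤ (Φ 1 (ray u)).re ∧
      (Φ 1 (ray u)).re ≤ (X j).re + δ := by
    intro u hu
    have h1 := (Complex.abs_re_le_norm _).trans (hδ (ray u))
    rw [Complex.sub_re, abs_le] at h1
    have := hrayre u hu
    exact ⟨by linarith, by linarith⟩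
  have hmemS : ∀ i, (X j).re - ν * u1 - δ ≤ (Φ 1 (X i)).re → (Φ 1 (X i)).re ≤ (X j).re + δ →
      i ∈ S := by
    intro i h1 h2
    change |(Φ 1 (X i)).re - (X j).re| ≤ δ
    refine abs_le.2 ⟨?_, by linarith⟩
    by_contra hc
    have := hgap2 i (by linarith [not_le.1 hc])
    linarith
  have leg1 : G (1, u1) * (G (1, 0))⁻¹ ∈ vanCol S := by
    have hG1 : IsTransport τ (Set.Icc 0 u1) (fun u => Y (1, u)) (fun u => G (1, u)) :=
      hG.comp (p := fun u : ℝ => ((1:ℝ), u)) (by fun_prop) fun s hs => ⟨i1, hs⟩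
    refine hG1.mem isPreconnected_Icc _ (fun u hu => ?_) iu iu1
    filter_upwards [self_mem_nhdsWithin] with u' hu'
    refine tr_mem _ (hYinj _ ⟨i1, hu⟩) (hYinj _ ⟨i1, hu'⟩) fun a b hab => ?_
    have e1 := re_le_of_key_lt hab.1
    have e2 := re_le_of_key_lt hab.2
    by_cases ha : a = j <;> by_cases hb : b = j
    · exact el_mem_vanCol (ha ▸ hjS) (hb ▸ hjS)
    · rw [ha, hYj, hYi _ _ b hb] at e1 e2
      exact el_mem_vanCol (ha ▸ hjS) (hmemS b ((hrayre1 u hu).1.trans e1)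
        (e2.trans (hrayre1 u' hu').2))
    · rw [hb, hYj, hYi _ _ a ha] at e1 e2
      exact el_mem_vanCol (hmemS a ((hrayre1 u' hu').1.trans e2)
        (e1.trans (hrayre1 u hu).2)) (hb ▸ hjS)
    · exfalso
      have h1 := hab.1
      have h2 := hab.2
      rw [hYi _ _ a ha, hYi _ _ b hb] at h1 h2
      exact lt_asymm h1 h2
  have himtop : R' + 1 ≤ (ray u1).im := by
    have := abs_le.1 ((Complex.abs_im_le_norm _).trans (hXR j))
    simp only [ray]; linarith
  have hraytop : ∀ s, Φ s (ray u1) = ray u1 := fun s => hΦ.supp s _ <| by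
    have := (Complex.abs_im_le_norm (ray u1))
    have h2 := le_abs_self (ray u1).im
    linarith
  have leg2 : G (0, u1) * (G (1, u1))⁻¹ ∈ fixCol j := by
    have hG1 : IsTransport τ (Set.Icc 0 1) (fun s => Y (s, u1)) (fun s => G (s, u1)) :=
      hG.comp (p := fun s : ℝ => (s, u1)) (by fun_prop) fun s hs => ⟨hs, iu1⟩
    refine hG1.mem isPreconnected_Icc _ (fun s hs => ?_) i1 i0
    filter_upwards [self_mem_nhdsWithin] with s' hs'
    refine tr_mem _ (hYinj _ ⟨hs, iu1⟩) (hYinj _ ⟨hs', iu1⟩) fun a b hab => ?_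
    have hne : a ≠ b := by rintro rfl; exact lt_irrefl _ hab.1
    have him : ∀ i, i ≠ j → (Y (s, u1) i).im < (Y (s, u1) j).im := fun i hi => by
      rw [hYi _ _ i hi, hYj, hraytop]
      have := (le_abs_self _).trans ((Complex.abs_im_le_norm _).trans (hΦR s i))
      linarith
    exact el_mem_fixCol (fun h => by subst h; exact (him b hne.symm).le)
      (fun h => by subst h; exact him a hne)
  have leg3 : G (0, 0) * (G (0, u1))⁻¹ ∈ fixCol j := by
    have hG1 : IsTransport τ (Set.Icc 0 u1) (fun u => Y (0, u)) (fun u => G (0, u)) :=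
      hG.comp (p := fun u : ℝ => ((0:ℝ), u)) (by fun_prop) fun s hs => ⟨i0, hs⟩
    refine hG1.mem isPreconnected_Icc _ (fun u hu => ?_) iu1 iu
    filter_upwards [self_mem_nhdsWithin] with u' hu'
    refine tr_mem _ (hYinj _ ⟨i0, hu⟩) (hYinj _ ⟨i0, hu'⟩) fun a b hab => ?_
    have hne : a ≠ b := by rintro rfl; exact lt_irrefl _ hab.1
    have main : ∀ i, i ≠ j → ∀ v ∈ Set.Icc 0 u1, ∀ v' ∈ Set.Icc 0 u1,
        (ray v').re ≤ (X i).re → key (X i) < key (ray v) → v = 0 ∧ (X i).im < (X j).im := by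
      intro i hi v hv v' hv' h1 h2
      have h3 := re_le_of_key_lt h2
      have h4 := hrayre v hv
      have h5 := hrayre v' hv'
      have h6 : (X j).re ≤ (X i).re := by
        by_contra hc
        have := hgap1 i (not_le.1 hc)
        linarith
      have h7 : (X j).re - ν * v = (X j).re := le_antisymm h4.2 (h6.trans h3)
      have hv0 : v = 0 := by
        have : ν * v = 0 := by linarith
        exact (mul_eq_zero.1 this).resolve_left hν.ne'
      refine ⟨hv0, ?_⟩
      subst hv0
      rw [hray0] at h2
      rcases key_lt.1 h2 with h | h
      · exact absurd h6 (not_le.2 h)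
      · exact h.2
    refine el_mem_fixCol (fun h => ?_) (fun h => ?_)
    · subst h
      have hb := hne.symm
      have h1 := re_le_of_key_lt hab.1
      have h2 := hab.2
      simp only [hYj, hYi _ _ b hb, h0] at h1 h2 ⊢
      have := (main b hb u' hu' u hu h1 h2).2
      have h3 : (X j).im ≤ (ray u).im := by simp only [ray]; linarith [hu.1]
      linarith
    · subst h
      have h1 := hab.1
      have h2 := re_le_of_key_lt hab.2
      simp only [hYj, hYi _ _ a hne, h0] at h1 h2 ⊢
      have := main a hne u hu u' hu' h2 h1
      rw [this.1, hray0]; exact this.2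
  have hMinv : (G (1, 0) * (G (0, 0))⁻¹)⁻¹ = (G (0, 0) * (G (0, u1))⁻¹) *
      ((G (0, u1) * (G (1, u1))⁻¹) * (G (1, u1) * (G (1, 0))⁻¹)) := by group
  rw [hFG, act, hMinv, Matrix.single_one_vecMul, Matrix.row]
  have hkS : k ∉ S := fun h => absurd h (not_le.2 hjk)
  have := (leg1 (Pi.single k 1) fun i hi => by
    rw [Pi.single_apply, if_neg]; rintro rfl; exact hkS hi).1 j hjS
  have e2 := leg2 ((G (1, u1) * (G (1, 0))⁻¹).1 *ᵥ Pi.single k 1)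
  have e3 := leg3 ((G (0, u1) * (G (1, u1))⁻¹).1 *ᵥ
    ((G (1, u1) * (G (1, 0))⁻¹).1 *ᵥ Pi.single k 1))
  rw [e2, this, Matrix.mulVec_mulVec, Matrix.mulVec_mulVec, ← Units.val_mul,
    ← Units.val_mul] at e3
  simpa using e3

end Locality

section Slab

variable {ι : Type*} [DecidableEq ι] [Fintype ι]

/-- Squared euclidean norm. -/
noncomputable def nsq (v : ι → ℂ) : ℝ := ∑ j, ‖v j‖ ^ 2

theorem nsq_nonneg (v : ι → ℂ) : 0 ≤ nsq v := Finset.sum_nonneg fun _ _ => by positivity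

theorem nsq_add_le (v w : ι → ℂ) : nsq (v + w) ≤ 2 * (nsq v + nsq w) := by
  simp only [nsq, ← Finset.sum_add_distrib, Finset.mul_sum]
  refine Finset.sum_le_sum fun j _ => ?_
  have := norm_add_le (v j) (w j)
  have h2 := pow_le_pow_left₀ (norm_nonneg _) this 2
  simp only [Pi.add_apply]
  nlinarith [sq_nonneg (‖v j‖ - ‖w j‖)]

theorem nsq_neg (v : ι → ℂ) : nsq (-v) = nsq v := by simp [nsq]

theorem nsq_sub_le (v w : ι → ℂ) : nsq (v - w) ≤ 2 * (nsq v + nsq w) := by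
  rw [sub_eq_add_neg]
  exact (nsq_add_le _ _).trans (by rw [nsq_neg])

theorem nsq_smul (c : ℂ) (v : ι → ℂ) : nsq (c • v) = ‖c‖ ^ 2 * nsq v := by
  simp [nsq, mul_pow, Finset.mul_sum]

/-- Standard hermitian product. -/
noncomputable def ip (v w : ι → ℂ) : ℂ := ∑ j, conj (v j) * w j

theorem ip_self (v : ι → ℂ) : ip v v = nsq v := by
  simp [ip, nsq, Complex.conj_mul']

theorem norm_sg_le (x y : ℂ) : ‖sg x y‖ ≤ 1 := by
  unfold sg; split_ifs <;> simp

theorem skew_bound (X : ι → ℂ) (v w : ι → ℂ) :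
    ‖∑ j, ∑ k, sg (X j) (X k) * (conj (v j) * w k)‖ ≤ (∑ j, ‖v j‖) * ∑ k, ‖w k‖ := by
  rw [Finset.sum_mul_sum]
  refine (norm_sum_le _ _).trans (Finset.sum_le_sum fun j _ => (norm_sum_le _ _).trans
    (Finset.sum_le_sum fun k _ => ?_))
  rw [norm_mul, norm_mul, RCLike.norm_conj]
  exact mul_le_of_le_one_left (by positivity) (norm_sg_le _ _)

theorem sum_norm_sq_le {S : Finset ι} {v : ι → ℂ} (hv : ∀ j ∉ S, v j = 0) :
    (∑ j, ‖v j‖) ^ 2 ≤ S.card * nsq v := by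
  have h1 : ∑ j, ‖v j‖ = ∑ j ∈ S, ‖v j‖ :=
    (Finset.sum_subset (Finset.subset_univ S) fun j _ hj => by simp [hv j hj]).symm
  rw [h1]
  refine (sq_sum_le_card_mul_sum_sq).trans ?_
  gcongr
  exact Finset.sum_le_sum_of_subset_of_nonneg (Finset.subset_univ S) fun _ _ _ => by positivity

theorem form_self_bound {ε : ℝ} (hε : 0 ≤ ε) (X : ι → ℂ) {S : Finset ι} {v : ι → ℂ}
    (hv : ∀ j ∉ S, v j = 0) : ‖form ε X v v - nsq v‖ ≤ ε * S.card * nsq v := by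
  have : form ε X v v - nsq v =
      -(Complex.I * ε * ∑ j, ∑ k, sg (X j) (X k) * (conj (v j) * v k)) := by
    rw [form, ← ip_self, ip]; ring
  rw [this, norm_neg, norm_mul, norm_mul, Complex.norm_I, one_mul, Complex.norm_real,
    Real.norm_of_nonneg hε, mul_assoc]
  refine mul_le_mul_of_nonneg_left ((skew_bound X v v).trans ?_) hε
  rw [← sq]; exact sum_norm_sq_le hv

/-- Indicator vector. -/
noncomputable def ind (S : Finset ι) : ι → ℂ := fun j => if j ∈ S then 1 else 0

theorem nsq_ind (S : Finset ι) : nsq (ind S) = S.card := by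
  simp [nsq, ind, apply_ite, Finset.sum_ite_mem]

theorem form_ind (ε : ℝ) (X : ι → ℂ) (S : Finset ι) : form ε X (ind S) (ind S) = S.card := by
  have h : ∑ j, ∑ k, sg (X j) (X k) * (conj (ind S j) * ind S k) = 0 := by
    have h1 : ∑ j, ∑ k, sg (X j) (X k) * (conj (ind S j) * ind S k) =
        - ∑ j, ∑ k, sg (X j) (X k) * (conj (ind S j) * ind S k) := by
      conv_lhs => rw [Finset.sum_comm]
      rw [← Finset.sum_neg_distrib]
      refine Finset.sum_congr rfl fun j _ => ?_
      rw [← Finset.sum_neg_distrib]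
      refine Finset.sum_congr rfl fun k _ => ?_
      rw [sg_comm]
      have : ∀ j, conj (ind S j) = ind S j := fun j => by unfold ind; split_ifs <;> simp
      rw [this, this]; ring
    exact self_eq_neg.1 h1
  have h2 : ∑ j, conj (ind S j) * ind S j = S.card := by
    have := ip_self (ind S)
    rw [nsq_ind] at this
    simpa [ip] using this
  rw [form, h, h2]; simp

theorem nsq_le_form {ε : ℝ} (hε : 0 ≤ ε) (X : ι → ℂ) {S : Finset ι} {v : ι → ℂ}
    (hv : ∀ j ∉ S, v j = 0) (hS : ε * S.card ≤ 1 / 2) :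
    nsq v ≤ (1 + 2 * (ε * S.card)) * (form ε X v v).re ∧
      (form ε X v v).re ≤ 3 / 2 * nsq v := by
  have h := (Complex.abs_re_le_norm _).trans (form_self_bound hε X hv)
  rw [Complex.sub_re, Complex.ofReal_re, abs_le] at h
  have h0 := nsq_nonneg v
  have h1 : 0 ≤ ε * S.card := by positivity
  generalize ε * (S.card : ℝ) = e at *
  constructor
  · have : (1 - e) * nsq v ≤ (form ε X v v).re := by nlinarith
    nlinarith [mul_nonneg h1 h0]
  · nlinarith

/-- `exp (-2 π i x)`. -/
noncomputable def ph (x : ℝ) : ℂ := Complex.exp (Complex.I * (-(2 * Real.pi * x) : ℝ))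

theorem norm_ph (x : ℝ) : ‖ph x‖ = 1 := by
  rw [ph, mul_comm, Complex.norm_exp_ofReal_mul_I]

theorem ph_add (x y : ℝ) : ph (x + y) = ph x * ph y := by
  rw [ph, ph, ph, ← Complex.exp_add]; congr 1; push_cast; ring

theorem norm_ph_sub_le (x y : ℝ) : ‖ph x - ph y‖ ≤ 2 * Real.pi * |x - y| := by
  have h : ph x - ph y = ph y * (ph (x - y) - 1) := by
    rw [mul_sub, ← ph_add]; simp
  rw [h, norm_mul, norm_ph, one_mul]
  refine (Real.norm_exp_I_mul_ofReal_sub_one_le).trans ?_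
  rw [norm_neg, norm_mul, Real.norm_of_nonneg (by positivity)]; rfl

/-- The position of the label `j` in lexicographic order. -/
noncomputable def rk (X : ι → ℂ) (j : ι) : ℕ := (Finset.univ.filter fun k => key (X k) < key (X j)).card

/-- The Fourier mode of frequency `m`. -/
noncomputable def mode (m : ℕ) (X : ι → ℂ) (j : ι) : ℂ := ph (m * rk X j / Fintype.card ι)

theorem card_diff_le {S T A : Finset ι} (h1 : S \ T ⊆ A) (h2 : T \ S ⊆ A) :
    |(S.card : ℝ) - T.card| ≤ A.card := by
  have aux : ∀ {S T : Finset ι}, S \ T ⊆ A → (S.card : ℝ) ≤ T.card + A.card := fun {S T} h => by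
    have : S ⊆ T ∪ A := fun x hx => by
      by_cases hT : x ∈ T
      · exact Finset.mem_union_left _ hT
      · exact Finset.mem_union_right _ (h (by simp [hx, hT]))
    exact_mod_cast (Finset.card_le_card this).trans (Finset.card_union_le _ _)
  have := aux h1
  have := aux h2
  rw [abs_le]
  constructor <;> linarith

/-- The labels within `2 * δ` of the `l`-th column of width `w`. -/
noncomputable def wide (w δ : ℝ) (X : ι → ℂ) (l : ℤ) : Finset ι :=
  Finset.univ.filter fun p => l * w - 2 * δ ≤ (X p).re ∧ (X p).re ≤ (l + 1) * w + 2 * δ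

open Classical in
/-- The labels within `2 * δ` of a column boundary. -/
noncomputable def zone (w δ : ℝ) (X : ι → ℂ) : Finset ι :=
  Finset.univ.filter fun p => ∃ l : ℤ, |(X p).re - l * w| ≤ 2 * δ

/-- A configuration is evenly spread at scale `w` up to perturbations of size `δ`. -/
def Spread (c w δ : ℝ) (X : ι → ℂ) : Prop :=
  (∀ l : ℤ, ((wide w δ X l).card : ℝ) ≤ c * Fintype.card ι) ∧
  ((zone w δ X).card : ℝ) ≤ c * Fintype.card ι

theorem norm_mode_sub_le {m : ℕ} {X : ι → ℂ} {j : ι} {a b : ℝ} (ha : |(rk X j : ℝ) - a| ≤ b) :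
    ‖mode m X j - ph (m * a / Fintype.card ι)‖ ≤ 2 * Real.pi * m * (b / Fintype.card ι) := by
  refine (norm_ph_sub_le _ _).trans ?_
  rw [mul_assoc (2 * Real.pi)]
  gcongr
  rw [← sub_div, ← mul_sub, abs_div, abs_mul, Nat.abs_cast, Nat.abs_cast, mul_div_assoc]
  gcongr

section

variable {c w δ : ℝ} {X X' : ι → ℂ}

/-- Index of the column containing a label. -/
noncomputable def col (w : ℝ) (X : ι → ℂ) (p : ι) : ℤ := ⌊(X p).re / w⌋

theorem col_spec (hw : 0 < w) (p : ι) : col w X p * w ≤ (X p).re ∧ (X p).re < (col w X p + 1) * w := by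
  have h1 := Int.floor_le ((X p).re / w)
  have h2 := Int.lt_floor_add_one ((X p).re / w)
  rw [le_div_iff₀ hw] at h1
  rw [div_lt_iff₀ hw] at h2
  exact ⟨h1, h2⟩

theorem col_mono (hw : 0 < w) {p q : ι} (h : (X p).re ≤ (X q).re) : col w X p ≤ col w X q :=
  Int.floor_mono (by gcongr)

theorem Spread.rk_sub (hS : Spread c w δ X) (hw : 0 < w) (hδ : 0 ≤ δ)
    (hm : ∀ k, |(X' k).re - (X k).re| ≤ δ) (j : ι) :
    |(rk X' j : ℝ) - rk X j| ≤ c * Fintype.card ι := by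
  refine (card_diff_le (A := wide w δ X (col w X j)) (fun p hp => ?_) (fun p hp => ?_)).trans
    (hS.1 (col w X j))
  all_goals
    simp only [wide, Finset.mem_sdiff, Finset.mem_filter, Finset.mem_univ, true_and, not_lt] at hp ⊢
    have hc := col_spec (X := X) hw j
    have h1 := abs_le.1 (hm p)
    have h2 := abs_le.1 (hm j)
    have h3 := re_le_of_key_lt hp.1
    have h4 : ∀ x y : ℂ, key x ≤ key y → x.re ≤ y.re := fun x y h => by
      rcases h.lt_or_eq with h | h
      · exact re_le_of_key_lt h
      · rw [key_injective h]
    have h5 := h4 _ _ hp.2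
    constructor <;> linarith

theorem Spread.rk_sub_col (hS : Spread c w δ X) (hw : 0 < w) (hδ : 0 ≤ δ) (j : ι) :
    |(rk X j : ℝ) - (Finset.univ.filter fun k => col w X k < col w X j).card| ≤
      c * Fintype.card ι := by
  refine (card_diff_le (A := wide w δ X (col w X j)) (fun p hp => ?_) (fun p hp => ?_)).trans
    (hS.1 (col w X j))
  all_goals
    simp only [wide, Finset.mem_sdiff, Finset.mem_filter, Finset.mem_univ, true_and, not_lt] at hp ⊢
  · have h1 := col_mono hw (re_le_of_key_lt hp.1)
    have h2 : col w X p = col w X j := le_antisymm h1 hp.2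
    have h3 := col_spec (X := X) hw p
    rw [h2] at h3
    constructor <;> linarith
  · exfalso
    have h4 : (X j).re ≤ (X p).re := by
      rcases hp.2.lt_or_eq with h | h
      · exact re_le_of_key_lt h
      · rw [key_injective h]
    exact absurd hp.1 (not_lt.2 (col_mono hw h4))

end

end Slab

section SlabEstimate

variable {ι : Type*} [DecidableEq ι] [Fintype ι]

theorem nsq_ind_sub {J J' : Finset ι} (h : J ⊆ J') :
    nsq (ind J' - ind J) = (J'.card : ℝ) - J.card := by
  have : ind J' - ind J = ind (J' \ J) := by
    funext k
    by_cases h1 : k ∈ J <;> by_cases h2 : k ∈ J' <;> simp [ind, h1, h2]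
    exact h2 (h h1)
  rw [this, nsq_ind, Finset.card_sdiff_of_subset h, Nat.cast_sub (Finset.card_le_card h)]

variable {ε : ℝ} {X X' : ι → ℂ} {A : (ι → ℂ) →ₗ[ℂ] (ι → ℂ)} {J J' : Finset ι}

theorem linearMap_supp (hA : ∀ j ∈ J, ∀ k ∉ J', A (Pi.single j 1) k = 0) {v : ι → ℂ}
    (hv : ∀ j ∉ J, v j = 0) : ∀ k ∉ J', A v k = 0 := by
  intro k hk
  have : v = ∑ j, v j • Pi.single (M := fun _ => ℂ) j 1 := by
    funext i; simp [Finset.sum_apply, Pi.single_apply]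
  rw [this, map_sum, Finset.sum_apply]
  refine Finset.sum_eq_zero fun j _ => ?_
  rw [map_smul, Pi.smul_apply]
  by_cases hj : j ∈ J
  · rw [hA j hj k hk, smul_zero]
  · rw [hv j hj, zero_smul]

theorem nsq_map_le (hε : 0 ≤ ε) (hform : ∀ v w, form ε X' (A v) (A w) = form ε X v w)
    (hA : ∀ j ∈ J, ∀ k ∉ J', A (Pi.single j 1) k = 0) (hJ : J ⊆ J') (hn : ε * J'.card ≤ 1 / 2)
    {v : ι → ℂ} (hv : ∀ j ∉ J, v j = 0) : nsq (A v) ≤ 3 * nsq v := by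
  have h1 := (nsq_le_form hε X' (linearMap_supp hA hv) hn).1
  have h2 := (nsq_le_form hε X (fun j hj => hv j fun h => hj (hJ h)) hn).2
  rw [hform] at h1
  have h0 : 0 ≤ (form ε X v v).re := by
    have := nsq_nonneg (A v)
    have h3 : 0 ≤ ε * J'.card := by positivity
    by_contra h
    nlinarith
  nlinarith

theorem nsq_map_ind_sub_le (hε : 0 ≤ ε) (hform : ∀ v w, form ε X' (A v) (A w) = form ε X v w)
    (hsum : ∀ v, ∑ j, A v j = ∑ j, v j)
    (hA : ∀ j ∈ J, ∀ k ∉ J', A (Pi.single j 1) k = 0) (hn : ε * J'.card ≤ 1 / 2) :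
    nsq (A (ind J) - ind J') ≤ (J'.card - J.card : ℝ) + 2 * (ε * J'.card) * J.card := by
  have hs := linearMap_supp hA (v := ind J) (fun j hj => by simp [ind, hj])
  have h1 := (nsq_le_form hε X' hs hn).1
  rw [hform, form_ind, Complex.natCast_re] at h1
  have h2 : nsq (A (ind J) - ind J') =
      nsq (A (ind J)) - 2 * (∑ k, A (ind J) k).re + J'.card := by
    have : ∀ k, ‖A (ind J) k - ind J' k‖ ^ 2 =
        ‖A (ind J) k‖ ^ 2 - 2 * (A (ind J) k).re + (if k ∈ J' then 1 else 0) := fun k => by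
      by_cases hk : k ∈ J'
      · simp only [ind, hk, if_true]
        rw [← Complex.normSq_eq_norm_sq, ← Complex.normSq_eq_norm_sq, Complex.normSq_apply,
          Complex.normSq_apply, Complex.sub_re, Complex.sub_im, Complex.one_re, Complex.one_im]
        ring
      · simp [ind, hk, hs k hk]
    simp only [nsq, Pi.sub_apply, this]
    rw [Finset.sum_add_distrib, Finset.sum_sub_distrib, Complex.re_sum, Finset.mul_sum]
    simp
  have h3 : (∑ k, A (ind J) k).re = J.card := by
    rw [hsum]; simp [ind]
  rw [h2, h3]
  linarith

theorem nsq_map_block_le {c B : ℝ} (hε : 0 ≤ ε)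
    (hform : ∀ v w, form ε X' (A v) (A w) = form ε X v w)
    (hsum : ∀ v, ∑ j, A v j = ∑ j, v j)
    (hA : ∀ j ∈ J, ∀ k ∉ J', A (Pi.single j 1) k = 0) (hJ : J ⊆ J')
    (hB : ε * J'.card ≤ B * c) (hn : B * c ≤ 1 / 2) {f : ℂ} (hf : ‖f‖ = 1)
    {u : ι → ℂ} {b : ℝ} (hu : ∀ j ∈ J, ‖u j - f‖ ≤ b) :
    nsq (A (fun j => if j ∈ J then u j else 0) - fun j => if j ∈ J then u j else 0) ≤
      8 * (J'.card - J.card : ℝ) + 8 * (B * c) * J.card + 16 * b ^ 2 * J.card := by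
  set η : ι → ℂ := fun j => if j ∈ J then u j - f else 0 with hη
  have hv : (fun j => if j ∈ J then u j else 0) = f • ind J + η := by
    funext j; by_cases h : j ∈ J <;> simp [ind, hη, h]
  have hn' := hB.trans hn
  have e1 := nsq_map_ind_sub_le hε hform hsum hA hn'
  have e2 := nsq_map_le hε hform hA hJ hn' (v := η) (fun j hj => by simp [hη, hj])
  have e3 : nsq η ≤ b ^ 2 * J.card := by
    have : nsq η = ∑ j ∈ J, ‖u j - f‖ ^ 2 := by
      simp only [nsq, hη, apply_ite, norm_zero]
      rw [← Finset.sum_filter_add_sum_filter_not Finset.univ (· ∈ J)]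
      simp only [Finset.filter_mem_eq_inter, Finset.univ_inter]
      rw [Finset.sum_congr rfl fun j hj => by rw [if_pos hj],
        Finset.sum_eq_zero (s := Finset.univ.filter (· ∉ J)) fun j hj => by
          rw [if_neg (Finset.mem_filter.1 hj).2]; simp, add_zero]
    rw [this]
    refine (Finset.sum_le_card_nsmul _ _ (b ^ 2) fun j hj =>
      pow_le_pow_left₀ (norm_nonneg _) (hu j hj) 2).trans ?_
    rw [nsmul_eq_mul, mul_comm]
  have e4 : A (f • ind J + η) - (f • ind J + η) =
      f • ((A (ind J) - ind J') + (ind J' - ind J)) + (A η - η) := by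
    rw [map_add, map_smul]; module
  rw [hv, e4]
  have e5 := nsq_add_le (f • ((A (ind J) - ind J') + (ind J' - ind J))) (A η - η)
  rw [nsq_smul, hf, one_pow, one_mul] at e5
  have e6 := nsq_add_le (A (ind J) - ind J') (ind J' - ind J)
  have e7 := nsq_sub_le (A η) η
  rw [nsq_ind_sub hJ] at e6
  have e8 : 2 * (ε * J'.card) * J.card ≤ 2 * (B * c) * J.card := by gcongr
  linarith

variable {w δ : ℝ}

theorem mem_wide_col (hw : 0 < w) (hδ : 0 ≤ δ) (k : ι) : k ∈ wide w δ X (col w X k) := by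
  have h := col_spec (X := X) hw k
  simp only [wide, Finset.mem_filter, Finset.mem_univ, true_and]
  constructor <;> linarith

theorem col_of_mem_wide (hw : 0 < w) (hδ : 2 * δ < w) {k : ι} {l : ℤ} (h : k ∈ wide w δ X l) :
    l - 1 ≤ col w X k ∧ col w X k ≤ l + 1 := by
  simp only [wide, Finset.mem_filter, Finset.mem_univ, true_and] at h
  have hc := col_spec (X := X) hw k
  constructor
  · have : ((l - 1 : ℤ) : ℝ) < (col w X k + 1 : ℤ) := by
      push_cast
      refine lt_of_mul_lt_mul_right (a := w) ?_ hw.le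
      linarith
    have := Int.cast_lt.1 this
    omega
  · have : ((col w X k : ℤ) : ℝ) < (l + 2 : ℤ) := by
      push_cast
      refine lt_of_mul_lt_mul_right (a := w) ?_ hw.le
      linarith
    have := Int.cast_lt.1 this
    omega

theorem mem_zone_of_mem_wide (hw : 0 < w) {k : ι} {l : ℤ} (h : k ∈ wide w δ X l)
    (hl : col w X k ≠ l) : k ∈ zone w δ X := by
  simp only [wide, Finset.mem_filter, Finset.mem_univ, true_and] at h
  simp only [zone, Finset.mem_filter, Finset.mem_univ, true_and]
  have hc := col_spec (X := X) hw k
  rcases lt_or_gt_of_ne hl with h1 | h1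
  · refine ⟨l, abs_le.2 ?_⟩
    have : (col w X k : ℝ) + 1 ≤ l := by exact_mod_cast h1
    have := mul_le_mul_of_nonneg_right this hw.le
    have := h.1
    constructor <;> linarith
  · refine ⟨l + 1, abs_le.2 ?_⟩
    have : (l : ℝ) + 1 ≤ col w X k := by exact_mod_cast h1
    have := mul_le_mul_of_nonneg_right this hw.le
    have := h.2
    push_cast
    constructor <;> linarith

theorem card_wide_le (hw : 0 < w) (hδ : 2 * δ < w) (L : Finset ℤ) (k : ι) :
    (L.filter fun l => k ∈ wide w δ X l).card ≤ 3 := by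
  refine (Finset.card_le_card (t := Finset.Icc (col w X k - 1) (col w X k + 1))
    fun l hl => ?_).trans (by rw [Int.card_Icc]; omega)
  have := col_of_mem_wide hw hδ (Finset.mem_filter.1 hl).2
  rw [Finset.mem_Icc]; omega

theorem nsq_sum_le (hw : 0 < w) (hδ : 2 * δ < w) (L : Finset ℤ) (g : ℤ → ι → ℂ)
    (hg : ∀ l, ∀ k ∉ wide w δ X l, g l k = 0) : nsq (∑ l ∈ L, g l) ≤ 3 * ∑ l ∈ L, nsq (g l) := by
  simp only [nsq]
  rw [Finset.sum_comm, Finset.mul_sum]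
  refine Finset.sum_le_sum fun k _ => ?_
  rw [Finset.sum_apply]
  have h1 : ∑ l ∈ L, g l k = ∑ l ∈ L.filter (fun l => k ∈ wide w δ X l), g l k := by
    rw [Finset.sum_filter]
    exact Finset.sum_congr rfl fun l _ => by split_ifs with h <;> simp [hg l k, h]
  rw [h1]
  calc _ ≤ (∑ l ∈ L.filter (fun l => k ∈ wide w δ X l), ‖g l k‖) ^ 2 :=
        pow_le_pow_left₀ (norm_nonneg _) (norm_sum_le _ _) 2
    _ ≤ (L.filter (fun l => k ∈ wide w δ X l)).card *
        ∑ l ∈ L.filter (fun l => k ∈ wide w δ X l), ‖g l k‖ ^ 2 := sq_sum_le_card_mul_sum_sq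
    _ ≤ 3 * ∑ l ∈ L, ‖g l k‖ ^ 2 := by
        gcongr
        · exact_mod_cast card_wide_le hw hδ L k
        · exact Finset.filter_subset _ _

/-- The labels in the `l`-th column. -/
noncomputable def column (w : ℝ) (X : ι → ℂ) (l : ℤ) : Finset ι :=
  Finset.univ.filter fun p => col w X p = l

theorem sum_wide_sub_le (hw : 0 < w) (hδ : 2 * δ < w) (L : Finset ℤ) :
    ∑ l ∈ L, ((wide w δ X l).card - (column w X l).card : ℝ) ≤ 3 * (zone w δ X).card := by
  have h1 : ∀ l, ((wide w δ X l).card - (column w X l).card : ℝ) ≤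
      ∑ k ∈ zone w δ X, if k ∈ wide w δ X l then 1 else 0 := fun l => by
    have : wide w δ X l ⊆ column w X l ∪ (zone w δ X).filter (· ∈ wide w δ X l) := fun k hk => by
      by_cases h : col w X k = l
      · exact Finset.mem_union_left _ (by simp [column, h])
      · exact Finset.mem_union_right _
          (Finset.mem_filter.2 ⟨mem_zone_of_mem_wide hw hk h, hk⟩)
    have h := (Finset.card_le_card this).trans (Finset.card_union_le _ _)
    have h' : ((wide w δ X l).card : ℝ) ≤ (column w X l).card +
      ((zone w δ X).filter (· ∈ wide w δ X l)).card := by exact_mod_cast h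
    rw [Finset.sum_boole]
    linarith
  refine (Finset.sum_le_sum fun l _ => h1 l).trans ?_
  rw [Finset.sum_comm]
  refine (Finset.sum_le_card_nsmul _ _ (3 : ℝ) fun k _ => ?_).trans
    (by rw [nsmul_eq_mul, mul_comm])
  rw [Finset.sum_boole]
  exact_mod_cast card_wide_le hw hδ L k

/-- A form-preserving map which moves mass only slightly in the horizontal direction nearly
preserves the low Fourier modes. -/
theorem nsq_map_mode_sub_le {m : ℕ} {c B : ℝ} (hε : 0 ≤ ε)
    (hform : ∀ v w, form ε X' (A v) (A w) = form ε X v w)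
    (hsum : ∀ v, ∑ j, A v j = ∑ j, v j) (hδ0 : 0 ≤ δ)
    (hloc : ∀ j k, 2 * δ < |(X k).re - (X j).re| → A (Pi.single j 1) k = 0)
    (hmove : ∀ k, |(X' k).re - (X k).re| ≤ δ) (hw : 0 < w) (hδ : 2 * δ < w)
    (hS : Spread c w δ X) (hB : ε * Fintype.card ι ≤ B) (hc : 0 ≤ c) (hc1 : c ≤ 1)
    (hBc : B * c ≤ 1 / 2) :
    nsq (A (mode m X) - mode m X') ≤
      (144 + 48 * B + 98 * (2 * Real.pi * m) ^ 2) * c * Fintype.card ι := by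
  rcases isEmpty_or_nonempty ι with hι | hι
  · simp [nsq]
  set N : ℝ := ((Fintype.card ι : ℕ) : ℝ) with hN
  have hNpos : 0 < N := by rw [hN]; exact_mod_cast Fintype.card_pos
  set u := mode m X
  set L : Finset ℤ := Finset.univ.image (col w X)
  set b : ℝ := 2 * Real.pi * m * c
  have hcN : c * N / N = c := mul_div_cancel_right₀ _ hNpos.ne'
  set v : ℤ → ι → ℂ := fun l j => if j ∈ column w X l then u j else 0 with hv
  have hcol : ∀ l, column w X l ⊆ wide w δ X l := fun l k hk => by
    have := (Finset.mem_filter.1 hk).2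
    rw [← this]; exact mem_wide_col hw hδ0 k
  have huv : u = ∑ l ∈ L, v l := by
    funext j
    rw [Finset.sum_apply, Finset.sum_eq_single (col w X j)]
    · simp [hv, column]
    · intro l _ hl; simp [hv, column, hl.symm]
    · intro h; exact absurd (Finset.mem_image_of_mem _ (Finset.mem_univ j)) h
  have hA : ∀ l, ∀ j ∈ column w X l, ∀ k ∉ wide w δ X l, A (Pi.single j 1) k = 0 := by
    intro l j hj k hk
    refine hloc j k ?_
    by_contra h
    rw [not_lt, abs_le] at h
    apply hk
    have hl := (Finset.mem_filter.1 hj).2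
    have hs := col_spec (X := X) hw j
    rw [hl] at hs
    simp only [wide, Finset.mem_filter, Finset.mem_univ, true_and]
    constructor <;> linarith
  have hblock : ∀ l, nsq (A (v l) - v l) ≤
      8 * ((wide w δ X l).card - (column w X l).card : ℝ) +
        (8 * (B * c) + 16 * b ^ 2) * (column w X l).card := by
    intro l
    have h1 : ε * (wide w δ X l).card ≤ B * c := by
      calc ε * ((wide w δ X l).card : ℝ) ≤ ε * (c * N) := by gcongr; exact hS.1 l
        _ = (ε * N) * c := by ring
        _ ≤ _ := by gcongr
    have := nsq_map_block_le hε hform hsum (hA l) (hcol l) h1 hBc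
      (f := ph (m * ((Finset.univ.filter fun k => col w X k < l).card : ℝ) / Fintype.card ι))
      (norm_ph _)
      (u := u) (b := b) (fun j hj => by
        have hl := (Finset.mem_filter.1 hj).2
        have := norm_mode_sub_le (m := m) (hS.rk_sub_col hw hδ0 j)
        rw [hl] at this
        refine this.trans_eq ?_
        rw [hcN])
    linarith
  have hsub : A u - u = ∑ l ∈ L, (A (v l) - v l) := by
    rw [Finset.sum_sub_distrib, ← map_sum, ← huv]
  have hsupp : ∀ l, ∀ k ∉ wide w δ X l, (A (v l) - v l) k = 0 := fun l k hk => by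
    rw [Pi.sub_apply, linearMap_supp (hA l) (fun j hj => by simp [hv, hj]) k hk]
    have : k ∉ column w X l := fun h => hk (hcol l h)
    simp [hv, this]
  have hcard : ∑ l ∈ L, ((column w X l).card : ℝ) = N := by
    rw [hN, ← Finset.card_univ, ← Nat.cast_sum]
    rw [Finset.card_eq_sum_card_image (col w X) Finset.univ]
    rfl
  have h1 : nsq (A u - u) ≤ 3 * (8 * (3 * (c * N)) + (8 * (B * c) + 16 * b ^ 2) * N) := by
    rw [hsub]
    refine (nsq_sum_le hw hδ L _ hsupp).trans ?_
    gcongr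
    refine (Finset.sum_le_sum fun l _ => hblock l).trans ?_
    rw [Finset.sum_add_distrib, ← Finset.mul_sum, ← Finset.mul_sum, hcard]
    have := sum_wide_sub_le (X := X) hw hδ L
    have := hS.2
    gcongr
    linarith
  have h2 : nsq (u - mode m X') ≤ b ^ 2 * N := by
    rw [nsq]
    refine (Finset.sum_le_card_nsmul _ _ (b ^ 2) fun j _ => ?_).trans_eq
      (by rw [nsmul_eq_mul, mul_comm, Finset.card_univ])
    refine pow_le_pow_left₀ (norm_nonneg _) ?_ 2
    rw [Pi.sub_apply, norm_sub_rev]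
    refine (norm_mode_sub_le (m := m) (hS.rk_sub hw hδ0 hmove j)).trans_eq ?_
    rw [hcN]
  have h3 : A u - mode m X' = (A u - u) + (u - mode m X') := by abel
  rw [h3]
  refine (nsq_add_le _ _).trans ?_
  have h4 : b ^ 2 ≤ (2 * Real.pi * m) ^ 2 * c := by
    have : b ^ 2 = (2 * Real.pi * m) ^ 2 * c * c := by simp only [b]; ring
    rw [this]
    exact mul_le_of_le_one_right (by positivity) hc1
  have h5 := mul_le_mul_of_nonneg_right h4 hNpos.le
  nlinarith

end SlabEstimate

section Determinants

variable {Q : ℕ}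

theorem exists_det_near_one (Q : ℕ) : ∃ η > 0, ∀ A : (Fin Q → ℂ) →ₗ[ℂ] (Fin Q → ℂ),
    (∀ v, ‖A v‖ ≤ η * ‖v‖) → ‖LinearMap.det (1 + A) - 1‖ < 1 / 2 := by
  have hcont : Continuous fun M : Fin Q → Fin Q → ℂ => (Matrix.of M).det :=
    Continuous.matrix_det (continuous_id : Continuous fun M : Matrix (Fin Q) (Fin Q) ℂ => M)
  have hc1 : ContinuousAt (fun M : Fin Q → Fin Q → ℂ => (Matrix.of M).det)
      (fun i j => (1 : Matrix (Fin Q) (Fin Q) ℂ) i j) := hcont.continuousAt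
  obtain ⟨η, hη, h⟩ := Metric.continuousAt_iff.1 hc1 (1 / 2) (by norm_num)
  refine ⟨η / 2, by positivity, fun A hA => ?_⟩
  have h1 : LinearMap.det (1 + A) = (LinearMap.toMatrix' (1 + A)).det :=
    (LinearMap.det_toMatrix' _).symm
  rw [h1]
  have h2 := @h (LinearMap.toMatrix' (1 + A)) ?_
  · have h3 : (Matrix.of (1 : Matrix (Fin Q) (Fin Q) ℂ)).det = 1 := Matrix.det_one
    rw [h3, dist_eq_norm] at h2
    exact h2
  · refine lt_of_le_of_lt ((dist_pi_le_iff (by positivity : 0 ≤ η / 2)).2 fun i =>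
      (dist_pi_le_iff (by positivity)).2 fun j => ?_) (half_lt_self hη)
    have h3 : LinearMap.toMatrix' (1 + A) i j - (1 : Matrix (Fin Q) (Fin Q) ℂ) i j =
        A (Pi.single j 1) i := by
      rw [map_add, Matrix.add_apply, LinearMap.toMatrix'_one, add_sub_cancel_left,
        LinearMap.toMatrix'_apply]
    rw [dist_eq_norm, h3]
    refine (norm_le_pi_norm _ i).trans ((hA _).trans ?_)
    rw [Pi.norm_single]
    simp

theorem det_ne_zero_of_injective {A : (Fin Q → ℂ) →ₗ[ℂ] (Fin Q → ℂ)} (hA : Function.Injective A) :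
    LinearMap.det A ≠ 0 := by
  have : IsUnit A := (LinearMap.isUnit_iff_ker_eq_bot A).2 (LinearMap.ker_eq_bot.2 hA)
  exact (this.map LinearMap.det).ne_zero

theorem norm_det_div_sub_one_lt {η : ℝ} (hη : ∀ A : (Fin Q → ℂ) →ₗ[ℂ] (Fin Q → ℂ),
    (∀ v, ‖A v‖ ≤ η * ‖v‖) → ‖LinearMap.det (1 + A) - 1‖ < 1 / 2)
    {A B : (Fin Q → ℂ) →ₗ[ℂ] (Fin Q → ℂ)} (hA : Function.Injective A)
    (h : ∀ c, ‖B c - A c‖ ≤ η * ‖A c‖) : ‖LinearMap.det B / LinearMap.det A - 1‖ < 1 / 2 := by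
  let e := LinearEquiv.ofInjectiveEndo A hA
  have he : ∀ c, e c = A c := fun _ => rfl
  have h1 := hη ((B - A) ∘ₗ e.symm.toLinearMap) (fun v => by
    have := h (e.symm v)
    rw [← he (e.symm v), e.apply_symm_apply] at this
    have h3 : ((B - A) ∘ₗ e.symm.toLinearMap) v = B (e.symm v) - v := by
      have : A (e.symm v) = v := by rw [← he, e.apply_symm_apply]
      simp [this]
    rwa [h3])
  have h2 : B = (1 + (B - A) ∘ₗ e.symm.toLinearMap) ∘ₗ A := by
    ext1 c
    refine LinearMap.ext fun x => ?_
    simp [← he]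
  have h3 : LinearMap.det B = LinearMap.det (1 + (B - A) ∘ₗ e.symm.toLinearMap) *
      LinearMap.det A := by
    conv_lhs => rw [h2]
    exact LinearMap.det_comp _ _
  rwa [h3, mul_div_cancel_right₀ _ (det_ne_zero_of_injective hA)]

end Determinants

theorem re_pos_of_near_one {z : ℂ} (h : ‖z - 1‖ < 1 / 2) : 0 < z.re := by
  have := (Complex.abs_re_le_norm _).trans_lt h
  rw [Complex.sub_re, Complex.one_re, abs_lt] at this
  linarith

theorem arg_mul_of_re_pos {z w : ℂ} (hz : 0 < z.re) (hw : 0 < w.re) :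
    (z * w).arg = z.arg + w.arg := by
  have h1 := Complex.abs_arg_lt_pi_div_two_iff.2 (Or.inl hz)
  have h2 := Complex.abs_arg_lt_pi_div_two_iff.2 (Or.inl hw)
  rw [abs_lt] at h1 h2
  refine Complex.arg_mul (by rintro rfl; simp at hz) (by rintro rfl; simp at hw) ⟨?_, ?_⟩ <;>
    linarith

section Polynomials

open Polynomial

/-- The continuous argument of a polynomial without zeros in the unit disc. -/
noncomputable def rootArg (p : ℂ[X]) (u : ℂ) : ℝ := (p.roots.map fun r => (1 - u / r).arg).sum

variable {p : ℂ[X]}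

theorem rootArg_zero (p : ℂ[X]) : rootArg p 0 = 0 := by simp [rootArg]

theorem re_one_sub_pos (hp : ∀ z : ℂ, ‖z‖ ≤ 1 → p.eval z ≠ 0) {u r : ℂ} (hu : ‖u‖ ≤ 1)
    (hr : r ∈ p.roots) : 0 < (1 - u / r).re := by
  have h1 : 1 < ‖r‖ := by
    by_contra h
    exact hp r (not_lt.1 h) (isRoot_of_mem_roots hr)
  have h2 : ‖u / r‖ < 1 := by
    rw [norm_div, div_lt_one (by linarith)]; linarith
  have := (Complex.abs_re_le_norm _).trans_lt h2
  rw [abs_lt] at this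
  rw [Complex.sub_re, Complex.one_re]; linarith

theorem abs_rootArg_le (hp : ∀ z : ℂ, ‖z‖ ≤ 1 → p.eval z ≠ 0) {u : ℂ} (hu : ‖u‖ ≤ 1) :
    |rootArg p u| ≤ p.natDegree * (Real.pi / 2) := by
  rw [rootArg]
  refine Multiset.abs_sum_le_sum_abs.trans ?_
  refine (Multiset.sum_le_card_nsmul _ (Real.pi / 2) ?_).trans ?_
  · intro x hx
    rw [Multiset.map_map, Multiset.mem_map] at hx
    obtain ⟨r, hr, rfl⟩ := hx
    exact Complex.abs_arg_le_pi_div_two_iff.2 (re_one_sub_pos hp hu hr).le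
  · rw [nsmul_eq_mul, Multiset.card_map, Multiset.card_map]
    gcongr
    exact_mod_cast p.card_roots'

theorem coe_rootArg (hp : ∀ z : ℂ, ‖z‖ ≤ 1 → p.eval z ≠ 0) {u : ℂ} (hu : ‖u‖ ≤ 1) :
    (rootArg p u : Real.Angle) = ((p.eval u / p.eval 0).arg : Real.Angle) := by
  have hr : ∀ r ∈ p.roots, 0 < (1 - u / r).re := fun r hr => re_one_sub_pos hp hu hr
  have hr0 : ∀ r ∈ p.roots, r ≠ 0 := fun r hr h =>
    hp r (by simp [h]) (isRoot_of_mem_roots hr)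
  have h1 : ∀ z, p.eval z = p.leadingCoeff * (p.roots.map fun r => z - r).prod := fun z => by
    conv_lhs => rw [(IsAlgClosed.splits p).eq_prod_roots]
    simp [eval_multiset_prod, Multiset.map_map]
  have hl : p.leadingCoeff ≠ 0 := fun h => hp 0 (by simp) (by rw [h1, h, zero_mul])
  rw [h1, h1, mul_div_mul_left _ _ hl, rootArg, ← Multiset.prod_map_div]
  generalize p.roots = s at hr hr0 ⊢
  clear h1 hl
  induction s using Multiset.induction_on with
  | empty => simp
  | cons a s ih =>
    have e : (u - a) / (0 - a) = 1 - u / a := by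
      have := hr0 a (Multiset.mem_cons_self a s)
      field_simp
      ring
    have ha := hr a (Multiset.mem_cons_self a s)
    have hs : (s.map fun r => (u - r) / (0 - r)).prod ≠ 0 := by
      rw [Ne, Multiset.prod_eq_zero_iff, Multiset.mem_map]
      rintro ⟨r, hrs, h0⟩
      have h2 := hr0 r (Multiset.mem_cons_of_mem hrs)
      have h3 := hr r (Multiset.mem_cons_of_mem hrs)
      have e : (u - r) / (0 - r) = 1 - u / r := by field_simp; ring
      rw [← e, h0] at h3
      simp at h3
    rw [Multiset.map_cons, Multiset.map_cons, Multiset.sum_cons, Multiset.prod_cons, e,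
      Complex.arg_mul_coe_angle (fun h => by rw [h] at ha; simp at ha) hs, Real.Angle.coe_add,
      ih (fun r h => hr r (Multiset.mem_cons_of_mem h))
        (fun r h => hr0 r (Multiset.mem_cons_of_mem h))]

theorem continuousOn_rootArg (hp : ∀ z : ℂ, ‖z‖ ≤ 1 → p.eval z ≠ 0) :
    ContinuousOn (fun u : ℝ => rootArg p u) (Set.Icc 0 1) := by
  have h : ∀ r ∈ p.roots, ContinuousOn (fun u : ℝ => (1 - (u:ℂ) / r).arg) (Set.Icc 0 1) := by
    intro r hr u hu
    have hc : ContinuousWithinAt (fun u : ℝ => 1 - (u:ℂ) / r) (Set.Icc 0 1) u := by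
      have : Continuous fun u : ℝ => 1 - (u:ℂ) / r := by fun_prop
      exact this.continuousWithinAt
    refine (Complex.continuousAt_arg (Or.inl (re_one_sub_pos hp ?_ hr))).comp_continuousWithinAt
      (f := fun u : ℝ => 1 - (u:ℂ) / r) hc
    rw [Complex.norm_real, Real.norm_of_nonneg hu.1]; exact hu.2
  unfold rootArg
  generalize p.roots = s at h
  induction s using Multiset.induction_on with
  | empty => simpa using continuousOn_const
  | cons a s ih =>
    simp only [Multiset.map_cons, Multiset.sum_cons]
    exact (h a (Multiset.mem_cons_self a s)).add (ih fun r hr => h r (Multiset.mem_cons_of_mem hr))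

theorem eq_of_continuousOn_angle {f : ℝ → ℝ} (hf : ContinuousOn f (Set.Icc 0 1))
    (h : ∀ u ∈ Set.Icc (0:ℝ) 1, (f u : Real.Angle) = 0) : f 1 = f 0 := by
  refine const_of_locally (isPreconnected_Icc (a := (0:ℝ)) (b := 1)) f (fun k hk => ?_)
    (by simp) (by simp)
  filter_upwards [self_mem_nhdsWithin, (Metric.continuousWithinAt_iff'.1 (hf k hk)) 1 one_pos]
    with k' hk' hd
  have : ((f k' : ℝ) : Real.Angle) = f k := by rw [h k hk, h k' hk']
  obtain ⟨n, hn⟩ := Real.Angle.angle_eq_iff_two_pi_dvd_sub.1 this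
  rw [Real.dist_eq, hn, abs_mul, abs_of_pos Real.two_pi_pos] at hd
  have hn0 : n = 0 := by
    by_contra hne
    have : (1:ℝ) ≤ |(n:ℝ)| := by exact_mod_cast Int.one_le_abs hne
    nlinarith [Real.pi_gt_three]
  rw [hn0] at hn
  simp at hn
  linarith

/-- The polynomial `det (A + u B)`. -/
noncomputable def pencil {Q : ℕ} (A B : (Fin Q → ℂ) →ₗ[ℂ] (Fin Q → ℂ)) : ℂ[X] :=
  Matrix.det ((X : ℂ[X]) • (LinearMap.toMatrix' B).map C + (LinearMap.toMatrix' A).map C)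

variable {Q : ℕ} (A B : (Fin Q → ℂ) →ₗ[ℂ] (Fin Q → ℂ))

theorem eval_pencil (u : ℂ) : (pencil A B).eval u = LinearMap.det (A + u • B) := by
  rw [pencil, ← coe_evalRingHom, RingHom.map_det, ← LinearMap.det_toMatrix']
  congr 1
  ext i j
  simp
  ring

theorem natDegree_pencil_le : (pencil A B).natDegree ≤ Q := by
  refine (natDegree_det_X_add_C_le (LinearMap.toMatrix' B) (LinearMap.toMatrix' A)).trans ?_
  rw [Fintype.card_fin]

end Polynomials

section

variable {V : Type*} [AddCommGroup V] [Module ℂ V] {Q : ℕ} {E : Type*} [NormedAddCommGroup E]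
  [NormedSpace ℝ E]

/-- A family of coordinate maps on a cone of negative vectors which vary by small steps. -/
structure Coarse (V : Type*) [AddCommGroup V] [Module ℂ V] (Q : ℕ) {E : Type*}
    [NormedAddCommGroup E] [NormedSpace ℝ E] (K : Set E) where
  L : E → V →ₗ[ℂ] (Fin Q → ℂ)
  W : E → (Fin Q → ℂ) →ₗ[ℂ] V
  neg : V → Prop
  near : E → E → Prop
  LW : ∀ k ∈ K, ∀ c, L k (W k c) = c
  W_neg : ∀ k ∈ K, ∀ c, neg (W k c)
  definite : ∀ k ∈ K, ∀ y, neg y → L k y = 0 → y = 0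
  interp : ∀ k ∈ K, ∀ y, neg y → ∀ u : ℂ, ‖u‖ ≤ 1 →
    neg (W k (L k y) + u • (y - W k (L k y)))
  η : ℝ
  det_near : ∀ A : (Fin Q → ℂ) →ₗ[ℂ] (Fin Q → ℂ),
    (∀ v, ‖A v‖ ≤ η * ‖v‖) → ‖LinearMap.det (1 + A) - 1‖ < 1 / 2
  step : ∀ k ∈ K, ∀ k' ∈ K, near k k' → ∀ y, neg y → ‖L k' y - L k y‖ ≤ η * ‖L k y‖
  δ : ℝ
  δ_pos : 0 < δ
  near_of_dist : ∀ k ∈ K, ∀ k' ∈ K, dist k k' < δ → near k k'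

namespace Coarse

variable {K : Set E} (C : Coarse V Q K)

/-- Frames of negative subspaces. -/
def IsFrame (Y : (Fin Q → ℂ) →ₗ[ℂ] V) : Prop := Function.Injective Y ∧ ∀ c, C.neg (Y c)

/-- The determinant of a frame in the coordinates at `k`. -/
noncomputable def det (Y : (Fin Q → ℂ) →ₗ[ℂ] V) (k : E) : ℂ := LinearMap.det (C.L k ∘ₗ Y)

variable {C} {Y : (Fin Q → ℂ) →ₗ[ℂ] V} {k k' k'' : E}

theorem W_frame (hk : k ∈ K) : C.IsFrame (C.W k) :=
  ⟨fun a b h => by rw [← C.LW k hk a, h, C.LW k hk], C.W_neg k hk⟩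

theorem IsFrame.inj (hY : C.IsFrame Y) (hk : k ∈ K) : Function.Injective (C.L k ∘ₗ Y) := by
  rw [← LinearMap.ker_eq_bot, LinearMap.ker_eq_bot']
  intro c hc
  have := C.definite k hk _ (hY.2 c) hc
  exact hY.1 (by rw [this, map_zero])

theorem IsFrame.det_ne (hY : C.IsFrame Y) (hk : k ∈ K) : C.det Y k ≠ 0 :=
  det_ne_zero_of_injective (hY.inj hk)

theorem IsFrame.ratio (hY : C.IsFrame Y) (hk : k ∈ K) (hk' : k' ∈ K) (h : C.near k k') :
    ‖C.det Y k' / C.det Y k - 1‖ < 1 / 2 :=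
  norm_det_div_sub_one_lt C.det_near (hY.inj hk) fun c => C.step k hk k' hk' h _ (hY.2 c)

variable (C) in
/-- The angle by which the determinant of a frame turns between two parameters. -/
noncomputable def ang (Y : (Fin Q → ℂ) →ₗ[ℂ] V) (k k' : E) : ℝ := (C.det Y k' / C.det Y k).arg

theorem IsFrame.ang_add (hY : C.IsFrame Y) (hk : k ∈ K) (hk' : k' ∈ K) (hk'' : k'' ∈ K)
    (h : C.near k k') (h' : C.near k' k'') :
    C.ang Y k k'' = C.ang Y k k' + C.ang Y k' k'' := by
  rw [ang, ang, ang, add_comm, ← arg_mul_of_re_pos (re_pos_of_near_one (hY.ratio hk' hk'' h'))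
    (re_pos_of_near_one (hY.ratio hk hk' h)), div_mul_div_cancel₀ (hY.det_ne hk')]

theorem IsFrame.ang_self (hY : C.IsFrame Y) (hk : k ∈ K) : C.ang Y k k = 0 := by
  rw [ang, div_self (hY.det_ne hk), Complex.arg_one]

variable (C) in
/-- `P` is a lift of the argument of the determinant of the frame `Y`. -/
def IsPot (S : Set E) (Y : (Fin Q → ℂ) →ₗ[ℂ] V) (P : E → ℝ) : Prop :=
  ∀ k ∈ S, ∀ᶠ k' in 𝓝[S] k, P k' = P k + C.ang Y k k'

theorem IsFrame.exists_pot (hY : C.IsFrame Y) (hK : IsCompact K) (hc : Convex ℝ K) :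
    ∃ P, C.IsPot K Y P := by
  obtain ⟨F, hF⟩ := exists_potential (Γ := Multiplicative ℝ) hK hc
    (c := fun k k' => Multiplicative.ofAdd (C.ang Y k k')) C.δ_pos
    (fun k hk => by rw [hY.ang_self hk]; rfl)
    (fun k hk k' hk' k'' hk'' h1 h2 h3 => by
      rw [hY.ang_add hk hk' hk'' (C.near_of_dist _ hk _ hk' h1) (C.near_of_dist _ hk' _ hk'' h2),
        ofAdd_add, mul_comm])
  refine ⟨fun k => (F k).toAdd, fun k hk => ?_⟩
  filter_upwards [self_mem_nhdsWithin,
    mem_nhdsWithin_of_mem_nhds (Metric.ball_mem_nhds k (half_pos C.δ_pos))] with k' hk' hb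
  have := hF k hk k' hk' (by rw [dist_comm]; exact hb)
  simp only [this, toAdd_mul, toAdd_ofAdd]
  ring

theorem IsPot.sub_eq {S : Set E} {P P' : E → ℝ} (hS : IsPreconnected S) (h : C.IsPot S Y P)
    (h' : C.IsPot S Y P') (hk : k ∈ S) (hk' : k' ∈ S) : P k' - P k = P' k' - P' k := by
  have := const_of_locally hS (fun k => P k - P' k) (fun k hk => by
    filter_upwards [h k hk, h' k hk] with x h1 h2
    rw [h1, h2]; ring) hk hk'
  linarith

theorem IsPot.mono {S S' : Set E} {P : E → ℝ} (h : C.IsPot S Y P) (hS : S' ⊆ S) :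
    C.IsPot S' Y P := fun k hk => (h k (hS hk)).filter_mono (nhdsWithin_mono k hS)

/-- On a connected set of parameters near `k` the lift is the principal argument. -/
theorem IsPot.sub_eq_ang {S : Set E} {P : E → ℝ} (hY : C.IsFrame Y) (h : C.IsPot S Y P)
    (hSK : S ⊆ K) (hS : IsPreconnected S) (hk : k ∈ S) (hk' : k' ∈ S)
    (hn : ∀ x ∈ S, C.near k x) : P k' - P k = C.ang Y k k' := by
  have h1 : C.IsPot S Y (C.ang Y k) := fun x hx => by
    filter_upwards [self_mem_nhdsWithin,
      mem_nhdsWithin_of_mem_nhds (Metric.ball_mem_nhds x C.δ_pos)] with x' hx' hb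
    exact hY.ang_add (hSK hk) (hSK hx) (hSK hx') (hn x hx)
      (C.near_of_dist _ (hSK hx) _ (hSK hx') (by rw [dist_comm]; exact hb))
  rw [h.sub_eq hS h1 hk hk', hY.ang_self (hSK hk), sub_zero]

theorem abs_ang_le : |C.ang Y k k'| ≤ Real.pi := Complex.abs_arg_le_pi _

theorem IsPot.map_linear {S : Set E} {P : E → ℝ} (h : C.IsPot S Y P)
    (A : (Fin Q → ℂ) →ₗ[ℂ] (Fin Q → ℂ)) (hA : LinearMap.det A ≠ 0) :
    C.IsPot S (Y ∘ₗ A) P := fun k hk => by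
  filter_upwards [h k hk] with x hx
  have : ∀ x, C.det (Y ∘ₗ A) x = C.det Y x * LinearMap.det A := fun x => by
    rw [det, ← LinearMap.comp_assoc, LinearMap.det_comp]; rfl
  rw [hx, ang, ang, this, this, mul_div_mul_right _ _ hA]

theorem IsFrame.exists_bounded (hY : C.IsFrame Y) (hK : IsPreconnected K) {k₀ : E} (hk₀ : k₀ ∈ K) :
    ∃ S : E → ℝ, (∀ k ∈ K, |S k| ≤ Q * (Real.pi / 2)) ∧
      ∀ P P', C.IsPot K Y P → C.IsPot K (C.W k₀) P' → ∀ k ∈ K, ∀ k' ∈ K,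
        P k' - P k = P' k' - P' k + (S k' - S k) := by
  set Y₀ := C.W k₀ ∘ₗ C.L k₀ ∘ₗ Y with hY₀
  set Z : ℂ → (Fin Q → ℂ) →ₗ[ℂ] V := fun u => Y₀ + u • (Y - Y₀) with hZ
  have hZf : ∀ u : ℂ, ‖u‖ ≤ 1 → C.IsFrame (Z u) := fun u hu => by
    refine ⟨fun a b h => hY.inj hk₀ ?_, fun c => C.interp k₀ hk₀ _ (hY.2 c) u hu⟩
    have h1 : ∀ c, C.L k₀ (Z u c) = C.L k₀ (Y c) := fun c => by
      simp [hZ, hY₀, C.LW k₀ hk₀]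
    change C.L k₀ (Y a) = C.L k₀ (Y b)
    rw [← h1, ← h1, h]
  have hZd : ∀ u k, C.det (Z u) k = (pencil (C.L k ∘ₗ Y₀) (C.L k ∘ₗ (Y - Y₀))).eval u := fun u k => by
    rw [eval_pencil, det]
    congr 1
    simp only [hZ, LinearMap.comp_add, LinearMap.comp_smul]
  set p : E → Polynomial ℂ := fun k => pencil (C.L k ∘ₗ Y₀) (C.L k ∘ₗ (Y - Y₀)) with hp
  have hne : ∀ k ∈ K, ∀ z, ‖z‖ ≤ 1 → (p k).eval z ≠ 0 := fun k hk z hz => by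
    rw [← hZd]; exact (hZf z hz).det_ne hk
  refine ⟨fun k => rootArg (p k) 1, fun k hk => ?_, fun P P' hP hP' k hk k' hk' => ?_⟩
  · refine (abs_rootArg_le (hne k hk) (by simp)).trans ?_
    gcongr
    exact natDegree_pencil_le _ _
  have hP₀ : C.IsPot K Y₀ P' := hP'.map_linear _ (det_ne_zero_of_injective (hY.inj hk₀))
  have hstep : ∀ k ∈ K, ∀ k' ∈ K, C.near k k' →
      C.ang Y k k' = C.ang Y₀ k k' + (rootArg (p k') 1 - rootArg (p k) 1) := by
    intro k hk k' hk' hn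
    have h01 : ∀ u ∈ Set.Icc (0:ℝ) 1, ‖(u:ℂ)‖ ≤ 1 := fun u hu => by
      rw [Complex.norm_real, Real.norm_of_nonneg hu.1]; exact hu.2
    have hratio : ∀ u ∈ Set.Icc (0:ℝ) 1, 0 < ((p k').eval (u:ℂ) / (p k).eval (u:ℂ)).re :=
      fun u hu => re_pos_of_near_one (by
        have := (hZf u (h01 u hu)).ratio hk hk' hn
        rwa [hZd, hZd] at this)
    have hpc : ∀ k, ContinuousOn (fun u : ℝ => (p k).eval (u:ℂ)) (Set.Icc 0 1) := fun k =>
      ((p k).continuous.comp Complex.continuous_ofReal).continuousOn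
    have := eq_of_continuousOn_angle
      (f := fun u : ℝ => rootArg (p k') u - rootArg (p k) u -
        (((p k').eval (u:ℂ) / (p k).eval (u:ℂ)).arg -
          ((p k').eval (0:ℂ) / (p k).eval (0:ℂ)).arg)) ?_ ?_
    · simp only [Complex.ofReal_zero, rootArg_zero, Complex.ofReal_one, sub_self] at this
      have e0 : C.ang Y₀ k k' = ((p k').eval (0:ℂ) / (p k).eval (0:ℂ)).arg := by
        rw [ang, ← hZd, ← hZd]; simp [hZ]
      have e1 : C.ang Y k k' = ((p k').eval (1:ℂ) / (p k).eval (1:ℂ)).arg := by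
        rw [ang, ← hZd, ← hZd]; simp [hZ]
      rw [e0, e1]
      linarith
    · refine ((continuousOn_rootArg (hne k' hk')).sub (continuousOn_rootArg (hne k hk))).sub
        (ContinuousOn.sub (fun u hu => ?_) continuousOn_const)
      exact (Complex.continuousAt_arg (Or.inl (hratio u hu))).comp_continuousWithinAt
        (f := fun u : ℝ => (p k').eval (u:ℂ) / (p k).eval (u:ℂ)) ((hpc k' u hu).div (hpc k u hu) (hne k hk _ (h01 u hu)))
    · intro u hu
      have n0 : ‖(0:ℂ)‖ ≤ 1 := by simp
      have a1 := hne k hk _ (h01 u hu)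
      have a2 := hne k' hk' _ (h01 u hu)
      have a3 := hne k hk _ n0
      have a4 := hne k' hk' _ n0
      simp only [Real.Angle.coe_sub]
      rw [coe_rootArg (hne k hk) (h01 u hu), coe_rootArg (hne k' hk') (h01 u hu), Complex.arg_div_coe_angle a2 a4,
        Complex.arg_div_coe_angle a1 a3, Complex.arg_div_coe_angle a2 a1,
        Complex.arg_div_coe_angle a4 a3]
      abel
  have := const_of_locally hK (fun x => P x - P' x - rootArg (p x) 1) (fun x hx => by
    filter_upwards [hP x hx, hP₀ x hx, self_mem_nhdsWithin,
      mem_nhdsWithin_of_mem_nhds (Metric.ball_mem_nhds x C.δ_pos)] with x' h1 h2 hx' hb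
    have := hstep x hx x' hx' (C.near_of_dist _ hx _ hx' (by rw [dist_comm]; exact hb))
    rw [h1, h2, this]; ring) hk hk'
  linarith

/-- Two frames turn by nearly the same angle. -/
theorem abs_pot_sub_le (hK : IsPreconnected K) {k₀ : E} (hk₀ : k₀ ∈ K) (hY : C.IsFrame Y)
    {P P' : E → ℝ} (hP : C.IsPot K Y P) (hP' : C.IsPot K (C.W k₀) P') (hk : k ∈ K) (hk' : k' ∈ K) :
    |(P k' - P k) - (P' k' - P' k)| ≤ Q * Real.pi := by
  obtain ⟨S, hS, h⟩ := hY.exists_bounded hK hk₀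
  rw [h P P' hP hP' k hk k' hk', add_sub_cancel_left]
  refine (abs_sub _ _).trans ?_
  have := hS k hk
  have := hS k' hk'
  linarith

end Coarse

end

section Rank

variable {ι : Type*} [Fintype ι] [DecidableEq ι] {X : ι → ℂ}

theorem rk_lt_rk {j k : ι} (h : key (X j) < key (X k)) : rk X j < rk X k := by
  refine Finset.card_lt_card ⟨fun p hp => ?_, fun hs => ?_⟩
  · simp only [Finset.mem_filter, Finset.mem_univ, true_and] at hp ⊢
    exact hp.trans h
  · have := hs (Finset.mem_filter.2 ⟨Finset.mem_univ j, h⟩)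
    simp at this

theorem rk_lt_iff {j k : ι} : rk X j < rk X k ↔ key (X j) < key (X k) := by
  refine ⟨fun h => ?_, rk_lt_rk⟩
  rcases lt_trichotomy (key (X j)) (key (X k)) with h1 | h1 | h1
  · exact h1
  · simp [rk, h1] at h
  · exact absurd (rk_lt_rk h1) h.not_gt

theorem rk_lt_card (j : ι) : rk X j < Fintype.card ι := by
  refine Finset.card_lt_univ_of_notMem (x := j) ?_
  simp

theorem rk_injective (hX : Function.Injective X) : Function.Injective (rk X) := by
  intro j k h
  refine hX (key_injective ?_)
  rcases lt_trichotomy (key (X j)) (key (X k)) with h1 | h1 | h1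
  · exact absurd h (rk_lt_rk h1).ne
  · exact h1
  · exact absurd h (rk_lt_rk h1).ne'

theorem image_rk (hX : Function.Injective X) :
    Finset.univ.image (rk X) = Finset.range (Fintype.card ι) := by
  refine Finset.eq_of_subset_of_card_le (fun i hi => ?_) ?_
  · obtain ⟨j, -, rfl⟩ := Finset.mem_image.1 hi
    exact Finset.mem_range.2 (rk_lt_card j)
  · rw [Finset.card_range, Finset.card_image_of_injective _ (rk_injective hX), Finset.card_univ]

theorem sum_rk (hX : Function.Injective X) (g : ℕ → ℂ) :
    ∑ j, g (rk X j) = ∑ i ∈ Finset.range (Fintype.card ι), g i := by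
  rw [← image_rk hX, Finset.sum_image fun a _ b _ h => rk_injective hX h]

theorem sg_eq_rk (j k : ι) :
    sg (X j) (X k) = if rk X j < rk X k then 1 else if rk X k < rk X j then -1 else 0 := by
  simp only [sg, rk_lt_iff]

theorem sum_sg (hX : Function.Injective X) (g : ℕ → ℂ) (j : ι) :
    ∑ k, sg (X j) (X k) * g (rk X k) =
      ∑ i ∈ Finset.range (Fintype.card ι), g i - g (rk X j) -
        2 * ∑ i ∈ Finset.range (rk X j), g i := by
  simp only [sg_eq_rk]
  rw [sum_rk hX fun i => (if rk X j < i then 1 else if i < rk X j then -1 else 0) * g i]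
  set r := rk X j
  have hr : r < Fintype.card ι := rk_lt_card j
  have h1 : ∑ i ∈ Finset.range r, g i =
      ∑ i ∈ Finset.range (Fintype.card ι), if i < r then g i else 0 := by
    rw [← Finset.sum_filter]
    congr 1
    ext i; simp only [Finset.mem_range, Finset.mem_filter]; omega
  have h2 : g r = ∑ i ∈ Finset.range (Fintype.card ι), if i = r then g i else 0 := by
    rw [Finset.sum_ite_eq' _ r, if_pos (Finset.mem_range.2 hr)]
  rw [h1, h2, Finset.mul_sum, ← Finset.sum_sub_distrib, ← Finset.sum_sub_distrib]
  refine Finset.sum_congr rfl fun i _ => ?_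
  rcases lt_trichotomy i r with h | h | h
  · simp [h, h.not_gt, h.ne]; ring
  · simp [h]
  · simp [h, h.not_gt, h.ne']

end Rank

section Phase

theorem ph_zero : ph 0 = 1 := by simp [ph]

theorem ph_nat_mul (k : ℕ) (x : ℝ) : ph (k * x) = ph x ^ k := by
  rw [ph, ph, ← Complex.exp_nat_mul]; congr 1; push_cast; ring

theorem ph_int (k : ℤ) : ph k = 1 := by
  rw [ph, Complex.exp_eq_one_iff]
  exact ⟨-k, by push_cast; ring⟩

theorem conj_ph (x : ℝ) : conj (ph x) = ph (-x) := by
  rw [ph, ph, ← Complex.exp_conj, map_mul, Complex.conj_I, Complex.conj_ofReal]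
  congr 1; push_cast; ring

theorem ph_eq_one {x : ℝ} (h : ph x = 1) : ∃ k : ℤ, x = k := by
  rw [ph, Complex.exp_eq_one_iff] at h
  obtain ⟨k, hk⟩ := h
  refine ⟨-k, ?_⟩
  have h2 : ((-(2 * Real.pi * x) : ℝ) : ℂ) = (k * (2 * Real.pi) : ℝ) := by
    have : Complex.I * ((-(2 * Real.pi * x) : ℝ) : ℂ) = Complex.I * (k * (2 * Real.pi) : ℝ) := by
      rw [hk]; push_cast; ring
    exact mul_left_cancel₀ Complex.I_ne_zero this
  have h3 := Complex.ofReal_injective h2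
  push_cast
  have := Real.pi_pos
  have : (2 * Real.pi) * (x + k) = 0 := by linarith
  rcases mul_eq_zero.1 this with h | h
  · linarith
  · linarith

theorem sum_ph_pow {n : ℕ} {d : ℤ} (hd : |d| < n) :
    ∑ i ∈ Finset.range n, ph (d / n) ^ i = if d = 0 then (n : ℂ) else 0 := by
  have hn : (0:ℝ) < n := by exact_mod_cast (abs_nonneg d).trans_lt hd
  split_ifs with h
  · simp [h, ph_zero]
  · have hz : ph (d / n) ≠ 1 := fun h1 => by
      obtain ⟨k, hk⟩ := ph_eq_one h1
      rw [div_eq_iff hn.ne'] at hk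
      have hk' : d = k * n := by exact_mod_cast hk
      have : k ≠ 0 := by rintro rfl; simp at hk'; exact h hk'
      have h2 := Int.one_le_abs this
      rw [hk', abs_mul, Nat.abs_cast] at hd
      nlinarith
    have h1 := geom_sum_eq hz n
    rw [h1, ← ph_nat_mul, mul_div_cancel₀ _ hn.ne', ph_int]
    simp

theorem ph_add_one {x : ℝ} (hx : Real.sin (Real.pi * x) ≠ 0) :
    ph x + 1 = Complex.I * (Real.cos (Real.pi * x) / Real.sin (Real.pi * x) : ℝ) * (ph x - 1) := by
  set c := Real.cos (Real.pi * x) with hc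
  set s := Real.sin (Real.pi * x) with hs
  have h1 : ph x = ((c:ℂ) - Complex.I * s) ^ 2 := by
    have : (c:ℂ) - Complex.I * s = Complex.exp (((-(Real.pi * x) : ℝ) : ℂ) * Complex.I) := by
      rw [Complex.exp_mul_I, ← Complex.ofReal_cos, ← Complex.ofReal_sin, Real.cos_neg, Real.sin_neg,
        ← hc, ← hs]; push_cast; ring
    rw [this, ← Complex.exp_nat_mul, ph]; congr 1; push_cast; ring
  have h2 : (c:ℂ) ^ 2 + (s:ℂ) ^ 2 = 1 := by
    have := Real.cos_sq_add_sin_sq (Real.pi * x)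
    rw [← hc, ← hs] at this; exact_mod_cast this
  have hs' : (s:ℂ) ≠ 0 := by exact_mod_cast hx
  rw [h1]; push_cast
  field_simp
  linear_combination (norm := skip) (-(s:ℂ) - Complex.I * c) * h2
  ring_nf
  simp only [Complex.I_sq, show Complex.I ^ 3 = -Complex.I by rw [pow_succ, Complex.I_sq]; ring]
  ring

end Phase

section Fourier

variable {ι : Type*} [Fintype ι] [DecidableEq ι] {X : ι → ℂ} {ε : ℝ}

theorem mode_eq_pow (m : ℕ) (X : ι → ℂ) (j : ι) :
    mode m X j = ph (m / Fintype.card ι) ^ rk X j := by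
  rw [mode, ← ph_nat_mul]; congr 1; ring

/-- The skew operator of the form. -/
noncomputable def skewOp (ε : ℝ) (X : ι → ℂ) (v : ι → ℂ) (j : ι) : ℂ :=
  v j - Complex.I * ε * ∑ k, sg (X j) (X k) * v k

theorem form_eq_ip (v w : ι → ℂ) : form ε X v w = ip v (skewOp ε X w) := by
  simp only [form, ip, skewOp, mul_sub, Finset.sum_sub_distrib, Finset.mul_sum]
  congr 1
  refine Finset.sum_congr rfl fun j _ => Finset.sum_congr rfl fun k _ => by ring

theorem ip_add_right (v w w' : ι → ℂ) : ip v (w + w') = ip v w + ip v w' := by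
  simp [ip, mul_add, Finset.sum_add_distrib]

theorem ip_smul_right (v w : ι → ℂ) (c : ℂ) : ip v (c • w) = c * ip v w := by
  simp only [ip, Finset.mul_sum, Pi.smul_apply, smul_eq_mul]
  exact Finset.sum_congr rfl fun j _ => by ring

theorem ip_sum_right {κ : Type*} (s : Finset κ) (v : ι → ℂ) (w : κ → ι → ℂ) :
    ip v (∑ i ∈ s, w i) = ∑ i ∈ s, ip v (w i) := by
  simp only [ip, Finset.sum_apply, Finset.mul_sum]
  exact Finset.sum_comm

theorem conj_ip (v w : ι → ℂ) : conj (ip v w) = ip w v := by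
  simp [ip, mul_comm]

theorem skewOp_add (v w : ι → ℂ) : skewOp ε X (v + w) = skewOp ε X v + skewOp ε X w := by
  funext j
  simp only [skewOp, Pi.add_apply, mul_add, Finset.sum_add_distrib]; ring

theorem skewOp_smul (c : ℂ) (w : ι → ℂ) : skewOp ε X (c • w) = c • skewOp ε X w := by
  funext j
  simp only [skewOp, Pi.smul_apply, smul_eq_mul, mul_sub, Finset.mul_sum]
  congr 1
  exact Finset.sum_congr rfl fun j _ => by ring

theorem form_add_right (v w w' : ι → ℂ) : form ε X v (w + w') = form ε X v w + form ε X v w' := by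
  simp only [form_eq_ip, skewOp_add, ip_add_right]

theorem form_smul_right (v w : ι → ℂ) (c : ℂ) : form ε X v (c • w) = c * form ε X v w := by
  simp only [form_eq_ip, skewOp_smul, ip_smul_right]

theorem form_zero_right (v : ι → ℂ) : form ε X v 0 = 0 := by
  simpa using form_smul_right (ε := ε) (X := X) v 0 0

theorem form_sum_right {κ : Type*} (s : Finset κ) (v : ι → ℂ) (w : κ → ι → ℂ) :
    form ε X v (∑ i ∈ s, w i) = ∑ i ∈ s, form ε X v (w i) := by
  classical
  induction s using Finset.induction_on with
  | empty => simp [form_zero_right]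
  | insert a s ha ih => rw [Finset.sum_insert ha, Finset.sum_insert ha, form_add_right, ih]

theorem conj_form (v w : ι → ℂ) : conj (form ε X v w) = form ε X w v := by
  simp only [form, map_sub, map_sum, map_mul, Complex.conj_conj, Complex.conj_I,
    Complex.conj_ofReal, conj_sg]
  rw [Finset.sum_comm (f := fun j k => sg (X j) (X k) * (v j * conj (w k)))]
  have : ∀ j k, sg (X k) (X j) * (v k * conj (w j)) = -(sg (X j) (X k) * (conj (w j) * v k)) :=
    fun j k => by rw [sg_comm (X j) (X k)]; ring
  simp only [this, Finset.sum_neg_distrib]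
  rw [show (∑ x, v x * conj (w x)) = ∑ x, conj (w x) * v x from
    Finset.sum_congr rfl fun j _ => mul_comm _ _]
  ring

/-- The eigenvalue of the form on the `l`-th Fourier mode. -/
noncomputable def lam (ε : ℝ) (n l : ℕ) : ℝ :=
  1 - ε * (Real.cos (Real.pi * (l / n)) / Real.sin (Real.pi * (l / n)))

theorem sin_pos_of_mode {n l : ℕ} (hl : 0 < l) (hn : l < n) :
    0 < Real.sin (Real.pi * ((l:ℝ) / n)) := by
  have h1 : (0:ℝ) < l := by exact_mod_cast hl
  have h2 : (0:ℝ) < n := by exact_mod_cast hl.trans hn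
  have h3 : (l:ℝ) / n < 1 := by rw [div_lt_one h2]; exact_mod_cast hn
  have := Real.pi_pos
  refine Real.sin_pos_of_pos_of_lt_pi (by positivity) ?_
  nlinarith

theorem ip_mode (hX : Function.Injective X) {l m : ℕ} (hl : l < Fintype.card ι)
    (hm : m < Fintype.card ι) :
    ip (mode l X) (mode m X) = if l = m then (Fintype.card ι : ℂ) else 0 := by
  have h1 : ip (mode l X) (mode m X) =
      ∑ i ∈ Finset.range (Fintype.card ι), ph (((m - l : ℤ) : ℝ) / Fintype.card ι) ^ i := by
    rw [← sum_rk hX]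
    refine Finset.sum_congr rfl fun j _ => ?_
    rw [mode_eq_pow, mode_eq_pow, map_pow, ← mul_pow, conj_ph, ← ph_add]
    congr 2; push_cast; ring
  rw [h1, sum_ph_pow (by rw [abs_lt]; constructor <;> omega)]
  by_cases h : l = m
  · simp [h]
  · rw [if_neg h, if_neg (by omega)]

theorem sum_mode (hX : Function.Injective X) {l : ℕ} (h0 : 0 < l) (hl : l < Fintype.card ι) :
    ∑ j, mode l X j = 0 := by
  have := ip_mode hX (l := 0) (m := l) (h0.trans hl) hl
  rw [if_neg h0.ne] at this
  rw [← this, ip]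
  exact Finset.sum_congr rfl fun j _ => by simp [mode, ph_zero]

theorem ip_mode_zero (y : ι → ℂ) : ip (mode 0 X) y = ∑ j, y j :=
  Finset.sum_congr rfl fun j _ => by simp [mode, ph_zero]

theorem form_mode (hX : Function.Injective X) {l : ℕ} (h0 : 0 < l) (hl : l < Fintype.card ι)
    {y : ι → ℂ} (hy : ∑ j, y j = 0) :
    form ε X y (mode l X) = lam ε (Fintype.card ι) l * ip y (mode l X) := by
  set z := ph (l / Fintype.card ι) with hz
  have hs := sin_pos_of_mode h0 hl
  have hz1 : z + 1 = _ := ph_add_one hs.ne'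
  set ct : ℝ := Real.cos (Real.pi * ((l:ℝ) / Fintype.card ι)) / Real.sin (Real.pi * ((l:ℝ) / Fintype.card ι))
    with hct
  have hne : z - 1 ≠ 0 := fun h => by
    rw [h, mul_zero] at hz1
    have : (2:ℂ) = 0 := by linear_combination hz1 - h
    norm_num at this
  have hsk : ∀ j, skewOp ε X (mode l X) j =
      lam ε (Fintype.card ι) l * mode l X j + (-(Complex.I * ε * (2 / (z - 1)))) := by
    intro j
    have h1 := sum_sg hX (fun i => z ^ i) j
    have h2 : ∑ i ∈ Finset.range (Fintype.card ι), z ^ i = 0 := by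
      have := sum_mode hX h0 hl
      simp only [mode_eq_pow] at this
      rwa [sum_rk hX (fun i => z ^ i)] at this
    rw [h2, geom_sum_eq (sub_ne_zero.1 hne)] at h1
    simp only [skewOp, mode_eq_pow]
    rw [← hz, h1, lam, ← hct]
    push_cast
    set w := z ^ rk X j
    have h3 : 2 * ((w - 1) / (z - 1)) = w * (Complex.I * ct - 1) - 2 / (z - 1) := by
      field_simp
      linear_combination w * hz1
    rw [h3]
    linear_combination (w * ε * ct) * Complex.I_sq
  rw [form_eq_ip, ip, ip, Finset.mul_sum]
  simp only [hsk, mul_add, Finset.sum_add_distrib, ← Finset.sum_mul]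
  rw [← map_sum, hy, map_zero, zero_mul, add_zero]
  exact Finset.sum_congr rfl fun j _ => by ring

theorem card_smul_eq (hX : Function.Injective X) (y : ι → ℂ) :
    (Fintype.card ι : ℂ) • y =
      ∑ l ∈ Finset.range (Fintype.card ι), ip (mode l X) y • mode l X := by
  funext j
  simp only [Finset.sum_apply, Pi.smul_apply, smul_eq_mul, ip, Finset.sum_mul]
  rw [Finset.sum_comm]
  have h : ∀ k, ∑ l ∈ Finset.range (Fintype.card ι), conj (mode l X k) * y k * mode l X j =
      if k = j then (Fintype.card ι : ℂ) * y k else 0 := by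
    intro k
    have h1 : ∀ l, conj (mode l X k) * y k * mode l X j =
        y k * ph (((rk X j - rk X k : ℤ) : ℝ) / Fintype.card ι) ^ l := fun l => by
      rw [mode, mode, conj_ph, mul_right_comm, ← ph_add, ← ph_nat_mul, mul_comm]
      congr 2; push_cast; ring
    simp only [h1]
    have h2 := rk_lt_card (X := X) j
    have h3 := rk_lt_card (X := X) k
    rw [← Finset.mul_sum, sum_ph_pow (by rw [abs_lt]; constructor <;> omega)]
    by_cases hkj : k = j
    · subst hkj; simp [mul_comm]
    · have : rk X k ≠ rk X j := fun h => hkj (rk_injective hX h)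
      rw [if_neg (by omega), if_neg hkj, mul_zero]
  simp only [h, Finset.sum_ite_eq', Finset.mem_univ, if_true]

theorem card_mul_nsq (hX : Function.Injective X) (y : ι → ℂ) :
    Fintype.card ι * nsq y = ∑ l ∈ Finset.range (Fintype.card ι), ‖ip (mode l X) y‖ ^ 2 := by
  have h : ip y ((Fintype.card ι : ℂ) • y) =
      ∑ l ∈ Finset.range (Fintype.card ι), ip (mode l X) y * ip y (mode l X) := by
    rw [card_smul_eq hX, ip_sum_right]
    simp only [ip_smul_right]
  rw [ip_smul_right, ip_self] at h
  simp only [← conj_ip (mode _ X) y, Complex.mul_conj'] at h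
  exact_mod_cast h

theorem card_mul_form (hX : Function.Injective X) {y : ι → ℂ} (hy : ∑ j, y j = 0) :
    (Fintype.card ι : ℂ) * form ε X y y = (∑ l ∈ Finset.Ico 1 (Fintype.card ι),
      lam ε (Fintype.card ι) l * ‖ip (mode l X) y‖ ^ 2 : ℝ) := by
  rcases isEmpty_or_nonempty ι with hι | hι
  · simp
  rw [← form_smul_right, card_smul_eq hX, form_sum_right, Finset.range_eq_Ico,
    Finset.sum_eq_sum_Ico_succ_bot Fintype.card_pos, ip_mode_zero, hy, zero_smul, form_zero_right,
    zero_add]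
  push_cast
  refine Finset.sum_congr rfl fun l hl => ?_
  have hl := Finset.mem_Ico.1 hl
  rw [form_smul_right, form_mode hX (by omega) hl.2 hy, ← conj_ip (mode l X) y,
    ← Complex.mul_conj']
  ring

end Fourier

section Tangent

theorem tan_mul_le {l x : ℝ} (hl : 0 ≤ l) (hl1 : l ≤ 1) (hx : 0 ≤ x) (hx2 : x < Real.pi / 2) :
    Real.tan (l * x) ≤ l * Real.tan x := by
  have hpi := Real.pi_pos
  have hmem : ∀ y ∈ Set.Icc 0 x, ∀ m ∈ Set.Icc (0:ℝ) 1, 0 < Real.cos (m * y) := fun y hy m hm => by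
    refine Real.cos_pos_of_mem_Ioo ⟨?_, ?_⟩ <;> nlinarith [hy.1, hy.2, hm.1, hm.2, mul_nonneg hm.1 hy.1]
  have hd : ∀ y ∈ Set.Icc 0 x, HasDerivAt (fun y => l * Real.tan y - Real.tan (l * y))
      (l * (1 / Real.cos y ^ 2) - 1 / Real.cos (l * y) ^ 2 * l) y := fun y hy => by
    have h1 : Real.cos y ≠ 0 := by simpa using (hmem y hy 1 (by simp)).ne'
    have h2 := (hmem y hy l ⟨hl, hl1⟩).ne'
    have h3 : HasDerivAt (fun y : ℝ => l * y) l y := by simpa using (hasDerivAt_id y).const_mul l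
    exact ((Real.hasDerivAt_tan h1).const_mul l).sub
      (HasDerivAt.comp (h₂ := Real.tan) y (Real.hasDerivAt_tan h2) h3)
  have hmono : MonotoneOn (fun y => l * Real.tan y - Real.tan (l * y)) (Set.Icc 0 x) := by
    refine monotoneOn_of_deriv_nonneg (convex_Icc 0 x)
      (fun y hy => (hd y hy).continuousAt.continuousWithinAt)
      (fun y hy => (hd y (interior_subset hy)).differentiableAt.differentiableWithinAt) fun y hy => ?_
    have hy := interior_subset hy
    rw [(hd y hy).deriv]
    have h1 : 0 < Real.cos y := by simpa using hmem y hy 1 (by simp)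
    have h2 : Real.cos y ≤ Real.cos (l * y) := by
      refine Real.cos_le_cos_of_nonneg_of_le_pi (mul_nonneg hl hy.1) (by linarith [hy.2]) ?_
      nlinarith [hy.1]
    have h3 : 1 / Real.cos (l * y) ^ 2 ≤ 1 / Real.cos y ^ 2 := by gcongr
    nlinarith
  have := hmono (Set.left_mem_Icc.2 hx) (Set.right_mem_Icc.2 hx) hx
  simp at this
  linarith

end Tangent

/-- `κ` lies well inside the `Q`-th spectral gap for `n` strands. -/
structure Level (Q n : ℕ) (κ ε : ℝ) : Prop where
  one_le : 1 ≤ Q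
  lo : Q + 1 / 4 ≤ κ
  hi : κ ≤ Q + 3 / 4
  large : 4 * (Q + 1) ≤ n
  eps : ε = Real.tan (Real.pi * (κ / n))

namespace Level

variable {Q n : ℕ} {κ ε : ℝ} (h : Level Q n κ ε)
include h

theorem n_pos : (0:ℝ) < n := by
  have := h.large
  exact_mod_cast (show 0 < n by omega)

theorem κ_pos : 0 < κ := by
  have := h.lo
  have : (0:ℝ) ≤ Q := Nat.cast_nonneg Q
  linarith

theorem four_le : 4 * κ ≤ n := by
  have h1 : (4 * (Q + 1) : ℝ) ≤ n := by exact_mod_cast h.large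
  have := h.hi
  linarith

theorem eps_nonneg : 0 ≤ ε := by
  have h1 := h.n_pos
  have h2 := h.κ_pos
  have h3 := h.four_le
  have hpi := Real.pi_pos
  rw [h.eps]
  refine Real.tan_nonneg_of_nonneg_of_le_pi_div_two (by positivity) ?_
  have : κ / n ≤ 1 / 4 := by rw [div_le_iff₀ h1]; linarith
  nlinarith

theorem eps_mul_le : ε * n ≤ 4 * (Q + 1) := by
  have h1 := h.n_pos
  have h2 := h.κ_pos
  have h3 := h.four_le
  have hpi := Real.pi_pos
  have h4 : Real.tan (4 * κ / n * (Real.pi / 4)) ≤ 4 * κ / n * Real.tan (Real.pi / 4) :=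
    tan_mul_le (by positivity) (by rw [div_le_one h1]; exact h3) (by positivity) (by linarith)
  rw [Real.tan_pi_div_four, mul_one, show 4 * κ / n * (Real.pi / 4) = Real.pi * (κ / n) by ring,
    ← h.eps, le_div_iff₀ h1] at h4
  linarith [h.hi]

theorem lam_le {l : ℕ} (hl : 1 ≤ l) (hlQ : l ≤ Q) : lam ε n l ≤ -(1 / (4 * Q)) := by
  have h1 := h.n_pos
  have h2 := h.κ_pos
  have h3 := h.four_le
  have hpi := Real.pi_pos
  have hl0 : (1:ℝ) ≤ l := by exact_mod_cast hl
  have hlQ' : (l:ℝ) ≤ Q := by exact_mod_cast hlQ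
  have hκn : κ / n ≤ 1 / 4 := by rw [div_le_iff₀ h1]; linarith
  have hlo := h.lo
  have h4 : Real.tan (l / κ * (Real.pi * (κ / n))) ≤ l / κ * Real.tan (Real.pi * (κ / n)) :=
    tan_mul_le (by positivity) (by rw [div_le_one h2]; linarith) (by positivity) (by nlinarith)
  rw [show l / κ * (Real.pi * (κ / n)) = Real.pi * (l / n) by field_simp, ← h.eps] at h4
  have hln : (l:ℝ) / n ≤ 1 / 4 := by rw [div_le_iff₀ h1]; linarith
  have ht : 0 < Real.tan (Real.pi * (l / n)) :=
    Real.tan_pos_of_pos_of_lt_pi_div_two (by positivity) (by nlinarith)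
  have h5 : Real.cos (Real.pi * (l / n)) / Real.sin (Real.pi * (l / n)) =
      (Real.tan (Real.pi * (l / n)))⁻¹ := by rw [Real.tan_eq_sin_div_cos, inv_div]
  have h6 : κ / l ≤ ε * (Real.tan (Real.pi * (l / n)))⁻¹ := by
    rw [← div_eq_mul_inv, le_div_iff₀ ht]
    calc κ / l * Real.tan (Real.pi * (l / n)) ≤ κ / l * (l / κ * ε) := by gcongr
      _ = ε := by field_simp
  have h7 : 1 + 1 / (4 * Q) ≤ κ / l := by
    rw [le_div_iff₀ (by linarith)]
    have hQ : (0:ℝ) < Q := by linarith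
    calc (1 + 1 / (4 * Q : ℝ)) * l ≤ (1 + 1 / (4 * Q : ℝ)) * Q := by gcongr
      _ = Q + 1 / 4 := by field_simp
      _ ≤ κ := hlo
  rw [lam, h5]
  linarith

theorem le_lam {l : ℕ} (hl : Q < l) (hln : l < n) : 1 / (4 * (Q + 1)) ≤ lam ε n l := by
  have h1 := h.n_pos
  have h2 := h.κ_pos
  have hpi := Real.pi_pos
  have hl0 : (Q + 1:ℝ) ≤ l := by exact_mod_cast hl
  have hs := sin_pos_of_mode (by omega : 0 < l) hln
  have hQ : (0:ℝ) ≤ Q := Nat.cast_nonneg Q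
  have hone : 1 / (4 * (Q + 1) : ℝ) ≤ 1 := by
    rw [div_le_one (by positivity)]; linarith
  have he := h.eps_nonneg
  rw [lam]
  rcases le_or_gt (Real.cos (Real.pi * (l / n))) 0 with hc | hc
  · have := mul_nonpos_of_nonneg_of_nonpos he (div_nonpos_of_nonpos_of_nonneg hc hs.le)
    linarith
  · have hln' : Real.pi * ((l:ℝ) / n) < Real.pi / 2 := by
      by_contra hcon
      push Not at hcon
      have h3 : (l:ℝ) / n ≤ 1 := by rw [div_le_one h1]; exact_mod_cast hln.le
      exact hc.not_ge (Real.cos_nonpos_of_pi_div_two_le_of_le hcon (by nlinarith))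
    have hl1 : (0:ℝ) < l := by linarith
    have h4 : Real.tan (κ / l * (Real.pi * (l / n))) ≤ κ / l * Real.tan (Real.pi * (l / n)) :=
      tan_mul_le (by positivity) (by rw [div_le_one hl1]; linarith [h.hi]) (by positivity) hln'
    rw [show κ / l * (Real.pi * (l / n)) = Real.pi * (κ / n) by field_simp, ← h.eps] at h4
    have ht : 0 < Real.tan (Real.pi * (l / n)) :=
      Real.tan_pos_of_pos_of_lt_pi_div_two (by positivity) hln'
    have h5 : Real.cos (Real.pi * (l / n)) / Real.sin (Real.pi * (l / n)) =
        (Real.tan (Real.pi * (l / n)))⁻¹ := by rw [Real.tan_eq_sin_div_cos, inv_div]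
    have h6 : ε * (Real.tan (Real.pi * (l / n)))⁻¹ ≤ κ / l := by
      rw [← div_eq_mul_inv, div_le_iff₀ ht]; exact h4
    have h7 : κ / l ≤ 1 - 1 / (4 * (Q + 1)) := by
      rw [div_le_iff₀ hl1]
      calc κ ≤ Q + 3 / 4 := h.hi
        _ = (1 - 1 / (4 * (Q + 1) : ℝ)) * (Q + 1) := by field_simp; ring
        _ ≤ _ := by
          refine mul_le_mul_of_nonneg_left hl0 (by linarith)
    rw [h5]
    linarith

theorem abs_lam_le {l : ℕ} (hl : 0 < l) (hln : l < n) : |lam ε n l| ≤ 2 * Q + 3 := by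
  have h1 := h.n_pos
  have hpi := Real.pi_pos
  have hl0 : (1:ℝ) ≤ l := by exact_mod_cast hl
  have hl1 : (l + 1:ℝ) ≤ n := by exact_mod_cast hln
  have hs := sin_pos_of_mode hl hln
  have he := h.eps_nonneg
  have hen := h.eps_mul_le
  have h2 : 2 / n ≤ Real.sin (Real.pi * (l / n)) := by
    rcases le_total (Real.pi * ((l:ℝ) / n)) (Real.pi / 2) with hx | hx
    · refine le_trans ?_ (Real.mul_le_sin (by positivity) hx)
      rw [show 2 / Real.pi * (Real.pi * ((l:ℝ) / n)) = 2 * l / n by field_simp]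
      gcongr; linarith
    · rw [← Real.sin_pi_sub]
      have hle : (l:ℝ) / n ≤ 1 := by rw [div_le_one h1]; linarith
      refine le_trans ?_ (Real.mul_le_sin (by nlinarith) (by linarith))
      rw [show 2 / Real.pi * (Real.pi - Real.pi * ((l:ℝ) / n)) = 2 * (n - l) / n by field_simp]
      gcongr; linarith
  have h3 : |Real.cos (Real.pi * (l / n)) / Real.sin (Real.pi * (l / n))| ≤ n / 2 := by
    rw [abs_div, abs_of_pos hs, div_le_iff₀ hs]
    refine (Real.abs_cos_le_one _).trans ?_
    calc (1:ℝ) = n / 2 * (2 / n) := by field_simp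
      _ ≤ _ := by gcongr
  rw [lam]
  refine (abs_sub _ _).trans ?_
  rw [abs_mul, abs_of_nonneg he, abs_one]
  have := mul_le_mul_of_nonneg_left h3 he
  linarith

end Level

section Cone

variable {ι : Type*} [Fintype ι] [DecidableEq ι] {X X' : ι → ℂ} {ε κ : ℝ} {Q : ℕ}

theorem nsq_pi_single_le (v : ι → ℂ) : (∑ j, ‖v j‖) ^ 2 ≤ Fintype.card ι * nsq v := by
  have := sum_norm_sq_le (S := Finset.univ) (v := v) (by simp)
  simpa using this

theorem norm_form_le (hε : 0 ≤ ε) (X : ι → ℂ) (v w : ι → ℂ) :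
    ‖form ε X v w‖ ≤ (1 + ε * Fintype.card ι) * (√(nsq v) * √(nsq w)) := by
  have h1 : ‖∑ j, conj (v j) * w j‖ ≤ √(nsq v) * √(nsq w) := by
    refine (norm_sum_le _ _).trans ?_
    simp only [norm_mul, RCLike.norm_conj]
    exact Real.sum_mul_le_sqrt_mul_sqrt _ _ _
  have h2 : ∀ v : ι → ℂ, ∑ j, ‖v j‖ ≤ √(Fintype.card ι) * √(nsq v) := fun v => by
    rw [← Real.sqrt_mul (Nat.cast_nonneg _)]
    exact Real.le_sqrt_of_sq_le (nsq_pi_single_le v)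
  have h3 := (skew_bound X v w).trans (mul_le_mul (h2 v) (h2 w)
    (Finset.sum_nonneg fun _ _ => norm_nonneg _) (by positivity))
  have h4 : √(Fintype.card ι : ℝ) * √(nsq v) * (√(Fintype.card ι : ℝ) * √(nsq w)) =
      Fintype.card ι * (√(nsq v) * √(nsq w)) := by
    rw [mul_mul_mul_comm, Real.mul_self_sqrt (Nat.cast_nonneg _)]
  rw [h4] at h3
  rw [form]
  refine (norm_sub_le _ _).trans ?_
  rw [norm_mul, norm_mul, Complex.norm_I, one_mul, Complex.norm_real, Real.norm_of_nonneg hε]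
  have := mul_le_mul_of_nonneg_left h3 hε
  linarith

/-- The low Fourier coefficients of a vector. -/
noncomputable def low (Q : ℕ) (X : ι → ℂ) : (ι → ℂ) →ₗ[ℂ] (Fin Q → ℂ) where
  toFun y l := ip (mode (l + 1) X) y / Fintype.card ι
  map_add' y z := by funext l; simp [ip_add_right, add_div]
  map_smul' c y := by funext l; simp [ip_smul_right, mul_div_assoc]

/-- The vector with given low Fourier coefficients. -/
noncomputable def synth (Q : ℕ) (X : ι → ℂ) : (Fin Q → ℂ) →ₗ[ℂ] (ι → ℂ) where
  toFun c := ∑ l, c l • mode (l + 1) X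
  map_add' c d := by simp [add_smul, Finset.sum_add_distrib]
  map_smul' c d := by simp [mul_smul, Finset.smul_sum]

theorem low_apply (y : ι → ℂ) (l : Fin Q) :
    low Q X y l = ip (mode (l + 1) X) y / Fintype.card ι := rfl

theorem synth_apply (c : Fin Q → ℂ) : synth Q X c = ∑ l, c l • mode (l + 1) X := rfl

/-- The cone of non-positive vectors of sum zero. -/
def Neg (ε : ℝ) (X : ι → ℂ) (y : ι → ℂ) : Prop := ∑ j, y j = 0 ∧ (form ε X y y).re ≤ 0

theorem ip_mode_synth (hX : Function.Injective X) (hQ : Q < Fintype.card ι) {m : ℕ}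
    (hm : m < Fintype.card ι) (c : Fin Q → ℂ) :
    ip (mode m X) (synth Q X c) =
      ∑ l : Fin Q, if m = l + 1 then (Fintype.card ι : ℂ) * c l else 0 := by
  rw [synth_apply, ip_sum_right]
  refine Finset.sum_congr rfl fun l _ => ?_
  rw [ip_smul_right, ip_mode hX hm (by omega)]
  split_ifs <;> simp [mul_comm]

theorem ip_mode_synth_of_lt (hX : Function.Injective X) (hQ : Q < Fintype.card ι) {m : ℕ}
    (hm : m < Fintype.card ι) (hQm : Q < m) (c : Fin Q → ℂ) :
    ip (mode m X) (synth Q X c) = 0 := by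
  rw [ip_mode_synth hX hQ hm]
  exact Finset.sum_eq_zero fun l _ => if_neg (by omega)

theorem low_synth (hX : Function.Injective X) (hQ : Q < Fintype.card ι) (c : Fin Q → ℂ) :
    low Q X (synth Q X c) = c := by
  funext l
  rw [low_apply, ip_mode_synth hX hQ (by omega)]
  have h : ∀ l' : Fin Q, ((l : ℕ) + 1 = l' + 1) ↔ l = l' := fun l' => by
    rw [Nat.add_right_cancel_iff, Fin.ext_iff]
  simp only [h, Finset.sum_ite_eq, Finset.mem_univ, if_true]
  have : (Fintype.card ι : ℂ) ≠ 0 := by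
    have : Fintype.card ι ≠ 0 := by omega
    exact_mod_cast this
  field_simp

theorem sum_synth (hX : Function.Injective X) (hQ : Q < Fintype.card ι) (c : Fin Q → ℂ) :
    ∑ j, synth Q X c j = 0 := by
  rw [← ip_mode_zero (X := X), ip_mode_synth hX hQ (by omega)]
  exact Finset.sum_eq_zero fun l _ => if_neg (by omega)

theorem card_mul_form_re (hX : Function.Injective X) {y : ι → ℂ} (hy : ∑ j, y j = 0) :
    (Fintype.card ι : ℝ) * (form ε X y y).re = ∑ l ∈ Finset.Ico 1 (Fintype.card ι),
      lam ε (Fintype.card ι) l * ‖ip (mode l X) y‖ ^ 2 := by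
  have := congrArg Complex.re (card_mul_form (ε := ε) hX hy)
  rwa [Complex.ofReal_re, ← Complex.ofReal_natCast, Complex.re_ofReal_mul] at this

variable (h : Level Q (Fintype.card ι) κ ε) (hX : Function.Injective X)
include h hX

theorem Neg.synth (c : Fin Q → ℂ) : Neg ε X (synth Q X c) := by
  have hQ : Q < Fintype.card ι := by have := h.large; omega
  refine ⟨sum_synth hX hQ c, ?_⟩
  have h1 := card_mul_form_re (ε := ε) hX (sum_synth hX hQ c)
  by_contra hcon
  push Not at hcon
  have h2 := mul_pos h.n_pos hcon
  rw [h1] at h2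
  refine h2.not_ge (Finset.sum_nonpos fun l hl => ?_)
  obtain ⟨hl1, hl2⟩ := Finset.mem_Ico.1 hl
  rcases le_or_gt l Q with hlQ | hlQ
  · refine mul_nonpos_of_nonpos_of_nonneg ((h.lam_le hl1 hlQ).trans ?_) (by positivity)
    simp; 
  · rw [ip_mode_synth_of_lt hX hQ hl2 hlQ]; simp

theorem Neg.sum_high_le {y : ι → ℂ} (hy : Neg ε X y) :
    ∑ l ∈ Finset.Ico (Q + 1) (Fintype.card ι), ‖ip (mode l X) y‖ ^ 2 ≤
      4 * (Q + 1) * (2 * Q + 3) * ∑ l ∈ Finset.Ico 1 (Q + 1), ‖ip (mode l X) y‖ ^ 2 := by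
  have hQ : Q + 1 ≤ Fintype.card ι := by have := h.large; omega
  have h1 := card_mul_form_re (ε := ε) hX hy.1
  have h2 := mul_nonpos_of_nonneg_of_nonpos h.n_pos.le hy.2
  rw [h1, ← Finset.sum_Ico_consecutive _ (by omega : 1 ≤ Q + 1) hQ] at h2
  have h3 : 1 / (4 * (Q + 1)) * ∑ l ∈ Finset.Ico (Q + 1) (Fintype.card ι), ‖ip (mode l X) y‖ ^ 2 ≤
      ∑ l ∈ Finset.Ico (Q + 1) (Fintype.card ι),
        lam ε (Fintype.card ι) l * ‖ip (mode l X) y‖ ^ 2 := by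
    rw [Finset.mul_sum]
    refine Finset.sum_le_sum fun l hl => ?_
    have hl := Finset.mem_Ico.1 hl
    gcongr
    exact h.le_lam (by omega) hl.2
  have h4 : -((2 * Q + 3) * ∑ l ∈ Finset.Ico 1 (Q + 1), ‖ip (mode l X) y‖ ^ 2) ≤
      ∑ l ∈ Finset.Ico 1 (Q + 1), lam ε (Fintype.card ι) l * ‖ip (mode l X) y‖ ^ 2 := by
    rw [Finset.mul_sum, ← Finset.sum_neg_distrib]
    refine Finset.sum_le_sum fun l hl => ?_
    have hl := Finset.mem_Ico.1 hl
    have := (abs_le.1 (h.abs_lam_le (l := l) (by omega) (by omega))).1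
    rw [← neg_mul]
    gcongr
  have hq : (0:ℝ) < 4 * (Q + 1) := by positivity
  have h5 : 1 / (4 * (Q + 1)) * ∑ l ∈ Finset.Ico (Q + 1) (Fintype.card ι), ‖ip (mode l X) y‖ ^ 2 ≤
      (2 * Q + 3) * ∑ l ∈ Finset.Ico 1 (Q + 1), ‖ip (mode l X) y‖ ^ 2 := by linarith
  rw [one_div, inv_mul_le_iff₀ hq] at h5
  linarith

theorem sum_low_le (y : ι → ℂ) : ∑ l ∈ Finset.Ico 1 (Q + 1), ‖ip (mode l X) y‖ ^ 2 ≤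
    Q * (Fintype.card ι * ‖low Q X y‖) ^ 2 := by
  rw [Finset.sum_Ico_eq_sum_range, show Q + 1 - 1 = Q by omega]
  rw [Finset.sum_range fun i => ‖ip (mode (1 + i) X) y‖ ^ 2]
  refine (Finset.sum_le_card_nsmul _ _ ((Fintype.card ι * ‖low Q X y‖) ^ 2) (fun l _ => ?_)).trans
    (le_of_eq (by simp))
  have h1 := norm_le_pi_norm (low Q X y) l
  have hn := h.n_pos
  rw [low_apply, norm_div, Complex.norm_natCast, div_le_iff₀ hn, add_comm, mul_comm] at h1
  gcongr

theorem Neg.nsq_le {y : ι → ℂ} (hy : Neg ε X y) :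
    nsq y ≤ (1 + 4 * (Q + 1) * (2 * Q + 3)) * Q * Fintype.card ι * ‖low Q X y‖ ^ 2 := by
  have hQ : Q + 1 ≤ Fintype.card ι := by have := h.large; omega
  have h1 := card_mul_nsq hX y
  rw [Finset.range_eq_Ico, Finset.sum_eq_sum_Ico_succ_bot (by omega), ip_mode_zero, hy.1,
    ← Finset.sum_Ico_consecutive _ (by omega : 0 + 1 ≤ Q + 1) hQ] at h1
  have h2 := Neg.sum_high_le h hX hy
  have h3 := sum_low_le h hX y
  have hn := h.n_pos
  simp only [norm_zero, zero_add, ne_eq, OfNat.ofNat_ne_zero, not_false_eq_true, zero_pow] at h1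
  refine le_of_mul_le_mul_left ?_ hn
  rw [h1]
  have h4 := mul_le_mul_of_nonneg_left h3 (by positivity : (0:ℝ) ≤ 1 + 4 * (Q + 1) * (2 * Q + 3))
  nlinarith

theorem Neg.eq_zero {y : ι → ℂ} (hy : Neg ε X y) (h0 : low Q X y = 0) : y = 0 := by
  have h1 := Neg.nsq_le h hX hy
  rw [h0, norm_zero] at h1
  have h2 : nsq y = 0 := le_antisymm (by simpa using h1) (nsq_nonneg y)
  rw [nsq, Finset.sum_eq_zero_iff_of_nonneg fun _ _ => by positivity] at h2
  funext j
  simpa using h2 j (Finset.mem_univ j)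

theorem Neg.interp {y : ι → ℂ} (hy : Neg ε X y) {u : ℂ} (hu : ‖u‖ ≤ 1) :
    Neg ε X (Braid.synth Q X (low Q X y) + u • (y - Braid.synth Q X (low Q X y))) := by
  have hQ : Q < Fintype.card ι := by have := h.large; omega
  set s := Braid.synth Q X (low Q X y) with hs
  have hs0 : ∑ j, s j = 0 := sum_synth hX hQ _
  have hsum : ∑ j, (s + u • (y - s)) j = 0 := by
    simp [Finset.sum_add_distrib, ← Finset.mul_sum, hs0, hy.1]
  refine ⟨hsum, ?_⟩
  have h1 := card_mul_form_re (ε := ε) hX hsum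
  have h2 := card_mul_form_re (ε := ε) hX hy.1
  have h3 : ∑ l ∈ Finset.Ico 1 (Fintype.card ι),
      lam ε (Fintype.card ι) l * ‖ip (mode l X) (s + u • (y - s))‖ ^ 2 ≤
      ∑ l ∈ Finset.Ico 1 (Fintype.card ι), lam ε (Fintype.card ι) l * ‖ip (mode l X) y‖ ^ 2 := by
    refine Finset.sum_le_sum fun l hl => ?_
    obtain ⟨hl1, hl2⟩ := Finset.mem_Ico.1 hl
    rw [sub_eq_add_neg, ip_add_right, ip_smul_right, ip_add_right, ← neg_one_smul ℂ s, ip_smul_right]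
    rcases le_or_gt l Q with hlQ | hlQ
    · have : ip (mode l X) s = ip (mode l X) y := by
        have h4 := congrFun (low_synth hX hQ (low Q X y)) ⟨l - 1, by omega⟩
        have hn : (Fintype.card ι : ℂ) ≠ 0 := by exact_mod_cast h.n_pos.ne'
        rw [← hs, low_apply, low_apply] at h4
        simp only [Nat.sub_add_cancel hl1] at h4
        exact (div_left_inj' hn).1 h4
      rw [this]; simp
    · rw [hs, ip_mode_synth_of_lt hX hQ hl2 hlQ]
      have hp := h.le_lam hlQ hl2
      have hp0 : 0 ≤ lam ε (Fintype.card ι) l := le_trans (by positivity) hp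
      have : ‖0 + u * (ip (mode l X) y + -1 * 0)‖ ≤ ‖ip (mode l X) y‖ := by
        rw [mul_zero, add_zero, zero_add, norm_mul]
        exact mul_le_of_le_one_left (norm_nonneg _) hu
      gcongr
  have h4 := mul_nonpos_of_nonneg_of_nonpos h.n_pos.le hy.2
  have hn := h.n_pos
  by_contra hcon
  push Not at hcon
  have := mul_pos hn hcon
  linarith

/-- The constant controlling a single step. -/
noncomputable def stepConst (Q : ℕ) : ℝ :=
  (4 * Q * (1 + 4 * (Q + 1))) ^ 2 * ((1 + 4 * (Q + 1) * (2 * Q + 3)) * Q) *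
    (144 + 48 * (4 * (Q + 1)) + 98 * (2 * Real.pi * Q) ^ 2)

theorem norm_low_sub_le {w δ c : ℝ} {A : (ι → ℂ) →ₗ[ℂ] (ι → ℂ)} {B : (ι → ℂ) →ₗ[ℂ] (ι → ℂ)}
    (hX' : Function.Injective X') (hBA : ∀ v, B (A v) = v)
    (hform : ∀ v w, form ε X (B v) (B w) = form ε X' v w)
    (hsum : ∀ v, ∑ j, B v j = ∑ j, v j) (hδ0 : 0 ≤ δ)
    (hloc : ∀ j k, 2 * δ < |(X' k).re - (X' j).re| → B (Pi.single j 1) k = 0)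
    (hmove : ∀ k, |(X k).re - (X' k).re| ≤ δ) (hw : 0 < w) (hδ : 2 * δ < w)
    (hS : Spread c w δ X') (hc : 0 ≤ c) (hc1 : c ≤ 1) (hBc : 4 * (Q + 1) * c ≤ 1 / 2)
    {y : ι → ℂ} (hy : Neg ε X y) :
    ‖low Q X' (A y) - low Q X y‖ ≤ √(stepConst Q * c) * ‖low Q X y‖ := by
  have hQ : Q < Fintype.card ι := by have := h.large; omega
  have hn := h.n_pos
  have hQ1 : (1:ℝ) ≤ Q := by exact_mod_cast h.one_le
  have hy' : ∑ j, A y j = 0 := by rw [← hsum, hBA, hy.1]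
  refine (pi_norm_le_iff_of_nonneg (by positivity)).2 fun l => ?_
  have hl : (l : ℕ) + 1 < Fintype.card ι := by omega
  set m := (l : ℕ) + 1
  have hmQ : (m : ℝ) ≤ Q := by exact_mod_cast (show (l:ℕ) + 1 ≤ Q by omega)
  have e1 : form ε X' (A y) (mode m X') = _ := form_mode hX' (by omega) hl hy'
  have e2 : form ε X y (mode m X) = _ := form_mode hX (by omega) hl hy.1
  rw [← hform, hBA] at e1
  have e3 : (lam ε (Fintype.card ι) m : ℂ) * (ip (A y) (mode m X') - ip y (mode m X)) =
      form ε X y (B (mode m X') - mode m X) := by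
    rw [mul_sub, ← e1, ← e2, sub_eq_add_neg (B _), form_add_right, ← neg_one_smul ℂ (mode m X),
      form_smul_right]; ring
  have s1 := nsq_map_mode_sub_le (m := m) h.eps_nonneg hform hsum hδ0 hloc hmove hw hδ hS
    h.eps_mul_le hc hc1 hBc
  have s2 := norm_form_le h.eps_nonneg X y (B (mode m X') - mode m X)
  have s3 := Neg.nsq_le h hX hy
  set b := ‖low Q X y‖
  have hlam : 1 / (4 * Q) ≤ |lam ε (Fintype.card ι) m| := by
    have := h.lam_le (l := m) (by omega) (by omega)
    rw [le_abs]; right; linarith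
  set C1 : ℝ := (1 + 4 * (Q + 1) * (2 * Q + 3)) * Q
  set C2 : ℝ := 144 + 48 * (4 * (Q + 1)) + 98 * (2 * Real.pi * Q) ^ 2
  have s4 : √(nsq y) ≤ √(C1 * Fintype.card ι * b ^ 2) := Real.sqrt_le_sqrt s3
  have s5 : √(nsq (B (mode m X') - mode m X)) ≤ √(C2 * c * Fintype.card ι) := by
    refine Real.sqrt_le_sqrt (s1.trans ?_)
    have : (m : ℝ) ^ 2 ≤ (Q : ℝ) ^ 2 := by gcongr
    have hC : 144 + 48 * (4 * ((Q : ℝ) + 1)) + 98 * (2 * Real.pi * m) ^ 2 ≤ C2 := by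
      show _ ≤ 144 + 48 * (4 * ((Q : ℝ) + 1)) + 98 * (2 * Real.pi * Q) ^ 2
      gcongr
    gcongr
  have s6 : √(C1 * Fintype.card ι * b ^ 2) * √(C2 * c * Fintype.card ι) =
      Fintype.card ι * b * √(C1 * C2 * c) := by
    rw [← Real.sqrt_mul (by positivity)]
    rw [show C1 * (Fintype.card ι : ℝ) * b ^ 2 * (C2 * c * Fintype.card ι) =
      (Fintype.card ι * b) ^ 2 * (C1 * C2 * c) by ring, Real.sqrt_mul (by positivity),
      Real.sqrt_sq (by positivity)]
  have s7 : √(stepConst Q * c) = 4 * Q * (1 + 4 * (Q + 1)) * √(C1 * C2 * c) := by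
    rw [stepConst, show (4 * Q * (1 + 4 * (Q + 1)) : ℝ) ^ 2 * ((1 + 4 * (Q + 1) * (2 * Q + 3)) * Q) *
      (144 + 48 * (4 * (Q + 1)) + 98 * (2 * Real.pi * Q) ^ 2) * c =
      (4 * Q * (1 + 4 * (Q + 1))) ^ 2 * (C1 * C2 * c) by ring, Real.sqrt_mul (by positivity),
      Real.sqrt_sq (by positivity)]
  have s8 : ‖form ε X y (B (mode m X') - mode m X)‖ ≤
      (1 + 4 * (Q + 1)) * (Fintype.card ι * b * √(C1 * C2 * c)) := by
    refine s2.trans ?_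
    rw [← s6]
    have := h.eps_mul_le
    gcongr
  have s9 : ‖ip (mode m X') (A y) - ip (mode m X) y‖ = ‖ip (A y) (mode m X') - ip y (mode m X)‖ := by
    rw [← conj_ip (A y), ← conj_ip y (mode m X), ← map_sub, RCLike.norm_conj]
  rw [← e3, norm_mul, Complex.norm_real, Real.norm_eq_abs, ← s9] at s8
  have s10 := (mul_le_mul_of_nonneg_right hlam (norm_nonneg _)).trans s8
  rw [one_div, inv_mul_le_iff₀ (by positivity)] at s10
  rw [Pi.sub_apply, low_apply, low_apply, ← sub_div, norm_div, Complex.norm_natCast,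
    div_le_iff₀ hn, s7]
  refine s10.trans (le_of_eq ?_)
  ring

end Cone

section Family

variable {E : Type*} [NormedAddCommGroup E] [NormedSpace ℝ E] {ι : Type*} [Fintype ι] [DecidableEq ι]

/-- A continuous family of homeomorphisms of the plane supported in a fixed disc. -/
structure IsFam (Φ : E → ℂ ≃ₜ ℂ) : Prop where
  cont : Continuous fun p : E × ℂ => Φ p.1 p.2
  supp : ∀ k x, 1 ≤ ‖x‖ → Φ k x = x

/-- Two members of a family are uniformly `δ`-close. -/
def Close (δ : ℝ) (Φ : E → ℂ ≃ₜ ℂ) (k k' : E) : Prop := ∀ x, ‖Φ k x - Φ k' x‖ ≤ δ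

theorem IsFam.locality {Φ : E → ℂ ≃ₜ ℂ} (hΦ : IsFam Φ) {K : Set E} (hc : Convex ℝ K) {τ : ℂˣ}
    {X : ι → ℂ} (hX : Function.Injective X) {F : E → GL ι ℂ}
    (hF : IsTransport τ K (fun k i => Φ k (X i)) F) {δ : ℝ} {k k' : E} (hk : k ∈ K) (hk' : k' ∈ K)
    (h : Close δ Φ k k') {i j : ι} (hij : δ < |(Φ k (X i)).re - (Φ k' (X j)).re|) :
    act (F k * (F k')⁻¹) (Pi.single j 1) i = 0 := by
  have hp : ContinuousOn (fun s : ℝ => k' + s • (k - k')) (Set.Icc 0 1) := by fun_prop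
  have hm : Set.MapsTo (fun s : ℝ => k' + s • (k - k')) (Set.Icc 0 1) K := fun s hs =>
    hc.add_smul_sub_mem hk' hk hs
  have hT := hF.comp hp hm
  have hc1 : Continuous (Function.uncurry fun (s : ℝ) (x : ℂ) =>
      Φ (k' + s • (k - k')) ((Φ k').symm x)) := by
    have h1 : Continuous fun p : ℝ × ℂ => (k' + p.1 • (k - k'), (Φ k').symm p.2) := by fun_prop
    exact hΦ.cont.comp h1
  have hI : IsIso 1 (fun (s : ℝ) (x : ℂ) => Φ (k' + s • (k - k')) ((Φ k').symm x)) :=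
    ⟨hc1, fun s => (Φ _).injective.comp (Φ k').symm.injective, fun s x hx => by
      have : (Φ k').symm x = x := by rw [Homeomorph.symm_apply_eq, hΦ.supp _ _ hx]
      change Φ _ ((Φ k').symm x) = x
      rw [this, hΦ.supp _ _ hx]⟩
  have := Braid.locality (τ := τ) (δ := δ) (F := fun s : ℝ => F (k' + s • (k - k'))) hI
    (fun x => by simp) (X := fun i => Φ k' (X i)) ((Φ k').injective.comp hX)
    (hT.congr fun s _ => by funext i; simp) (fun x => by simpa using h ((Φ k').symm x))
    (j := j) (k := i) (by simpa using hij)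
  simpa using this

end Family

section Constants

/-- The unit complex number attached to the parameter `κ` and `n` strands. -/
noncomputable def tauOf (κ : ℝ) (n : ℕ) : ℂˣ :=
  Units.mk0 (Complex.exp ((2 * Real.pi * (κ / n) : ℝ) * Complex.I)) (Complex.exp_ne_zero _)

/-- The skew parameter attached to `κ` and `n` strands. -/
noncomputable def epsOf (κ : ℝ) (n : ℕ) : ℝ := Real.tan (Real.pi * (κ / n))

theorem compat_of {κ : ℝ} {n : ℕ} (h : Real.cos (Real.pi * (κ / n)) ≠ 0) :
    Compat (tauOf κ n) (epsOf κ n) := by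
  set a := Real.pi * (κ / n) with ha
  have e : ((tauOf κ n : ℂˣ) : ℂ) = Complex.exp (a * Complex.I) * Complex.exp (a * Complex.I) := by
    rw [tauOf, Units.val_mk0, ← Complex.exp_add, ha]; congr 1; push_cast; ring
  have h1 : conj (Complex.exp (a * Complex.I)) * Complex.exp (a * Complex.I) = 1 := by
    rw [← Complex.exp_conj, ← Complex.exp_add]; simp
  refine ⟨?_, ?_⟩
  · rw [e, map_mul]; linear_combination (conj (Complex.exp (a * Complex.I)) *
      Complex.exp (a * Complex.I) + 1) * h1
  · have hc : (Real.cos a : ℂ) ≠ 0 := by exact_mod_cast h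
    have h2 : (Real.sin a : ℂ) ^ 2 + (Real.cos a : ℂ) ^ 2 = 1 := by
      exact_mod_cast Real.sin_sq_add_cos_sq a
    rw [e, Complex.exp_mul_I, ← Complex.ofReal_cos, ← Complex.ofReal_sin, epsOf, ← ha,
      Real.tan_eq_sin_div_cos, Complex.ofReal_div]
    field_simp
    linear_combination ((Real.sin a : ℂ) ^ 2 * Real.cos a + Complex.I * (Real.sin a : ℂ) ^ 3) *
      Complex.I_sq - (Complex.I * Real.sin a + Real.cos a) * h2

theorem level_of {Q n : ℕ} {κ : ℝ} (h1 : 1 ≤ Q) (h2 : Q + 1 / 4 ≤ κ) (h3 : κ ≤ Q + 3 / 4)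
    (h4 : 4 * (Q + 1) ≤ n) : Level Q n κ (epsOf κ n) := ⟨h1, h2, h3, h4, rfl⟩

theorem compat_of_level {Q n : ℕ} {κ ε : ℝ} (h : Level Q n κ ε) :
    Compat (tauOf κ n) (epsOf κ n) := by
  have h1 := h.n_pos
  have h2 := h.κ_pos
  have h3 : κ / n ≤ 1 / 4 := by rw [div_le_iff₀ h1]; linarith [h.four_le]
  have hpi := Real.pi_pos
  refine compat_of (Real.cos_pos_of_mem_Ioo ⟨?_, ?_⟩).ne'
  · have : 0 ≤ Real.pi * (κ / n) := by positivity
    linarith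
  · nlinarith

/-- The determinant tolerance. -/
noncomputable def detTol (Q : ℕ) : ℝ := (exists_det_near_one Q).choose

theorem detTol_pos (Q : ℕ) : 0 < detTol Q := (exists_det_near_one Q).choose_spec.1

theorem detTol_spec (Q : ℕ) (A : (Fin Q → ℂ) →ₗ[ℂ] (Fin Q → ℂ)) (hA : ∀ v, ‖A v‖ ≤ detTol Q * ‖v‖) :
    ‖LinearMap.det (1 + A) - 1‖ < 1 / 2 := (exists_det_near_one Q).choose_spec.2 A hA

/-- The permitted density. -/
noncomputable def dens (Q : ℕ) : ℝ := min (1 / (8 * (Q + 1))) (detTol Q ^ 2 / (stepConst Q + 1))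

theorem stepConst_nonneg (Q : ℕ) : 0 ≤ stepConst Q := by unfold stepConst; positivity

theorem dens_pos (Q : ℕ) : 0 < dens Q := by
  have := stepConst_nonneg Q
  have := detTol_pos Q
  unfold dens; positivity

theorem dens_le (Q : ℕ) : 4 * (Q + 1) * dens Q ≤ 1 / 2 := by
  have : dens Q ≤ 1 / (8 * (Q + 1)) := min_le_left _ _
  rw [le_div_iff₀ (by positivity)] at this
  linarith

theorem dens_le_one (Q : ℕ) : dens Q ≤ 1 := by
  have := dens_le Q
  have := dens_pos Q
  have : (0:ℝ) ≤ Q := by positivity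
  nlinarith

theorem sqrt_dens_le (Q : ℕ) : √(stepConst Q * dens Q) ≤ detTol Q := by
  have h0 := stepConst_nonneg Q
  have h1 : dens Q ≤ detTol Q ^ 2 / (stepConst Q + 1) := min_le_right _ _
  rw [le_div_iff₀ (by positivity)] at h1
  have := dens_pos Q
  refine Real.sqrt_le_iff.2 ⟨(detTol_pos Q).le, by nlinarith⟩

/-- The column width. -/
noncomputable def wid (Q : ℕ) : ℝ := dens Q / 16

/-- The displacement tolerance. -/
noncomputable def tol (Q : ℕ) : ℝ := dens Q * wid Q / 100

theorem wid_pos (Q : ℕ) : 0 < wid Q := div_pos (dens_pos Q) (by norm_num)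

theorem tol_pos (Q : ℕ) : 0 < tol Q := div_pos (mul_pos (dens_pos Q) (wid_pos Q)) (by norm_num)

theorem two_tol_lt (Q : ℕ) : 2 * tol Q < wid Q := by
  have := dens_le_one Q
  have := wid_pos Q
  unfold tol
  nlinarith

end Constants

section Turn

variable {E : Type*} [NormedAddCommGroup E] [NormedSpace ℝ E] {ι : Type*} [Fintype ι] [DecidableEq ι]

/-- The action as a linear map. -/
noncomputable def actL (T : GL ι ℂ) : (ι → ℂ) →ₗ[ℂ] (ι → ℂ) where
  toFun := act T
  map_add' := act_add T
  map_smul' := act_smul T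

@[simp] theorem actL_apply (T : GL ι ℂ) (v : ι → ℂ) : actL T v = act T v := rfl

/-- The data of a family which is good along a configuration. -/
structure Setup (Q : ℕ) (κ : ℝ) (K : Set E) (Φ : E → ℂ ≃ₜ ℂ) (X : ι → ℂ) (r : ℝ)
    (F : E → GL ι ℂ) : Prop where
  level : Level Q (Fintype.card ι) κ (epsOf κ (Fintype.card ι))
  fam : IsFam Φ
  convex : Convex ℝ K
  inj : Function.Injective X
  spread : ∀ k ∈ K, Spread (dens Q) (wid Q) (tol Q) fun i => Φ k (X i)
  pos : 0 < r
  near : ∀ k ∈ K, ∀ k' ∈ K, dist k k' < r → Close (tol Q) Φ k k'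
  transport : IsTransport (tauOf κ (Fintype.card ι)) K (fun k i => Φ k (X i)) F

namespace Setup

variable {Q : ℕ} {κ r : ℝ} {K : Set E} {Φ : E → ℂ ≃ₜ ℂ} {X : ι → ℂ} {F : E → GL ι ℂ}
  (S : Setup Q κ K Φ X r F)

include S in
theorem injective (k : E) : Function.Injective fun i => Φ k (X i) := (Φ k).injective.comp S.inj

include S in
theorem neg_iff {k k' : E} (hk : k ∈ K) (hk' : k' ∈ K) (y : ι → ℂ) :
    Neg (epsOf κ (Fintype.card ι)) (fun i => Φ k (X i)) (act (F k) y) ↔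
      Neg (epsOf κ (Fintype.card ι)) (fun i => Φ k' (X i)) (act (F k') y) := by
  have e : act (F k') y = act (F k' * (F k)⁻¹) (act (F k) y) := by
    rw [← act_mul, inv_mul_cancel_right]
  rw [Neg, Neg, e, S.transport.form (compat_of_level S.level) S.convex.isPreconnected
    (fun k _ => S.injective k) hk hk', S.transport.sum S.convex.isPreconnected
    (fun k _ => S.injective k) hk hk']

/-- The coordinate maps of a good family. -/
noncomputable def coarse (k₀ : E) (hk₀ : k₀ ∈ K) : Coarse (ι → ℂ) Q K where
  L k := low Q (fun i => Φ k (X i)) ∘ₗ actL (F k)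
  W k := actL (F k)⁻¹ ∘ₗ synth Q (fun i => Φ k (X i))
  neg y := Neg (epsOf κ (Fintype.card ι)) (fun i => Φ k₀ (X i)) (act (F k₀) y)
  near := Close (tol Q) Φ
  LW k hk c := by
    have := S.level.large
    simp only [LinearMap.comp_apply, actL_apply, act_act_inv]
    exact low_synth (S.injective k) (by omega) c
  W_neg k hk c := by
    rw [S.neg_iff hk₀ hk]
    simp only [LinearMap.comp_apply, actL_apply, act_act_inv]
    exact Neg.synth S.level (S.injective k) c
  definite k hk y hy h0 := by
    rw [S.neg_iff hk₀ hk] at hy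
    have := hy.eq_zero S.level (S.injective k) h0
    rw [← act_inv_act (F k) y, this]
    exact (actL (F k)⁻¹).map_zero
  interp k hk y hy u hu := by
    rw [S.neg_iff hk₀ hk] at hy ⊢
    have := hy.interp S.level (S.injective k) hu
    simpa only [LinearMap.comp_apply, actL_apply, act_act_inv, act_add, act_smul, act_sub] using this
  η := detTol Q
  det_near := detTol_spec Q
  step k hk k' hk' hn y hy := by
    rw [S.neg_iff hk₀ hk] at hy
    have e : act (F k') y = act (F k' * (F k)⁻¹) (act (F k) y) := by
      rw [← act_mul, inv_mul_cancel_right]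
    have hm : ∀ i, |(Φ k (X i)).re - (Φ k' (X i)).re| ≤ tol Q := fun i => by
      rw [← Complex.sub_re]; exact (Complex.abs_re_le_norm _).trans (hn _)
    have := norm_low_sub_le S.level (S.injective k) (X' := fun i => Φ k' (X i))
      (A := actL (F k' * (F k)⁻¹)) (B := actL (F k * (F k')⁻¹)) (S.injective k')
      (fun v => by
        simp only [actL_apply]; rw [← act_mul]; simp [act_one])
      (fun v w => S.transport.form (compat_of_level S.level) S.convex.isPreconnected
        (fun k _ => S.injective k) hk' hk v w)
      (fun v => S.transport.sum S.convex.isPreconnected (fun k _ => S.injective k) hk' hk v)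
      (tol_pos Q).le (fun j i hij => S.fam.locality S.convex S.inj S.transport hk hk' hn (by
        have := hm i
        have h2 := abs_sub_le (Φ k' (X i)).re (Φ k (X i)).re (Φ k' (X j)).re
        rw [abs_sub_comm (Φ k' (X i)).re (Φ k (X i)).re] at h2
        linarith)) hm (wid_pos Q) (two_tol_lt Q) (S.spread k' hk') (dens_pos Q).le (dens_le_one Q)
      (dens_le Q) hy
    simp only [LinearMap.comp_apply, actL_apply, e]
    simp only [actL_apply] at this
    exact this.trans (mul_le_mul_of_nonneg_right (sqrt_dens_le Q) (norm_nonneg _))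
  δ := r
  δ_pos := S.pos
  near_of_dist := S.near

end Setup

/-- The transport along a path, from time `0`. -/
noncomputable def hol (τ : ℂˣ) (x : ℝ → ι → ℂ) (t : ℝ) : GL ι ℂ :=
  open Classical in if h : ∃ F, IsTransport τ (Set.Icc 0 1) x F then
    h.choose t * (h.choose 0)⁻¹ else 1

theorem hol_eq {τ : ℂˣ} {x : ℝ → ι → ℂ} {F : ℝ → GL ι ℂ} (hF : IsTransport τ (Set.Icc 0 1) x F)
    {t : ℝ} (ht : t ∈ Set.Icc (0:ℝ) 1) : hol τ x t = F t * (F 0)⁻¹ := by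
  have h : ∃ F, IsTransport τ (Set.Icc 0 1) x F := ⟨F, hF⟩
  rw [hol, dif_pos h]
  exact h.choose_spec.unique isPreconnected_Icc hF (by simp) ht

/-- The determinant along a path of configurations. -/
noncomputable def dAt (Q : ℕ) (κ : ℝ) (x : ℝ → ι → ℂ) (t : ℝ) : ℂ :=
  LinearMap.det (low Q (x t) ∘ₗ actL (hol (tauOf κ (Fintype.card ι)) x t) ∘ₗ synth Q (x 0))

/-- The total turn of the determinant, sampled at `L` steps. -/
noncomputable def turn (Q : ℕ) (κ : ℝ) (L : ℕ) (x : ℝ → ι → ℂ) : ℝ :=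
  ∑ i ∈ Finset.range L, (dAt Q κ x ((i + 1 : ℕ) / L) / dAt Q κ x (i / L)).arg

theorem abs_turn_le (Q : ℕ) (κ : ℝ) (L : ℕ) (x : ℝ → ι → ℂ) : |turn Q κ L x| ≤ L * Real.pi := by
  refine (Finset.abs_sum_le_sum_abs _ _).trans ((Finset.sum_le_card_nsmul _ _ Real.pi
    fun i _ => Complex.abs_arg_le_pi _).trans ?_)
  simp

namespace Coarse

variable {V : Type*} [AddCommGroup V] [Module ℂ V] {Q : ℕ} {K : Set E} {C : Coarse V Q K}
  {Y : (Fin Q → ℂ) →ₗ[ℂ] V} {P : E → ℝ}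

theorem IsPot.sub_eq_sum (hY : C.IsFrame Y) (h : C.IsPot K Y P) {p : ℝ → E}
    (hp : ContinuousOn p (Set.Icc 0 1)) (hpK : Set.MapsTo p (Set.Icc 0 1) K) {M : ℕ} (hM : 0 < M)
    (hn : ∀ s ∈ Set.Icc (0:ℝ) 1, ∀ t ∈ Set.Icc (0:ℝ) 1, |s - t| ≤ 1 / M → C.near (p s) (p t)) :
    P (p 1) - P (p 0) = ∑ i ∈ Finset.range M, C.ang Y (p (i / M)) (p ((i + 1 : ℕ) / M)) := by
  have hM' : (0:ℝ) < M := by exact_mod_cast hM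
  have key : ∀ i ∈ Finset.range M, C.ang Y (p (i / M)) (p ((i + 1 : ℕ) / M)) =
      P (p ((i + 1 : ℕ) / M)) - P (p (i / M)) := by
    intro i hi
    have hiM : ((i + 1 : ℕ) : ℝ) ≤ M := by exact_mod_cast Finset.mem_range.1 hi
    have h0 : (i / M : ℝ) ≤ ((i + 1 : ℕ) : ℝ) / M := by gcongr; simp
    have hs : Set.Icc (i / M : ℝ) (((i + 1 : ℕ) : ℝ) / M) ⊆ Set.Icc 0 1 := fun x hx =>
      ⟨le_trans (by positivity) hx.1, hx.2.trans ((div_le_one hM').2 hiM)⟩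
    have hsub : p '' Set.Icc (i / M : ℝ) (((i + 1 : ℕ) : ℝ) / M) ⊆ K := by
      rintro _ ⟨x, hx, rfl⟩; exact hpK (hs hx)
    refine (((h.mono hsub).sub_eq_ang hY hsub (isPreconnected_Icc.image _ (hp.mono hs))
      ⟨_, Set.left_mem_Icc.2 h0, rfl⟩ ⟨_, Set.right_mem_Icc.2 h0, rfl⟩ ?_)).symm
    rintro _ ⟨x, hx, rfl⟩
    refine hn _ (hs (Set.left_mem_Icc.2 h0)) _ (hs hx) ?_
    rw [abs_sub_comm, abs_of_nonneg (sub_nonneg.2 hx.1)]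
    have := hx.2
    push_cast at this
    rw [add_div] at this
    linarith
  rw [Finset.sum_congr rfl key, Finset.sum_range_sub (fun i : ℕ => P (p (i / M)))]
  simp [hM.ne']

end Coarse

/-- The path of configurations along a segment. -/
noncomputable def seg (Φ : E → ℂ ≃ₜ ℂ) (X : ι → ℂ) (k k' : E) (s : ℝ) (i : ι) :
    ℂ := Φ (k + s • (k' - k)) (X i)

namespace Setup

variable {Q : ℕ} {κ r : ℝ} {K : Set E} {Φ : E → ℂ ≃ₜ ℂ} {X : ι → ℂ} {F : E → GL ι ℂ}
  (S : Setup Q κ K Φ X r F) {k₀ : E} {hk₀ : k₀ ∈ K}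

theorem dAt_seg {k k' : E} (hk : k ∈ K) (hk' : k' ∈ K) {s : ℝ} (hs : s ∈ Set.Icc (0:ℝ) 1) :
    dAt Q κ (seg Φ X k k') s =
      (S.coarse k₀ hk₀).det ((S.coarse k₀ hk₀).W k) (k + s • (k' - k)) := by
  have hT := S.transport.comp (p := fun s : ℝ => k + s • (k' - k)) (K' := Set.Icc 0 1)
    (by fun_prop) (fun s hs => S.convex.add_smul_sub_mem hk hk' hs)
  have e := hol_eq (x := seg Φ X k k') hT hs
  rw [dAt, e, Coarse.det]
  congr 1
  refine LinearMap.ext fun y => ?_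
  have e0 : seg Φ X k k' 0 = fun i => Φ k (X i) := by funext i; simp [seg]
  simp only [coarse, LinearMap.comp_apply, actL_apply, act_mul, e0, zero_smul, add_zero]
  rfl

theorem turn_seg {k k' : E} (hk : k ∈ K) (hk' : k' ∈ K) {L : ℕ} (hL : 0 < L)
    (hn : dist k k' < r * L) {P : E → ℝ}
    (hP : (S.coarse k₀ hk₀).IsPot K ((S.coarse k₀ hk₀).W k) P) :
    turn Q κ L (seg Φ X k k') = P k' - P k := by
  have hL' : (0:ℝ) < L := by exact_mod_cast hL
  have := Coarse.IsPot.sub_eq_sum (Coarse.W_frame hk) hP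
    (p := fun s : ℝ => k + s • (k' - k)) (by fun_prop)
    (fun s hs => S.convex.add_smul_sub_mem hk hk' hs) hL (fun s hs t ht hst => by
      refine S.near _ (S.convex.add_smul_sub_mem hk hk' hs) _
        (S.convex.add_smul_sub_mem hk hk' ht) ?_
      rw [dist_add_left, dist_eq_norm, ← sub_smul, norm_smul, Real.norm_eq_abs, ← dist_eq_norm,
        dist_comm]
      calc |s - t| * dist k k' ≤ 1 / L * dist k k' := by gcongr
        _ < r := by rw [one_div, inv_mul_lt_iff₀ hL', mul_comm]; exact hn)
  simp only [one_smul, zero_smul, add_zero, add_sub_cancel] at this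
  rw [this, turn]
  refine Finset.sum_congr rfl fun i hi => ?_
  have hiM : ((i + 1 : ℕ) : ℝ) ≤ L := by exact_mod_cast Finset.mem_range.1 hi
  have hi0 : ((i : ℕ) : ℝ) ≤ L := by exact_mod_cast (Finset.mem_range.1 hi).le
  rw [S.dAt_seg (k₀ := k₀) (hk₀ := hk₀) hk hk' ⟨by positivity, (div_le_one hL').2 hiM⟩,
    S.dAt_seg (k₀ := k₀) (hk₀ := hk₀) hk hk' ⟨by positivity, (div_le_one hL').2 hi0⟩, Coarse.ang]

include S in
/-- Turns along segments are the differences of a single function, up to a bounded error. -/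
theorem exists_turn (hK : IsCompact K) (hk₀ : k₀ ∈ K) :
    ∃ P : E → ℝ, (∀ k ∈ K, ∀ k' ∈ K, ∀ L : ℕ, 0 < L → dist k k' < r * L →
      |turn Q κ L (seg Φ X k k') - (P k' - P k)| ≤ Q * Real.pi) ∧
      ∀ k ∈ K, ∀ k' ∈ K, ∀ M : ℕ, 0 < M →
        (∀ s ∈ Set.Icc (0:ℝ) 1, ∀ t ∈ Set.Icc (0:ℝ) 1, |s - t| ≤ 1 / M →
          Close (tol Q) Φ (k + s • (k' - k)) (k + t • (k' - k))) → |P k' - P k| ≤ M * Real.pi := by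
  set C := S.coarse k₀ hk₀
  obtain ⟨P, hP⟩ := (Coarse.W_frame (C := C) hk₀).exists_pot hK S.convex
  refine ⟨P, fun k hk k' hk' L hL hn => ?_, fun k hk k' hk' M hM hn => ?_⟩
  · obtain ⟨P', hP'⟩ := (Coarse.W_frame (C := C) hk).exists_pot hK S.convex
    rw [S.turn_seg hk hk' hL hn hP']
    exact Coarse.abs_pot_sub_le S.convex.isPreconnected hk₀ (Coarse.W_frame hk) hP' hP hk hk'
  · have := Coarse.IsPot.sub_eq_sum (Coarse.W_frame hk₀) hP
      (p := fun s : ℝ => k + s • (k' - k)) (by fun_prop)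
      (fun s hs => S.convex.add_smul_sub_mem hk hk' hs) hM hn
    simp only [one_smul, zero_smul, add_zero, add_sub_cancel] at this
    rw [this]
    refine (Finset.abs_sum_le_sum_abs _ _).trans ((Finset.sum_le_card_nsmul _ _ Real.pi
      fun i _ => Coarse.abs_ang_le).trans ?_)
    simp

end Setup

end Turn

section Alexander

variable {E : Type*} [NormedAddCommGroup E] [NormedSpace ℝ E]

theorem IsFam.norm_lt {Φ : E → ℂ ≃ₜ ℂ} (h : IsFam Φ) {k : E} {x : ℂ} (hx : ‖x‖ < 1) :
    ‖Φ k x‖ < 1 := by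
  by_contra hc
  push Not at hc
  have := h.supp k _ hc
  rw [(Φ k).injective this] at hc
  linarith

theorem IsFam.norm_sub_le {Φ : E → ℂ ≃ₜ ℂ} (h : IsFam Φ) (k : E) (x : ℂ) : ‖Φ k x - x‖ ≤ 2 := by
  rcases lt_or_ge ‖x‖ 1 with hx | hx
  · have := h.norm_lt (k := k) hx
    linarith [_root_.norm_sub_le (Φ k x) x]
  · rw [h.supp k x hx]; simp

theorem IsFam.exists_close {Φ : E → ℂ ≃ₜ ℂ} (h : IsFam Φ) {K : Set E} (hK : IsCompact K) {δ : ℝ}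
    (hδ : 0 < δ) : ∃ r > 0, ∀ k ∈ K, ∀ k' ∈ K, dist k k' < r → Close δ Φ k k' := by
  have hu := (hK.prod (isCompact_closedBall (0:ℂ) 1)).uniformContinuousOn_of_continuous
    h.cont.continuousOn
  obtain ⟨r, hr, hr'⟩ := Metric.uniformContinuousOn_iff.1 hu δ hδ
  refine ⟨r, hr, fun k hk k' hk' hd x => ?_⟩
  rcases lt_or_ge ‖x‖ 1 with hx | hx
  · have := hr' (k, x) ⟨hk, by simpa using hx.le⟩ (k', x) ⟨hk', by simpa using hx.le⟩ (by
      simpa [Prod.dist_eq, hr] using hd)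
    rw [dist_eq_norm] at this
    exact this.le
  · rw [h.supp k x hx, h.supp k' x hx]; simpa using hδ.le

theorem IsFam.comp {E' : Type*} [NormedAddCommGroup E'] [NormedSpace ℝ E'] {Φ : E → ℂ ≃ₜ ℂ}
    (h : IsFam Φ) {f : E' → E} (hf : Continuous f) : IsFam fun e => Φ (f e) :=
  ⟨h.cont.comp (by fun_prop : Continuous fun p : E' × ℂ => (f p.1, p.2)), fun k => h.supp _⟩

theorem IsFam.trans {Φ Ψ : E → ℂ ≃ₜ ℂ} (h : IsFam Φ) (h' : IsFam Ψ) :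
    IsFam fun e => (Φ e).trans (Ψ e) :=
  ⟨h'.cont.comp (continuous_fst.prodMk h.cont), fun k x hx => by
    rw [Homeomorph.trans_apply, h.supp k x hx, h'.supp k x hx]⟩

/-- Conjugation of a homeomorphism by the dilation of factor `t`. -/
noncomputable def alexPos (a : ℂ ≃ₜ ℂ) (t : ℝ) (ht : t ≠ 0) : ℂ ≃ₜ ℂ :=
  ((Homeomorph.smulOfNeZero t ht).symm.trans a).trans (Homeomorph.smulOfNeZero t ht)

/-- The Alexander isotopy. -/
noncomputable def alex (a : ℂ ≃ₜ ℂ) (t : ℝ) : ℂ ≃ₜ ℂ :=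
  if h : 0 < min t 1 then alexPos a (min t 1) h.ne' else Homeomorph.refl ℂ

theorem alex_apply (a : ℂ ≃ₜ ℂ) {t : ℝ} (ht : 0 < t) (x : ℂ) :
    alex a t x = min t 1 • a ((min t 1)⁻¹ • x) := by
  rw [alex, dif_pos (lt_min ht one_pos)]; rfl

theorem alex_of_nonpos (a : ℂ ≃ₜ ℂ) {t : ℝ} (ht : t ≤ 0) : alex a t = Homeomorph.refl ℂ := by
  rw [alex, dif_neg (by simp [ht])]

theorem alex_zero (a : ℂ ≃ₜ ℂ) : alex a 0 = Homeomorph.refl ℂ := alex_of_nonpos a le_rfl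

theorem alex_one (a : ℂ ≃ₜ ℂ) : alex a 1 = a := by
  ext x : 1
  rw [alex_apply a one_pos]; simp

theorem alex_trans (a b : ℂ ≃ₜ ℂ) (t : ℝ) : alex (a.trans b) t = (alex a t).trans (alex b t) := by
  ext x : 1
  rcases lt_or_ge 0 t with ht | ht
  · have : min t 1 ≠ 0 := (lt_min ht one_pos).ne'
    simp [alex_apply _ ht, this]
  · simp [alex_of_nonpos _ ht]

theorem norm_alex_sub_le {a : ℂ ≃ₜ ℂ} {c : ℝ} (hc : 0 ≤ c) (ha : ∀ x, ‖a x - x‖ ≤ c) (t : ℝ)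
    (x : ℂ) : ‖alex a t x - x‖ ≤ c * max (min t 1) 0 := by
  rcases lt_or_ge 0 t with ht | ht
  · have h0 : 0 < min t 1 := lt_min ht one_pos
    have : x = min t 1 • (min t 1)⁻¹ • x := by rw [smul_smul, mul_inv_cancel₀ h0.ne', one_smul]
    rw [alex_apply _ ht]
    conv_lhs => rw [this]
    rw [smul_smul _ (min t 1), inv_mul_cancel₀ h0.ne', one_smul, ← smul_sub, norm_smul,
      Real.norm_of_nonneg h0.le, max_eq_left h0.le, mul_comm]
    gcongr
    exact ha _
  · rw [alex_of_nonpos _ ht]; simp; positivity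

theorem IsFam.alex {Φ : E → ℂ ≃ₜ ℂ} (h : IsFam Φ) : IsFam fun p : E × ℝ => alex (Φ p.1) p.2 := by
  refine ⟨continuous_iff_continuousAt.2 fun ⟨⟨e, t⟩, x⟩ => ?_, fun ⟨e, t⟩ x hx => ?_⟩
  · rcases lt_or_ge 0 t with ht | ht
    · have ho : ∀ᶠ p : (E × ℝ) × ℂ in 𝓝 ((e, t), x), 0 < p.1.2 :=
        (continuous_snd.comp continuous_fst).continuousAt.eventually (lt_mem_nhds ht)
      have h0 : min t 1 ≠ 0 := (lt_min ht one_pos).ne'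
      refine ContinuousAt.congr (f := fun p : (E × ℝ) × ℂ =>
        min p.1.2 1 • Φ p.1.1 ((min p.1.2 1)⁻¹ • p.2)) ?_ ?_
      · have h1 : ContinuousAt (fun p : (E × ℝ) × ℂ => min p.1.2 1) ((e, t), x) := by
          have : Continuous (fun p : (E × ℝ) × ℂ => min p.1.2 1) := by fun_prop
          exact this.continuousAt
        have h2 : ContinuousAt (fun p : (E × ℝ) × ℂ => (p.1.1, (min p.1.2 1)⁻¹ • p.2))
            ((e, t), x) := continuousAt_fst.fst.prodMk ((h1.inv₀ h0).smul continuousAt_snd)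
        exact h1.smul (ContinuousAt.comp (g := fun p : E × ℂ => Φ p.1 p.2) h.cont.continuousAt h2)
      · filter_upwards [ho] with p hp
        rw [alex_apply _ hp]
    · rw [ContinuousAt, Braid.alex_of_nonpos _ ht, Metric.tendsto_nhds]
      intro ε hε
      have hcont : Continuous fun p : (E × ℝ) × ℂ => 2 * max (min p.1.2 1) 0 + dist p.2 x := by
        fun_prop
      have := hcont.tendsto ((e, t), x)
      have h0 : 2 * max (min t 1) 0 + dist x x = 0 := by
        rw [max_eq_right ((min_le_left t 1).trans ht)]; simp
      simp only [h0] at this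
      filter_upwards [this.eventually (gt_mem_nhds hε)] with p hp
      refine lt_of_le_of_lt ?_ hp
      refine (dist_triangle _ p.2 _).trans ?_
      rw [dist_eq_norm (Braid.alex _ _ _)]
      exact add_le_add (norm_alex_sub_le zero_le_two (h.norm_sub_le _) _ _) le_rfl
  · rcases lt_or_ge 0 t with ht | ht
    · have h0 : 0 < min t 1 := lt_min ht one_pos
      dsimp only
      rw [alex_apply _ ht, h.supp, smul_smul, mul_inv_cancel₀ h0.ne', one_smul]
      rw [norm_smul, norm_inv, Real.norm_of_nonneg h0.le, ← div_eq_inv_mul, le_div_iff₀ h0]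
      linarith [min_le_right t 1]
    · dsimp only
      rw [alex_of_nonpos _ ht]; rfl

end Alexander

section DTurn

variable {E : Type*} [NormedAddCommGroup E] [NormedSpace ℝ E] {ι : Type*} [Fintype ι] [DecidableEq ι]

/-- The difference of the turns at two parameters. -/
noncomputable def dturn (Q L : ℕ) (x : ℝ → ι → ℂ) : ℝ :=
  turn Q (Q + 3 / 4) L x - turn Q (Q + 1 / 4) L x

theorem abs_dturn_le (Q L : ℕ) (x : ℝ → ι → ℂ) : |dturn Q L x| ≤ 2 * L * Real.pi := by
  refine (abs_sub _ _).trans ?_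
  linarith [abs_turn_le Q (Q + 3 / 4) L x, abs_turn_le Q (Q + 1 / 4) L x]

/-- Configurations which stay evenly spread along a family of maps. -/
def GoodFor (Q : ℕ) (K : Set E) (T : E → ℂ → ℂ) (X : ι → ℂ) : Prop :=
  ∀ k ∈ K, Spread (dens Q) (wid Q) (tol Q) fun i => T k (X i)

theorem exists_setup {Q : ℕ} {κ : ℝ} (hQ : 1 ≤ Q) (h1 : Q + 1 / 4 ≤ κ) (h2 : κ ≤ Q + 3 / 4)
    (hN : 4 * (Q + 1) ≤ Fintype.card ι) {K : Set E} (hK : IsCompact K) (hc : Convex ℝ K)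
    {Φ : E → ℂ ≃ₜ ℂ} (hΦ : IsFam Φ) {X : ι → ℂ} (hX : Function.Injective X)
    (hG : GoodFor Q K (fun k => Φ k) X) {r : ℝ} (hr : 0 < r)
    (hn : ∀ k ∈ K, ∀ k' ∈ K, dist k k' < r → Close (tol Q) Φ k k') :
    ∃ F, Setup Q κ K Φ X r F := by
  have hcont : Continuous fun k => fun i => Φ k (X i) := continuous_pi fun i =>
    hΦ.cont.comp (continuous_id.prodMk continuous_const)
  obtain ⟨F, hF⟩ := exists_transport (tauOf κ (Fintype.card ι)) hK hc hcont.continuousOn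
    (fun k _ => (Φ k).injective.comp hX)
  exact ⟨F, level_of hQ h1 h2 hN, hΦ, hc, hX, hG, hr, hn, hF⟩

theorem exists_dturn {Q : ℕ} (hQ : 1 ≤ Q) (hN : 4 * (Q + 1) ≤ Fintype.card ι) {K : Set E}
    (hK : IsCompact K) (hc : Convex ℝ K) (hne : K.Nonempty) {Φ : E → ℂ ≃ₜ ℂ} (hΦ : IsFam Φ)
    {X : ι → ℂ} (hX : Function.Injective X) (hG : GoodFor Q K (fun k => Φ k) X) {r : ℝ} (hr : 0 < r)
    (hn : ∀ k ∈ K, ∀ k' ∈ K, dist k k' < r → Close (tol Q) Φ k k') :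
    ∃ P : E → ℝ, (∀ k ∈ K, ∀ k' ∈ K, ∀ L : ℕ, 0 < L → dist k k' < r * L →
      |dturn Q L (seg Φ X k k') - (P k' - P k)| ≤ 2 * Q * Real.pi) ∧
      ∀ k ∈ K, ∀ k' ∈ K, ∀ M : ℕ, 0 < M →
        (∀ s ∈ Set.Icc (0:ℝ) 1, ∀ t ∈ Set.Icc (0:ℝ) 1, |s - t| ≤ 1 / M →
          Close (tol Q) Φ (k + s • (k' - k)) (k + t • (k' - k))) →
        |P k' - P k| ≤ 2 * M * Real.pi := by
  obtain ⟨k₀, hk₀⟩ := hne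
  obtain ⟨F, S⟩ := exists_setup (κ := Q + 3 / 4) hQ (by linarith) le_rfl hN hK hc hΦ hX hG hr hn
  obtain ⟨F', S'⟩ := exists_setup (κ := Q + 1 / 4) hQ le_rfl (by linarith) hN hK hc hΦ hX hG hr hn
  obtain ⟨P, h1, h2⟩ := S.exists_turn hK hk₀
  obtain ⟨P', h1', h2'⟩ := S'.exists_turn hK hk₀
  refine ⟨fun k => P k - P' k, fun k hk k' hk' L hL hd => ?_, fun k hk k' hk' M hM h => ?_⟩
  · have a1 := abs_le.1 (h1 k hk k' hk' L hL hd)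
    have a2 := abs_le.1 (h1' k hk k' hk' L hL hd)
    rw [dturn, abs_le]
    constructor <;> linarith
  · have a1 := abs_le.1 (h2 k hk k' hk' M hM h)
    have a2 := abs_le.1 (h2' k hk k' hk' M hM h)
    rw [abs_le]
    constructor <;> linarith

/-- The path of a configuration along the Alexander isotopy. -/
noncomputable def alexPath (a : ℂ ≃ₜ ℂ) (X : ι → ℂ) (s : ℝ) (i : ι) : ℂ := alex a s (X i)

theorem isFam_const {a : ℂ ≃ₜ ℂ} (ha : ∀ x, 1 ≤ ‖x‖ → a x = x) : IsFam fun _ : E => a :=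
  ⟨a.continuous.comp continuous_snd, fun _ => ha⟩

theorem isFam_alex {a : ℂ ≃ₜ ℂ} (ha : ∀ x, 1 ≤ ‖x‖ → a x = x) : IsFam fun t : ℝ => alex a t :=
  (isFam_const (E := ℝ) ha).alex.comp (f := fun t => (t, t)) (by fun_prop)

/-- The two-parameter family joining the Alexander isotopies of two maps and of their composition. -/
noncomputable def sqFam (a b : ℂ ≃ₜ ℂ) (p : ℝ × ℝ) : ℂ ≃ₜ ℂ := (alex a p.2).trans (alex b p.1)

/-- The unit square. -/
def sq : Set (ℝ × ℝ) := Set.Icc 0 1 ×ˢ Set.Icc 0 1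

theorem isCompact_sq : IsCompact sq := isCompact_Icc.prod isCompact_Icc

theorem convex_sq : Convex ℝ sq := (convex_Icc _ _).prod (convex_Icc _ _)

theorem mem_sq {a b : ℝ} (h1 : 0 ≤ a) (h2 : a ≤ 1) (h3 : 0 ≤ b) (h4 : b ≤ 1) : (a, b) ∈ sq :=
  ⟨⟨h1, h2⟩, h3, h4⟩

variable {a b : ℂ ≃ₜ ℂ} (ha : ∀ x, 1 ≤ ‖x‖ → a x = x) (hb : ∀ x, 1 ≤ ‖x‖ → b x = x) {Q : ℕ}
  (hQ : 1 ≤ Q)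

include ha hb in
theorem isFam_sqFam : IsFam (sqFam a b) :=
  ((isFam_alex ha).comp continuous_snd).trans ((isFam_alex hb).comp continuous_fst)

include ha hb hQ in
/-- The turn is a quasimorphism. -/
theorem exists_quasi : ∃ L₀ : ℕ, ∀ L ≥ L₀, ∀ {ι : Type} [Fintype ι] [DecidableEq ι],
    4 * (Q + 1) ≤ Fintype.card ι → ∀ X : ι → ℂ, Function.Injective X →
    GoodFor Q sq (fun k => sqFam a b k) X →
    |dturn Q L (alexPath (a.trans b) X) - dturn Q L (alexPath a X) -
      dturn Q L (alexPath b fun i => a (X i))| ≤ 6 * Q * Real.pi := by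
  have hF := isFam_sqFam ha hb
  obtain ⟨r, hr, hn⟩ := hF.exists_close isCompact_sq (tol_pos Q)
  obtain ⟨L₀, hL₀⟩ := exists_nat_gt (1 / r)
  refine ⟨max L₀ 1, fun L hL ι _ _ hN X hX hG => ?_⟩
  have hL1 : 0 < L := by have := le_of_max_le_right hL; omega
  have hrL : 1 < r * L := by
    rw [div_lt_iff₀ hr] at hL₀
    have : (L₀ : ℝ) ≤ L := by exact_mod_cast le_of_max_le_left hL
    nlinarith
  obtain ⟨P, hP, -⟩ := exists_dturn hQ hN isCompact_sq convex_sq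
    ⟨(0, 0), mem_sq le_rfl zero_le_one le_rfl zero_le_one⟩ hF hX hG hr hn
  have h00 : ((0:ℝ), (0:ℝ)) ∈ sq := mem_sq le_rfl zero_le_one le_rfl zero_le_one
  have h01 : ((0:ℝ), (1:ℝ)) ∈ sq := mem_sq le_rfl zero_le_one zero_le_one le_rfl
  have h11 : ((1:ℝ), (1:ℝ)) ∈ sq := mem_sq zero_le_one le_rfl zero_le_one le_rfl
  have e1 := hP _ h00 _ h11 L hL1 (by simpa [Prod.dist_eq] using hrL)
  have e2 := hP _ h00 _ h01 L hL1 (by simpa [Prod.dist_eq] using hrL)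
  have e3 := hP _ h01 _ h11 L hL1 (by simpa [Prod.dist_eq] using hrL)
  have s1 : seg (sqFam a b) X (0, 0) (1, 1) = alexPath (a.trans b) X := by
    funext s i; simp [seg, sqFam, alexPath, alex_trans]
  have s2 : seg (sqFam a b) X (0, 0) (0, 1) = alexPath a X := by
    funext s i; simp [seg, sqFam, alexPath, alex_zero]
  have s3 : seg (sqFam a b) X (0, 1) (1, 1) = alexPath b fun i => a (X i) := by
    funext s i; simp [seg, sqFam, alexPath, alex_one]
  rw [s1] at e1
  rw [s2] at e2
  rw [s3] at e3
  rw [abs_le] at e1 e2 e3 ⊢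
  constructor <;> linarith

include ha hQ in
/-- The turn of a fixed map is bounded independently of the number of strands. -/
theorem exists_bound : ∃ B : ℝ, ∃ L₀ : ℕ, ∀ L ≥ L₀, ∀ {ι : Type} [Fintype ι] [DecidableEq ι],
    4 * (Q + 1) ≤ Fintype.card ι → ∀ X : ι → ℂ, Function.Injective X →
    GoodFor Q (Set.Icc 0 1) (fun k => alex a k) X → |dturn Q L (alexPath a X)| ≤ B := by
  have hF := isFam_alex ha
  obtain ⟨r, hr, hn⟩ := hF.exists_close isCompact_Icc (K := Set.Icc 0 1) (tol_pos Q)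
  obtain ⟨L₀, hL₀⟩ := exists_nat_gt (1 / r)
  have hrL : ∀ L ≥ L₀, 1 < r * L := fun L hL => by
    rw [div_lt_iff₀ hr] at hL₀
    have : (L₀ : ℝ) ≤ L := by exact_mod_cast hL
    nlinarith
  have hpos : ∀ L ≥ L₀, 0 < L := fun L hL => by
    have h1 := hrL L hL
    by_contra h
    have : L = 0 := by omega
    rw [this] at h1
    norm_num at h1
  refine ⟨2 * L₀ * Real.pi + 2 * Q * Real.pi, L₀, fun L hL ι _ _ hN X hX hG => ?_⟩
  obtain ⟨P, hP, hP'⟩ := exists_dturn hQ hN isCompact_Icc (convex_Icc (0:ℝ) 1)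
    ⟨0, by simp⟩ hF hX hG hr hn
  have e1 := hP 0 (by simp) 1 (by simp) L (hpos L hL) (by simpa using hrL L hL)
  have e2 := hP' 0 (by simp) 1 (by simp) L₀ (hpos L₀ le_rfl) (fun s hs t ht hst => by
    refine hn _ (by simpa using hs) _ (by simpa using ht) ?_
    have h1 := hrL L₀ le_rfl
    have h0 : (0:ℝ) < L₀ := by exact_mod_cast hpos L₀ le_rfl
    have : dist ((0:ℝ) + s • (1 - 0)) (0 + t • (1 - 0)) = |s - t| := by simp [Real.dist_eq]
    rw [this]
    refine hst.trans_lt ?_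
    rw [div_lt_iff₀ h0]; exact h1)
  have s1 : seg (fun t => alex a t) X 0 1 = alexPath a X := by
    funext s i; simp [seg, alexPath]
  rw [s1] at e1
  rw [abs_le] at e1 e2 ⊢
  constructor <;> linarith

include ha hQ in
/-- The turn of a map which is uniformly close to the identity. -/
theorem exists_small (hs : ∀ x, ‖a x - x‖ ≤ tol Q / 2) :
    ∃ L₀ : ℕ, ∀ L ≥ L₀, ∀ {ι : Type} [Fintype ι] [DecidableEq ι],
    4 * (Q + 1) ≤ Fintype.card ι → ∀ X : ι → ℂ, Function.Injective X →
    GoodFor Q (Set.Icc 0 1) (fun k => alex a k) X →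
    |dturn Q L (alexPath a X)| ≤ (2 * Q + 2) * Real.pi := by
  have hF := isFam_alex ha
  obtain ⟨r, hr, hn⟩ := hF.exists_close isCompact_Icc (K := Set.Icc 0 1) (tol_pos Q)
  obtain ⟨L₀, hL₀⟩ := exists_nat_gt (1 / r)
  refine ⟨max L₀ 1, fun L hL ι _ _ hN X hX hG => ?_⟩
  have hL1 : 0 < L := by have := le_of_max_le_right hL; omega
  have hrL : 1 < r * L := by
    rw [div_lt_iff₀ hr] at hL₀
    have : (L₀ : ℝ) ≤ L := by exact_mod_cast le_of_max_le_left hL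
    nlinarith
  obtain ⟨P, hP, hP'⟩ := exists_dturn hQ hN isCompact_Icc (convex_Icc (0:ℝ) 1)
    ⟨0, by simp⟩ hF hX hG hr hn
  have e1 := hP 0 (by simp) 1 (by simp) L hL1 (by simpa using hrL)
  have hd : ∀ t x, ‖alex a t x - x‖ ≤ tol Q / 2 := fun t x => by
    have h0 := (norm_nonneg _).trans (hs x)
    refine (norm_alex_sub_le h0 hs t x).trans (mul_le_of_le_one_right h0 ?_)
    simp
  have e2 := hP' 0 (by simp) 1 (by simp) 1 one_pos (fun s hs t ht hst x => by
    have h1 := hd (0 + s • (1 - 0)) x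
    have h2 := hd (0 + t • (1 - 0)) x
    rw [norm_sub_rev] at h2
    exact (norm_sub_le_norm_sub_add_norm_sub _ x _).trans
      ((add_le_add h1 h2).trans (add_halves _).le))
  have s1 : seg (fun t => alex a t) X 0 1 = alexPath a X := by
    funext s i; simp [seg, alexPath]
  rw [s1] at e1
  rw [abs_le] at e1 e2 ⊢
  push_cast at e2
  constructor <;> linarith

/-- The turn along the Alexander isotopy agrees with the turn along another isotopy. -/
theorem exists_isotopy {h : ℝ → ℂ ≃ₜ ℂ} (hh : IsFam h) (h0 : h 0 = Homeomorph.refl ℂ) (hQ : 1 ≤ Q) :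
    ∃ L₀ : ℕ, ∀ L ≥ L₀, ∀ {ι : Type} [Fintype ι] [DecidableEq ι],
    4 * (Q + 1) ≤ Fintype.card ι → ∀ X : ι → ℂ, Function.Injective X →
    GoodFor Q sq (fun k => alex (h k.1) k.2) X →
    |dturn Q L (alexPath (h 1) X) - dturn Q L (seg h X 0 1)| ≤ (4 * Q + 4) * Real.pi := by
  have hF : IsFam fun p : ℝ × ℝ => alex (h p.1) p.2 := hh.alex
  obtain ⟨r, hr, hn⟩ := hF.exists_close isCompact_sq (tol_pos Q)
  obtain ⟨L₀, hL₀⟩ := exists_nat_gt (1 / r)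
  refine ⟨max L₀ 1, fun L hL ι _ _ hN X hX hG => ?_⟩
  have hL1 : 0 < L := by have := le_of_max_le_right hL; omega
  have hrL : 1 < r * L := by
    rw [div_lt_iff₀ hr] at hL₀
    have : (L₀ : ℝ) ≤ L := by exact_mod_cast le_of_max_le_left hL
    nlinarith
  have h00 : ((0:ℝ), (0:ℝ)) ∈ sq := mem_sq le_rfl zero_le_one le_rfl zero_le_one
  have h01 : ((0:ℝ), (1:ℝ)) ∈ sq := mem_sq le_rfl zero_le_one zero_le_one le_rfl
  have h10 : ((1:ℝ), (0:ℝ)) ∈ sq := mem_sq zero_le_one le_rfl le_rfl zero_le_one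
  have h11 : ((1:ℝ), (1:ℝ)) ∈ sq := mem_sq zero_le_one le_rfl zero_le_one le_rfl
  obtain ⟨P, hP, hP'⟩ := exists_dturn hQ hN isCompact_sq convex_sq ⟨_, h00⟩ hF hX hG hr hn
  have hr1 : ∀ t, alex (Homeomorph.refl ℂ) t = Homeomorph.refl ℂ := fun t => by
    ext x : 1
    have := norm_alex_sub_le (a := Homeomorph.refl ℂ) le_rfl (by simp) t x
    rw [zero_mul] at this
    exact sub_eq_zero.1 (norm_le_zero_iff.1 this)
  have e1 := hP _ h10 _ h11 L hL1 (by simpa [Prod.dist_eq] using hrL)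
  have e2 := hP _ h01 _ h11 L hL1 (by simpa [Prod.dist_eq] using hrL)
  have e3 := hP' _ h00 _ h10 1 one_pos (fun s hs t ht hst x => by
    simp [alex_zero, (tol_pos Q).le])
  have e4 := hP' _ h00 _ h01 1 one_pos (fun s hs t ht hst x => by
    simp [h0, hr1, (tol_pos Q).le])
  have s1 : seg (fun p : ℝ × ℝ => alex (h p.1) p.2) X (1, 0) (1, 1) = alexPath (h 1) X := by
    funext s i; simp [seg, alexPath]
  have s2 : seg (fun p : ℝ × ℝ => alex (h p.1) p.2) X (0, 1) (1, 1) = seg h X 0 1 := by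
    funext s i; simp [seg, alex_one]
  rw [s1] at e1
  rw [s2] at e2
  rw [abs_le] at e1 e2 e3 e4 ⊢
  push_cast at e3 e4
  constructor <;> linarith

end DTurn

section Map

variable {ι R S : Type*} [DecidableEq ι] [Fintype ι] [CommRing R] [CommRing S] (f : R →+* S)
  {τ : Rˣ} {U : ι → ℝ} {P : ι → ι → Prop} {l l' : List ι} {T : GL ι R}

theorem map_rot (τ : Rˣ) (a b : ι) :
    GeneralLinearGroup.map f (rot τ a b) = rot (Units.map (f : R →* S) τ) a b := by
  refine Units.ext (Matrix.ext fun i k => ?_)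
  simp only [rot, rotM, GeneralLinearGroup.map_apply, Matrix.of_apply, Matrix.one_apply]
  split_ifs <;> simp

theorem map_el (τ : Rˣ) (U : ι → ℝ) (a b : ι) :
    GeneralLinearGroup.map f (el τ U a b) = el (Units.map (f : R →* S) τ) U a b := by
  unfold el
  split_ifs
  · exact map_rot f τ a b
  · rw [map_inv, map_rot]

theorem Wd.map (h : Wd τ U P l l' T) :
    Wd (Units.map (f : R →* S) τ) U P l l' (GeneralLinearGroup.map f T) := by
  induction h with
  | refl l => rw [map_one]; exact .refl l
  | swap a b l h => rw [map_el]; exact .swap a b l h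
  | cons x _ ih => exact .cons x ih
  | trans _ _ ih ih' => rw [map_mul]; exact .trans ih ih'

theorem IsTransport.map {E : Type*} [PseudoMetricSpace E] {K : Set E} (hK : IsCompact K)
    {X : E → ι → ℂ} (hX : ContinuousOn X K) (hi : ∀ k ∈ K, Function.Injective (X k))
    {F : E → GL ι R} (h : IsTransport τ K X F) :
    IsTransport (Units.map (f : R →* S) τ) K X fun k => GeneralLinearGroup.map f (F k) := by
  obtain ⟨ρ, hρ, δ, hδ, hs, hn⟩ := exists_near hK hX hi
  intro k hk
  filter_upwards [h k hk, self_mem_nhdsWithin,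
    mem_nhdsWithin_of_mem_nhds (Metric.ball_mem_nhds k hδ)] with k' h1 h2 h3
  rw [h1, map_mul]
  congr 1
  have hd := hn k hk k' h2 (by rwa [dist_comm])
  have hU : ∀ a b, Inv (X k) (X k') a b → (X k a).im ≠ (X k b).im := fun a b hab =>
    ((hs k hk).im_lt_iff hd hd hab).2
  exact ((tr_wd τ (hi k hk) (hi k' h2)).map f).unique (tr_wd _ (hi k hk) (hi k' h2))
    (ord_nodup _) (mem_ord _) hU hU

end Map

section Continuity

variable {ι : Type*} [DecidableEq ι] [Fintype ι]

/-- The universal parameter. -/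
noncomputable def tauC (n : ℕ) : C(ℝ, ℂ)ˣ where
  val := ⟨fun κ => Complex.exp ((2 * Real.pi * (κ / n) : ℝ) * Complex.I), by fun_prop⟩
  inv := ⟨fun κ => Complex.exp (-((2 * Real.pi * (κ / n) : ℝ) * Complex.I)), by fun_prop⟩
  val_inv := by ext κ; simp [← Complex.exp_add]
  inv_val := by ext κ; simp [← Complex.exp_add]

/-- Evaluation. -/
noncomputable def evalHom (κ : ℝ) : C(ℝ, ℂ) →+* ℂ := (ContinuousMap.evalAlgHom ℂ ℂ κ).toRingHom

theorem map_tauC (κ : ℝ) (n : ℕ) : Units.map (evalHom κ : C(ℝ, ℂ) →* ℂ) (tauC n) = tauOf κ n :=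
  Units.ext rfl

theorem continuous_det_of_apply {Q : ℕ} {A : ℝ → (Fin Q → ℂ) →ₗ[ℂ] (Fin Q → ℂ)}
    (h : ∀ c, Continuous fun κ => A κ c) : Continuous fun κ => LinearMap.det (A κ) := by
  simp_rw [← LinearMap.det_toMatrix']
  refine Continuous.matrix_det (continuous_matrix fun i j => ?_)
  simp only [LinearMap.toMatrix'_apply]
  exact (continuous_apply i).comp (h _)

theorem continuous_dAt {x : ℝ → ι → ℂ} (hx : ContinuousOn x (Set.Icc 0 1))
    (hi : ∀ t ∈ Set.Icc (0:ℝ) 1, Function.Injective (x t)) (Q : ℕ) {t : ℝ}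
    (ht : t ∈ Set.Icc (0:ℝ) 1) : Continuous fun κ => dAt Q κ x t := by
  obtain ⟨F, hF⟩ := exists_transport (tauC (Fintype.card ι)) isCompact_Icc (convex_Icc 0 1) hx hi
  have e : ∀ κ, hol (tauOf κ (Fintype.card ι)) x t =
      GeneralLinearGroup.map (evalHom κ) (F t * (F 0)⁻¹) := fun κ => by
    have := hF.map (evalHom κ) isCompact_Icc hx hi
    rw [map_tauC] at this
    rw [hol_eq this ht, map_mul, map_inv]
  refine continuous_det_of_apply fun c => ?_
  refine (LinearMap.continuous_of_finiteDimensional (low Q (x t))).comp ?_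
  refine continuous_pi fun i => ?_
  simp only [LinearMap.comp_apply, actL_apply, act, e, ← map_inv, vecMul, dotProduct,
    GeneralLinearGroup.map_apply]
  exact continuous_finsetSum _ fun j _ => continuous_const.mul (ContinuousMap.continuous _)

theorem continuousAt_turn {x : ℝ → ι → ℂ} (hx : ContinuousOn x (Set.Icc 0 1))
    (hi : ∀ t ∈ Set.Icc (0:ℝ) 1, Function.Injective (x t)) {Q L : ℕ} {κ : ℝ}
    (h : ∀ i < L, 0 < (dAt Q κ x ((i + 1 : ℕ) / L) / dAt Q κ x (i / L)).re) :
    ContinuousAt (fun κ => turn Q κ L x) κ := by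
  refine tendsto_finsetSum _ fun i hi' => ?_
  have hiL := Finset.mem_range.1 hi'
  have hL : (0:ℝ) < L := by exact_mod_cast (by omega : 0 < L)
  have h1 : (((i + 1 : ℕ) : ℝ) / L) ∈ Set.Icc (0:ℝ) 1 :=
    ⟨by positivity, (div_le_one hL).2 (by exact_mod_cast hiL)⟩
  have h0 : ((i : ℝ) / L) ∈ Set.Icc (0:ℝ) 1 :=
    ⟨by positivity, (div_le_one hL).2 (by exact_mod_cast hiL.le)⟩
  have hne : dAt Q κ x (i / L) ≠ 0 := fun h0 => by
    have := h i hiL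
    rw [h0, div_zero] at this
    simp at this
  exact ContinuousAt.comp (f := fun κ => dAt Q κ x ((i + 1 : ℕ) / L) / dAt Q κ x (i / L))
    (Complex.continuousAt_arg (Or.inl (h i hiL)))
    ((continuous_dAt hx hi Q h1).continuousAt.div (continuous_dAt hx hi Q h0).continuousAt hne)

variable {E : Type*} [NormedAddCommGroup E] [NormedSpace ℝ E]
  {Q : ℕ} {κ r : ℝ} {K : Set E} {Φ : E → ℂ ≃ₜ ℂ} {X : ι → ℂ} {F : E → GL ι ℂ}

theorem Setup.re_pos (S : Setup Q κ K Φ X r F) {k k' : E} (hk : k ∈ K) (hk' : k' ∈ K) {L : ℕ}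
    (hn : dist k k' < r * L) {i : ℕ} (hi : i < L) :
    0 < (dAt Q κ (seg Φ X k k') ((i + 1 : ℕ) / L) / dAt Q κ (seg Φ X k k') (i / L)).re := by
  have hL : (0:ℝ) < L := by exact_mod_cast (by omega : 0 < L)
  have h1 : (((i + 1 : ℕ) : ℝ) / L) ∈ Set.Icc (0:ℝ) 1 :=
    ⟨by positivity, (div_le_one hL).2 (by exact_mod_cast hi)⟩
  have h0 : ((i : ℝ) / L) ∈ Set.Icc (0:ℝ) 1 :=
    ⟨by positivity, (div_le_one hL).2 (by exact_mod_cast hi.le)⟩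
  rw [S.dAt_seg (k₀ := k) (hk₀ := hk) hk hk' h1, S.dAt_seg (k₀ := k) (hk₀ := hk) hk hk' h0]
  refine re_pos_of_near_one ((Coarse.W_frame hk).ratio (S.convex.add_smul_sub_mem hk hk' h0)
    (S.convex.add_smul_sub_mem hk hk' h1) (S.near _ (S.convex.add_smul_sub_mem hk hk' h0) _
      (S.convex.add_smul_sub_mem hk hk' h1) ?_))
  rw [dist_add_left, dist_eq_norm, ← sub_smul, norm_smul, Real.norm_eq_abs, ← dist_eq_norm,
    dist_comm k' k]
  have : |(i / L : ℝ) - (i + 1 : ℕ) / L| = 1 / L := by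
    rw [← sub_div, abs_div, abs_of_pos hL]; push_cast; rw [sub_add_cancel_left]; simp
  rw [this, one_div, inv_mul_lt_iff₀ hL, mul_comm]
  exact hn

end Continuity

section HalfTwist

variable {ι : Type*} [DecidableEq ι] [Fintype ι]

/-- The effect on a colour of passing in front of a list of strands. -/
noncomputable def wind (τ : ℂˣ) (z : ι → ℂ) (l : List ι) (w : ℂ) : ℂ :=
  l.foldl (fun w x => τ * w + (1 - τ) * z x) w

variable {τ : ℂˣ} {U : ι → ℝ} {z : ι → ℂ} {l : List ι} {A : Finset ι}

theorem wind_cons (x : ι) (w : ℂ) : wind τ z (x :: l) w = wind τ z l (τ * w + (1 - τ) * z x) := rfl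

theorem wind_affine (l : List ι) (w : ℂ) :
    wind τ z l w = (τ : ℂ) ^ l.length * w + wind τ z l 0 := by
  induction l generalizing w with
  | nil => simp [wind]
  | cons x l ih =>
    rw [wind_cons, wind_cons, ih, ih (τ * 0 + _), List.length_cons, pow_succ]
    ring

theorem wind_comb (l : List ι) (w w' : ℂ) :
    wind τ z l (τ * w + (1 - τ) * w') = τ * wind τ z l w + (1 - τ) * wind τ z l w' := by
  rw [wind_affine l (_ + _), wind_affine l w, wind_affine l w']
  ring

theorem wind_const (c : ℂ) (l : List ι) : wind τ (fun _ : ι => c) l c = c := by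
  induction l with
  | nil => rfl
  | cons x l ih =>
    rw [wind_cons]
    convert ih using 2
    ring

theorem wind_zero (h : ∀ x ∈ l, z x = 0) : wind τ z l 0 = 0 := by
  induction l with
  | nil => rfl
  | cons x l ih =>
    rw [wind_cons, h x (by simp), mul_zero, mul_zero, add_zero,
      ih fun y hy => h y (List.mem_cons_of_mem _ hy)]

theorem pass_of_lt {h : ℝ} (hl : ∀ x ∈ l, h < U x) (w : ℂ) : pass τ U z h l w = wind τ z l w := by
  induction l generalizing w with
  | nil => rfl
  | cons x l ih =>
    rw [pass, if_pos (hl x (by simp)), wind_cons, ih fun y hy => hl y (List.mem_cons_of_mem _ hy)]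

theorem pass_of_not_lt {h : ℝ} (hl : ∀ x ∈ l, ¬ h < U x) (w : ℂ) : pass τ U z h l w = w := by
  induction l generalizing w with
  | nil => rfl
  | cons x l ih =>
    rw [pass, if_neg (hl x (by simp)), ih fun y hy => hl y (List.mem_cons_of_mem _ hy)]

theorem pass_filter {h : ℝ} (hU : ∀ x, x ∉ A → ¬ h < U x) (l : List ι) (w : ℂ) :
    pass τ U z h (l.filter (· ∈ A)) w = pass τ U z h l w := by
  induction l generalizing w with
  | nil => rfl
  | cons x l ih =>
    by_cases hx : x ∈ A
    · rw [List.filter_cons_of_pos (by simpa using hx), pass, pass, ih]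
    · rw [List.filter_cons_of_neg (by simpa using hx), pass, ih, if_neg (hU x hx)]

theorem flow_filter {j : ι} (hj : j ∈ A) (hU : ∀ x, x ∉ A → ¬ U j < U x) (l : List ι) :
    flow τ U z j (l.filter (· ∈ A)) = flow τ U z j l := by
  induction l with
  | nil => rfl
  | cons x l ih =>
    by_cases hx : x ∈ A
    · rw [List.filter_cons_of_pos (by simpa using hx), flow, flow, ih, pass_filter hU]
    · rw [List.filter_cons_of_neg (by simpa using hx), flow, ih, if_neg]
      rintro rfl; exact hx hj

theorem flow_append_cons {j : ι} {m m' : List ι} (hj : j ∉ m) :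
    flow τ U z j (m ++ j :: m') = pass τ U z (U j) m' (z j) := by
  induction m with
  | nil => simp [flow]
  | cons x m ih =>
    rw [List.cons_append, flow, if_neg (by rintro rfl; simp at hj),
      ih fun h => hj (List.mem_cons_of_mem _ h)]

theorem filter_ord {X : ι → ℂ} (hX : Function.Injective X) {y : ι → ℝ} (hm : ∀ a, a ∈ l ↔ a ∈ A)
    (hl : l.Pairwise fun a b => y a < y b)
    (h : ∀ a ∈ A, ∀ b ∈ A, y a < y b → key (X a) < key (X b)) :
    (ord X).filter (· ∈ A) = l := by
  have hl' : l.Pairwise fun a b => key (X a) < key (X b) := hl.imp_of_mem fun ha hb hab =>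
    h _ ((hm _).1 ha) _ ((hm _).1 hb) hab
  have hn : l.Nodup := hl.imp fun hab => by rintro rfl; exact lt_irrefl _ hab
  refine List.Perm.eq_of_pairwise (le := fun a b => key (X a) < key (X b))
    (fun a b _ _ h1 h2 => absurd h1 h2.asymm) ((ord_pairwise hX).filter _) hl' ?_
  refine (List.perm_ext_iff_of_nodup ((ord_nodup X).filter _) hn).2 fun a => ?_
  simp [mem_ord, hm]

theorem half_twist {X X' : ι → ℂ} (hX : Function.Injective X) (hX' : Function.Injective X')
    (hl : (ord X).filter (· ∈ A) = l) (hl' : (ord X').filter (· ∈ A) = l.reverse)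
    (hm : ∀ a, a ∈ l ↔ a ∈ A) (hU : l.Pairwise fun a b => (X a).im < (X b).im)
    (hI : ∀ a b, Inv X X' a b → a ∈ A ∧ b ∈ A) (z : ι → ℂ) :
    (∀ j ∉ A, ((tr τ X X').1 *ᵥ z) j = z j) ∧
      ∀ m j m', l = m ++ j :: m' → ((tr τ X X').1 *ᵥ z) j = wind τ z (j :: m') (z j) := by
  refine ⟨fun j hj => ?_, fun m j m' hlm => ?_⟩
  · exact tr_mem (τ := τ) (fixCol j) hX hX' (fun a b hab => el_mem_fixCol
      (by rintro rfl; exact absurd (hI _ _ hab).1 hj)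
      (by rintro rfl; exact absurd (hI _ _ hab).2 hj)) z
  have hnd : l.Nodup := hU.imp fun hab => by rintro rfl; exact lt_irrefl _ hab
  have hjA : j ∈ A := (hm j).1 (by simp [hlm])
  set c : ℝ := -(∑ i, |(X i).im|) - 1 with hc
  have hcU : ∀ i, c < (X i).im := fun i => by
    have h1 := neg_abs_le (X i).im
    have h2 := Finset.single_le_sum (f := fun i => |(X i).im|) (fun i _ => abs_nonneg _)
      (Finset.mem_univ i)
    rw [hc]; linarith [show |(X i).im| ≤ ∑ i, |(X i).im| from h2]
  set V : ι → ℝ := fun i => if i ∈ A then (X i).im else c with hV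
  have hVA : ∀ i ∈ A, V i = (X i).im := fun i hi => if_pos hi
  have hw : Wd τ V (Inv X X') (ord X) (ord X') (tr τ X X') :=
    (tr_wd τ hX hX').mono (fun _ _ h => h) fun a b hab => by
      rw [hVA a (hI a b hab).1, hVA b (hI a b hab).2]
  have hne : ∀ a b, Inv X X' a b → V a ≠ V b := fun a b hab h => by
    obtain ⟨ha, hb⟩ := hI a b hab
    rw [hVA a ha, hVA b hb] at h
    have hab' : a ≠ b := by rintro rfl; exact lt_irrefl _ hab.1
    have hs : Std.Symm fun a b => (X a).im ≠ (X b).im := ⟨fun x y h => h.symm⟩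
    exact (hU.imp (S := fun a b => (X a).im ≠ (X b).im) fun h => h.ne).forall
      ((hm a).2 ha) ((hm b).2 hb) hab' h
  have key := hw.flow_eq (ord_nodup X) hne z (mem_ord X j)
  have hout : ∀ x, x ∉ A → ¬ V j < V x := fun x hx => by
    rw [hVA j hjA, hV]; simp only [if_neg hx]; exact (hcU j).asymm
  rw [← flow_filter hjA hout, ← flow_filter hjA hout (ord X), hl, hl', hlm, List.reverse_append,
    List.reverse_cons, List.append_assoc, List.singleton_append] at key
  rw [hlm] at hnd hU
  have hnd' := List.nodup_append.1 hnd
  have hjm : j ∉ m := fun h => hnd'.2.2 j h j (by simp) rfl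
  have hjm' : j ∉ m'.reverse := by
    rw [List.mem_reverse]; exact (List.nodup_cons.1 hnd'.2.1).1
  have hUp := List.pairwise_append.1 hU
  have hA : ∀ x ∈ m ++ j :: m', x ∈ A := fun x hx => (hm x).1 (hlm ▸ hx)
  rw [flow_append_cons hjm, flow_append_cons hjm', pass_of_not_lt, pass_of_lt] at key
  · rw [key, wind_cons]; congr 1; ring
  · intro x hx
    rw [hVA j hjA, hVA x (hA x (by simp [hx]))]
    exact (List.pairwise_cons.1 hUp.2.1).1 x hx
  · intro x hx
    rw [List.mem_reverse] at hx
    rw [hVA j hjA, hVA x (hA x (by simp [hx]))]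
    exact (hUp.2.2 x hx j (by simp)).asymm

/-- The composition of two half twists. -/
theorem wind_reverse {z z' : ι → ℂ} {l : List ι}
    (h : ∀ m j m', l = m ++ j :: m' → z' j = wind τ z (j :: m') (z j)) :
    ∀ m m', l = m ++ m' → ∀ w, wind τ z' m.reverse (wind τ z m' w) = wind τ z l w := by
  intro m
  induction m using List.reverseRecOn with
  | nil => rintro m' rfl w; rfl
  | append_singleton m k ih =>
    intro m' hl w
    have hl' : l = m ++ k :: m' := by rw [hl]; simp
    have hk : z' k = wind τ z m' (z k) := by
      rw [h m k m' hl', wind_cons]; congr 1; ring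
    rw [List.reverse_append, List.reverse_singleton, List.singleton_append, wind_cons, hk,
      ← wind_comb, ← wind_cons, ih _ hl']

end HalfTwist

section FullTwist

variable {ι : Type*} [DecidableEq ι] [Fintype ι]

/-- A block of points on the real axis is rotated about the origin while the others stay put. -/
noncomputable def spin (A : Finset ι) (y : ι → ℝ) (X : ι → ℂ) (t : ℝ) (i : ι) : ℂ :=
  if i ∈ A then Complex.exp (2 * Real.pi * t * Complex.I) * y i else X i

variable {A : Finset ι} {y : ι → ℝ} {X : ι → ℂ} {τ : ℂˣ}

theorem spin_of_mem {t : ℝ} {i : ι} (hi : i ∈ A) :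
    (spin A y X t i).re = Real.cos (2 * Real.pi * t) * y i ∧
      (spin A y X t i).im = Real.sin (2 * Real.pi * t) * y i := by
  rw [spin, if_pos hi, show (2 * Real.pi * t * Complex.I : ℂ) =
    ((2 * Real.pi * t : ℝ) : ℂ) * Complex.I by push_cast; ring]
  constructor
  · rw [Complex.re_mul_ofReal, Complex.exp_ofReal_mul_I_re]
  · rw [Complex.im_mul_ofReal, Complex.exp_ofReal_mul_I_im]

theorem spin_of_notMem {t : ℝ} {i : ι} (hi : i ∉ A) : spin A y X t i = X i := if_neg hi

theorem abs_spin_le {t : ℝ} {i : ι} (hi : i ∈ A) : |(spin A y X t i).re| ≤ |y i| := by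
  rw [(spin_of_mem hi).1, abs_mul]
  exact mul_le_of_le_one_left (abs_nonneg _) (Real.abs_cos_le_one _)

/-- Two times at which the configurations are ordered in the same way along the block. -/
def SameDir (t t' : ℝ) : Prop :=
  (0 < Real.cos (2 * Real.pi * t) ∨ Real.cos (2 * Real.pi * t) = 0 ∧ 0 < Real.sin (2 * Real.pi * t))
    ↔ (0 < Real.cos (2 * Real.pi * t') ∨
      Real.cos (2 * Real.pi * t') = 0 ∧ 0 < Real.sin (2 * Real.pi * t'))

theorem spin_key {t : ℝ} {i j : ι} (hi : i ∈ A) (hj : j ∈ A) (hij : y i < y j) :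
    (key (spin A y X t i) < key (spin A y X t j) ↔
      (0 < Real.cos (2 * Real.pi * t) ∨
        Real.cos (2 * Real.pi * t) = 0 ∧ 0 < Real.sin (2 * Real.pi * t))) ∧
    (key (spin A y X t j) < key (spin A y X t i) ↔
      ¬ (0 < Real.cos (2 * Real.pi * t) ∨
        Real.cos (2 * Real.pi * t) = 0 ∧ 0 < Real.sin (2 * Real.pi * t))) := by
  have h1 := Real.sin_sq_add_cos_sq (2 * Real.pi * t)
  rw [key_lt, key_lt, (spin_of_mem hi).1, (spin_of_mem hi).2, (spin_of_mem hj).1,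
    (spin_of_mem hj).2]
  set c := Real.cos (2 * Real.pi * t)
  set s := Real.sin (2 * Real.pi * t)
  rcases lt_trichotomy c 0 with h | h | h
  · have : c * y j < c * y i := mul_lt_mul_of_neg_left hij h
    simp [this, this.ne', this.not_gt, h.not_gt, h.ne]
  · have hs : s ≠ 0 := by rintro hs; rw [h, hs] at h1; norm_num at h1
    rcases lt_or_gt_of_ne hs with hs | hs
    · have : s * y j < s * y i := mul_lt_mul_of_neg_left hij hs
      simp [h, this, this.not_gt, hs.not_gt]
    · have : s * y i < s * y j := mul_lt_mul_of_pos_left hij hs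
      simp [h, this, this.not_gt, hs]
  · have : c * y i < c * y j := mul_lt_mul_of_pos_left hij h
    simp [this, this.not_gt, h, this.ne']

/-- The standing assumptions on a spinning block. -/
structure SpinData (A : Finset ι) (y : ι → ℝ) (X : ι → ℂ) : Prop where
  inj : Function.Injective X
  ne : ∀ i ∈ A, ∀ j ∈ A, y i = y j → i = j
  far : ∀ i ∈ A, ∀ j ∉ A, |y i| < |(X j).re|

variable (h : SpinData A y X)
include h

theorem SpinData.injective (t : ℝ) : Function.Injective (spin A y X t) := fun i j hij => by
  by_cases hi : i ∈ A <;> by_cases hj : j ∈ A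
  · refine h.ne i hi j hj ?_
    rw [spin, spin, if_pos hi, if_pos hj] at hij
    exact_mod_cast mul_left_cancel₀ (Complex.exp_ne_zero _) hij
  · have h1 := h.far i hi j hj
    have h2 := abs_spin_le (X := X) (y := y) (t := t) hi
    rw [hij, spin_of_notMem hj] at h2
    exact absurd h2 h1.not_ge
  · have h1 := h.far j hj i hi
    have h2 := abs_spin_le (X := X) (y := y) (t := t) hj
    rw [← hij, spin_of_notMem hi] at h2
    exact absurd h2 h1.not_ge
  · rw [spin_of_notMem hi, spin_of_notMem hj] at hij
    exact h.inj hij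

theorem SpinData.inv {t t' : ℝ} {i j : ι} (hij : Inv (spin A y X t) (spin A y X t') i j) :
    i ∈ A ∧ j ∈ A := by
  by_contra hA
  have key : ∀ i ∈ A, ∀ j ∉ A, ∀ t t', (key (spin A y X t i) < key (spin A y X t j) →
      key (spin A y X t' i) < key (spin A y X t' j)) ∧
      (key (spin A y X t j) < key (spin A y X t i) →
      key (spin A y X t' j) < key (spin A y X t' i)) := fun i hi j hj t t' => by
    have h1 := h.far i hi j hj
    have h2 := (abs_le.1 (abs_spin_le (X := X) (y := y) (t := t) hi))
    have h3 := (abs_le.1 (abs_spin_le (X := X) (y := y) (t := t') hi))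
    rw [key_lt, key_lt, key_lt, key_lt, spin_of_notMem hj, spin_of_notMem hj]
    rcases lt_abs.1 h1 with h4 | h4
    · exact ⟨fun _ => .inl (by linarith), fun h => by rcases h with h | ⟨h, -⟩ <;> linarith⟩
    · exact ⟨fun h => by rcases h with h | ⟨h, -⟩ <;> linarith, fun _ => .inl (by linarith)⟩
  by_cases hi : i ∈ A <;> by_cases hj : j ∈ A
  · exact hA ⟨hi, hj⟩
  · exact ((key i hi j hj t t').1 hij.1).asymm hij.2
  · exact ((key j hj i hi t t').2 hij.1).asymm hij.2
  · have := hij.2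
    rw [spin_of_notMem hi, spin_of_notMem hj] at this
    have h2 := hij.1
    rw [spin_of_notMem hi, spin_of_notMem hj] at h2
    exact this.asymm h2

theorem SpinData.tr_eq {t t' : ℝ} (hs : SameDir t t') :
    tr τ (spin A y X t) (spin A y X t') = 1 := by
  refine Subgroup.mem_bot.1 (tr_mem ⊥ (h.injective t) (h.injective t') fun i j hij => ?_)
  obtain ⟨hi, hj⟩ := h.inv hij
  exfalso
  rcases lt_trichotomy (y i) (y j) with h1 | h1 | h1
  · have := (spin_key (X := X) (t := t) hi hj h1).1.1 hij.1
    exact (spin_key (X := X) (t := t') hi hj h1).2.1 hij.2 (hs.1 this)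
  · obtain rfl := h.ne i hi j hj h1
    exact lt_irrefl _ hij.1
  · have := (spin_key (X := X) (t := t) hj hi h1).2.1 hij.1
    exact this (hs.2 ((spin_key (X := X) (t := t') hj hi h1).1.1 hij.2))

theorem SpinData.const {F : ℝ → GL ι ℂ} {a b : ℝ} (hab : a ≤ b)
    (hF : IsTransport τ (Set.Icc a b) (spin A y X) F)
    (hs : ∀ t ∈ Set.Icc a b, ∀ t' ∈ Set.Icc a b, SameDir t t') : F b = F a := by
  have := hF.mem isPreconnected_Icc ⊥ (fun k hk => by
    filter_upwards [self_mem_nhdsWithin] with k' hk'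
    exact Subgroup.mem_bot.2 (h.tr_eq (hs k hk k' hk'))) (Set.left_mem_Icc.2 hab)
    (Set.right_mem_Icc.2 hab)
  exact mul_inv_eq_one.1 (Subgroup.mem_bot.1 this)

omit h

/-- The block is ordered by `y`, rather than in the reverse order. -/
def Dir (t : ℝ) : Prop :=
  0 < Real.cos (2 * Real.pi * t) ∨ Real.cos (2 * Real.pi * t) = 0 ∧ 0 < Real.sin (2 * Real.pi * t)

theorem cos_quarter : Real.cos (2 * Real.pi * (1 / 4)) = 0 ∧
    Real.sin (2 * Real.pi * (1 / 4)) = 1 := by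
  rw [show 2 * Real.pi * (1 / 4) = Real.pi / 2 by ring]
  exact ⟨Real.cos_pi_div_two, Real.sin_pi_div_two⟩

theorem cos_three_quarters : Real.cos (2 * Real.pi * (3 / 4)) = 0 ∧
    Real.sin (2 * Real.pi * (3 / 4)) = -1 := by
  rw [show 2 * Real.pi * (3 / 4) = Real.pi / 2 + Real.pi by ring]
  simp [Real.cos_add_pi, Real.sin_add_pi]

theorem dir_of_le {t : ℝ} (h0 : 0 ≤ t) (h1 : t ≤ 1 / 4) : Dir t := by
  rcases h1.lt_or_eq with h1 | rfl
  · exact .inl (Real.cos_pos_of_mem_Ioo ⟨by nlinarith [Real.pi_pos], by nlinarith [Real.pi_pos]⟩)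
  · exact .inr ⟨cos_quarter.1, by rw [cos_quarter.2]; norm_num⟩

theorem dir_of_gt {t : ℝ} (h0 : 3 / 4 < t) (h1 : t ≤ 1) : Dir t := by
  refine .inl ?_
  rw [← Real.cos_sub_two_pi]
  exact Real.cos_pos_of_mem_Ioo ⟨by nlinarith [Real.pi_pos], by nlinarith [Real.pi_pos]⟩

theorem not_dir {t : ℝ} (h0 : 1 / 4 < t) (h1 : t ≤ 3 / 4) : ¬ Dir t := by
  rcases h1.lt_or_eq with h1 | rfl
  · have := Real.cos_neg_of_pi_div_two_lt_of_lt (x := 2 * Real.pi * t)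
      (by nlinarith [Real.pi_pos]) (by nlinarith [Real.pi_pos])
    rintro (h | h)
    · exact h.not_gt this
    · exact this.ne h.1
  · rintro (h | h)
    · exact h.ne' cos_three_quarters.1
    · have := h.2
      rw [cos_three_quarters.2] at this; norm_num at this

theorem exists_step {a b c : ℝ} (hac : a ≤ c) (hcb : c < b) {p : ℝ → Prop}
    (hp : ∀ᶠ t in 𝓝[Set.Icc a b] c, p t) : ∃ t, c < t ∧ t ≤ b ∧ p t := by
  have h1 : ∀ᶠ t in 𝓝[>] c, p t := by
    refine Filter.Eventually.filter_mono ?_ hp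
    rw [← nhdsWithin_Ioc_eq_nhdsGT hcb]
    exact nhdsWithin_mono _ fun t ht => ⟨hac.trans ht.1.le, ht.2⟩
  obtain ⟨t, ht, h2⟩ := (h1.and (Ioc_mem_nhdsGT hcb)).exists
  exact ⟨t, h2.1, h2.2, ht⟩

theorem SpinData.order (h : SpinData A y X) {l : List ι} (hm : ∀ a, a ∈ l ↔ a ∈ A)
    (hl : l.Pairwise fun a b => y a < y b) (t : ℝ) :
    (Dir t → (ord (spin A y X t)).filter (· ∈ A) = l) ∧
      (¬ Dir t → (ord (spin A y X t)).filter (· ∈ A) = l.reverse) := by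
  refine ⟨fun ht => filter_ord (h.injective t) hm hl fun a ha b hb hab =>
    (spin_key ha hb hab).1.2 ht, fun ht => filter_ord (y := fun i => - y i) (h.injective t)
      (by simpa using hm) ?_ fun a ha b hb hab =>
        (spin_key hb ha (neg_lt_neg_iff.1 hab)).2.2 ht⟩
  rw [List.pairwise_reverse]
  exact hl.imp fun h => neg_lt_neg h

/-- The monodromy of a full twist of a block. -/
theorem SpinData.full_twist (h : SpinData A y X) {l : List ι} (hm : ∀ a, a ∈ l ↔ a ∈ A)
    (hl : l.Pairwise fun a b => y a < y b) {F : ℝ → GL ι ℂ}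
    (hF : IsTransport τ (Set.Icc 0 1) (spin A y X) F) (z : ι → ℂ) :
    (∀ j ∉ A, ((F 1 * (F 0)⁻¹).1 *ᵥ z) j = z j) ∧
      ∀ j ∈ A, ((F 1 * (F 0)⁻¹).1 *ᵥ z) j = wind τ z l (z j) := by
  obtain ⟨t₁, h1, h1', e1⟩ := exists_step (b := 3 / 4) (by norm_num) (by norm_num)
    ((hF.mono (Set.Icc_subset_Icc_right (by norm_num : (3 / 4 : ℝ) ≤ 1))) (1 / 4)
      ⟨by norm_num, by norm_num⟩)
  obtain ⟨t₂, h2, h2', e2⟩ := exists_step (by norm_num) (by norm_num) (hF (3 / 4)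
      ⟨by norm_num, by norm_num⟩)
  have c1 : F (1 / 4) = F 0 := h.const (by norm_num)
    (hF.mono (Set.Icc_subset_Icc_right (by norm_num))) fun t ht t' ht' =>
      iff_of_true (dir_of_le ht.1 ht.2) (dir_of_le ht'.1 ht'.2)
  have c2 : F (3 / 4) = F t₁ := h.const h1'
    (hF.mono (Set.Icc_subset_Icc (by linarith) (by norm_num))) fun t ht t' ht' =>
      iff_of_false (not_dir (h1.trans_le ht.1) ht.2) (not_dir (h1.trans_le ht'.1) ht'.2)
  have c3 : F 1 = F t₂ := h.const h2'
    (hF.mono (Set.Icc_subset_Icc (by linarith) le_rfl)) fun t ht t' ht' =>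
      iff_of_true (dir_of_gt (h2.trans_le ht.1) ht.2) (dir_of_gt (h2.trans_le ht'.1) ht'.2)
  have hM : F 1 * (F 0)⁻¹ = tr τ (spin A y X (3 / 4)) (spin A y X t₂) *
      tr τ (spin A y X (1 / 4)) (spin A y X t₁) := by
    rw [c3, e2, c2, e1, c1, mul_assoc, mul_inv_cancel_right]
  have him : ∀ {t : ℝ} {i : ι}, i ∈ A → (spin A y X t i).im = Real.sin (2 * Real.pi * t) * y i :=
    fun hi => (spin_of_mem hi).2
  obtain ⟨p1, p2⟩ := half_twist (τ := τ) (h.injective (1 / 4)) (h.injective t₁)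
    ((h.order hm hl _).1 (dir_of_le (by norm_num) le_rfl)) ((h.order hm hl _).2 (not_dir h1 h1')) hm
    (hl.imp_of_mem fun ha hb hab => by
      rw [him ((hm _).1 ha), him ((hm _).1 hb), cos_quarter.2]; simpa using hab)
    (fun a b => h.inv) z
  obtain ⟨q1, q2⟩ := half_twist (τ := τ) (h.injective (3 / 4)) (h.injective t₂)
    ((h.order hm hl _).2 (not_dir (by norm_num) le_rfl))
    (((h.order hm hl _).1 (dir_of_gt h2 h2')).trans l.reverse_reverse.symm) (by simpa using hm)
    (List.pairwise_reverse.2 (hl.imp_of_mem fun ha hb hab => by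
      rw [him ((hm _).1 ha), him ((hm _).1 hb), cos_three_quarters.2]; simpa using hab))
    (fun a b => h.inv) ((tr τ (spin A y X (1 / 4)) (spin A y X t₁)).1 *ᵥ z)
  rw [hM, Units.val_mul, ← Matrix.mulVec_mulVec]
  refine ⟨fun j hj => by rw [q1 j hj, p1 j hj], fun j hj => ?_⟩
  obtain ⟨m, m', hlm⟩ := List.append_of_mem ((hm j).2 hj)
  rw [q2 m'.reverse j m.reverse (by rw [hlm]; simp), wind_cons, ← wind_reverse p2 m (j :: m') hlm,
    p2 m j m' hlm]
  congr 1
  ring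

/-- Vectors supported on the block, with zero sum. -/
def IsRel (A : Finset ι) (v : ι → ℂ) : Prop := (∀ i ∉ A, v i = 0) ∧ ∑ i, v i = 0

theorem SpinData.act_full_twist (h : SpinData A y X) {F : ℝ → GL ι ℂ}
    (hF : IsTransport τ (Set.Icc 0 1) (spin A y X) F) (v : ι → ℂ) :
    IsRel A (act (F 1 * (F 0)⁻¹) v - v) ∧
      (IsRel A v → act (F 1 * (F 0)⁻¹) v = ((τ : ℂ) ^ A.card)⁻¹ • v) := by
  classical
  set l := A.toList.insertionSort fun a b => y a ≤ y b with hldef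
  have hm : ∀ a, a ∈ l ↔ a ∈ A := fun a => by simp [hldef]
  have hcard : l.length = A.card := by simp [hldef]
  have hnd : l.Nodup := (List.perm_insertionSort _ _).nodup_iff.2 A.nodup_toList
  have hl : l.Pairwise fun a b => y a < y b := by
    have : Std.Total fun a b : ι => y a ≤ y b := ⟨fun a b => le_total _ _⟩
    have : IsTrans ι fun a b : ι => y a ≤ y b := ⟨fun a b c => le_trans⟩
    have h1 := List.pairwise_insertionSort (fun a b => y a ≤ y b) A.toList
    have h2 : l.Pairwise (· ≠ ·) := hnd
    exact (h1.and h2).imp_of_mem fun ha hb hab => lt_of_le_of_ne hab.1 fun he =>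
      hab.2 (h.ne _ ((hm _).1 ha) _ ((hm _).1 hb) he)
  have ft := h.full_twist hm hl hF
  set M := F 1 * (F 0)⁻¹
  have hd : ∀ v z, act M v ⬝ᵥ (M.1 *ᵥ z) = v ⬝ᵥ z := act_dotProduct M
  refine ⟨⟨fun i hi => ?_, ?_⟩, fun hv => ?_⟩
  · have h1 : M.1 *ᵥ (Pi.single i 1) = Pi.single i 1 := by
      ext j
      by_cases hj : j ∈ A
      · rw [(ft _).2 j hj]
        have hji : ∀ k ∈ A, (Pi.single i 1 : ι → ℂ) k = 0 := fun k hk =>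
          Pi.single_eq_of_ne (by rintro rfl; exact hi hk) _
        rw [hji j hj, wind_zero fun x hx => hji x ((hm x).1 hx)]
      · rw [(ft _).1 j hj]
    have := hd v (Pi.single i 1)
    rw [h1, dotProduct_single_one, dotProduct_single_one] at this
    rw [Pi.sub_apply, this, sub_self]
  · have h1 : M.1 *ᵥ (fun _ => 1) = fun _ => 1 := by
      ext j
      by_cases hj : j ∈ A
      · rw [(ft _).2 j hj, wind_const]
      · rw [(ft _).1 j hj]
    have := hd v fun _ => 1
    rw [h1] at this
    simp only [dotProduct, mul_one] at this
    simp [this]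
  · have h1 : ∀ z, ((τ : ℂ) ^ A.card)⁻¹ • v ⬝ᵥ (M.1 *ᵥ z) = v ⬝ᵥ z := fun z => by
      have hτ : (τ : ℂ) ^ A.card ≠ 0 := pow_ne_zero _ τ.ne_zero
      have h2 : ∀ i, v i * (M.1 *ᵥ z) i =
          (τ : ℂ) ^ A.card * (v i * z i) + v i * wind τ z l 0 := fun i => by
        by_cases hi : i ∈ A
        · rw [(ft z).2 i hi, wind_affine, hcard]; ring
        · rw [hv.1 i hi]; ring
      rw [smul_dotProduct, dotProduct, Finset.sum_congr rfl fun i _ => h2 i,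
        Finset.sum_add_distrib, ← Finset.mul_sum, ← Finset.sum_mul, hv.2, zero_mul, add_zero,
        smul_eq_mul, inv_mul_cancel_left₀ hτ, dotProduct]
    ext i
    have h3 := (hd v (M⁻¹.1 *ᵥ Pi.single i 1)).trans (h1 _).symm
    rw [Matrix.mulVec_mulVec, show M.1 * M⁻¹.1 = 1 from M.mul_inv, Matrix.one_mulVec,
      dotProduct_single_one, dotProduct_single_one] at h3
    exact h3

end FullTwist

section AdaptedFrame

variable {V : Type*} [AddCommGroup V] [Module ℂ V] {Q : ℕ} {B : V → V → ℂ} {S : Submodule ℂ V}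
  {M : V →ₗ[ℂ] V} {lm : ℂ} {k : V} {L : V →ₗ[ℂ] (Fin Q → ℂ)} {W : (Fin Q → ℂ) →ₗ[ℂ] V}

/-- If an isometry acts by a scalar on the image of `M - 1`, and this image contains exactly one
negative direction, then there is an invariant negative frame on which it has determinant that
scalar. -/
theorem exists_adapted_frame (hadd : ∀ u v w, B u (v + w) = B u v + B u w)
    (hsmul : ∀ u v c, B u (c • v) = c * B u v) (hconj : ∀ u v, conj (B u v) = B v u)
    (hM : ∀ v w, B (M v) (M w) = B v w) (hlm : lm ≠ 1)
    (hMM : ∀ v, M (M v - v) = lm • (M v - v)) (hMS : ∀ v ∈ S, M v ∈ S)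
    (hdef : ∀ y ∈ S, (B y y).re ≤ 0 → L y = 0 → y = 0)
    (hWS : ∀ c, W c ∈ S) (hLW : ∀ c, L (W c) = c) (hWn : ∀ c, c ≠ 0 → (B (W c) (W c)).re < 0)
    (hkS : k ∈ S) (hk : (B k k).re < 0) (hMk : M k = lm • k)
    (hpos : ∀ v, (∃ u, M u - u = v) → v ∈ S → B k v = 0 → 0 ≤ (B v v).re) :
    ∃ (Y : (Fin Q → ℂ) →ₗ[ℂ] V) (D : (Fin Q → ℂ) →ₗ[ℂ] (Fin Q → ℂ)), Function.Injective Y ∧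
      (∀ c, Y c ∈ S ∧ (B (Y c) (Y c)).re ≤ 0) ∧ (∀ c, M (Y c) = Y (D c)) ∧
      LinearMap.det D = lm := by
  have hz : ∀ u, B u 0 = 0 := fun u => by simpa using hsmul u 0 0
  have hz' : ∀ u, B 0 u = 0 := fun u => by rw [← hconj, hz, map_zero]
  have haddl : ∀ u v w, B (u + v) w = B u w + B v w := fun u v w => by
    rw [← hconj, hadd, map_add, hconj, hconj]
  have hsmull : ∀ u v c, B (c • u) v = conj c * B u v := fun u v c => by
    rw [← hconj, hsmul, map_mul, hconj]
  have hneg : ∀ u v, B u (-v) = - B u v := fun u v => by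
    rw [← neg_one_smul ℂ, hsmul]; ring
  have hsub : ∀ u v w, B u (v - w) = B u v - B u w := fun u v w => by
    rw [sub_eq_add_neg, hadd, hneg]; ring
  have hWn' : ∀ c, (B (W c) (W c)).re ≤ 0 := fun c => by
    by_cases hc : c = 0
    · simp [hc, hz]
    · exact (hWn c hc).le
  have hkk : B k k ≠ 0 := fun h => by rw [h] at hk; exact lt_irrefl _ hk
  obtain ⟨e, he⟩ : ∃ e, B k (W e) = 1 := by
    by_cases h0 : ∀ c, B k (W c) = 0
    · have h1 : k - W (L k) = 0 := by
        refine hdef _ (S.sub_mem hkS (hWS _)) ?_ (by rw [map_sub, hLW, sub_self])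
        have : B (k - W (L k)) (k - W (L k)) = B k k + B (W (L k)) (W (L k)) := by
          have h2 : B (W (L k)) k = 0 := by rw [← hconj, h0, map_zero]
          rw [sub_eq_add_neg, hadd, haddl, hneg, haddl, ← neg_one_smul ℂ (W (L k)), hsmull, hsmull,
            h0, h2, map_neg, map_one]
          ring
        rw [this, Complex.add_re]
        linarith [hWn' (L k)]
      rw [sub_eq_zero] at h1
      have h2 := h0 (L k)
      rw [← h1] at h2
      exact absurd h2 hkk
    · push Not at h0
      obtain ⟨c, hc⟩ := h0
      exact ⟨(B k (W c))⁻¹ • c, by rw [map_smul, hsmul, inv_mul_cancel₀ hc]⟩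
  let φ : (Fin Q → ℂ) →ₗ[ℂ] ℂ :=
    { toFun := fun c => B k (W c)
      map_add' := fun c d => by rw [map_add, hadd]
      map_smul' := fun c d => by rw [map_smul, hsmul]; rfl }
  have hφ : ∀ c, φ c = B k (W c) := fun c => rfl
  have hlm1 : lm - 1 ≠ 0 := sub_ne_zero.2 hlm
  let T : V →ₗ[ℂ] V := (lm - 1)⁻¹ • (M - LinearMap.id)
  have hT : ∀ v, T v = (lm - 1)⁻¹ • (M v - v) := fun v => rfl
  have hMT : ∀ v, M (T v) = lm • T v := fun v => by
    rw [hT, map_smul, hMM, smul_comm]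
  have hMv : ∀ v, M v = v + (lm - 1) • T v := fun v => by
    rw [hT, smul_smul, mul_inv_cancel₀ hlm1, one_smul]; abel
  have hMp : ∀ v, M (v - T v) = v - T v := fun v => by
    rw [map_sub, hMT, hMv, sub_smul, one_smul]; abel
  have hTS : ∀ v ∈ S, T v ∈ S := fun v hv => S.smul_mem _ (S.sub_mem (hMS v hv) hv)
  have horth : ∀ p q, M p = p → M q = lm • q → B p q = 0 := fun p q hp hq => by
    have h1 := hM p q
    rw [hp, hq, hsmul] at h1
    have h2 : (lm - 1) * B p q = 0 := by rw [sub_mul, h1]; ring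
    exact (mul_eq_zero.1 h2).resolve_left hlm1
  have horth' : ∀ p q, M p = p → M q = lm • q → B q p = 0 := fun p q hp hq => by
    rw [← hconj, horth p q hp hq, map_zero]
  have hsplit : ∀ v, B v v = B (v - T v) (v - T v) + B (T v) (T v) := fun v => by
    conv_lhs => rw [← sub_add_cancel v (T v)]
    rw [hadd, haddl, haddl, horth _ _ (hMp v) (hMT v), horth' _ _ (hMp v) (hMT v)]
    ring
  have hTpos : ∀ v ∈ S, B k v = 0 → 0 ≤ (B (T v) (T v)).re := fun v hv h0 => by
    refine hpos _ ⟨(lm - 1)⁻¹ • v, by rw [map_smul, ← smul_sub]; rfl⟩ (hTS v hv) ?_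
    have : B k v = B k (v - T v) + B k (T v) := by rw [← hadd, sub_add_cancel]
    rw [horth' _ _ (hMp v) hMk, zero_add] at this
    rw [← this, h0]
  let w : (Fin Q → ℂ) →ₗ[ℂ] V := W ∘ₗ (LinearMap.id - φ.smulRight e)
  have hw : ∀ c, w c = W (c - φ c • e) := fun c => rfl
  have hkw : ∀ c, B k (w c) = 0 := fun c => by
    rw [hw, map_sub, map_smul, hsub, hsmul, he, hφ, mul_one, sub_self]
  let Y : (Fin Q → ℂ) →ₗ[ℂ] V := (LinearMap.id - T) ∘ₗ w + φ.smulRight k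
  have hY : ∀ c, Y c = (w c - T (w c)) + φ c • k := fun c => rfl
  have hwS : ∀ c, w c ∈ S := fun c => hWS _
  have hBY : ∀ c, (B (Y c) (Y c)).re =
      (B (w c) (w c)).re - (B (T (w c)) (T (w c))).re + ‖φ c‖ ^ 2 * (B k k).re := fun c => by
    have h1 : B (Y c) (Y c) = B (w c - T (w c)) (w c - T (w c)) +
        (φ c * conj (φ c)) * B k k := by
      rw [hY, hadd, haddl, haddl, hsmul, hsmull, hsmul, hsmull, horth _ _ (hMp _) hMk,
        horth' _ _ (hMp _) hMk]
      ring
    rw [h1, hsplit (w c), Complex.mul_conj, Complex.normSq_eq_norm_sq]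
    simp only [Complex.add_re, Complex.re_ofReal_mul]
    ring
  have hwneg : ∀ c, (B (w c) (w c)).re ≤ 0 := fun c => hWn' _
  refine ⟨Y, LinearMap.transvection φ ((lm - 1) • e), ?_, fun c => ⟨?_, ?_⟩, fun c => ?_, ?_⟩
  · refine (injective_iff_map_eq_zero Y).2 fun c hc => ?_
    have h1 : φ c = 0 := by
      have : B k (Y c) = φ c * B k k := by
        rw [hY, hadd, horth' _ _ (hMp _) hMk, hsmul, zero_add]
      rw [hc, hz] at this
      exact (mul_eq_zero.1 this.symm).resolve_right hkk
    by_contra hne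
    have h2 := hBY c
    rw [hc, hz, h1, hw, h1, zero_smul, sub_zero] at h2
    have h3 := hTpos (W c) (hWS c) (by rw [← hφ, h1])
    have h4 := hWn c hne
    simp at h2
    linarith
  · exact S.add_mem (S.sub_mem (hwS c) (hTS _ (hwS c))) (S.smul_mem _ hkS)
  · rw [hBY]
    have h1 := hTpos (w c) (hwS c) (hkw c)
    nlinarith [hwneg c, sq_nonneg ‖φ c‖]
  · have h1 : φ (LinearMap.transvection φ ((lm - 1) • e) c) = lm * φ c := by
      rw [LinearMap.transvection.apply, map_add, map_smul, map_smul, hφ e, he, smul_eq_mul,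
        smul_eq_mul]
      ring
    have h2 : w (LinearMap.transvection φ ((lm - 1) • e) c) = w c := by
      rw [hw, hw, h1, LinearMap.transvection.apply, smul_smul]
      congr 1
      rw [add_sub_assoc, ← sub_smul, show φ c * (lm - 1) - lm * φ c = -φ c by ring, neg_smul,
        ← sub_eq_add_neg]
    rw [hY, hY, h1, h2, map_add, hMp, map_smul, hMk, smul_smul, mul_comm]
  · rw [LinearMap.transvection.det, map_smul, hφ, he, smul_eq_mul]
    ring

end AdaptedFrame

section Lap

variable {ι : Type*} [DecidableEq ι] [Fintype ι]

/-- A block of points is rotated about the origin while the others stay put. -/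
noncomputable def lap (A : Finset ι) (X : ι → ℂ) (t : ℝ) (i : ι) : ℂ :=
  if i ∈ A then Complex.exp (2 * Real.pi * t * Complex.I) * X i else X i

/-- The block lies inside a disc and the other points outside of it, in general position. -/
structure LapData (A : Finset ι) (X : ι → ℂ) : Prop where
  inj : Function.Injective X
  ne : ∀ i ∈ A, ∀ j ∈ A, (X i).re = (X j).re → i = j
  re_ne : ∀ j ∉ A, (X j).re ≠ 0
  lt : ∀ i ∈ A, ∀ j ∉ A, ‖X i‖ < ‖X j‖

/-- The block is flattened onto the real axis and shrunk. -/
noncomputable def flat (A : Finset ι) (X : ι → ℂ) (c u : ℝ) (i : ι) : ℂ :=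
  if i ∈ A then (1 - u : ℝ) * X i + (u * c * (X i).re : ℝ) else X i

theorem lap_flat_one (A : Finset ι) (X : ι → ℂ) (c t : ℝ) :
    lap A (flat A X c 1) t = spin A (fun i => c * (X i).re) X t := by
  ext i
  by_cases hi : i ∈ A <;> simp [lap, flat, spin, hi]

theorem lap_flat_zero (A : Finset ι) (X : ι → ℂ) (c t : ℝ) :
    lap A (flat A X c 0) t = lap A X t := by
  ext i
  by_cases hi : i ∈ A <;> simp [lap, flat, hi]

theorem lap_zero (A : Finset ι) (X : ι → ℂ) : lap A X 0 = X := by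
  ext i
  by_cases hi : i ∈ A <;> simp [lap]

theorem lap_one (A : Finset ι) (X : ι → ℂ) : lap A X 1 = X := by
  ext i
  by_cases hi : i ∈ A <;> simp [lap, Complex.exp_two_pi_mul_I]

theorem lap_add_one (A : Finset ι) (X : ι → ℂ) (t : ℝ) : lap A X (t + 1) = lap A X t := by
  ext i
  by_cases hi : i ∈ A
  · simp only [lap, if_pos hi]
    rw [show 2 * Real.pi * ((t + 1 : ℝ) : ℂ) * Complex.I =
      2 * Real.pi * t * Complex.I + 2 * Real.pi * Complex.I by push_cast; ring, Complex.exp_add,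
      Complex.exp_two_pi_mul_I, mul_one]
  · simp [lap, hi]

variable {A : Finset ι} {X : ι → ℂ} {τ : ℂˣ}

theorem norm_exp_turn (t : ℝ) : ‖Complex.exp (2 * Real.pi * t * Complex.I)‖ = 1 := by
  rw [show (2 * Real.pi * t * Complex.I : ℂ) = ((2 * Real.pi * t : ℝ) : ℂ) * Complex.I by
    push_cast; ring, Complex.norm_exp_ofReal_mul_I]

theorem LapData.lap_injective (h : LapData A X) (t : ℝ) : Function.Injective (lap A X t) :=
  fun i j hij => by
  by_cases hi : i ∈ A <;> by_cases hj : j ∈ A <;> simp only [lap, hi, hj, if_true, if_false] at hij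
  · exact h.inj (mul_left_cancel₀ (Complex.exp_ne_zero _) hij)
  · have := h.lt i hi j hj
    rw [← hij, norm_mul, norm_exp_turn, one_mul] at this
    exact absurd this (lt_irrefl _)
  · have := h.lt j hj i hi
    rw [hij, norm_mul, norm_exp_turn, one_mul] at this
    exact absurd this (lt_irrefl _)
  · exact h.inj hij

theorem LapData.flat (h : LapData A X) {c u : ℝ} (hc : 0 < c) (hc1 : c ≤ 1) (hu : 0 ≤ u)
    (hu1 : u ≤ 1) : LapData A (flat A X c u) := by
  have hre : ∀ i ∈ A, (Braid.flat A X c u i).re = (1 - u + u * c) * (X i).re := fun i hi => by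
    simp only [Braid.flat, hi, if_true, Complex.add_re, Complex.re_ofReal_mul, Complex.ofReal_re]
    ring
  have hpos : 0 < 1 - u + u * c := by
    rcases hu1.lt_or_eq with h | rfl
    · nlinarith
    · linarith
  have hout : ∀ j ∉ A, Braid.flat A X c u j = X j := fun j hj => by simp [Braid.flat, hj]
  have hle : ∀ i ∈ A, ‖Braid.flat A X c u i‖ ≤ ‖X i‖ := fun i hi => by
    simp only [Braid.flat, hi, if_true]
    refine (norm_add_le _ _).trans ?_
    rw [norm_mul, Complex.norm_real, Complex.norm_real, Real.norm_eq_abs, Real.norm_eq_abs,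
      abs_mul, abs_of_nonneg (by linarith), abs_of_nonneg (by positivity)]
    have h1 := Complex.abs_re_le_norm (X i)
    have h2 : u * c * |(X i).re| ≤ u * ‖X i‖ := by
      refine mul_le_mul ?_ h1 (abs_nonneg _) hu
      nlinarith
    nlinarith
  have hlt : ∀ i ∈ A, ∀ j ∉ A, ‖Braid.flat A X c u i‖ < ‖Braid.flat A X c u j‖ := fun i hi j hj =>
    (hle i hi).trans_lt ((h.lt i hi j hj).trans_eq (by rw [hout j hj]))
  have hne : ∀ i ∈ A, ∀ j ∈ A, (Braid.flat A X c u i).re = (Braid.flat A X c u j).re → i = j :=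
    fun i hi j hj hij => by
      rw [hre i hi, hre j hj] at hij
      exact h.ne i hi j hj (mul_left_cancel₀ hpos.ne' hij)
  refine ⟨fun i j hij => ?_, hne, fun j hj => by rw [hout j hj]; exact h.re_ne j hj, hlt⟩
  by_cases hi : i ∈ A <;> by_cases hj : j ∈ A
  · exact hne i hi j hj (by rw [hij])
  · exact absurd (hlt i hi j hj) (by rw [hij]; exact lt_irrefl _)
  · exact absurd (hlt j hj i hi) (by rw [hij]; exact lt_irrefl _)
  · rw [hout i hi, hout j hj] at hij
    exact h.inj hij

theorem LapData.exists_shrink (h : LapData A X) :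
    ∃ c : ℝ, 0 < c ∧ c ≤ 1 ∧ SpinData A (fun i => c * (X i).re) X := by
  have h1 : ∀ᶠ c : ℝ in 𝓝 0, ∀ i ∈ A, ∀ j, j ∉ A → |c * (X i).re| < |(X j).re| := by
    refine (Filter.eventually_all_finset A).2 fun i _ => Filter.eventually_all.2 fun j => ?_
    by_cases hj : j ∈ A
    · simp [hj]
    · have : ContinuousAt (fun c : ℝ => |c * (X i).re|) 0 := by fun_prop
      filter_upwards [this.eventually_lt continuousAt_const
        (by simpa using h.re_ne j hj : |(0:ℝ) * (X i).re| < |(X j).re|)] with c hc _ using hc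
  have h2 : ∀ᶠ c : ℝ in 𝓝[>] 0, ∀ i ∈ A, ∀ j, j ∉ A → |c * (X i).re| < |(X j).re| :=
    h1.filter_mono nhdsWithin_le_nhds
  obtain ⟨c, hc, hc'⟩ := (h2.and (Ioc_mem_nhdsGT (zero_lt_one (α := ℝ)))).exists
  exact ⟨c, hc'.1, hc'.2, h.inj, fun i hi j hj hij => h.ne i hi j hj
    (mul_left_cancel₀ hc'.1.ne' hij), hc⟩

theorem continuous_lap_flat (A : Finset ι) (X : ι → ℂ) (c : ℝ) :
    Continuous fun p : ℝ × ℝ => lap A (flat A X c p.1) p.2 := by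
  refine continuous_pi fun i => ?_
  by_cases hi : i ∈ A
  · simp only [lap, flat, hi, if_true]; fun_prop
  · simp only [lap, flat, hi, if_false]; fun_prop

/-- The monodromy of a lap is conjugate to that of a full twist. -/
theorem LapData.monodromy (h : LapData A X) {F : ℝ → GL ι ℂ}
    (hF : IsTransport τ (Set.Icc 0 1) (lap A X) F) :
    ∃ (y : ι → ℝ) (P : GL ι ℂ), SpinData A y X ∧
      (∀ v, ∑ i, act P v i = ∑ i, v i) ∧
      (∀ ε, Compat τ ε → ∀ v w, form ε (spin A y X 0) (act P v) (act P w) = form ε X v w) ∧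
      (∀ v, IsRel A (act P (act (F 1 * (F 0)⁻¹) v - v))) ∧
      ∀ v, IsRel A (act P v) → act (F 1 * (F 0)⁻¹) v = ((τ : ℂ) ^ A.card)⁻¹ • v := by
  obtain ⟨c, hc, hc1, hS⟩ := h.exists_shrink
  set y : ι → ℝ := fun i => c * (X i).re with hy
  set R : Set (ℝ × ℝ) := Set.Icc 0 1 ×ˢ Set.Icc 0 1 with hR
  obtain ⟨G, hG⟩ := exists_transport (R := ℂ) τ (isCompact_Icc.prod isCompact_Icc : IsCompact R)
    ((convex_Icc 0 1).prod (convex_Icc 0 1)) (continuous_lap_flat A X c).continuousOn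
    fun p hp => (h.flat hc hc1 hp.1.1 hp.1.2).lap_injective p.2
  have m0 : (0:ℝ) ∈ Set.Icc (0:ℝ) 1 := by simp
  have m1 : (1:ℝ) ∈ Set.Icc (0:ℝ) 1 := by simp
  have e0 : IsTransport τ (Set.Icc 0 1) (lap A X) fun t => G (0, t) :=
    (hG.comp (p := fun t : ℝ => ((0:ℝ), t)) (by fun_prop) fun t ht => ⟨m0, ht⟩).congr fun t _ =>
      lap_flat_zero A X c t
  have e1 : IsTransport τ (Set.Icc 0 1) (spin A y X) fun t => G (1, t) :=
    (hG.comp (p := fun t : ℝ => ((1:ℝ), t)) (by fun_prop) fun t ht => ⟨m1, ht⟩).congr fun t _ =>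
      lap_flat_one A X c t
  have b0 : IsTransport τ (Set.Icc 0 1) (fun u => Braid.flat A X c u) fun u => G (u, 0) :=
    (hG.comp (p := fun u : ℝ => (u, (0:ℝ))) (by fun_prop) fun u hu => ⟨hu, m0⟩).congr fun u _ =>
      lap_zero A _
  have b1 : IsTransport τ (Set.Icc 0 1) (fun u => Braid.flat A X c u) fun u => G (u, 1) :=
    (hG.comp (p := fun u : ℝ => (u, (1:ℝ))) (by fun_prop) fun u hu => ⟨hu, m1⟩).congr fun u _ =>
      lap_one A _
  have hinj : ∀ u ∈ Set.Icc (0:ℝ) 1, Function.Injective (Braid.flat A X c u) := fun u hu =>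
    (h.flat hc hc1 hu.1 hu.2).inj
  have hM := hF.unique isPreconnected_Icc e0 m0 m1
  have hP := b0.unique isPreconnected_Icc b1 m0 m1
  obtain ⟨P, hPdef⟩ : ∃ P, P = G (1, 0) * (G (0, 0))⁻¹ := ⟨_, rfl⟩
  rw [← hPdef] at hP
  have hconj : F 1 * (F 0)⁻¹ = P⁻¹ * (G (1, 1) * (G (1, 0))⁻¹) * P := by
    have h11 : G (1, 1) = P * G (0, 1) := by rw [hP, inv_mul_cancel_right]
    rw [hM, h11, hPdef]
    group
  have f0 : Braid.flat A X c 0 = X := by rw [← lap_zero A (Braid.flat A X c 0), lap_flat_zero, lap_zero]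
  have f1 : Braid.flat A X c 1 = spin A y X 0 := by
    rw [← lap_flat_one, lap_zero]
  have hact : ∀ v, act P (act (F 1 * (F 0)⁻¹) v) = act (G (1, 1) * (G (1, 0))⁻¹) (act P v) :=
    fun v => by
    rw [hconj, act_mul P, act_mul _ P⁻¹, act_act_inv]
  refine ⟨y, P, hS, fun v => hPdef ▸ ?_, fun ε hε v w => ?_, fun v => ?_, fun v hv => ?_⟩
  · exact b0.sum isPreconnected_Icc hinj m0 m1 v
  · have := b0.form hε isPreconnected_Icc hinj m0 m1 v w
    rw [f0, f1] at this
    rw [hPdef]; exact this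
  · rw [act_sub, hact]
    exact (hS.act_full_twist e1 _).1
  · rw [← act_inv_act P (act _ v), hact, (hS.act_full_twist e1 _).2 hv, act_smul, act_inv_act]

theorem sum_restrict {v : ι → ℂ} (hv : ∀ i ∉ A, v i = 0) : ∑ i, v i = ∑ i : A, v i := by
  rw [Finset.sum_coe_sort A v]
  exact (Finset.sum_subset (Finset.subset_univ A) fun i _ hi => hv i hi).symm

theorem form_restrict {ε : ℝ} {Z v w : ι → ℂ} (hv : ∀ i ∉ A, v i = 0) (hw : ∀ i ∉ A, w i = 0) :
    form ε Z v w = form ε (fun i : A => Z i) (fun i : A => v i) fun i : A => w i := by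
  rw [form, form, sum_restrict (A := A) fun i hi => by rw [hw i hi, mul_zero],
    sum_restrict (A := A) fun i hi => Finset.sum_eq_zero fun k _ => by rw [hv i hi]; simp,
    Finset.sum_congr rfl fun i _ => sum_restrict (A := A) fun k hk => by rw [hw k hk]; simp]

theorem form_synth_neg {Q : ℕ} {κ ε : ℝ} (hL : Level Q (Fintype.card ι) κ ε)
    (hX : Function.Injective X) {c : Fin Q → ℂ} (hc : c ≠ 0) :
    (form ε X (synth Q X c) (synth Q X c)).re < 0 := by
  obtain ⟨l, hl⟩ := Function.ne_iff.1 hc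
  have hn := hL.large
  have hQ : Q < Fintype.card ι := by omega
  have h1 := card_mul_form_re (ε := ε) hX (sum_synth (Q := Q) hX hQ c)
  have h2 : ∑ l ∈ Finset.Ico 1 (Fintype.card ι),
      lam ε (Fintype.card ι) l * ‖ip (mode l X) (synth Q X c)‖ ^ 2 < 0 := by
    have hneg : ∀ m, 1 ≤ m → m ≤ Q → lam ε (Fintype.card ι) m < 0 := fun m h1 h2 =>
      (hL.lam_le h1 h2).trans_lt (neg_neg_of_pos (by have := hL.one_le; positivity))
    refine Finset.sum_neg' (fun m hm => ?_) ⟨l + 1, ?_, ?_⟩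
    · rw [Finset.mem_Ico] at hm
      by_cases hmQ : m ≤ Q
      · exact mul_nonpos_of_nonpos_of_nonneg (hneg m hm.1 hmQ).le (by positivity)
      · rw [ip_mode_synth_of_lt hX hQ hm.2 (by omega)]; simp
    · simp only [Finset.mem_Ico]; omega
    · refine mul_neg_of_neg_of_pos (hneg _ (by omega) (by omega)) (pow_pos (norm_pos_iff.2 ?_) 2)
      rw [ip_mode_synth hX hQ (by omega), Finset.sum_eq_single l]
      · rw [if_pos rfl]
        exact mul_ne_zero (Nat.cast_ne_zero.2 (by omega)) hl
      · intro b _ hb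
        rw [if_neg]
        intro he; exact hb (Fin.ext (by omega))
      · simp
  rw [← h1] at h2
  exact (pos_iff_neg_of_mul_neg h2).1 hL.n_pos

/-- A vector with one slowly varying mode removed has nonnegative form at level one. -/
theorem form_nonneg_of_orthogonal {κ ε : ℝ} (hL : Level 1 (Fintype.card ι) κ ε)
    (hX : Function.Injective X) {v : ι → ℂ} (hv : ∑ i, v i = 0)
    (h : form ε X (mode 1 X) v = 0) : 0 ≤ (form ε X v v).re := by
  have hn := hL.large
  have h1 := card_mul_form_re (ε := ε) hX hv
  have h0 : ip (mode 1 X) v = 0 := by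
    rw [← conj_form, form_mode hX one_pos (by omega) hv, map_mul, conj_ip, Complex.conj_ofReal,
      mul_eq_zero] at h
    refine h.resolve_left fun h' => ?_
    have := hL.lam_le le_rfl le_rfl
    rw [Complex.ofReal_eq_zero] at h'
    rw [h'] at this
    norm_num at this
  have h2 : 0 ≤ ∑ l ∈ Finset.Ico 1 (Fintype.card ι),
      lam ε (Fintype.card ι) l * ‖ip (mode l X) v‖ ^ 2 := by
    refine Finset.sum_nonneg fun m hm => ?_
    rw [Finset.mem_Ico] at hm
    rcases hm.1.eq_or_lt with rfl | h3
    · rw [h0]; simp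
    · exact mul_nonneg (le_trans (by norm_num) (hL.le_lam h3 hm.2)) (by positivity)
  rw [← h1] at h2
  exact nonneg_of_mul_nonneg_right h2 hL.n_pos

theorem LapData.exists_frame (h : LapData A X) {Q : ℕ} {κ κ' ε : ℝ}
    (hL : Level Q (Fintype.card ι) κ ε) (hA : Level 1 A.card κ' ε) (hτ : Compat τ ε)
    (hlm : (τ : ℂ) ^ A.card ≠ 1) {F : ℝ → GL ι ℂ}
    (hF : IsTransport τ (Set.Icc 0 1) (lap A X) F) :
    ∃ (Y : (Fin Q → ℂ) →ₗ[ℂ] (ι → ℂ)) (D : (Fin Q → ℂ) →ₗ[ℂ] (Fin Q → ℂ)),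
      Function.Injective Y ∧ (∀ c, Neg ε X (Y c)) ∧
      (∀ c, act (F 1 * (F 0)⁻¹) (Y c) = Y (D c)) ∧
      LinearMap.det D = ((τ : ℂ) ^ A.card)⁻¹ := by
  obtain ⟨y, P, hS, hPs, hPf, hM1, hM2⟩ := h.monodromy hF
  have m0 : (0:ℝ) ∈ Set.Icc (0:ℝ) 1 := by simp
  have m1 : (1:ℝ) ∈ Set.Icc (0:ℝ) 1 := by simp
  have hinj : ∀ t ∈ Set.Icc (0:ℝ) 1, Function.Injective (lap A X t) := fun t _ => h.lap_injective t
  have hform := fun v w => hF.form hτ isPreconnected_Icc hinj m0 m1 v w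
  have hsum := fun v => hF.sum isPreconnected_Icc hinj m0 m1 v
  rw [lap_zero, lap_one] at hform
  set M := F 1 * (F 0)⁻¹
  have hQ : Q < Fintype.card ι := by have := hL.large; omega
  have hA' : Level 1 (Fintype.card A) κ' ε := by simpa using hA
  set Z : A → ℂ := fun i => spin A y X 0 i with hZ
  have hZi : Function.Injective Z := (hS.injective 0).comp Subtype.val_injective
  have hcA : 1 < Fintype.card A := by have := hA'.large; omega
  set u : ι → ℂ := fun i => if hi : i ∈ A then mode 1 Z ⟨i, hi⟩ else 0 with hu
  have hu0 : ∀ i ∉ A, u i = 0 := fun i hi => by simp [hu, hi]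
  have huA : (fun i : A => u i) = mode 1 Z := by ext i; simp [hu]
  have husum : ∑ i, u i = 0 := by
    rw [sum_restrict hu0, ← sum_mode hZi one_pos hcA]
    exact Finset.sum_congr rfl fun i _ => congrFun huA i
  have huneg : (form ε Z (mode 1 Z) (mode 1 Z)).re < 0 := by
    have h1 := form_synth_neg hA' hZi (c := fun _ => 1) (fun h => by simpa using congrFun h 0)
    simpa [synth_apply] using h1
  obtain ⟨Y, D, h1, h2, h3, h4⟩ := exists_adapted_frame (B := form ε X)
    (S := LinearMap.ker (∑ i : ι, LinearMap.proj (R := ℂ) (φ := fun _ : ι => ℂ) i))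
    (M := actL M) (lm := ((τ : ℂ) ^ A.card)⁻¹) (k := act P⁻¹ u) (L := low Q X) (W := synth Q X)
    form_add_right form_smul_right conj_form hform (by simpa using hlm)
    (fun v => hM2 _ (hM1 v)) (fun v hv => by
      simp only [LinearMap.mem_ker, LinearMap.sum_apply, LinearMap.proj_apply] at hv ⊢
      exact (hsum v).trans hv)
    (fun v hv hn h0 => Neg.eq_zero hL h.inj ⟨by simpa using hv, hn⟩ h0)
    (fun c => by simpa using sum_synth (Q := Q) h.inj hQ c) (low_synth h.inj hQ)
    (fun c hc => form_synth_neg hL h.inj hc)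
    (by
      have := hPs (act P⁻¹ u)
      rw [act_act_inv, husum] at this
      simpa using this.symm)
    (by
      rw [← hPf ε hτ, act_act_inv, form_restrict hu0 hu0, huA]
      exact huneg)
    (hM2 _ (by rw [act_act_inv]; exact ⟨hu0, husum⟩))
    (by
      rintro v ⟨w, rfl⟩ - hk
      have hr := hM1 w
      rw [← hPf ε hτ, act_act_inv] at hk
      rw [← hPf ε hτ]
      change form ε _ u (act P (act M w - w)) = 0 at hk
      change 0 ≤ (form ε _ (act P (act M w - w)) (act P (act M w - w))).re
      rw [form_restrict hu0 hr.1, huA] at hk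
      rw [form_restrict hr.1 hr.1]
      exact form_nonneg_of_orthogonal hA' hZi ((sum_restrict hr.1).symm.trans hr.2) hk)
  exact ⟨Y, D, h1, fun c => ⟨by simpa using (h2 c).1, (h2 c).2⟩, h3, h4⟩

end Lap

section LapTurn

/-- A continuous function which stays close to integers stays close to the same integer. -/
theorem eq_of_continuousOn_near {f : ℝ → ℝ} {z : ℝ → ℤ} {a b : ℝ} (hab : a ≤ b)
    (hf : ContinuousOn f (Set.Icc a b)) (h : ∀ x ∈ Set.Icc a b, |f x - z x| < 1 / 4) :
    z a = z b := by
  have key : ∀ {g : ℝ → ℝ} {w : ℝ → ℤ}, ContinuousOn g (Set.Icc a b) →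
      (∀ x ∈ Set.Icc a b, |g x - w x| < 1 / 4) → ¬ w a < w b := by
    intro g w hg hw hlt
    have ha := abs_lt.1 (hw a (Set.left_mem_Icc.2 hab))
    have hb := abs_lt.1 (hw b (Set.right_mem_Icc.2 hab))
    have hlt' : (w a : ℝ) + 1 ≤ w b := by exact_mod_cast hlt
    obtain ⟨c, hc, hgc⟩ := intermediate_value_Icc hab hg
      (show (w a : ℝ) + 1 / 2 ∈ Set.Icc (g a) (g b) from ⟨by linarith, by linarith⟩)
    have h1 := abs_lt.1 (hw c hc)
    rw [hgc] at h1
    have h2 : (w c : ℝ) < w a + 1 := by linarith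
    have h3 : (w a : ℝ) < w c + 1 := by linarith
    have h4 : w c = w a := by
      have h2' : w c < w a + 1 := by exact_mod_cast h2
      have h3' : w a < w c + 1 := by exact_mod_cast h3
      omega
    rw [h4] at h1
    linarith
  refine le_antisymm (not_lt.1 ?_) (not_lt.1 (key hf h))
  have h2 := key (g := fun x => -f x) (w := fun x => -z x) hf.neg fun x hx => by
    rw [← abs_neg]; convert h x hx using 2; push_cast; ring
  simpa using h2

/-- Potentials are lifts of the argument. -/
theorem Coarse.IsPot.coe_sub {V : Type*} [AddCommGroup V] [Module ℂ V] {Q : ℕ}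
    {E : Type*} [NormedAddCommGroup E] [NormedSpace ℝ E] {K : Set E}
    {C : Coarse V Q K} {Y : (Fin Q → ℂ) →ₗ[ℂ] V} {P : E → ℝ} (hY : C.IsFrame Y)
    (h : C.IsPot K Y P) (hc : Convex ℝ K) {k k' : E} (hk : k ∈ K) (hk' : k' ∈ K) :
    ((P k' - P k : ℝ) : Real.Angle) = ((C.det Y k' / C.det Y k).arg : Real.Angle) := by
  obtain ⟨M, hM⟩ := exists_nat_gt (dist k k' / C.δ)
  have hM0 : (0:ℝ) < M := lt_of_le_of_lt (div_nonneg dist_nonneg C.δ_pos.le) hM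
  have hM' : 0 < M := by exact_mod_cast hM0
  have hmem : ∀ s ∈ Set.Icc (0:ℝ) 1, k + s • (k' - k) ∈ K :=
    fun s hs => hc.add_smul_sub_mem hk hk' hs
  have := IsPot.sub_eq_sum hY h (p := fun s : ℝ => k + s • (k' - k)) (by fun_prop) hmem hM'
    (fun s hs t ht hst => by
      refine C.near_of_dist _ (hmem s hs) _ (hmem t ht) ?_
      rw [dist_add_left, dist_eq_norm, ← sub_smul, norm_smul, Real.norm_eq_abs, ← dist_eq_norm,
        dist_comm]
      rw [div_lt_iff₀ C.δ_pos] at hM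
      calc |s - t| * dist k k' ≤ 1 / M * dist k k' := by gcongr
        _ < C.δ := by rw [one_div, inv_mul_lt_iff₀ hM0]; exact hM)
  simp only [one_smul, zero_smul, add_zero, add_sub_cancel] at this
  rw [this]
  have hne : ∀ i ≤ M, C.det Y (k + ((i : ℝ) / M) • (k' - k)) ≠ 0 := fun i hi =>
    hY.det_ne (hmem _ ⟨by positivity, (div_le_one hM0).2 (by exact_mod_cast hi)⟩)
  have key : ∀ j ≤ M, ((∑ i ∈ Finset.range j, C.ang Y (k + ((i : ℝ) / M) • (k' - k))
      (k + (((i + 1 : ℕ) : ℝ) / M) • (k' - k)) : ℝ) : Real.Angle) =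
      ((C.det Y (k + ((j : ℝ) / M) • (k' - k)) / C.det Y k).arg : Real.Angle) := by
    intro j
    induction j with
    | zero => intro _; simp [div_self (hY.det_ne hk)]
    | succ j ih =>
      intro hj
      rw [Finset.sum_range_succ, Real.Angle.coe_add, ih (by omega), ang, add_comm,
        ← Complex.arg_mul_coe_angle (div_ne_zero (hne _ hj) (hne j (by omega)))
          (div_ne_zero (hne j (by omega)) (hY.det_ne hk)), div_mul_div_cancel₀ (hne j (by omega))]
  have h1 := key M le_rfl
  rw [div_self hM0.ne', one_smul, add_sub_cancel] at h1
  exact h1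

variable {ι : Type*} [Fintype ι] [DecidableEq ι]

theorem level_block {n a : ℕ} {κ : ℝ} (hn : 0 < n) (ha : 8 ≤ a) (h1 : 5 / 4 ≤ κ * a / n)
    (h2 : κ * a / n ≤ 7 / 4) : Level 1 a (κ * a / n) (epsOf κ n) := by
  refine ⟨le_rfl, by push_cast; linarith, by push_cast; linarith, by omega, ?_⟩
  have : (a : ℝ) ≠ 0 := by positivity
  rw [epsOf]
  congr 2
  field_simp

theorem tauOf_pow_ne_one {n a : ℕ} {κ : ℝ} (h1 : 5 / 4 ≤ κ * a / n)
    (h2 : κ * a / n ≤ 7 / 4) : ((tauOf κ n : ℂˣ) : ℂ) ^ a ≠ 1 := by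
  intro h
  rw [tauOf, Units.val_mk0, ← Complex.exp_nat_mul, Complex.exp_eq_one_iff] at h
  obtain ⟨z, hz⟩ := h
  have hI : (κ * a / n : ℝ) = z := by
    have h3 : (2 * Real.pi * Complex.I) * ((κ * a / n : ℝ) : ℂ) = (2 * Real.pi * Complex.I) * z := by
      rw [mul_comm _ (z : ℂ), ← hz]; push_cast; ring
    have := mul_left_cancel₀ Complex.two_pi_I_ne_zero h3
    exact_mod_cast this
  rw [hI] at h1 h2
  have h3 : (1:ℝ) < z := by linarith
  have h4 : (z:ℝ) < 2 := by linarith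
  have h3' : 1 < z := by exact_mod_cast h3
  have h4' : z < 2 := by exact_mod_cast h4
  omega

variable {Q : ℕ} {κ r : ℝ} {Φ : ℝ → ℂ ≃ₜ ℂ} {X : ι → ℂ} {F : ℝ → GL ι ℂ} {A : Finset ι} {m : ℕ}

/-- Laps of a block turn, on the average, by an angle determined by the number of its points. -/
theorem Setup.exists_lap (S : Setup Q κ (Set.Icc 0 (m : ℝ)) Φ X r F) (hm : 0 < m)
    (h : LapData A X) (hΦ : ∀ t ∈ Set.Icc 0 (m : ℝ), (fun i => Φ t (X i)) = lap A X t)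
    (hA : 8 ≤ A.card) (h1 : 5 / 4 ≤ κ * A.card / Fintype.card ι)
    (h2 : κ * A.card / Fintype.card ι ≤ 7 / 4) {L : ℕ} (hL : 0 < L) (hLr : m < r * L) :
    ∃ z : ℤ, |turn Q κ L (seg Φ X 0 m) -
      m * (-(2 * Real.pi * (κ * A.card / Fintype.card ι)) + 2 * Real.pi * z)| ≤ Q * Real.pi := by
  set K := Set.Icc 0 (m : ℝ) with hKdef
  have hm1 : (1:ℝ) ≤ m := by exact_mod_cast hm
  have k0 : (0:ℝ) ∈ K := ⟨le_rfl, by positivity⟩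
  have kj : ∀ j ≤ m, (j:ℝ) ∈ K := fun j hj => ⟨by positivity, by exact_mod_cast hj⟩
  have hsub : Set.Icc (0:ℝ) 1 ⊆ K := Set.Icc_subset_Icc le_rfl hm1
  have hn : 0 < Fintype.card ι := by have := S.level.large; omega
  have htr : IsTransport (tauOf κ (Fintype.card ι)) K (lap A X) F := S.transport.congr hΦ
  obtain ⟨Y, D, hYi, hYn, hYD, hD⟩ := h.exists_frame S.level
    (level_block hn hA h1 h2) (compat_of_level S.level)
    (tauOf_pow_ne_one h1 h2) (htr.mono hsub)
  set lm := ((tauOf κ (Fintype.card ι) : ℂ) ^ A.card)⁻¹ with hlm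
  have hD0 : LinearMap.det D ≠ 0 := by rw [hD, hlm]; simp
  set C := S.coarse 0 k0 with hC
  have hX0 : (fun i => Φ 0 (X i)) = X := by rw [hΦ 0 k0, lap_zero]
  have hact : ∀ T : GL ι ℂ, Function.Injective (act T) := fun T v w hvw => by
    rw [← act_inv_act T v, hvw, act_inv_act]
  have hY : C.IsFrame (actL (F 0)⁻¹ ∘ₗ Y) := by
    refine ⟨(hact _).comp hYi, fun c => ?_⟩
    change Neg _ (fun i => Φ 0 (X i)) (act (F 0) (act (F 0)⁻¹ (Y c)))
    rw [act_act_inv, hX0]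
    exact hYn c
  set Y' := actL (F 0)⁻¹ ∘ₗ Y with hY'
  have hper : ∀ t ∈ Set.Icc (0:ℝ) (m - 1), F (t + 1) = F t * ((F 0)⁻¹ * F 1) := by
    intro t ht
    have hmap : Set.MapsTo (fun t : ℝ => t + 1) (Set.Icc 0 ((m : ℝ) - 1)) K := fun t ht =>
      ⟨by linarith [ht.1], by linarith [ht.2]⟩
    have e1 := htr.comp (K' := Set.Icc 0 ((m : ℝ) - 1)) (p := fun t : ℝ => t + 1) (by fun_prop) hmap
    have e2 := e1.congr (X' := lap A X) fun t _ => lap_add_one A X t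
    have e3 := e2.unique isPreconnected_Icc
      (htr.mono (Set.Icc_subset_Icc le_rfl (by linarith)))
      (k := 0) (Set.left_mem_Icc.2 (by linarith)) ht
    rw [zero_add, mul_inv_eq_iff_eq_mul] at e3
    rw [e3, mul_assoc]
  have hdet : ∀ t ∈ Set.Icc (0:ℝ) (m - 1), C.det Y' (t + 1) = C.det Y' t * lm := by
    intro t ht
    have ht' : t ∈ K := ⟨ht.1, by linarith [ht.2]⟩
    have ht1 : t + 1 ∈ K := ⟨by linarith [ht.1], by linarith [ht.2]⟩
    rw [← hD, Coarse.det, Coarse.det, ← LinearMap.det_comp]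
    congr 1
    refine LinearMap.ext fun c => ?_
    change low Q (fun i => Φ (t + 1) (X i)) (act (F (t + 1)) (act (F 0)⁻¹ (Y c))) =
      low Q (fun i => Φ t (X i)) (act (F t) (act (F 0)⁻¹ (Y (D c))))
    rw [hΦ t ht', hΦ _ ht1, lap_add_one, ← hYD, ← act_mul, ← act_mul, ← act_mul, hper t ht]
    rw [show F t * ((F 0)⁻¹ * F 1) * (F 0)⁻¹ = F t * (F 0)⁻¹ * (F 1 * (F 0)⁻¹) by group]
  obtain ⟨P, hP⟩ := hY.exists_pot isCompact_Icc (convex_Icc _ _)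
  have hstep : ∀ t ∈ Set.Icc (0:ℝ) (m - 1), P (t + 1) - P t = P 1 - P 0 := by
    intro t ht
    have hs : Set.Icc (0:ℝ) (m - 1) ⊆ K := Set.Icc_subset_Icc le_rfl (by linarith)
    have hP1 : C.IsPot (Set.Icc (0:ℝ) (m - 1)) Y' fun t => P (t + 1) := by
      intro k hk
      have hmap : Set.MapsTo (fun t : ℝ => t + 1) (Set.Icc 0 ((m : ℝ) - 1)) K := fun t ht =>
        ⟨by linarith [ht.1], by linarith [ht.2]⟩
      have hcont : ContinuousWithinAt (fun t : ℝ => t + 1) (Set.Icc 0 ((m : ℝ) - 1)) k := by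
        fun_prop
      filter_upwards [(hcont.tendsto_nhdsWithin hmap).eventually (hP _ (hmap hk)),
        self_mem_nhdsWithin] with x hx hxm
      rw [hx, Coarse.ang, Coarse.ang, hdet x hxm, hdet k hk, mul_div_mul_right]
      rw [← hD]; exact hD0
    have := hP1.sub_eq isPreconnected_Icc (hP.mono hs) (k := 0)
      (Set.left_mem_Icc.2 (by linarith)) ht
    rw [zero_add] at this
    linarith
  have hmul : ∀ j ≤ m, P (j : ℝ) - P 0 = j * (P 1 - P 0) := by
    intro j
    induction j with
    | zero => intro _; simp
    | succ j ih =>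
      intro hj
      have hj' : (j:ℝ) + 1 ≤ m := by exact_mod_cast hj
      have := hstep j ⟨by positivity, by linarith⟩
      have h3 := ih (by omega)
      push_cast
      linarith
  have hcoe := hP.coe_sub hY S.convex k0 (hsub (Set.right_mem_Icc.2 zero_le_one))
  have hd1 := hdet 0 (Set.left_mem_Icc.2 (by linarith))
  rw [zero_add] at hd1
  rw [hd1, mul_div_cancel_left₀ _ (hY.det_ne k0)] at hcoe
  have hlm' : lm = Complex.exp ((-(2 * Real.pi * (κ * A.card / Fintype.card ι)) : ℝ) * Complex.I) := by
    rw [hlm, tauOf, Units.val_mk0, ← Complex.exp_nat_mul, ← Complex.exp_neg]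
    congr 1
    push_cast
    ring
  rw [hlm', Complex.arg_exp_mul_I, Real.Angle.coe_toIocMod] at hcoe
  obtain ⟨z, hz⟩ := Real.Angle.angle_eq_iff_two_pi_dvd_sub.1 hcoe
  refine ⟨z, ?_⟩
  obtain ⟨P', hP'⟩ := (Coarse.W_frame (C := C) k0).exists_pot isCompact_Icc (convex_Icc _ _)
  rw [S.turn_seg (k₀ := 0) (hk₀ := k0) k0 (kj m le_rfl) hL (by
    rw [Real.dist_eq, zero_sub, abs_neg, Nat.abs_cast]; exact hLr) hP']
  have h5 := Coarse.abs_pot_sub_le S.convex.isPreconnected k0 hY hP hP' k0 (kj m le_rfl)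
  rw [hmul m le_rfl, show P 1 - P 0 = -(2 * Real.pi * (κ * A.card / Fintype.card ι)) +
    2 * Real.pi * z by linarith] at h5
  rwa [abs_sub_comm]

theorem continuous_seg {E : Type*} [NormedAddCommGroup E] [NormedSpace ℝ E] {Φ : E → ℂ ≃ₜ ℂ}
    (hΦ : IsFam Φ) (X : ι → ℂ) (k k' : E) : Continuous (seg Φ X k k') :=
  continuous_pi fun i => hΦ.cont.comp (f := fun s : ℝ => (k + s • (k' - k), X i)) (by fun_prop)

theorem dturn_lap (hQ : 1 ≤ Q) (hN : 4 * (Q + 1) ≤ Fintype.card ι) (hfam : IsFam Φ)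
    (h : LapData A X) (hΦ : ∀ t ∈ Set.Icc 0 (m : ℝ), (fun i => Φ t (X i)) = lap A X t)
    (hG : GoodFor Q (Set.Icc 0 (m : ℝ)) (fun k => Φ k) X) (hr : 0 < r)
    (hn : ∀ k ∈ Set.Icc 0 (m : ℝ), ∀ k' ∈ Set.Icc 0 (m : ℝ), dist k k' < r → Close (tol Q) Φ k k')
    (hA : 8 ≤ A.card) (h1 : 5 * Fintype.card ι ≤ (4 * Q + 1) * A.card)
    (h2 : (4 * Q + 3) * A.card ≤ 7 * Fintype.card ι) (hm : 2 * Q < m) {L : ℕ} (hL : 0 < L)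
    (hLr : m < r * L) :
    |dturn Q L (seg Φ X 0 m) + m * (Real.pi * (A.card / Fintype.card ι))| ≤ 2 * Q * Real.pi := by
  have hc0 : (0:ℝ) < Fintype.card ι := by
    have : 0 < Fintype.card ι := by omega
    exact_mod_cast this
  have h1' : (5:ℝ) * Fintype.card ι ≤ (4 * Q + 1) * A.card := by exact_mod_cast h1
  have h2' : (4 * Q + 3) * (A.card : ℝ) ≤ 7 * Fintype.card ι := by exact_mod_cast h2
  have hA0 : (0:ℝ) ≤ A.card := Nat.cast_nonneg _
  have hm0 : 0 < m := by omega
  have hmR : (2 * Q : ℝ) < m := by exact_mod_cast hm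
  have hmem : (m : ℝ) ∈ Set.Icc 0 (m : ℝ) := ⟨by positivity, le_rfl⟩
  have hmem0 : (0 : ℝ) ∈ Set.Icc 0 (m : ℝ) := ⟨le_rfl, by positivity⟩
  have hS : ∀ κ ∈ Set.Icc (Q + 1 / 4 : ℝ) (Q + 3 / 4), ∃ F, Setup Q κ (Set.Icc 0 (m : ℝ)) Φ X r F :=
    fun κ hκ => exists_setup hQ hκ.1 hκ.2 hN isCompact_Icc (convex_Icc _ _) hfam h.inj hG hr hn
  have hz : ∀ κ : ℝ, ∃ z : ℤ, κ ∈ Set.Icc (Q + 1 / 4 : ℝ) (Q + 3 / 4) →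
      |turn Q κ L (seg Φ X 0 m) - m * (-(2 * Real.pi * (κ * A.card / Fintype.card ι)) +
        2 * Real.pi * z)| ≤ Q * Real.pi := by
    intro κ
    by_cases hκ : κ ∈ Set.Icc (Q + 1 / 4 : ℝ) (Q + 3 / 4)
    · obtain ⟨F, S⟩ := hS κ hκ
      obtain ⟨z, hz⟩ := S.exists_lap hm0 h hΦ hA
        (by rw [le_div_iff₀ hc0]; nlinarith [hκ.1]) (by rw [div_le_iff₀ hc0]; nlinarith [hκ.2])
        hL hLr
      exact ⟨z, fun _ => hz⟩
    · exact ⟨0, fun h => absurd h hκ⟩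
  choose z hz using hz
  have hle : (Q + 1 / 4 : ℝ) ≤ Q + 3 / 4 := by linarith
  have hpi := Real.pi_pos
  have hzz : z (Q + 1 / 4) = z (Q + 3 / 4) := by
    refine eq_of_continuousOn_near hle (f := fun κ => (turn Q κ L (seg Φ X 0 m) +
      m * (2 * Real.pi * (κ * A.card / Fintype.card ι))) / (2 * Real.pi * m)) ?_ ?_
    · refine ContinuousOn.div_const (ContinuousOn.add (fun κ hκ => ?_) (by fun_prop)) _
      obtain ⟨F, S⟩ := hS κ hκ
      refine (continuousAt_turn (continuous_seg hfam X 0 m).continuousOn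
        (fun t _ => (Φ _).injective.comp h.inj) fun i hi => ?_).continuousWithinAt
      refine S.re_pos hmem0 hmem ?_ hi
      rw [Real.dist_eq, zero_sub, abs_neg, Nat.abs_cast]
      exact hLr
    · intro κ hκ
      have h3 := hz κ hκ
      have hpos : 0 < 2 * Real.pi * m := by positivity
      rw [show ∀ a b c : ℝ, (a + b) / (2 * Real.pi * m) - c =
        (a + b - 2 * Real.pi * m * c) / (2 * Real.pi * m) from fun a b c => by field_simp,
        abs_div, abs_of_pos hpos, div_lt_iff₀ hpos]
      calc _ = |turn Q κ L (seg Φ X 0 m) - m * (-(2 * Real.pi * (κ * A.card / Fintype.card ι)) +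
              2 * Real.pi * z κ)| := by congr 1; ring
        _ ≤ Q * Real.pi := h3
        _ < _ := by nlinarith
  have e1 := abs_le.1 (hz _ ⟨le_rfl, hle⟩)
  have e2 := abs_le.1 (hz _ ⟨hle, le_rfl⟩)
  rw [hzz] at e1
  rw [dturn]
  have e3 : m * (2 * Real.pi * ((Q + 3 / 4 : ℝ) * A.card / Fintype.card ι)) -
      m * (2 * Real.pi * ((Q + 1 / 4 : ℝ) * A.card / Fintype.card ι)) =
      m * (Real.pi * (A.card / Fintype.card ι)) := by field_simp; ring
  rw [abs_le]
  constructor <;> linarith [e1.1, e1.2, e2.1, e2.2]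

end LapTurn

section Rotations

/-- The rotation by `t` full turns. -/
noncomputable def rotv (t : ℝ) (x : ℂ) : ℂ := Complex.exp (2 * Real.pi * t * Complex.I) * x

@[simp] theorem rotv_zero (x : ℂ) : rotv 0 x = x := by simp [rotv]

theorem rotv_add (s t : ℝ) (x : ℂ) : rotv (s + t) x = rotv s (rotv t x) := by
  rw [rotv, rotv, rotv, ← mul_assoc, ← Complex.exp_add]
  congr 2
  push_cast
  ring

@[simp] theorem norm_rotv (t : ℝ) (x : ℂ) : ‖rotv t x‖ = ‖x‖ := by
  rw [rotv, norm_mul, norm_exp_turn, one_mul]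

theorem rotv_int (z : ℤ) (x : ℂ) : rotv z x = x := by
  have : Complex.exp (2 * Real.pi * (z : ℝ) * Complex.I) = 1 := by
    rw [Complex.exp_eq_one_iff]
    exact ⟨z, by push_cast; ring⟩
  rw [rotv, this, one_mul]

theorem norm_rotv_sub_le (s t : ℝ) (x : ℂ) :
    ‖rotv s x - rotv t x‖ ≤ 2 * Real.pi * |s - t| * ‖x‖ := by
  have h1 : rotv s x = rotv t (rotv (s - t) x) := by rw [← rotv_add]; congr 1; ring
  have h2 : rotv t (rotv (s - t) x) - rotv t x = rotv t (rotv (s - t) x - x) := by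
    simp only [rotv]; ring
  rw [h1, h2, norm_rotv, rotv, show Complex.exp (2 * Real.pi * (s - t : ℝ) * Complex.I) * x - x =
    (Complex.exp (Complex.I * (2 * Real.pi * (s - t) : ℝ)) - 1) * x by
      rw [sub_mul, one_mul]; congr 3; push_cast; ring, norm_mul]
  gcongr
  refine Real.norm_exp_I_mul_ofReal_sub_one_le.trans ?_
  rw [Real.norm_eq_abs, abs_mul, abs_of_pos Real.two_pi_pos]

theorem continuous_rotv : Continuous fun p : ℝ × ℂ => rotv p.1 p.2 := by
  unfold rotv
  fun_prop

/-- The homeomorphism which rotates the circle of radius `r` by `θ r` full turns. -/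
noncomputable def rotH (θ : C(ℝ, ℝ)) : ℂ ≃ₜ ℂ where
  toFun x := rotv (θ ‖x‖) x
  invFun x := rotv (-θ ‖x‖) x
  left_inv x := by
    simp only [norm_rotv]
    rw [← rotv_add, neg_add_cancel, rotv_zero]
  right_inv x := by
    simp only [norm_rotv]
    rw [← rotv_add, add_neg_cancel, rotv_zero]
  continuous_toFun := continuous_rotv.comp (f := fun x => (θ ‖x‖, x)) (by fun_prop)
  continuous_invFun := continuous_rotv.comp (f := fun x => (-θ ‖x‖, x)) (by fun_prop)

theorem rotH_apply (θ : C(ℝ, ℝ)) (x : ℂ) : rotH θ x = rotv (θ ‖x‖) x := rfl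

variable {J : Type*} [Fintype J]

theorem isFam_rotH {β : J → C(ℝ, ℝ)} (hβ : ∀ j, ∀ x, 1 ≤ x → β j x = 0) :
    IsFam fun k : J → ℝ => rotH (∑ j, k j • β j) := by
  refine ⟨?_, fun k x hx => ?_⟩
  · have : ∀ p : (J → ℝ) × ℂ, rotH (∑ j, p.1 j • β j) p.2 = rotv (∑ j, p.1 j * β j ‖p.2‖) p.2 := by
      intro p
      simp [rotH_apply, ContinuousMap.sum_apply]
    simp_rw [this]
    exact continuous_rotv.comp (f := fun p : (J → ℝ) × ℂ => (∑ j, p.1 j * β j ‖p.2‖, p.2))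
      (by fun_prop)
  · simp [rotH_apply, ContinuousMap.sum_apply, hβ _ _ hx]

theorem isFam_smul_rotH {θ : C(ℝ, ℝ)} (hθ : ∀ x, 1 ≤ x → θ x = 0) :
    IsFam fun s : ℝ => rotH (s • θ) := by
  have := (isFam_rotH (J := Unit) (β := fun _ => θ) fun _ => hθ).comp
    (f := fun (s : ℝ) (_ : Unit) => s) (by fun_prop)
  simpa using this

end Rotations

section Steps

/-- A continuous function which increases from `0` to `1` on `[-δ, 0]`. -/
noncomputable def ramp (δ y : ℝ) : ℝ := max 0 (min 1 (1 + y / δ))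

variable {δ : ℝ} (hδ : 0 < δ)
include hδ

theorem ramp_of_nonneg {y : ℝ} (hy : 0 ≤ y) : ramp δ y = 1 := by
  have : 0 ≤ y / δ := by positivity
  rw [ramp, min_eq_left (by linarith), max_eq_right zero_le_one]

theorem ramp_of_le {y : ℝ} (hy : y ≤ -δ) : ramp δ y = 0 := by
  have : y / δ ≤ -1 := by rw [div_le_iff₀ hδ]; linarith
  rw [ramp, max_eq_left]
  exact (min_le_right _ _).trans (by linarith)

omit hδ in
theorem ramp_mem (δ y : ℝ) : 0 ≤ ramp δ y ∧ ramp δ y ≤ 1 :=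
  ⟨le_max_left _ _, max_le zero_le_one (min_le_left _ _)⟩

theorem abs_sub_sum_ramp_le (hδ1 : δ ≤ 1) (n : ℕ) {y : ℝ} (hy : 0 ≤ y) (hyn : y ≤ n) :
    |y - ∑ i : Fin n, ramp δ (y - (i + 1))| ≤ 1 := by
  induction n with
  | zero =>
    have : y = 0 := le_antisymm (by simpa using hyn) hy
    simp [this]
  | succ n ih =>
    rw [Fin.sum_univ_castSucc]
    simp only [Fin.val_castSucc, Fin.val_last]
    push_cast at hyn
    rcases le_total y n with h | h
    · rw [ramp_of_le hδ (y := y - (n + 1)) (by linarith), add_zero]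
      exact ih h
    · rw [Finset.sum_congr rfl fun i _ => ramp_of_nonneg hδ (y := y - ((i : Fin n) + 1)) (by
        have : ((i : Fin n) : ℝ) + 1 ≤ n := by exact_mod_cast i.2
        linarith)]
      have := ramp_mem δ (y - (n + 1))
      simp only [Finset.sum_const, Finset.card_univ, Fintype.card_fin, nsmul_eq_mul, mul_one]
      rw [abs_le]
      constructor <;> linarith [this.1, this.2]

end Steps

section Twist

/-- Splits a profile into given pieces and a remainder. -/
def split {R : Type*} [AddCommGroup R] {n : ℕ} (Ω : R) (g : Fin n → R) : Fin (n + 1) → R :=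
  Fin.cons (Ω - ∑ i, g i) g

theorem sum_split {R : Type*} [AddCommGroup R] {n : ℕ} (Ω : R) (g : Fin n → R) :
    ∑ j, split Ω g j = Ω := by
  simp [split, Fin.sum_univ_succ]

/-- The twists along the superlevel sets of a profile. -/
noncomputable def levelTwist (Ω : ℝ → ℝ) (n : ℕ) (k : Fin (n + 1) → ℝ) (x : ℂ) : ℂ :=
  rotv (∑ j, k j * split (Ω ‖x‖) (fun i : Fin n => if (i : ℝ) + 1 ≤ Ω ‖x‖ then 1 else 0) j) x

noncomputable def rampC (Ω : C(ℝ, ℝ)) (δ : ℝ) (n : ℕ) (i : Fin n) : C(ℝ, ℝ) :=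
  ⟨fun x => ramp δ (Ω x - (i + 1)), by unfold ramp; fun_prop⟩

noncomputable def boxFam (Ω : C(ℝ, ℝ)) (δ : ℝ) (n : ℕ) (k : Fin (n + 1) → ℝ) : ℂ ≃ₜ ℂ :=
  rotH (∑ j, k j • split Ω (rampC Ω δ n) j)

noncomputable def twistSteps (Q : ℕ) : ℕ := ⌈2 * Real.pi / tol Q⌉₊ + 1

noncomputable def twistErr (Q : ℕ) : ℝ := 14 * Q * Real.pi + 2 * twistSteps Q * Real.pi

variable {Ω : C(ℝ, ℝ)} {δ : ℝ} {n : ℕ}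

theorem split_zero_apply (x : ℝ) :
    split Ω (rampC Ω δ n) 0 x = Ω x - ∑ i : Fin n, ramp δ (Ω x - (i + 1)) := by
  simp [split, rampC, ContinuousMap.sum_apply]

theorem split_succ_apply (i : Fin n) (x : ℝ) :
    split Ω (rampC Ω δ n) i.succ x = ramp δ (Ω x - (i + 1)) := by
  simp [split, rampC]

theorem boxFam_apply (k : Fin (n + 1) → ℝ) (x : ℂ) :
    boxFam Ω δ n k x = rotv (∑ j, k j * split Ω (rampC Ω δ n) j ‖x‖) x := by
  simp [boxFam, rotH_apply, ContinuousMap.sum_apply]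

variable (h0 : ∀ x, 0 ≤ Ω x) (h1 : ∀ x, 1 ≤ x → Ω x = 0) (hδ : 0 < δ) (hδ1 : δ ≤ 1)

include h1 hδ hδ1 in
theorem isFam_boxFam : IsFam (boxFam Ω δ n) := by
  refine isFam_rotH fun j x hx => ?_
  have hr : ∀ i : Fin n, ramp δ (Ω x - (i + 1)) = 0 := fun i => by
    refine ramp_of_le hδ ?_
    have : (0:ℝ) ≤ (i : ℕ) := by positivity
    rw [h1 x hx]; linarith
  refine Fin.cases ?_ (fun i => ?_) j
  · rw [split_zero_apply, h1 x hx]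
    rw [zero_sub, neg_eq_zero]
    simp only [h1 x hx] at hr
    exact Finset.sum_eq_zero fun i _ => hr i
  · rw [split_succ_apply, hr]

variable {ι : Type*} [Fintype ι] [DecidableEq ι] {X : ι → ℂ}

/-- The labels above a level. -/
noncomputable def above (Ω : ℝ → ℝ) (X : ι → ℂ) (i : ℕ) : Finset ι :=
  Finset.univ.filter fun p => (i : ℝ) + 1 ≤ Ω ‖X p‖

theorem mem_above {Ω : ℝ → ℝ} {i : ℕ} {p : ι} : p ∈ above Ω X i ↔ (i : ℝ) + 1 ≤ Ω ‖X p‖ := by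
  simp [above]

variable (hgap : ∀ p, ∀ i : Fin n, Ω ‖X p‖ < i + 1 → Ω ‖X p‖ ≤ i + 1 - δ)

include hδ hgap in
theorem ramp_sample (p : ι) (i : Fin n) :
    ramp δ (Ω ‖X p‖ - (i + 1)) = if (i : ℝ) + 1 ≤ Ω ‖X p‖ then 1 else 0 := by
  split_ifs with h
  · exact ramp_of_nonneg hδ (by linarith)
  · have := hgap p i (not_le.1 h)
    exact ramp_of_le hδ (by linarith)

include hδ hgap in
theorem boxFam_sample (k : Fin (n + 1) → ℝ) (p : ι) :
    boxFam Ω δ n k (X p) = levelTwist Ω n k (X p) := by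
  rw [boxFam_apply, levelTwist]
  congr 1
  refine Finset.sum_congr rfl fun j _ => ?_
  congr 1
  refine Fin.cases ?_ (fun i => ?_) j
  · rw [split_zero_apply]
    simp only [ramp_sample hδ hgap]
    simp [split]
  · rw [split_succ_apply, ramp_sample hδ hgap]
    simp [split]

include hδ hgap in
theorem boxFam_add (z : Fin n → ℤ) (k : Fin (n + 1) → ℝ) (p : ι) :
    boxFam Ω δ n ((Fin.cons 0 fun i => (z i : ℝ) : Fin (n + 1) → ℝ) + k) (X p) =
      boxFam Ω δ n k (X p) := by
  rw [boxFam_apply, boxFam_apply]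
  have : ∑ j, ((Fin.cons 0 fun i => (z i : ℝ) : Fin (n + 1) → ℝ) + k) j *
      split Ω (rampC Ω δ n) j ‖X p‖ = ∑ j, k j * split Ω (rampC Ω δ n) j ‖X p‖ +
      ((∑ i : Fin n, z i * if (i : ℝ) + 1 ≤ Ω ‖X p‖ then 1 else 0 : ℤ) : ℝ) := by
    simp only [Pi.add_apply, add_mul, Finset.sum_add_distrib]
    rw [add_comm]
    congr 1
    rw [Fin.sum_univ_succ]
    simp only [Fin.cons_zero, zero_mul, zero_add, Fin.cons_succ, split_succ_apply,
      ramp_sample hδ hgap]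
    push_cast
    rfl
  rw [this, rotv_add, rotv_int]

include hδ hgap in
theorem seg_boxFam_add (z : Fin n → ℤ) (k k' : Fin (n + 1) → ℝ) :
    seg (boxFam Ω δ n) X ((Fin.cons 0 fun i => (z i : ℝ) : Fin (n + 1) → ℝ) + k)
      ((Fin.cons 0 fun i => (z i : ℝ) : Fin (n + 1) → ℝ) + k') = seg (boxFam Ω δ n) X k k' := by
  ext s p
  rw [seg, seg, add_sub_add_left_eq_sub, add_assoc, boxFam_add hδ hgap]

theorem boxFam_one (s : ℝ) : boxFam Ω δ n (s • fun _ => 1) = rotH (s • Ω) := by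
  rw [boxFam]
  congr 1
  simp only [Pi.smul_apply, smul_eq_mul, mul_one]
  rw [← Finset.smul_sum, sum_split]

theorem boxFam_single (t : ℝ) (i : Fin n) (x : ℂ) :
    boxFam Ω δ n (t • Pi.single i.succ 1) x = rotv (t * ramp δ (Ω ‖x‖ - (i + 1))) x := by
  rw [boxFam_apply, Finset.sum_eq_single i.succ]
  · simp [split_succ_apply]
  · intro j _ hj
    simp [hj]
  · simp

include h0 h1 hδ hδ1 in
theorem close_boxFam (hn : ∀ x, Ω x ≤ n) {Q M : ℕ} (hM : twistSteps Q ≤ M) (k : Fin (n + 1) → ℝ)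
    {s t : ℝ} (hst : |s - t| ≤ 1 / M) :
    Close (tol Q) (boxFam Ω δ n) (k + s • Pi.single 0 1) (k + t • Pi.single 0 1) := by
  have hF := isFam_boxFam (n := n) h1 hδ hδ1
  intro x
  rcases le_or_gt 1 ‖x‖ with hx | hx
  · rw [hF.supp _ _ hx, hF.supp _ _ hx, sub_self, norm_zero]
    exact (tol_pos Q).le
  rw [boxFam_apply, boxFam_apply]
  refine (norm_rotv_sub_le _ _ _).trans ?_
  have e : ∑ j, (k + s • (Pi.single 0 1 : Fin (n + 1) → ℝ)) j * split Ω (rampC Ω δ n) j ‖x‖ -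
      ∑ j, (k + t • (Pi.single 0 1 : Fin (n + 1) → ℝ)) j * split Ω (rampC Ω δ n) j ‖x‖ =
      (s - t) * split Ω (rampC Ω δ n) 0 ‖x‖ := by
    rw [← Finset.sum_sub_distrib, Finset.sum_eq_single 0]
    · simp only [Pi.add_apply, Pi.smul_apply, Pi.single_eq_same, smul_eq_mul]; ring
    · intro j _ hj
      simp [hj]
    · simp
  rw [e, abs_mul, split_zero_apply]
  have h2 := abs_sub_sum_ramp_le hδ hδ1 n (h0 ‖x‖) (hn ‖x‖)
  have hM0 : (0:ℝ) < M := by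
    have : 0 < M := lt_of_lt_of_le (Nat.succ_pos _) hM
    exact_mod_cast this
  have h3 : 2 * Real.pi / tol Q ≤ M := by
    refine (Nat.le_ceil _).trans ?_
    exact_mod_cast (Nat.le_succ _).trans hM
  calc _ ≤ 2 * Real.pi * (1 / M * 1) * 1 := by gcongr
    _ ≤ tol Q := by
      rw [mul_one, mul_one, mul_one_div, div_le_iff₀ hM0]
      rw [div_le_iff₀ (tol_pos Q)] at h3
      linarith

variable {Q : ℕ} (hΩ : ∀ x y, 0 ≤ x → x ≤ y → Ω y ≤ Ω x)

include h1 hΩ in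
theorem lapData_above (hre : ∀ p q, (X p).re = (X q).re → p = q) (hre0 : ∀ p, (X p).re ≠ 0)
    (i : ℕ) : LapData (above Ω X i) X := by
  refine ⟨fun p q h => hre p q (by rw [h]), fun p _ q _ => hre p q, fun p _ => hre0 p,
    fun p hp q hq => ?_⟩
  rw [mem_above] at hp hq
  by_contra h
  exact hq (hp.trans (hΩ _ _ (norm_nonneg _) (not_lt.1 h)))

include h1 hδ hδ1 hΩ hgap in
theorem dturn_boxFam_single (hQ : 1 ≤ Q) (hN : 8 * (Q + 1) ≤ Fintype.card ι)
    (hre : ∀ p q, (X p).re = (X q).re → p = q) (hre0 : ∀ p, (X p).re ≠ 0) {m : ℕ} (hm : 2 * Q < m)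
    (hG : GoodFor Q (Set.Icc 0 fun _ => (m : ℝ)) (levelTwist Ω n) X)
    (hA : ∀ i : Fin n, 5 * Fintype.card ι ≤ (4 * Q + 1) * (above Ω X i).card ∧
      (4 * Q + 3) * (above Ω X i).card ≤ 7 * Fintype.card ι) {r : ℝ} (hr : 0 < r)
    (hcl : ∀ k ∈ Set.Icc (0 : Fin (n + 1) → ℝ) (fun _ => m),
      ∀ k' ∈ Set.Icc (0 : Fin (n + 1) → ℝ) (fun _ => m), dist k k' < r →
        Close (tol Q) (boxFam Ω δ n) k k') {L : ℕ} (hL : 0 < L) (hLr : m < r * L) (i : Fin n) :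
    |dturn Q L (seg (boxFam Ω δ n) X 0 ((m : ℝ) • Pi.single i.succ 1)) +
      m * (Real.pi * ((above Ω X i).card / Fintype.card ι))| ≤ 2 * Q * Real.pi := by
  have hmem : ∀ t ∈ Set.Icc 0 (m : ℝ), t • (Pi.single i.succ 1 : Fin (n + 1) → ℝ) ∈
      Set.Icc (0 : Fin (n + 1) → ℝ) (fun _ => m) := by
    intro t ht
    constructor <;> intro j <;> by_cases hj : j = i.succ <;> simp [hj, ht.1, ht.2]
  have hfam := (isFam_boxFam (n := n) h1 hδ hδ1).comp
    (f := fun t : ℝ => t • (Pi.single i.succ 1 : Fin (n + 1) → ℝ)) (by fun_prop)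
  have hs : seg (boxFam Ω δ n) X 0 ((m : ℝ) • Pi.single i.succ 1) =
      seg (fun t : ℝ => boxFam Ω δ n (t • Pi.single i.succ 1)) X 0 m := by
    ext s p
    simp [seg, smul_smul]
  rw [hs]
  refine dturn_lap (r := r) hQ (by omega) hfam (lapData_above h1 hΩ hre hre0 i) (fun t ht => ?_)
    (fun t ht => ?_) hr (fun k hk k' hk' hd => hcl _ (hmem k hk) _ (hmem k' hk') ?_) ?_
    (hA i).1 (hA i).2 hm hL hLr
  · ext p
    rw [boxFam_single, ramp_sample hδ hgap, lap]
    simp only [mem_above]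
    split_ifs
    · rw [mul_one, rotv]
    · rw [mul_zero, rotv_zero]
  · have := hG _ (hmem t ht)
    simpa only [← boxFam_sample hδ hgap] using this
  · rw [dist_eq_norm, ← sub_smul, norm_smul]
    have : ‖(Pi.single i.succ 1 : Fin (n + 1) → ℝ)‖ = 1 := by
      rw [Pi.norm_single, norm_one]
    rwa [this, mul_one, ← dist_eq_norm]
  · have := (hA i).1
    by_contra hlt
    have hlt' : (above Ω X i).card ≤ 7 := by omega
    have : (4 * Q + 1) * (above Ω X i).card ≤ (4 * Q + 1) * 7 := Nat.mul_le_mul_left _ hlt'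
    omega

end Twist

section TwistTurn

variable {Ω : C(ℝ, ℝ)} {δ : ℝ} {n : ℕ} {ι : Type*} [Fintype ι] [DecidableEq ι] {X : ι → ℂ}

theorem abs_sub_sum_le {f : ℕ → ℝ} {d : ℕ → ℝ} {c : ℝ} (n : ℕ)
    (h : ∀ i < n, |f (i + 1) - f i - d i| ≤ c) :
    |f n - f 0 - ∑ i ∈ Finset.range n, d i| ≤ n * c := by
  rw [← Finset.sum_range_sub, ← Finset.sum_sub_distrib]
  refine (Finset.abs_sum_le_sum_abs _ _).trans ((Finset.sum_le_sum fun i hi =>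
    h i (Finset.mem_range.1 hi)).trans ?_)
  simp

theorem exists_level_gap (Ω : ℝ → ℝ) (n : ℕ) (X : ι → ℂ) :
    ∃ δ, 0 < δ ∧ δ ≤ 1 ∧ ∀ p, ∀ i : Fin n, Ω ‖X p‖ < i + 1 → Ω ‖X p‖ ≤ i + 1 - δ := by
  have h : ∀ᶠ δ in 𝓝[>] (0:ℝ), ∀ p, ∀ i : Fin n, Ω ‖X p‖ < i + 1 → Ω ‖X p‖ ≤ i + 1 - δ := by
    refine eventually_all.2 fun p => eventually_all.2 fun i => ?_
    by_cases hlt : Ω ‖X p‖ < i + 1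
    · filter_upwards [nhdsWithin_le_nhds (Iio_mem_nhds (sub_pos.2 hlt))] with δ hδ _
      simp only [Set.mem_Iio] at hδ
      linarith
    · simp [hlt]
  obtain ⟨δ, h, hδ, hδ1⟩ := (h.and (Ioc_mem_nhdsGT zero_lt_one)).exists
  exact ⟨δ, hδ, hδ1, h⟩

theorem exists_nat_gt_mul {r : ℝ} (hr : 0 < r) (c : ℝ) : ∃ L : ℕ, 0 < L ∧ c < r * L := by
  obtain ⟨L, hL⟩ := exists_nat_gt (c / r)
  refine ⟨L + 1, L.succ_pos, ?_⟩
  rw [div_lt_iff₀ hr] at hL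
  push_cast; nlinarith

/-- The turning of a monotone radial twist. -/
theorem dturn_twist (h0 : ∀ x, 0 ≤ Ω x) (h1 : ∀ x, 1 ≤ x → Ω x = 0) (hn : ∀ x, Ω x ≤ n)
    (hΩ : ∀ x y, 0 ≤ x → x ≤ y → Ω y ≤ Ω x) {Q : ℕ} (hQ : 1 ≤ Q)
    (hN : 8 * (Q + 1) ≤ Fintype.card ι)
    (hre : ∀ p q, (X p).re = (X q).re → p = q) (hre0 : ∀ p, (X p).re ≠ 0)
    (hG : GoodFor Q (Set.Icc 0 fun _ => ((n + 2 * Q + 1 : ℕ) : ℝ)) (levelTwist Ω n) X)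
    (hA : ∀ i : Fin n, 5 * Fintype.card ι ≤ (4 * Q + 1) * (above Ω X i).card ∧
      (4 * Q + 3) * (above Ω X i).card ≤ 7 * Fintype.card ι) {r : ℝ} (hr : 0 < r)
    (hcl : ∀ k ∈ Set.Icc (0 : ℝ) 1, ∀ k' ∈ Set.Icc (0 : ℝ) 1, dist k k' < r →
        Close (tol Q) (fun s => rotH (s • Ω)) k k') {L : ℕ} (hL : 0 < L) (hLr : 1 < r * L) :
    |dturn Q L (seg (fun s : ℝ => rotH (s • Ω)) X 0 1) +
      Real.pi * ∑ i ∈ Finset.range n, ((above Ω X i).card / Fintype.card ι : ℝ)| ≤ twistErr Q := by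
  obtain ⟨δ, hδ, hδ1, hgap⟩ := exists_level_gap Ω n X
  set m := n + 2 * Q + 1
  set K := Set.Icc (0 : Fin (n + 1) → ℝ) fun _ => (m : ℝ)
  have hX : Function.Injective X := fun p q h => hre p q (by rw [h])
  have hF := isFam_boxFam (n := n) h1 hδ hδ1
  have hGB : GoodFor Q K (fun k => boxFam Ω δ n k) X := fun k hk => by
    have := hG k hk
    simpa only [← boxFam_sample hδ hgap] using this
  have hm1 : (1:ℝ) ≤ m := by exact_mod_cast (by omega : 1 ≤ m)
  have hm0 : (0:ℝ) ≤ m := zero_le_one.trans hm1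
  have hone : ∀ s ∈ Set.Icc (0:ℝ) 1, (s • fun _ => (1:ℝ)) ∈ K := fun s hs =>
    ⟨fun j => by simpa using hs.1, fun j => by simpa using hs.2.trans hm1⟩
  obtain ⟨r', hr', hcl'⟩ := hF.exists_close (isCompact_Icc (a := (0 : Fin (n + 1) → ℝ))
    (b := fun _ => (m : ℝ))) (tol_pos Q)
  obtain ⟨P, hP, hP'⟩ := exists_dturn hQ (by omega) isCompact_Icc (convex_Icc _ _)
    ⟨0, le_rfl, fun _ => hm0⟩ hF hX hGB hr' hcl'
  have hFh : IsFam fun s : ℝ => rotH (s • Ω) := by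
    simpa only [boxFam_one] using hF.comp (f := fun s : ℝ => s • fun _ => (1:ℝ)) (by fun_prop)
  obtain ⟨P₁, hP₁, -⟩ := exists_dturn hQ (by omega) (isCompact_Icc (a := (0:ℝ)) (b := 1))
    (convex_Icc _ _) ⟨0, le_rfl, zero_le_one⟩ hFh hX (fun s hs => by
      simpa only [boxFam_one] using hGB _ (hone s hs)) hr hcl
  have hseg : seg (fun s : ℝ => rotH (s • Ω)) X 0 1 =
      seg (boxFam Ω δ n) X 0 (fun _ => 1) := by
    ext s p
    simp only [seg, sub_zero, zero_add, smul_eq_mul, mul_one, boxFam_one]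
  have hp := Real.pi_pos
  set u : Fin (n + 1) → ℝ := Fin.cons 0 fun _ => 1 with hu
  have huv : (fun _ => (1:ℝ)) = u + (1:ℝ) • Pi.single 0 1 := by
    ext j
    refine Fin.cases ?_ (fun i => ?_) j <;> simp [hu]
  have huK : ∀ j : ℕ, j ≤ m → (j:ℝ) • u ∈ K := fun j hj => by
    have hj' : (j:ℝ) ≤ m := by exact_mod_cast hj
    constructor <;> intro l <;> refine Fin.cases ?_ (fun i => ?_) l <;> simp [hu, hj']
  have h1K : (fun _ => (1:ℝ)) ∈ K := by simpa using hone 1 (by simp)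
  have h0K : (0 : Fin (n + 1) → ℝ) ∈ K := ⟨le_rfl, fun _ => hm0⟩
  have huK1 : u ∈ K := by simpa using huK 1 (by omega)
  obtain ⟨L', hL', hLr'⟩ := exists_nat_gt_mul (lt_min hr hr') (m + 1)
  have hLL : (m:ℝ) + 1 < r * L' ∧ (m:ℝ) + 1 < r' * L' :=
    ⟨hLr'.trans_le (by gcongr; exact min_le_left _ _),
      hLr'.trans_le (by gcongr; exact min_le_right _ _)⟩
  have hd : ∀ k ∈ K, ∀ k' ∈ K, dist k k' < r' * L' := fun k hk k' hk' => by
    refine lt_of_le_of_lt ((dist_pi_le_iff hm0).2 fun j => ?_) ((lt_add_one _).trans hLL.2)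
    rw [Real.dist_eq, abs_le]
    have a1 := hk.1 j; have a2 := hk.2 j; have a3 := hk'.1 j; have a4 := hk'.2 j
    simp only [Pi.zero_apply] at a1 a3
    constructor <;> linarith
  have e1 := hP₁ 0 (by simp) 1 (by simp) L hL (by simpa using hLr)
  have e2 := hP₁ 0 (by simp) 1 (by simp) L' hL' (by
    rw [dist_zero_left, norm_one]; linarith [hLL.1])
  have e3 := hP 0 h0K _ h1K L' hL' (hd _ h0K _ h1K)
  have e4 : |P (fun _ => 1) - P u| ≤ 2 * twistSteps Q * Real.pi := by
    refine hP' u huK1 _ h1K _ (Nat.succ_pos _) fun s _ t _ hst => ?_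
    rw [huv, add_sub_cancel_left, one_smul]
    exact close_boxFam h0 h1 hδ hδ1 hn le_rfl u hst
  have e5 : |P ((m:ℝ) • u) - P 0 - m * (P u - P 0)| ≤ m * (4 * Q * Real.pi) := by
    have := abs_sub_sum_le (f := fun j : ℕ => P ((j:ℝ) • u)) (d := fun _ => P u - P 0)
      (c := 4 * Q * Real.pi) m fun i hi => ?_
    · simpa [mul_sub] using this
    have a1 := hP _ (huK i hi.le) _ (huK (i + 1) hi) L' hL' (hd _ (huK i hi.le) _ (huK (i + 1) hi))
    have a2 := hP 0 h0K u huK1 L' hL' (hd _ h0K _ huK1)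
    have a3 := seg_boxFam_add hδ hgap (fun _ : Fin n => (i:ℤ)) 0 u
    have a4 : (Fin.cons 0 fun _ : Fin n => ((i:ℤ):ℝ) : Fin (n + 1) → ℝ) = (i:ℝ) • u := by
      ext j
      refine Fin.cases ?_ (fun i => ?_) j <;> simp [hu]
    rw [a4, add_zero, show (i:ℝ) • u + u = ((i + 1 : ℕ) : ℝ) • u by push_cast; module] at a3
    rw [a3] at a1
    rw [abs_le] at a1 a2 ⊢
    constructor <;> linarith [a1.1, a1.2, a2.1, a2.2]
  set v : ℕ → Fin (n + 1) → ℝ := fun i => Fin.cons 0 fun j : Fin n => if (j:ℕ) < i then (m:ℝ) else 0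
    with hv
  have hvK : ∀ i, v i ∈ K := fun i => by
    constructor <;> intro l <;> refine Fin.cases ?_ (fun j => ?_) l <;>
      simp only [hv, Fin.cons_zero, Fin.cons_succ, Pi.zero_apply] <;> first | positivity | skip
    split_ifs <;> simp
  have e6 : |P ((m:ℝ) • u) - P 0 - ∑ i ∈ Finset.range n,
      -(m * (Real.pi * ((above Ω X i).card / Fintype.card ι)))| ≤ n * (4 * Q * Real.pi) := by
    have := abs_sub_sum_le (f := fun j : ℕ => P (v j))
      (d := fun i => -(m * (Real.pi * ((above Ω X i).card / Fintype.card ι))))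
      (c := 4 * Q * Real.pi) n fun i hi => ?_
    · have b1 : v n = (m:ℝ) • u := by
        ext j
        refine Fin.cases ?_ (fun i => ?_) j <;> simp [hu, hv]
      have b2 : v 0 = 0 := by
        ext j
        refine Fin.cases ?_ (fun i => ?_) j <;> simp [hv]
      simpa only [b1, b2] using this
    have a1 := hP _ (hvK i) _ (hvK (i + 1)) L' hL' (hd _ (hvK i) _ (hvK (i + 1)))
    have a2 := dturn_boxFam_single h1 hδ hδ1 hgap hΩ hQ hN hre hre0 (by omega) hG hA hr' hcl'
      hL' (by linarith [hLL.2]) ⟨i, hi⟩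
    have a3 := seg_boxFam_add hδ hgap (fun j : Fin n => if (j:ℕ) < i then (m:ℤ) else 0) 0
      ((m:ℝ) • Pi.single (Fin.succ ⟨i, hi⟩) 1)
    have a4 : (Fin.cons 0 fun j : Fin n => (((if (j:ℕ) < i then (m:ℤ) else 0 : ℤ)) : ℝ) :
        Fin (n + 1) → ℝ) = v i := by
      ext j
      refine Fin.cases ?_ (fun i => ?_) j <;> simp [hv]
    have a5 : v i + (m:ℝ) • (Pi.single (Fin.succ ⟨i, hi⟩) 1 : Fin (n + 1) → ℝ) = v (i + 1) := by
      ext j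
      refine Fin.cases ?_ (fun j => ?_) j
      · simp [hv]
      · simp only [hv, Pi.add_apply, Fin.cons_succ, Pi.smul_apply, Pi.single_apply,
          Fin.ext_iff, smul_eq_mul]
        rcases lt_trichotomy (j:ℕ) i with h | h | h
        · simp [h, h.ne, h.trans (Nat.lt_succ_self i)]
        · simp [h]
        · simp [h.not_gt, h.ne', h.not_ge]
    rw [a4, add_zero, a5] at a3
    rw [← a3] at a2
    simp only at a2 ⊢
    rw [abs_le] at a1 a2 ⊢
    constructor <;> linarith [a1.1, a1.2, a2.1, a2.2]
  rw [hseg] at e1 e2 ⊢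
  rw [Finset.sum_neg_distrib, ← Finset.mul_sum, ← Finset.mul_sum] at e6
  set S := ∑ i ∈ Finset.range n, ((above Ω X i).card / Fintype.card ι : ℝ)
  have hnm : (n:ℝ) ≤ m := by exact_mod_cast (by omega : n ≤ m)
  have e7 : |P u - P 0 + Real.pi * S| ≤ 8 * Q * Real.pi := by
    have : |m * (P u - P 0 + Real.pi * S)| ≤ m * (8 * Q * Real.pi) := by
      have : n * (4 * Q * Real.pi) ≤ m * (4 * Q * Real.pi) := by gcongr
      rw [abs_le] at e5 e6 ⊢
      constructor <;> linarith [e5.1, e5.2, e6.1, e6.2]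
    rw [abs_mul, abs_of_nonneg hm0] at this
    exact le_of_mul_le_mul_left this (zero_lt_one.trans_le hm1)
  rw [twistErr]
  rw [abs_le] at e1 e2 e3 e4 e7 ⊢
  constructor <;> linarith [e1.1, e1.2, e2.1, e2.2, e3.1, e3.2, e4.1, e4.2, e7.1, e7.2]

end TwistTurn

section Sampling
open ProbabilityTheory

/-- The uniform measure on the open unit disc. -/
noncomputable def unif : Measure ℂ := volume[|Metric.ball (0:ℂ) 1]

theorem volume_unit_ball : volume (Metric.ball (0:ℂ) 1) = ENNReal.ofReal Real.pi := by
  rw [Complex.volume_ball]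
  simp [← NNReal.coe_real_pi]

instance : IsProbabilityMeasure unif :=
  cond_isProbabilityMeasure_of_finite
    (by rw [volume_unit_ball]; simpa using Real.pi_pos) (by rw [volume_unit_ball]; simp)

theorem unif_apply (s : Set ℂ) :
    unif s = (ENNReal.ofReal Real.pi)⁻¹ * volume (Metric.ball 0 1 ∩ s) := by
  rw [unif, cond_apply measurableSet_ball, volume_unit_ball]

theorem ae_unif_norm : ∀ᵐ x ∂unif, ‖x‖ < 1 := by
  have h : ∀ᵐ x ∂volume.restrict (Metric.ball (0:ℂ) 1), ‖x‖ < 1 := by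
    filter_upwards [ae_restrict_mem measurableSet_ball] with x hx
    simpa using hx
  exact Measure.ae_smul_measure h _

/-- The law of a sequence of independent uniform points of the disc. -/
noncomputable def iid : Measure (ℕ → ℂ) := Measure.infinitePi fun _ => unif

instance : IsProbabilityMeasure iid := inferInstanceAs (IsProbabilityMeasure (Measure.infinitePi _))

theorem map_eval_iid (i : ℕ) : iid.map (fun ω => ω i) = unif := Measure.infinitePi_map_eval _ i

theorem ae_iid {p : ℂ → Prop} (h : ∀ᵐ x ∂unif, p x) : ∀ᵐ ω ∂iid, ∀ i, p (ω i) := by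
  refine ae_all_iff.2 fun i => ?_
  have h' := h
  rw [← map_eval_iid i] at h'
  exact ae_of_ae_map (measurable_pi_apply i).aemeasurable h'

theorem measurePreserving_iid {f : ℂ → ℂ} (hf : MeasurePreserving f unif unif) :
    MeasurePreserving (fun (ω : ℕ → ℂ) i => f (ω i)) iid iid := by
  have := hf.measurable
  refine ⟨by fun_prop, ?_⟩
  rw [iid, Measure.infinitePi_map_pi _ (fun _ => hf.measurable)]
  simp only [hf.map_eq]

open Classical in
theorem ae_tendsto_card {S : Set ℂ} (hS : MeasurableSet S) :
    ∀ᵐ ω ∂iid, Tendsto (fun N : ℕ =>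
      ((Finset.univ.filter fun i : Fin N => ω i ∈ S).card : ℝ) / N) atTop (𝓝 (unif.real S)) := by
  have hm : Measurable (S.indicator fun _ => (1:ℝ)) := measurable_const.indicator hS
  have hm' : ∀ i, Measurable fun ω : ℕ → ℂ => S.indicator (fun _ => (1:ℝ)) (ω i) := fun i =>
    hm.comp (measurable_pi_apply i)
  have hi : iIndepFun (fun (i : ℕ) (ω : ℕ → ℂ) => S.indicator (fun _ => (1:ℝ)) (ω i)) iid :=
    iIndepFun_infinitePi (P := fun _ => unif) (fun _ => hm)
  have h := strong_law_ae_real (μ := iid) (fun i ω => S.indicator (fun _ => (1:ℝ)) (ω i)) ?_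
    (fun i j hij => hi.indepFun hij) (fun i => ?_)
  · filter_upwards [h] with ω hω
    have e : ∫ ω : ℕ → ℂ, S.indicator (fun _ => (1:ℝ)) (ω 0) ∂iid = unif.real S := by
      have : ∫ x, S.indicator (fun _ => (1:ℝ)) x ∂(iid.map fun ω => ω 0) =
          ∫ ω : ℕ → ℂ, S.indicator (fun _ => (1:ℝ)) (ω 0) ∂iid :=
        integral_map (measurable_pi_apply 0).aemeasurable (by rw [map_eval_iid]; exact hm.aestronglyMeasurable)
      rw [← this, map_eval_iid, integral_indicator_const _ hS]
      simp
    rw [e] at hω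
    refine hω.congr fun N => ?_
    rw [Finset.card_filter, ← Fin.sum_univ_eq_sum_range (fun i => S.indicator (fun _ => (1:ℝ)) (ω i))]
    push_cast
    simp [Set.indicator_apply]
  · exact (integrable_const (1:ℝ)).mono' (hm' 0).aestronglyMeasurable
      (ae_of_all _ fun ω => by by_cases h : ω 0 ∈ S <;> simp [h])
  · refine ⟨(hm' i).aemeasurable, (hm' 0).aemeasurable, ?_⟩
    have : ∀ i, iid.map (fun ω : ℕ → ℂ => S.indicator (fun _ => (1:ℝ)) (ω i)) =
        unif.map (S.indicator fun _ => (1:ℝ)) := fun i => by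
      rw [← map_eval_iid i, Measure.map_map hm (by fun_prop)]; rfl
    rw [this, this]

open Classical in
/-- Eventual upper bound for the number of samples in a set. -/
theorem ae_eventually_card_le {S : Set ℂ} (hS : MeasurableSet S) {c : ℝ} (hc : unif.real S < c) :
    ∀ᵐ ω ∂iid, ∀ᶠ N : ℕ in atTop,
      ((Finset.univ.filter fun i : Fin N => ω i ∈ S).card : ℝ) ≤ c * N := by
  filter_upwards [ae_tendsto_card hS] with ω hω
  filter_upwards [hω.eventually (Iio_mem_nhds hc), eventually_gt_atTop 0] with N hN h0
  replace hN : _ < c := hN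
  rw [div_lt_iff₀ (by exact_mod_cast h0)] at hN
  exact hN.le

open Classical in
theorem ae_eventually_le_card {S : Set ℂ} (hS : MeasurableSet S) {c : ℝ} (hc : c < unif.real S) :
    ∀ᵐ ω ∂iid, ∀ᶠ N : ℕ in atTop,
      c * N ≤ ((Finset.univ.filter fun i : Fin N => ω i ∈ S).card : ℝ) := by
  filter_upwards [ae_tendsto_card hS] with ω hω
  filter_upwards [hω.eventually (Ioi_mem_nhds hc), eventually_gt_atTop 0] with N hN h0
  replace hN : c < _ := hN
  rw [lt_div_iff₀ (by exact_mod_cast h0)] at hN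
  exact hN.le

theorem unif_strip_le {a b : ℝ} (hab : a ≤ b) : unif.real {x : ℂ | a ≤ x.re ∧ x.re ≤ b} ≤ b - a := by
  rw [measureReal_def, unif_apply]
  have h1 : volume (Metric.ball (0:ℂ) 1 ∩ {x : ℂ | a ≤ x.re ∧ x.re ≤ b}) ≤
      ENNReal.ofReal (b - a) * 2 := by
    calc _ ≤ volume (Complex.measurableEquivRealProd ⁻¹' (Set.Icc a b ×ˢ Set.Icc (-1:ℝ) 1)) := by
          refine measure_mono fun x hx => ?_
          have h3 := (abs_lt.1 ((Complex.abs_im_le_norm x).trans_lt (by simpa using hx.1)))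
          exact ⟨hx.2, h3.1.le, h3.2.le⟩
      _ = _ := by
          rw [Complex.volume_preserving_equiv_real_prod.measure_preimage
            (measurableSet_Icc.prod measurableSet_Icc).nullMeasurableSet, Measure.volume_eq_prod,
            Measure.prod_prod, Real.volume_Icc, Real.volume_Icc]
          norm_num
  rw [ENNReal.toReal_mul, ENNReal.toReal_inv, ENNReal.toReal_ofReal Real.pi_pos.le]
  have h2 := ENNReal.toReal_mono (by finiteness) h1
  rw [ENNReal.toReal_mul, ENNReal.toReal_ofReal (sub_nonneg.2 hab)] at h2
  have h3 := Real.pi_gt_three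
  rw [inv_mul_le_iff₀ Real.pi_pos]
  norm_num at h2
  nlinarith [sub_nonneg.2 hab]

theorem unif_real_disc {c : ℝ} (hc : 0 ≤ c) (hc1 : c ≤ 1) :
    unif.real {x : ℂ | ‖x‖ ^ 2 < c} = c := by
  have h : {x : ℂ | ‖x‖ ^ 2 < c} = Metric.ball 0 √c := by
    ext x
    simp [Real.lt_sqrt (norm_nonneg x)]
  have hs : √c ≤ 1 := Real.sqrt_le_one.2 hc1
  rw [h, measureReal_def, unif_apply, Set.inter_eq_right.2 (Metric.ball_subset_ball hs),
    Complex.volume_ball]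
  rw [ENNReal.toReal_mul, ENNReal.toReal_inv, ENNReal.toReal_ofReal Real.pi_pos.le,
    ENNReal.toReal_mul, ENNReal.toReal_pow, ENNReal.toReal_ofReal (Real.sqrt_nonneg c),
    Real.sq_sqrt hc]
  have := Real.pi_pos.ne'
  simp only [ENNReal.coe_toReal, NNReal.coe_real_pi]
  field_simp

end Sampling

section Goodness
open ProbabilityTheory

theorem Spread.of_near {ι : Type*} [Fintype ι] [DecidableEq ι] {c w δ δ' : ℝ} {X X' : ι → ℂ}
    (h : Spread c w δ' X) (hX : ∀ i, ‖X i - X' i‖ ≤ 2 * δ' - 2 * δ) : Spread c w δ X' := by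
  have hre : ∀ i, |(X i).re - (X' i).re| ≤ 2 * δ' - 2 * δ := fun i =>
    (Complex.abs_re_le_norm (X i - X' i)).trans (hX i)
  constructor
  · refine fun l => le_trans ?_ (h.1 l)
    gcongr
    intro p hp
    simp only [wide, Finset.mem_filter, Finset.mem_univ, true_and] at hp ⊢
    have := abs_le.1 (hre p)
    constructor <;> linarith
  · refine le_trans ?_ h.2
    gcongr
    intro p hp
    simp only [zone, Finset.mem_filter, Finset.mem_univ, true_and] at hp ⊢
    obtain ⟨l, hl⟩ := hp
    refine ⟨l, (abs_sub_le _ _ _).trans (by linarith [hre p])⟩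

theorem wid_le (Q : ℕ) : wid Q ≤ 1 / 16 := by
  have := dens_le_one Q
  unfold wid; linarith

/-- The indices of the columns which meet the disc. -/
noncomputable def colBound (Q : ℕ) : ℕ := ⌈(1 + 3 * tol Q) / wid Q⌉₊ + 1

theorem colBound_mul_le (Q : ℕ) : (2 * colBound Q + 1) * wid Q ≤ 3 := by
  have hw := wid_pos Q
  have h1 := Nat.ceil_lt_add_one (a := (1 + 3 * tol Q) / wid Q)
    (div_nonneg (by linarith [tol_pos Q]) hw.le)
  have h2 : (⌈(1 + 3 * tol Q) / wid Q⌉₊ : ℝ) * wid Q < 1 + 3 * tol Q + wid Q := by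
    calc _ < ((1 + 3 * tol Q) / wid Q + 1) * wid Q := by gcongr
      _ = _ := by field_simp
  have h3 := wid_le Q
  have h4 := two_tol_lt Q
  unfold colBound
  push_cast
  nlinarith

theorem natAbs_le_colBound {Q : ℕ} {l : ℤ} {y : ℝ} (hy : |y| < 1) (h1 : l * wid Q - 3 * tol Q ≤ y)
    (h2 : y ≤ (l + 1) * wid Q + 3 * tol Q) : l ∈ Finset.Icc (-colBound Q : ℤ) (colBound Q) := by
  have hw := wid_pos Q
  have hc : (1 + 3 * tol Q) / wid Q ≤ (colBound Q : ℝ) - 1 := by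
    have := Nat.le_ceil ((1 + 3 * tol Q) / wid Q)
    unfold colBound
    push_cast; linarith
  rw [div_le_iff₀ hw] at hc
  rw [abs_lt] at hy
  rw [Finset.mem_Icc]
  constructor
  · have : -(colBound Q : ℝ) * wid Q ≤ l * wid Q := by linarith
    have := le_of_mul_le_mul_right this hw
    exact_mod_cast this
  · have : (l : ℝ) * wid Q ≤ colBound Q * wid Q := by linarith
    have := le_of_mul_le_mul_right this hw
    exact_mod_cast this

def strip (a b : ℝ) : Set ℂ := {x | a ≤ x.re ∧ x.re ≤ b}

theorem ae_spread (Q : ℕ) : ∀ᵐ ω ∂iid, ∀ᶠ N : ℕ in atTop,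
    Spread (dens Q) (wid Q) (3 / 2 * tol Q) fun i : Fin N => ω i := by
  classical
  have ht := tol_pos Q
  have hw := wid_pos Q
  have hd := dens_pos Q
  have hms : ∀ a b : ℝ, MeasurableSet (strip a b) := fun a b =>
    (measurableSet_le measurable_const Complex.measurable_re).inter
      (measurableSet_le Complex.measurable_re measurable_const)
  have htd : tol Q * 100 = dens Q * wid Q := by unfold tol; ring
  have htw : 16 * wid Q = dens Q := by unfold wid; ring
  have h1 : ∀ l : ℤ, ∀ᵐ ω ∂iid, ∀ᶠ N : ℕ in atTop, ((Finset.univ.filter fun i : Fin N =>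
      ω i ∈ strip (l * wid Q - 3 * tol Q) ((l + 1) * wid Q + 3 * tol Q)).card : ℝ)
        ≤ dens Q * N := fun l => by
    refine ae_eventually_card_le (hms _ _) ((unif_strip_le (by linarith)).trans_lt ?_)
    have := dens_le_one Q
    nlinarith
  set I := Finset.Icc (-colBound Q : ℤ) (colBound Q)
  set S : ℤ → Set ℂ := fun l => strip (l * wid Q - 3 * tol Q) (l * wid Q + 3 * tol Q)
  have h2 : ∀ᵐ ω ∂iid, ∀ᶠ N : ℕ in atTop, ((Finset.univ.filter fun i : Fin N =>
      ω i ∈ ⋃ l ∈ I, S l).card : ℝ) ≤ dens Q * N := by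
    refine ae_eventually_card_le (Finset.measurableSet_biUnion _ fun l _ => hms _ _) ?_
    refine (measureReal_biUnion_finset_le I S).trans_lt ?_
    refine (Finset.sum_le_sum fun l _ => unif_strip_le (by linarith)).trans_lt ?_
    simp only [add_sub_sub_cancel, Finset.sum_const, nsmul_eq_mul, I, Int.card_Icc]
    have : (((colBound Q : ℤ) + 1 - -colBound Q).toNat : ℝ) = 2 * colBound Q + 1 := by
      have : ((colBound Q : ℤ) + 1 - -colBound Q).toNat = 2 * colBound Q + 1 := by omega
      rw [this]; push_cast; ring
    rw [this]
    have h3 := colBound_mul_le Q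
    have : (2 * colBound Q + 1) * (3 * tol Q + 3 * tol Q) =
      ((2 * colBound Q + 1) * wid Q) * dens Q * (6 / 100) := by linear_combination (2 * colBound Q + 1) * 6 / 100 * htd
    rw [this]
    nlinarith
  filter_upwards [ae_all_iff.2 h1, h2, ae_iid ae_unif_norm] with ω h1 h2 h3
  filter_upwards [(Filter.eventually_all_finset I).2 fun l _ => h1 l, h2] with N h1 h2
  have hn : ∀ i, |(ω i).re| < 1 := fun i => (Complex.abs_re_le_norm _).trans_lt (h3 i)
  have e : 2 * (3 / 2 * tol Q) = 3 * tol Q := by ring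
  rw [Spread, Fintype.card_fin]
  constructor
  · intro l
    by_cases hl : l ∈ I
    · refine le_trans ?_ (h1 l hl)
      gcongr
      intro p hp
      simpa [wide, e, strip] using hp
    · rw [Finset.card_eq_zero.2]
      · simp only [Nat.cast_zero]; positivity
      · refine Finset.eq_empty_of_forall_notMem fun p hp => hl ?_
        simp only [wide, Finset.mem_filter, Finset.mem_univ, true_and, e] at hp
        exact natAbs_le_colBound (hn p) hp.1 hp.2
  · refine le_trans ?_ h2
    gcongr
    intro p hp
    simp only [zone, Finset.mem_filter, Finset.mem_univ, true_and, e, Set.mem_iUnion] at hp ⊢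
    obtain ⟨l, hl⟩ := hp
    rw [abs_le] at hl
    exact ⟨l, natAbs_le_colBound (hn p) (by linarith) (by nlinarith), by linarith, by linarith⟩

variable {E : Type*} [PseudoMetricSpace E]

/-- A uniformly continuous family of measure preserving maps of the disc. -/
structure IsSampler (K : Set E) (T : E → ℂ → ℂ) : Prop where
  compact : IsCompact K
  meas : ∀ k ∈ K, MeasurePreserving (T k) unif unif
  close : ∀ δ > 0, ∃ r > 0, ∀ k ∈ K, ∀ k' ∈ K, dist k k' < r → ∀ x, ‖x‖ < 1 → ‖T k x - T k' x‖ ≤ δ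

theorem IsSampler.ae_goodFor {K : Set E} {T : E → ℂ → ℂ} (h : IsSampler K T) (Q : ℕ) :
    ∀ᵐ ω ∂iid, ∀ᶠ N : ℕ in atTop, GoodFor Q K T fun i : Fin N => ω i := by
  obtain ⟨r, hr, hcl⟩ := h.close (tol Q) (tol_pos Q)
  obtain ⟨t, htK, ht⟩ := h.compact.elim_finite_subcover_image (b := K) (c := fun k => Metric.ball k r)
    (fun k _ => Metric.isOpen_ball) fun k hk =>
      Set.mem_iUnion₂.2 ⟨k, hk, Metric.mem_ball_self hr⟩
  have h1 : ∀ᵐ ω ∂iid, ∀ k ∈ t, ∀ᶠ N : ℕ in atTop,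
      Spread (dens Q) (wid Q) (3 / 2 * tol Q) fun i : Fin N => T k (ω i) := by
    refine (ae_ball_iff ht.1.countable).2 fun k hk => ?_
    exact (measurePreserving_iid (h.meas k (htK hk))).quasiMeasurePreserving.ae (ae_spread Q)
  filter_upwards [h1, ae_iid ae_unif_norm] with ω h1 h3
  filter_upwards [(eventually_all_finite ht.1).2 h1] with N h1 k hk
  obtain ⟨k', hk', hd⟩ := Set.mem_iUnion₂.1 (ht.2 hk)
  refine (h1 k' hk').of_near fun i => ?_
  refine (hcl k' (htK hk') k hk (by rwa [dist_comm]) _ (h3 i)).trans ?_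
  linarith

end Goodness

section Measurability
open ProbabilityTheory
variable {ι : Type*} [Fintype ι] [DecidableEq ι]

def SameOrder (X X' : ι → ℂ) : Prop := ∀ i j, key (X i) < key (X j) ↔ key (X' i) < key (X' j)

theorem SameOrder.tr_eq {X X' : ι → ℂ} (h : SameOrder X X') (hX : Function.Injective X)
    (hX' : Function.Injective X') (τ : ℂˣ) : tr τ X X' = 1 :=
  Subgroup.mem_bot.1 (tr_mem ⊥ hX hX' fun i j hij =>
    (lt_asymm hij.2 ((h i j).1 hij.1)).elim)

theorem SameOrder.mode_eq {X X' : ι → ℂ} (h : SameOrder X X') (m : ℕ) : mode m X = mode m X' := by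
  funext j
  rw [mode, mode, rk, rk, Finset.filter_congr fun k _ => h k j]

theorem SameOrder.low_eq {X X' : ι → ℂ} (h : SameOrder X X') (Q : ℕ) : low Q X = low Q X' := by
  ext y l; simp only [LinearMap.coe_comp, Function.comp_apply, low_apply, h.mode_eq]

theorem SameOrder.synth_eq {X X' : ι → ℂ} (h : SameOrder X X') (Q : ℕ) :
    synth Q X = synth Q X' :=
  LinearMap.ext fun c => by simp only [synth_apply, h.mode_eq]

theorem eventually_sameOrder {α : Type*} [TopologicalSpace α] {f : α → ι → ℂ} {x : α}
    (hf : ContinuousAt f x) (h : Function.Injective fun i => (f x i).re) :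
    ∀ᶠ y in 𝓝 x, SameOrder (f x) (f y) := by
  have hi : ∀ i, ContinuousAt (fun y => (f y i).re) x := fun i =>
    Complex.continuous_re.continuousAt.comp (continuousAt_pi.1 hf i)
  have : ∀ i j, ∀ᶠ y in 𝓝 x, key (f x i) < key (f x j) ↔ key (f y i) < key (f y j) := by
    intro i j
    by_cases hij : i = j
    · subst hij; simp
    rcases lt_or_gt_of_ne (h.ne hij) with h1 | h1
    · filter_upwards [(hi i).eventually_lt (hi j) h1] with y hy
      simp [key_lt, h1, hy]
    · filter_upwards [(hi j).eventually_lt (hi i) h1] with y hy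
      simp [key_lt, h1.not_gt, h1.ne', hy.not_gt, hy.ne']
  filter_upwards [eventually_all.2 fun i => eventually_all.2 (this i)] with y hy using hy

variable {a : ℂ ≃ₜ ℂ} (ha : ∀ x, 1 ≤ ‖x‖ → a x = x)
include ha

theorem continuous_alexPath : Continuous fun p : ℝ × (ι → ℂ) => alexPath a p.2 p.1 :=
  continuous_pi fun i => (isFam_alex ha).cont.comp (by fun_prop : Continuous
    fun p : ℝ × (ι → ℂ) => (p.1, p.2 i))

theorem eventually_dAt_eq (Q : ℕ) (κ : ℝ) {X : ι → ℂ} {t : ℝ} (ht : t ∈ Set.Icc (0:ℝ) 1)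
    (h0 : Function.Injective fun i => (X i).re)
    (h1 : Function.Injective fun i => (alexPath a X t i).re) :
    ∀ᶠ X' in 𝓝 X, dAt Q κ (alexPath a X') t = dAt Q κ (alexPath a X) t := by
  have hc := continuous_alexPath (ι := ι) ha
  have hinj : Function.Injective X := fun i j hij => h0 (by simp [hij])
  have h0' : Function.Injective fun i => (alexPath a X 0 i).re := by
    simpa [alexPath, alex_zero] using h0
  have hz : (0:ℝ) ∈ Set.Icc (0:ℝ) 1 := by simp
  obtain ⟨ρ, hρ, hball⟩ := Metric.nhds_basis_closedBall.mem_iff.1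
    (eventually_sameOrder (f := fun X : ι → ℂ => X) continuousAt_id h0)
  have hinj' : ∀ X' ∈ Metric.closedBall X ρ, Function.Injective X' := fun X' hX' i j hij => by
    by_contra hne
    have hs : SameOrder X X' := hball hX'
    have h2 := (hs i j).not.2 (by rw [hij]; exact lt_irrefl _)
    have h3 := (hs j i).not.2 (by rw [hij]; exact lt_irrefl _)
    exact hne (hinj (key_injective (le_antisymm (not_lt.1 h3) (not_lt.1 h2))))
  set K : Set (ℝ × (ι → ℂ)) := Set.Icc 0 1 ×ˢ Metric.closedBall X ρ
  have hpi : ∀ k ∈ K, Function.Injective (alexPath a k.2 k.1) := fun k hk =>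
    (alex a k.1).injective.comp (hinj' _ hk.2)
  obtain ⟨F, hF⟩ := exists_transport (R := ℂ) (tauOf κ (Fintype.card ι))
    (isCompact_Icc.prod (isCompact_closedBall X ρ))
    ((convex_Icc _ _).prod (convex_closedBall _ _)) hc.continuousOn hpi
  have hmem : ∀ᶠ X' in 𝓝 X, X' ∈ Metric.closedBall X ρ := Metric.closedBall_mem_nhds X hρ
  have hXb : X ∈ Metric.closedBall X ρ := Metric.mem_closedBall_self hρ.le
  have hhol : ∀ X' ∈ Metric.closedBall X ρ, hol (tauOf κ (Fintype.card ι)) (alexPath a X') t =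
      F (t, X') * (F (0, X'))⁻¹ := fun X' hX' =>
    hol_eq (F := fun s => F (s, X')) (hF.comp (p := fun s : ℝ => (s, X'))
      (by fun_prop) fun s hs => ⟨hs, hX'⟩) ht
  have key : ∀ s ∈ Set.Icc (0:ℝ) 1, (Function.Injective fun i => (alexPath a X s i).re) →
      ∀ᶠ X' in 𝓝 X, F (s, X') = F (s, X) ∧ SameOrder (alexPath a X s) (alexPath a X' s) := by
    intro s hs hre
    have hcs : ContinuousAt (fun X' : ι → ℂ => alexPath a X' s) X :=
      (hc.comp (by fun_prop : Continuous fun X' : ι → ℂ => (s, X'))).continuousAt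
    have h2 : Tendsto (fun X' : ι → ℂ => (s, X')) (𝓝 X) (𝓝[K] (s, X)) :=
      tendsto_nhdsWithin_iff.2 ⟨(by fun_prop : Continuous fun X' : ι → ℂ => (s, X')).continuousAt,
        hmem.mono fun X' hX' => ⟨hs, hX'⟩⟩
    filter_upwards [eventually_sameOrder hcs hre, hmem,
      h2.eventually (hF (s, X) ⟨hs, hXb⟩)] with X' h3 h4 h5
    refine ⟨?_, h3⟩
    rw [h5, h3.tr_eq (hpi (s, X) ⟨hs, hXb⟩) (hpi (s, X') ⟨hs, h4⟩), one_mul]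
  filter_upwards [key t ht h1, key 0 hz h0', hmem] with X' h2 h3 h4
  rw [dAt, dAt, hhol X' h4, hhol X hXb, h2.1, h3.1, h2.2.low_eq, h3.2.synth_eq]

theorem eventually_turn_eq (Q : ℕ) (κ : ℝ) (L : ℕ) {X : ι → ℂ}
    (h : ∀ i ≤ L, Function.Injective fun j => (alexPath a X (i / L) j).re) :
    ∀ᶠ X' in 𝓝 X, turn Q κ L (alexPath a X') = turn Q κ L (alexPath a X) := by
  rcases L.eq_zero_or_pos with rfl | hL
  · simp [turn]
  have h0 : Function.Injective fun i => (X i).re := by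
    simpa [alexPath, alex_zero] using h 0 (Nat.zero_le L)
  have hd : ∀ i ≤ L, ∀ᶠ X' in 𝓝 X, dAt Q κ (alexPath a X') ((i:ℕ) / L) =
      dAt Q κ (alexPath a X) ((i:ℕ) / L) := fun i hi => by
    refine eventually_dAt_eq ha Q κ ⟨by positivity, ?_⟩ h0 (h i hi)
    exact (div_le_one (by exact_mod_cast hL)).2 (by exact_mod_cast hi)
  have : ∀ᶠ X' in 𝓝 X, ∀ i ∈ Finset.range (L + 1), dAt Q κ (alexPath a X') ((i:ℕ) / L) =
      dAt Q κ (alexPath a X) ((i:ℕ) / L) :=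
    (Filter.eventually_all_finset _).2 fun i hi => hd i (Nat.lt_succ_iff.1 (Finset.mem_range.1 hi))
  filter_upwards [this] with X' hX'
  refine Finset.sum_congr rfl fun i hi => ?_
  rw [Finset.mem_range] at hi
  rw [hX' i (Finset.mem_range.2 (by omega)), hX' (i + 1) (Finset.mem_range.2 (by omega))]

end Measurability

section Average
open ProbabilityTheory

theorem unif_re_eq (c : ℝ) : unif {x : ℂ | x.re = c} = 0 := by
  have h : unif.real {x : ℂ | c ≤ x.re ∧ x.re ≤ c} ≤ c - c := unif_strip_le le_rfl
  rw [sub_self] at h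
  have h1 : unif.real {x : ℂ | c ≤ x.re ∧ x.re ≤ c} = 0 := le_antisymm h measureReal_nonneg
  have h2 : {x : ℂ | x.re = c} = {x : ℂ | c ≤ x.re ∧ x.re ≤ c} := by
    ext x; exact ⟨fun h => ⟨h.ge, h.le⟩, fun h => le_antisymm h.2 h.1⟩
  rwa [h2, ← measureReal_eq_zero_iff]

theorem ae_iid_re_ne {i j : ℕ} (hij : i ≠ j) : ∀ᵐ ω ∂iid, (ω i).re ≠ (ω j).re := by
  have hi : iIndepFun (fun (i : ℕ) (ω : ℕ → ℂ) => ω i) iid :=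
    iIndepFun_infinitePi (P := fun _ => unif) (X := fun _ x => x) fun _ => measurable_id
  have h1 := (indepFun_iff_map_prod_eq_prod_map_map (measurable_pi_apply i).aemeasurable
    (measurable_pi_apply j).aemeasurable).1 (hi.indepFun hij)
  rw [map_eval_iid, map_eval_iid] at h1
  have hms : MeasurableSet {p : ℂ × ℂ | ¬ p.1.re ≠ p.2.re} := by
    simp only [ne_eq, not_not]
    exact measurableSet_eq_fun (by fun_prop) (by fun_prop)
  have h2 : ∀ᵐ p ∂(unif.prod unif), p.1.re ≠ p.2.re := by
    rw [ae_iff, Measure.measure_prod_null hms]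
    refine ae_of_all _ fun x => ?_
    have := unif_re_eq x.re
    simpa [eq_comm] using this
  rw [← h1] at h2
  exact ae_of_ae_map (f := fun ω : ℕ → ℂ => (ω i, ω j)) (by fun_prop) h2

theorem ae_iid_injective : ∀ᵐ ω ∂iid, Function.Injective fun i => (ω i).re := by
  have : ∀ᵐ ω ∂iid, ∀ i j : ℕ, i ≠ j → (ω i).re ≠ (ω j).re :=
    ae_all_iff.2 fun i => ae_all_iff.2 fun j => by
      by_cases h : i = j
      · simp [h]
      · filter_upwards [ae_iid_re_ne h] with ω hω _ using hω
  filter_upwards [this] with ω hω i j hij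
  by_contra h
  exact hω i j h hij

theorem aestronglyMeasurable_of_eventually_eq {α : Type*} [TopologicalSpace α]
    [SecondCountableTopology α] [MeasurableSpace α] [BorelSpace α] {μ : Measure α} {f : α → ℝ}
    (h : ∀ᵐ x ∂μ, ∀ᶠ y in 𝓝 x, f y = f x) : AEStronglyMeasurable f μ := by
  set U := {x | ∀ᶠ y in 𝓝 x, f y = f x}
  have hU : IsOpen U := isOpen_iff_mem_nhds.2 fun x hx => by
    filter_upwards [hx.eventually_nhds, hx] with y hy hy'
    exact hy.mono fun z hz => hz.trans hy'.symm
  have hc : ContinuousOn f U := fun x hx =>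
    (tendsto_const_nhds.congr' (hx.mono fun y hy => hy.symm)).mono_left nhdsWithin_le_nhds
  have := hc.aestronglyMeasurable (μ := μ) hU.measurableSet
  rwa [Measure.restrict_eq_self_of_ae_mem (s := U) h] at this

/-- The twisting of the Alexander isotopy at the first points of a sequence. -/
noncomputable def sampleTurn (Q L N : ℕ) (a : ℂ ≃ₜ ℂ) (ω : ℕ → ℂ) : ℝ :=
  dturn Q L (alexPath a fun i : Fin N => ω i)

/-- The mean twisting of a homeomorphism. -/
noncomputable def mean (Q L N : ℕ) (a : ℂ ≃ₜ ℂ) : ℝ := ∫ ω, sampleTurn Q L N a ω ∂iid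

theorem aestronglyMeasurable_sampleTurn {a : ℂ ≃ₜ ℂ} (ha : ∀ x, 1 ≤ ‖x‖ → a x = x)
    (hm : ∀ t ∈ Set.Icc (0:ℝ) 1, MeasurePreserving (alex a t) unif unif) (Q L N : ℕ) :
    AEStronglyMeasurable (sampleTurn Q L N a) iid := by
  refine aestronglyMeasurable_of_eventually_eq ?_
  have h : ∀ᵐ ω ∂iid, ∀ i ∈ Finset.range (L + 1), Function.Injective fun j : ℕ =>
      (alex a ((i:ℕ) / L) (ω j)).re := by
    refine (ae_ball_iff (Finset.range (L + 1)).countable_toSet).2 fun i hi => ?_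
    have ht : ((i:ℕ) / L : ℝ) ∈ Set.Icc (0:ℝ) 1 := by
      refine ⟨by positivity, div_le_one_of_le₀ ?_ (by positivity)⟩
      have := Finset.mem_range.1 hi
      exact_mod_cast Nat.lt_succ_iff.1 this
    exact (measurePreserving_iid (hm _ ht)).quasiMeasurePreserving.ae ae_iid_injective
  filter_upwards [h] with ω hω
  have hc : Tendsto (fun (ω : ℕ → ℂ) (i : Fin N) => ω i) (𝓝 ω) (𝓝 fun i : Fin N => ω i) :=
    (by fun_prop : Continuous fun (ω : ℕ → ℂ) (i : Fin N) => ω i).continuousAt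
  have hi : ∀ i ≤ L, Function.Injective fun j : Fin N =>
      (alexPath a (fun i : Fin N => ω i) (i / L) j).re := fun i hi =>
    (hω i (Finset.mem_range.2 (by omega))).comp Fin.val_injective
  filter_upwards [hc.eventually (eventually_turn_eq ha Q (Q + 3 / 4) L hi),
    hc.eventually (eventually_turn_eq ha Q (Q + 1 / 4) L hi)] with ω' h1 h2
  simp only [sampleTurn, dturn, h1, h2]

theorem integrable_sampleTurn {a : ℂ ≃ₜ ℂ} (ha : ∀ x, 1 ≤ ‖x‖ → a x = x)
    (hm : ∀ t ∈ Set.Icc (0:ℝ) 1, MeasurePreserving (alex a t) unif unif) (Q L N : ℕ) :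
    Integrable (sampleTurn Q L N a) iid :=
  (integrable_const (2 * L * Real.pi)).mono' (aestronglyMeasurable_sampleTurn ha hm Q L N)
    (ae_of_all _ fun _ => abs_dturn_le _ _ _)

theorem eventually_integral_le {α : Type*} [MeasurableSpace α] {μ : Measure α}
    [IsProbabilityMeasure μ] {f : ℕ → α → ℝ} {B c : ℝ} (hf : ∀ N, AEStronglyMeasurable (f N) μ)
    (hB : ∀ N x, |f N x| ≤ B) (h : ∀ᵐ x ∂μ, ∀ᶠ N in atTop, f N x ≤ c) :
    ∀ᶠ N in atTop, ∫ x, f N x ∂μ ≤ c + 1 := by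
  have hm : ∀ N, AEStronglyMeasurable (fun x => max (f N x) c) μ := fun N =>
    (hf N).sup aestronglyMeasurable_const
  have hb : ∀ N x, ‖max (f N x) c‖ ≤ max B |c| := fun N x => by
    rcases max_choice (f N x) c with h | h <;> rw [h, Real.norm_eq_abs]
    · exact (hB N x).trans (le_max_left _ _)
    · exact le_max_right _ _
  have hl := tendsto_integral_of_dominated_convergence (μ := μ) (F := fun N x => max (f N x) c)
    (f := fun _ => c) (fun _ => max B |c|) hm (integrable_const _) (fun N => ae_of_all _ (hb N))
    (by
      filter_upwards [h] with x hx
      exact tendsto_const_nhds.congr' (hx.mono fun N hN => (max_eq_right hN).symm))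
  rw [integral_const, probReal_univ, one_smul] at hl
  filter_upwards [hl.eventually (Iio_mem_nhds (lt_add_one c))] with N hN
  refine le_trans (integral_mono ?_ ?_ fun x => le_max_left (f N x) c) (le_of_lt hN)
  · exact (integrable_const B).mono' (hf N) (ae_of_all _ (hB N))
  · exact (integrable_const _).mono' (hm N) (ae_of_all _ (hb N))

end Average

section Area
open ProbabilityTheory

theorem measurable_twist {θ : ℝ → ℝ} (hθ : Measurable θ) : Measurable fun x : ℂ => rotv (θ ‖x‖) x := by
  have h : Measurable fun x : ℂ => (θ ‖x‖, x) := (hθ.comp measurable_norm).prodMk measurable_id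
  have h2 := continuous_rotv.measurable
  have h3 := h2.comp h
  exact h3

theorem volume_preimage_twist {θ : ℝ → ℝ} (hθ : Measurable θ) {A : Set ℂ} (hA : MeasurableSet A) :
    volume ((fun x : ℂ => rotv (θ ‖x‖) x) ⁻¹' A) =
      ∫⁻ x : ℂ, ∫⁻ s : UnitAddCircle, A.indicator 1 ((AddCircle.toCircle s : ℂ) * x) := by
  have hrot : ∀ (t : ℝ) (x : ℂ), rotv t x = (AddCircle.toCircle (t : UnitAddCircle) : ℂ) * x :=
    fun t x => by rw [rotv, AddCircle.toCircle_apply_mk, Circle.coe_exp]; push_cast; simp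
  have hT := measurable_twist hθ
  have h1 : ∀ s : UnitAddCircle, volume ((fun x : ℂ => rotv (θ ‖x‖) x) ⁻¹' A) =
      ∫⁻ x : ℂ, A.indicator 1
        ((AddCircle.toCircle (((θ ‖x‖ : ℝ) : UnitAddCircle) + s) : ℂ) * x) := fun s => by
    rw [← lintegral_indicator_one (hT hA)]
    have hm := (rotation (AddCircle.toCircle s)).measurePreserving
    rw [← hm.lintegral_comp (measurable_one.indicator (hT hA))]
    refine lintegral_congr fun x => ?_
    have e : rotv (θ ‖(AddCircle.toCircle s : ℂ) * x‖) ((AddCircle.toCircle s : ℂ) * x) =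
        (AddCircle.toCircle (((θ ‖x‖ : ℝ) : UnitAddCircle) + s) : ℂ) * x := by
      rw [hrot, norm_mul, Circle.norm_coe, one_mul, AddCircle.toCircle_add, Circle.coe_mul, mul_assoc]
    rw [← e, rotation_apply]
    rfl
  have h2 : Measurable (Function.uncurry fun (s : UnitAddCircle) (x : ℂ) => A.indicator
      (1 : ℂ → ENNReal) ((AddCircle.toCircle (((θ ‖x‖ : ℝ) : UnitAddCircle) + s) : ℂ) * x)) := by
    refine (measurable_one.indicator hA : Measurable (A.indicator (1 : ℂ → ENNReal))).comp ?_
    have : Continuous fun p : UnitAddCircle × ℂ => (AddCircle.toCircle p.1 : ℂ) * p.2 := by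
      simp only [← Circle.smul_def, ← smul_eq_mul]
      exact (AddCircle.continuous_toCircle.comp continuous_fst).smul continuous_snd
    refine this.measurable.comp (Measurable.prodMk ?_ measurable_snd)
    have h3 : Measurable fun p : UnitAddCircle × ℂ => ((θ ‖p.2‖ : ℝ) : UnitAddCircle) :=
      (AddCircle.continuous_mk' (1:ℝ)).measurable.comp
        (hθ.comp (measurable_norm.comp measurable_snd))
    exact h3.add measurable_fst
  calc volume ((fun x : ℂ => rotv (θ ‖x‖) x) ⁻¹' A)
      = ∫⁻ _ : UnitAddCircle, volume ((fun x : ℂ => rotv (θ ‖x‖) x) ⁻¹' A) := by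
        rw [lintegral_const]; simp
    _ = _ := lintegral_congr h1
    _ = _ := lintegral_lintegral_swap h2.aemeasurable
    _ = _ := lintegral_congr fun x => lintegral_add_left_eq_self (μ := (volume : Measure UnitAddCircle))
        (fun s => A.indicator 1 ((AddCircle.toCircle s : ℂ) * x)) _

theorem measurePreserving_twist {θ : ℝ → ℝ} (hθ : Measurable θ) :
    MeasurePreserving (fun x : ℂ => rotv (θ ‖x‖) x) := by
  refine ⟨measurable_twist hθ, Measure.ext fun A hA => ?_⟩
  rw [Measure.map_apply (measurable_twist hθ) hA, volume_preimage_twist hθ hA,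
    ← volume_preimage_twist (θ := fun _ => 0) measurable_const hA]
  have : (fun x : ℂ => rotv 0 x) = id := funext fun x => by simp [rotv]
  rw [this, Set.preimage_id]

theorem measurePreserving_unif {T : ℂ → ℂ} (hT : MeasurePreserving T)
    (hb : ∀ x, ‖T x‖ < 1 ↔ ‖x‖ < 1) : MeasurePreserving T unif unif := by
  have h := hT.restrict_preimage (measurableSet_ball (x := (0:ℂ)) (ε := 1))
  have e : T ⁻¹' Metric.ball 0 1 = Metric.ball 0 1 := by ext x; simpa using hb x
  rw [e] at h
  exact h.smul_measure _

/-- Area preserving homeomorphisms of the plane supported in the disc. -/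
structure IsArea (a : ℂ ≃ₜ ℂ) : Prop where
  supp : ∀ x, 1 ≤ ‖x‖ → a x = x
  vol : MeasurePreserving a

theorem IsArea.refl : IsArea (Homeomorph.refl ℂ) := ⟨fun _ _ => rfl, MeasurePreserving.id _⟩

theorem IsArea.trans {a b : ℂ ≃ₜ ℂ} (ha : IsArea a) (hb : IsArea b) : IsArea (a.trans b) :=
  ⟨fun x hx => by rw [Homeomorph.trans_apply, ha.supp x hx, hb.supp x hx], hb.vol.comp ha.vol⟩

theorem IsArea.symm {a : ℂ ≃ₜ ℂ} (ha : IsArea a) : IsArea a.symm :=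
  ⟨fun x hx => by rw [Homeomorph.symm_apply_eq, ha.supp x hx],
    MeasurePreserving.symm a.toMeasurableEquiv ha.vol⟩

theorem IsArea.unif {a : ℂ ≃ₜ ℂ} (ha : IsArea a) : MeasurePreserving a unif unif :=
  measurePreserving_unif ha.vol fun x => by
    refine ⟨fun h => ?_, fun h => (isFam_const (E := ℝ) ha.supp).norm_lt (k := 0) h⟩
    by_contra hx
    rw [ha.supp x (not_lt.1 hx)] at h
    exact hx h

theorem isArea_rotH {θ : C(ℝ, ℝ)} (h : ∀ x, 1 ≤ x → θ x = 0) : IsArea (rotH θ) :=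
  ⟨fun x hx => by rw [rotH_apply, h _ hx, rotv_zero],
    measurePreserving_twist θ.continuous.measurable⟩

theorem IsArea.alex {a : ℂ ≃ₜ ℂ} (ha : IsArea a) (t : ℝ) : IsArea (alex a t) := by
  refine ⟨fun x hx => (isFam_alex ha.supp).supp t x hx, ?_⟩
  rcases le_or_gt t 0 with ht | ht
  · rw [alex_of_nonpos a ht]; exact IsArea.refl.vol
  set c := min t 1
  have hc : 0 < c := lt_min ht one_pos
  have e : ⇑(Braid.alex a t) = (c • ·) ∘ a ∘ (c⁻¹ • ·) := funext fun x => alex_apply a ht x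
  have hm : ∀ d : ℝ, Measurable (d • · : ℂ → ℂ) := fun d => measurable_const_smul d
  rw [e]
  refine ⟨(hm _).comp (ha.vol.measurable.comp (hm _)), ?_⟩
  rw [← Measure.map_map (hm _) (ha.vol.measurable.comp (hm _)), ← Measure.map_map ha.vol.measurable (hm _),
    Measure.map_addHaar_smul _ (inv_pos.2 hc).ne', Measure.map_smul, ha.vol.map_eq,
    Measure.map_smul, Measure.map_addHaar_smul _ hc.ne', smul_smul, ← ENNReal.ofReal_mul (abs_nonneg _),
    ← abs_mul, ← mul_inv, ← mul_pow, inv_mul_cancel₀ hc.ne']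
  simp

theorem isSampler_of_isFam {E : Type*} [NormedAddCommGroup E] [NormedSpace ℝ E] {K : Set E}
    (hK : IsCompact K) {Φ : E → ℂ ≃ₜ ℂ} (h : IsFam Φ) (hm : ∀ k ∈ K, IsArea (Φ k)) :
    IsSampler K fun k => Φ k where
  compact := hK
  meas k hk := (hm k hk).unif
  close δ hδ := by
    obtain ⟨r, hr, hcl⟩ := h.exists_close hK hδ
    exact ⟨r, hr, fun k hk k' hk' hd x _ => hcl k hk k' hk' hd x⟩

theorem isSampler_levelTwist {Ω : C(ℝ, ℝ)} {n : ℕ} (h0 : ∀ x, 0 ≤ Ω x) (hn : ∀ x, Ω x ≤ n)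
    (b : Fin (n + 1) → ℝ) : IsSampler (Set.Icc 0 b) (levelTwist Ω n) where
  compact := isCompact_Icc
  meas k _ := by
    refine measurePreserving_unif (measurePreserving_twist (θ := fun y => ∑ j, k j * split (Ω y)
      (fun i : Fin n => if (i : ℝ) + 1 ≤ Ω y then 1 else 0) j) ?_) fun x => by
        rw [levelTwist, norm_rotv]
    refine Finset.measurable_sum _ fun j _ => measurable_const.mul ?_
    have hi : ∀ i : Fin n, Measurable fun y => if (i : ℝ) + 1 ≤ Ω y then (1:ℝ) else 0 := fun i =>
      Measurable.ite (measurableSet_le measurable_const Ω.continuous.measurable)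
        measurable_const measurable_const
    refine Fin.cases ?_ (fun i => ?_) j
    · simp only [split, Fin.cons_zero]
      exact Ω.continuous.measurable.sub (Finset.measurable_sum _ fun i _ => hi i)
    · simpa only [split, Fin.cons_succ] using hi i
  close δ hδ := by
    have hπ := Real.pi_pos
    set C : ℝ := 2 * Real.pi * ((n + 1) * (2 * n + 1)) + 1
    have hC : 0 < C := by positivity
    refine ⟨δ / C, div_pos hδ hC, fun k _ k' _ hd x hx => ?_⟩
    set s := split (Ω ‖x‖) (fun i : Fin n => if (i : ℝ) + 1 ≤ Ω ‖x‖ then (1:ℝ) else 0) with hs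
    have hsj : ∀ j, |s j| ≤ 2 * n + 1 := by
      have h1 : ∀ i : Fin n, (0:ℝ) ≤ (if (i : ℝ) + 1 ≤ Ω ‖x‖ then (1:ℝ) else 0) ∧
          (if (i : ℝ) + 1 ≤ Ω ‖x‖ then (1:ℝ) else 0) ≤ 1 := fun i => by split_ifs <;> norm_num
      refine Fin.cases ?_ fun i => ?_
      · simp only [hs, split, Fin.cons_zero]
        have h2 := Finset.sum_nonneg fun i (_ : i ∈ Finset.univ) => (h1 i).1
        have h3 := Finset.sum_le_card_nsmul Finset.univ _ 1 fun i _ => (h1 i).2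
        rw [Finset.card_univ, Fintype.card_fin, nsmul_eq_mul, mul_one] at h3
        rw [abs_le]
        constructor <;> linarith [h0 ‖x‖, hn ‖x‖]
      · simp only [hs, split, Fin.cons_succ]
        rw [abs_of_nonneg (h1 i).1]
        linarith [(h1 i).2, (Nat.cast_nonneg n : (0:ℝ) ≤ n)]
    have hsum : |∑ j, k j * s j - ∑ j, k' j * s j| ≤ (n + 1) * (dist k k' * (2 * n + 1)) := by
      rw [← Finset.sum_sub_distrib]
      refine (Finset.abs_sum_le_sum_abs _ _).trans ((Finset.sum_le_card_nsmul _ _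
        (dist k k' * (2 * n + 1)) fun j _ => ?_).trans (by simp))
      rw [← sub_mul, abs_mul]
      gcongr
      · exact dist_le_pi_dist k k' j
      · exact hsj j
    rw [lt_div_iff₀ hC] at hd
    refine (norm_rotv_sub_le _ _ x).trans ?_
    calc _ ≤ 2 * Real.pi * ((n + 1) * (dist k k' * (2 * n + 1))) * 1 := by gcongr
      _ ≤ dist k k' * C := by
        have := dist_nonneg (x := k) (y := k')
        simp only [C]; nlinarith
      _ ≤ δ := hd.le

end Area

section Mean
open ProbabilityTheory
variable {a b : ℂ ≃ₜ ℂ} {Q : ℕ}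

theorem eventually_abs_integral_le {f : ℕ → (ℕ → ℂ) → ℝ} {B c : ℝ}
    (hf : ∀ N, AEStronglyMeasurable (f N) iid) (hB : ∀ N x, |f N x| ≤ B)
    (h : ∀ᵐ x ∂iid, ∀ᶠ N in atTop, |f N x| ≤ c) : ∀ᶠ N in atTop, |∫ x, f N x ∂iid| ≤ c + 1 := by
  filter_upwards [eventually_integral_le hf hB (h.mono fun x hx => hx.mono fun N => le_of_abs_le),
    eventually_integral_le (f := fun N x => -f N x) (fun N => (hf N).neg) (by simpa using hB)
      (h.mono fun x hx => hx.mono fun N => (neg_le_abs _).trans)] with N h1 h2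
  rw [integral_neg] at h2
  exact abs_le.2 ⟨by linarith, h1⟩

theorem ae_eventually_sample {p : ∀ N : ℕ, (Fin N → ℂ) → Prop} {M : ℕ}
    (h : ∀ᵐ ω ∂iid, ∀ᶠ N in atTop, M ≤ N → (Function.Injective fun i : Fin N => ω i) →
      p N fun i : Fin N => ω i) :
    ∀ᵐ ω ∂iid, ∀ᶠ N in atTop, p N fun i : Fin N => ω i := by
  filter_upwards [h, ae_iid_injective] with ω h1 h2
  filter_upwards [h1, eventually_ge_atTop M] with N h3 h4
  exact h3 h4 fun i j hij => Fin.ext (h2 (by simpa using congrArg Complex.re hij))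

theorem IsArea.aesm (ha : IsArea a) (Q L N : ℕ) : AEStronglyMeasurable (sampleTurn Q L N a) iid :=
  aestronglyMeasurable_sampleTurn ha.supp (fun t _ => (ha.alex t).unif) Q L N

theorem mean_trans (ha : IsArea a) (hb : IsArea b) (hQ : 1 ≤ Q) : ∀ᶠ L in atTop, ∀ᶠ N in atTop,
    |mean Q L N (a.trans b) - mean Q L N a - mean Q L N b| ≤ 6 * Q * Real.pi + 1 := by
  obtain ⟨L₀, h⟩ := exists_quasi ha.supp hb.supp hQ
  filter_upwards [eventually_ge_atTop L₀] with L hL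
  have hp := measurePreserving_iid ha.unif
  have hi := fun {c : ℂ ≃ₜ ℂ} (hc : IsArea c) N =>
    integrable_sampleTurn hc.supp (fun t _ => (hc.alex t).unif) Q L N
  have hs : IsSampler sq fun k => sqFam a b k := isSampler_of_isFam isCompact_sq
    (isFam_sqFam ha.supp hb.supp) fun k _ => (ha.alex k.2).trans (hb.alex k.1)
  have hib := fun N => hp.integrable_comp_of_integrable (hi hb N)
  have key := eventually_abs_integral_le (B := 6 * L * Real.pi) (c := 6 * Q * Real.pi)
    (f := fun N ω => sampleTurn Q L N (a.trans b) ω - sampleTurn Q L N a ω -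
      sampleTurn Q L N b fun i => a (ω i))
    (fun N => (((ha.trans hb).aesm Q L N).sub (ha.aesm Q L N)).sub (hib N).aestronglyMeasurable)
    (fun N ω => by
      refine (abs_sub _ _).trans ?_
      have h1 := abs_dturn_le Q L (alexPath (a.trans b) fun i : Fin N => ω i)
      have h2 := abs_dturn_le Q L (alexPath a fun i : Fin N => ω i)
      have h3 := abs_dturn_le Q L (alexPath b fun i : Fin N => a (ω i))
      have h4 := abs_sub (sampleTurn Q L N (a.trans b) ω) (sampleTurn Q L N a ω)
      unfold sampleTurn at *
      linarith)
    (ae_eventually_sample (M := 4 * (Q + 1))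
      (p := fun N X => |dturn Q L (alexPath (a.trans b) X) - dturn Q L (alexPath a X) -
        dturn Q L (alexPath b fun i => a (X i))| ≤ 6 * Q * Real.pi) <| by
      filter_upwards [hs.ae_goodFor Q] with ω hω
      filter_upwards [hω] with N hN hM hX
      have hM' : 4 * (Q + 1) ≤ Fintype.card (Fin N) := by simpa using hM
      exact h L hL hM' (fun i : Fin N => ω i) hX hN)
  filter_upwards [key] with N hN
  have e : ∫ ω, sampleTurn Q L N b (fun i => a (ω i)) ∂iid = mean Q L N b := by
    have := integral_map (f := sampleTurn Q L N b) hp.aemeasurable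
      (by rw [hp.map_eq]; exact hb.aesm Q L N)
    rw [hp.map_eq] at this
    exact this.symm
  have e2 := integral_sub ((hi (ha.trans hb) N).sub (hi ha N)) (hib N)
  have e3 := integral_sub (hi (ha.trans hb) N) (hi ha N)
  simp only [Pi.sub_apply, Function.comp_apply] at e2
  rwa [e2, e3, e] at hN

theorem eventually_abs_mean_le (ha : IsArea a) {B : ℝ} {L₀ : ℕ}
    (h : ∀ L ≥ L₀, ∀ {ι : Type} [Fintype ι] [DecidableEq ι],
      4 * (Q + 1) ≤ Fintype.card ι → ∀ X : ι → ℂ, Function.Injective X →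
      GoodFor Q (Set.Icc 0 1) (fun k => alex a k) X → |dturn Q L (alexPath a X)| ≤ B) :
    ∀ᶠ L in atTop, ∀ᶠ N in atTop, |mean Q L N a| ≤ B + 1 := by
  filter_upwards [eventually_ge_atTop L₀] with L hL
  refine eventually_abs_integral_le (ha.aesm Q L) (fun N ω => abs_dturn_le Q L _)
    (ae_eventually_sample (M := 4 * (Q + 1)) (p := fun N X => |dturn Q L (alexPath a X)| ≤ B) ?_)
  filter_upwards [(isSampler_of_isFam isCompact_Icc (isFam_alex ha.supp)
    fun k _ => ha.alex k).ae_goodFor Q] with ω hω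
  filter_upwards [hω] with N hN hM hX
  exact h L hL (by simpa using hM) _ hX hN

theorem mean_bounded (ha : IsArea a) (hQ : 1 ≤ Q) :
    ∃ B : ℝ, ∀ᶠ L in atTop, ∀ᶠ N in atTop, |mean Q L N a| ≤ B := by
  obtain ⟨B, L₀, h⟩ := exists_bound ha.supp hQ
  exact ⟨B + 1, eventually_abs_mean_le ha h⟩

theorem mean_small (ha : IsArea a) (hQ : 1 ≤ Q) (hs : ∀ x, ‖a x - x‖ ≤ tol Q / 2) :
    ∀ᶠ L in atTop, ∀ᶠ N in atTop, |mean Q L N a| ≤ (2 * Q + 2) * Real.pi + 1 := by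
  obtain ⟨L₀, h⟩ := exists_small ha.supp hQ hs
  exact eventually_abs_mean_le ha h

end Mean

section Twists
open ProbabilityTheory

/-- A cutoff profile: one near the origin, zero from radius `√(3 / (2 Q))` on. -/
noncomputable def bump (Q : ℕ) : C(ℝ, ℝ) where
  toFun x := max 0 (min 1 (9 - 6 * (Q * x ^ 2)))

variable {Q : ℕ}

theorem bump_apply (x : ℝ) : bump Q x = max 0 (min 1 (9 - 6 * (Q * x ^ 2))) := rfl

theorem bump_nonneg (x : ℝ) : 0 ≤ bump Q x := le_max_left _ _

theorem bump_le_one (x : ℝ) : bump Q x ≤ 1 := max_le zero_le_one (min_le_left _ _)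

theorem bump_eq_zero {x : ℝ} (h : 3 / 2 ≤ Q * x ^ 2) : bump Q x = 0 :=
  max_eq_left (min_le_of_right_le (by linarith))

theorem bump_eq_one {x : ℝ} (h : Q * x ^ 2 ≤ 4 / 3) : bump Q x = 1 := by
  rw [bump_apply, min_eq_left (by linarith), max_eq_right zero_le_one]

theorem bump_anti {x y : ℝ} (h0 : 0 ≤ x) (h : x ≤ y) : bump Q y ≤ bump Q x := by
  simp only [bump_apply]; gcongr

theorem bump_eq_zero_of_one_le (hQ : 8 ≤ Q) {x : ℝ} (h : 1 / 2 ≤ x) : bump Q x = 0 := by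
  have : (8:ℝ) ≤ Q := by exact_mod_cast hQ
  exact bump_eq_zero (by nlinarith)

theorem ae_above_bump (hQ : 8 ≤ Q) (n : ℕ) : ∀ᵐ ω ∂iid, ∀ᶠ N : ℕ in atTop,
    ∀ i : Fin n, 5 * N ≤ (4 * Q + 1) * (above ⇑(n • bump Q : C(ℝ, ℝ)) (fun i : Fin N => ω i) i).card ∧
      (4 * Q + 3) * (above ⇑(n • bump Q : C(ℝ, ℝ)) (fun i : Fin N => ω i) i).card ≤ 7 * N := by
  have hQ' : (8:ℝ) ≤ Q := by exact_mod_cast hQ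
  have hm : ∀ c : ℝ, MeasurableSet {x : ℂ | ‖x‖ ^ 2 < c} := fun c =>
    measurableSet_lt (by fun_prop) measurable_const
  have h1 : (5:ℝ) / (4 * Q + 1) < unif.real {x | ‖x‖ ^ 2 < 4 / (3 * Q)} := by
    rw [unif_real_disc (by positivity) (by rw [div_le_one (by positivity)]; linarith),
      div_lt_div_iff₀ (by positivity) (by positivity)]
    linarith
  have h2 : unif.real {x | ‖x‖ ^ 2 < 3 / (2 * Q)} < (7:ℝ) / (4 * Q + 3) := by
    rw [unif_real_disc (by positivity) (by rw [div_le_one (by positivity)]; linarith),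
      div_lt_div_iff₀ (by positivity) (by positivity)]
    linarith
  filter_upwards [ae_eventually_le_card (hm _) h1, ae_eventually_card_le (hm _) h2] with ω h3 h4
  filter_upwards [h3, h4] with N h3 h4 i
  have hn : (0:ℝ) < n := by exact_mod_cast i.pos
  have e : ∀ x, (n • bump Q : C(ℝ, ℝ)) x = n * bump Q x := fun x => by simp
  constructor
  · have : (Finset.univ.filter fun i : Fin N => ω i ∈ {x : ℂ | ‖x‖ ^ 2 < 4 / (3 * (Q:ℝ))}).card ≤
        (above ⇑(n • bump Q : C(ℝ, ℝ)) (fun i : Fin N => ω i) i).card := by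
      refine Finset.card_le_card fun p hp => mem_above.2 ?_
      have hp := (Finset.mem_filter.1 hp).2
      rw [Set.mem_ofPred_eq, lt_div_iff₀ (by positivity)] at hp
      rw [e, bump_eq_one (by linarith), mul_one]
      exact_mod_cast i.2
    have h5 := h3.trans (Nat.cast_le.2 this)
    rw [div_mul_eq_mul_div, div_le_iff₀ (by positivity)] at h5
    exact_mod_cast h5.trans_eq (mul_comm _ _)
  · have : (above ⇑(n • bump Q : C(ℝ, ℝ)) (fun i : Fin N => ω i) i).card ≤
        (Finset.univ.filter fun i : Fin N => ω i ∈ {x : ℂ | ‖x‖ ^ 2 < 3 / (2 * (Q:ℝ))}).card := by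
      refine Finset.card_le_card fun p hp => Finset.mem_filter.2 ⟨Finset.mem_univ _, ?_⟩
      have hp := mem_above.1 hp
      rw [Set.mem_ofPred_eq, lt_div_iff₀ (by positivity)]
      by_contra h
      rw [e, bump_eq_zero (by linarith), mul_zero] at hp
      linarith [(Nat.cast_nonneg i : (0:ℝ) ≤ (i:ℕ))]
    have h5 := (Nat.cast_le (α := ℝ)).2 this |>.trans h4
    rw [div_mul_eq_mul_div, le_div_iff₀ (by positivity)] at h5
    exact_mod_cast (mul_comm _ _).trans_le h5

theorem mean_bump (hQ : 8 ≤ Q) (n : ℕ) : ∀ᶠ L in atTop, ∀ᶠ N in atTop,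
    mean Q L N (rotH (n • bump Q)) ≤
      (4 * Q + 4) * Real.pi + twistErr Q - Real.pi * (n * (5 / (4 * Q + 1))) + 1 := by
  have hQ1 : 1 ≤ Q := by omega
  set Ω := n • bump Q with hΩ
  have e : ∀ x, Ω x = n * bump Q x := fun x => by simp [hΩ]
  have h0 : ∀ x, 0 ≤ Ω x := fun x => by rw [e]; exact mul_nonneg n.cast_nonneg (bump_nonneg x)
  have hn : ∀ x, Ω x ≤ n := fun x => by
    rw [e]; exact mul_le_of_le_one_right n.cast_nonneg (bump_le_one x)
  have h1 : ∀ x, 1 ≤ x → Ω x = 0 := fun x hx => by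
    rw [e, bump_eq_zero_of_one_le hQ (by linarith), mul_zero]
  have hmono : ∀ x y, 0 ≤ x → x ≤ y → Ω y ≤ Ω x := fun x y hx hxy => by
    rw [e, e]; exact mul_le_mul_of_nonneg_left (bump_anti hx hxy) n.cast_nonneg
  have hF := isFam_smul_rotH h1
  have hA : ∀ s : ℝ, IsArea (rotH (s • Ω)) := fun s => isArea_rotH fun x hx => by simp [h1 x hx]
  obtain ⟨L₀, hL₀⟩ := exists_isotopy hF
    (Homeomorph.ext fun x => by simp [rotH_apply, rotv_zero]) hQ1
  obtain ⟨r, hr, hcl⟩ := hF.exists_close isCompact_Icc (K := Set.Icc 0 1) (tol_pos Q)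
  obtain ⟨L₁, hL₁⟩ := exists_nat_gt (1 / r)
  filter_upwards [eventually_ge_atTop L₀, eventually_ge_atTop L₁, eventually_gt_atTop 0]
    with L hL hL1 hL2
  have hLr : 1 < r * L := by
    rw [div_lt_iff₀ hr] at hL₁
    have : (L₁ : ℝ) ≤ L := by exact_mod_cast hL1
    nlinarith
  refine eventually_integral_le ((isArea_rotH h1).aesm Q L) (fun N ω => abs_dturn_le Q L _) ?_
  have hs : IsSampler sq fun k : ℝ × ℝ => alex (rotH (k.1 • Ω)) k.2 :=
    isSampler_of_isFam isCompact_sq hF.alex fun k _ => (hA k.1).alex k.2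
  have hre0 : ∀ᵐ x ∂unif, x.re ≠ 0 := by rw [ae_iff]; simpa using unif_re_eq 0
  filter_upwards [hs.ae_goodFor Q, (isSampler_levelTwist h0 hn
    fun _ => ((n + 2 * Q + 1 : ℕ) : ℝ)).ae_goodFor Q, ae_iid_injective, ae_iid hre0,
    ae_above_bump hQ n] with ω hω1 hω2 hinj hre0 hω3
  filter_upwards [hω1, hω2, hω3, eventually_ge_atTop (8 * (Q + 1)), eventually_gt_atTop 0]
    with N h2 h3 h4 h5 h6
  set X := fun i : Fin N => ω i
  have hre : ∀ p q, (X p).re = (X q).re → p = q := fun p q h => Fin.ext (hinj h)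
  have hc : Fintype.card (Fin N) = N := Fintype.card_fin N
  have k1 := hL₀ L hL (by rw [hc]; omega) X (fun p q h => hre p q (by rw [h])) h2
  have k2 := dturn_twist h0 h1 hn hmono hQ1 (by rwa [hc]) hre (fun p => hre0 p) h3
    (by rw [hc]; exact h4) hr hcl hL2 hLr
  have k3 : n * (5 / (4 * Q + 1)) ≤
      ∑ i ∈ Finset.range n, ((above Ω X i).card / Fintype.card (Fin N) : ℝ) := by
    refine le_of_eq_of_le ?_ (Finset.card_nsmul_le_sum _ _ (5 / (4 * Q + 1) : ℝ) fun i hi => ?_)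
    · simp
    · have h7 : (5:ℝ) * N ≤ (4 * Q + 1) * (above Ω X i).card := by
        exact_mod_cast (h4 ⟨i, Finset.mem_range.1 hi⟩).1
      have : (0:ℝ) < N := by exact_mod_cast h6
      rw [hc, div_le_div_iff₀ (by positivity) this]
      linarith
  have k4 := mul_le_mul_of_nonneg_left k3 Real.pi_pos.le
  rw [one_smul] at k1
  have k5 := le_of_abs_le k1
  have k6 := le_of_abs_le k2
  change dturn Q L (alexPath (rotH Ω) X) ≤ _
  linarith

end Twists

section Tame
variable {a b : ℂ ≃ₜ ℂ} {Q : ℕ}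

/-- The filter of fine subdivisions and, after these, of large samples. -/
def fine : Filter (ℕ × ℕ) := atTop.curry atTop

instance : fine.NeBot := by
  refine ⟨fun h => ?_⟩
  have : ∀ᶠ p in fine, False := by rw [h]; exact eventually_bot
  rw [fine, eventually_curry_iff] at this
  exact this.exists.choose_spec.exists.choose_spec

theorem eventually_mean_trans (ha : IsArea a) (hb : IsArea b) (hQ : 1 ≤ Q) : ∀ᶠ p in fine,
    |mean Q p.1 p.2 (a.trans b) - mean Q p.1 p.2 a - mean Q p.1 p.2 b| ≤ 20 * Q := by
  rw [fine, eventually_curry_iff]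
  filter_upwards [mean_trans ha hb hQ] with L hL
  filter_upwards [hL] with N hN
  have : (1:ℝ) ≤ Q := by exact_mod_cast hQ
  nlinarith [Real.pi_lt_d2]

theorem eventually_mean_small (ha : IsArea a) (hQ : 1 ≤ Q) (hs : ∀ x, ‖a x - x‖ ≤ tol Q / 2) :
    ∀ᶠ p in fine, |mean Q p.1 p.2 a| ≤ 14 * Q := by
  rw [fine, eventually_curry_iff]
  filter_upwards [mean_small ha hQ hs] with L hL
  filter_upwards [hL] with N hN
  have : (1:ℝ) ≤ Q := by exact_mod_cast hQ
  nlinarith [Real.pi_lt_d2]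

theorem eventually_mean_symm (ha : IsArea a) (hQ : 1 ≤ Q) :
    ∀ᶠ p in fine, |mean Q p.1 p.2 a + mean Q p.1 p.2 a.symm| ≤ 34 * Q := by
  filter_upwards [eventually_mean_trans ha ha.symm hQ, eventually_mean_small IsArea.refl hQ
    fun x => by simpa using (half_pos (tol_pos Q)).le] with p h1 h2
  rw [Homeomorph.self_trans_symm] at h1
  rw [abs_le] at *
  constructor <;> linarith

/-- Homeomorphisms whose mean twisting grows at most linearly. -/
def Tame (a : ℂ ≃ₜ ℂ) : Prop :=
  ∃ m : ℝ, ∀ Q : ℕ, 1 ≤ Q → ∀ᶠ p in fine, |mean Q p.1 p.2 a| ≤ m * Q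

theorem tame_refl : Tame (Homeomorph.refl ℂ) :=
  ⟨14, fun Q hQ => eventually_mean_small IsArea.refl hQ fun x => by
    simpa using (half_pos (tol_pos Q)).le⟩

theorem Tame.trans (ha : IsArea a) (hb : IsArea b) (h : Tame a) (h' : Tame b) :
    Tame (a.trans b) := by
  obtain ⟨m, hm⟩ := h
  obtain ⟨n, hn⟩ := h'
  refine ⟨m + n + 20, fun Q hQ => ?_⟩
  filter_upwards [hm Q hQ, hn Q hQ, eventually_mean_trans ha hb hQ] with p h1 h2 h3
  rw [abs_le] at *
  constructor <;> linarith

theorem Tame.symm (ha : IsArea a) (h : Tame a) : Tame a.symm := by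
  obtain ⟨m, hm⟩ := h
  refine ⟨m + 34, fun Q hQ => ?_⟩
  filter_upwards [hm Q hQ, eventually_mean_symm ha hQ] with p h1 h2
  rw [abs_le] at *
  constructor <;> linarith

theorem Tame.conj (ha : IsArea a) (hb : IsArea b) (h : Tame a) :
    Tame ((b.symm.trans a).trans b) := by
  obtain ⟨m, hm⟩ := h
  refine ⟨m + 74, fun Q hQ => ?_⟩
  filter_upwards [hm Q hQ, eventually_mean_symm hb hQ, eventually_mean_trans hb.symm ha hQ,
    eventually_mean_trans (hb.symm.trans ha) hb hQ] with p h1 h2 h3 h4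
  rw [abs_le] at *
  constructor <;> linarith

theorem tame_commutator (ha : IsArea a) (hb : IsArea b) :
    Tame ((a.trans b).trans (a.symm.trans b.symm)) := by
  refine ⟨128, fun Q hQ => ?_⟩
  filter_upwards [eventually_mean_symm ha hQ, eventually_mean_symm hb hQ,
    eventually_mean_trans ha hb hQ, eventually_mean_trans ha.symm hb.symm hQ,
    eventually_mean_trans (ha.trans hb) (ha.symm.trans hb.symm) hQ] with p h1 h2 h3 h4 h5
  rw [abs_le] at *
  constructor <;> linarith

end Tame

section Wild

theorem exists_twisted {h : C(ℝ, ℝ)} (hh : ∀ x, 1 / 2 ≤ x → h x = 0) (Q : ℕ) :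
    ∃ Q' : ℕ, Q < Q' ∧ (∀ x : ℝ, Q' * x ^ 2 ≤ 2 → |x| ≤ tol Q / 4) ∧
      ∃ h' : C(ℝ, ℝ), (∀ x, 1 / 2 ≤ x → h' x = 0) ∧ (∀ x : ℝ, 2 ≤ Q' * x ^ 2 → h' x = h x) ∧
        ∀ᶠ p in fine, mean Q' p.1 p.2 (rotH h') ≤ -(Q' : ℝ) ^ 2 := by
  obtain ⟨M, hM⟩ := exists_nat_gt (2 / (tol Q / 4) ^ 2)
  have ht := tol_pos Q
  set Q' := max M (max (Q + 1) 8)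
  have h8 : 8 ≤ Q' := (le_max_right _ _).trans (le_max_right _ _)
  have hQ' : (0:ℝ) < Q' := by exact_mod_cast (by omega : 0 < Q')
  refine ⟨Q', (le_max_left (Q + 1) 8).trans (le_max_right _ _), fun x hx => ?_, ?_⟩
  · rw [div_lt_iff₀ (by positivity)] at hM
    have : (M:ℝ) ≤ Q' := by exact_mod_cast le_max_left _ _
    refine abs_le_of_sq_le_sq (le_of_mul_le_mul_left ?_ hQ') (by positivity)
    nlinarith [sq_nonneg (tol Q / 4)]
  have hA : ∀ {f : C(ℝ, ℝ)}, (∀ x, 1 / 2 ≤ x → f x = 0) → IsArea (rotH f) := fun hf =>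
    isArea_rotH fun x hx => hf x (by linarith)
  obtain ⟨B, hB⟩ := mean_bounded (hA hh) (by omega : 1 ≤ Q')
  have hc : 0 < Real.pi * (5 / (4 * Q' + 1)) := by positivity
  obtain ⟨n, hn⟩ := exists_nat_gt ((B + 20 * Q' + ((4 * Q' + 4) * Real.pi + twistErr Q' + 1) +
    (Q':ℝ) ^ 2) / (Real.pi * (5 / (4 * Q' + 1))))
  rw [div_lt_iff₀ hc] at hn
  have hb : ∀ x, 1 / 2 ≤ x → (n • bump Q') x = 0 := fun x hx => by
    simp [bump_eq_zero_of_one_le h8 hx]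
  refine ⟨n • bump Q' + h, fun x hx => by rw [ContinuousMap.add_apply, hb x hx, hh x hx, add_zero],
    fun x hx => ?_, ?_⟩
  · simp [bump_eq_zero (Q := Q') (x := x) (by linarith)]
  have e : rotH (n • bump Q' + h) = (rotH h).trans (rotH (n • bump Q')) := Homeomorph.ext fun x => by
    rw [Homeomorph.trans_apply, rotH_apply, rotH_apply, rotH_apply, norm_rotv,
      ContinuousMap.add_apply, rotv_add]
  have hB' : ∀ᶠ p in fine, |mean Q' p.1 p.2 (rotH h)| ≤ B := by
    rwa [fine, eventually_curry_iff]
  have hC := mean_bump h8 n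
  rw [← eventually_curry_iff (p := fun p : ℕ × ℕ => mean Q' p.1 p.2 (rotH (n • bump Q')) ≤ _)] at hC
  rw [e]
  filter_upwards [hB', hC, eventually_mean_trans (hA hh) (hA hb) (by omega : 1 ≤ Q')] with p h1 h2 h3
  rw [abs_le] at h1 h3
  linarith [mul_left_comm Real.pi (n:ℝ) (5 / (4 * Q' + 1))]

/-- Rotation of each circle around the origin, with no condition on the angle near the origin. -/
noncomputable def rotG (θ : ℝ → ℝ) (hθ : ContinuousOn θ {0}ᶜ) : ℂ ≃ₜ ℂ where
  toFun x := rotv (θ ‖x‖) x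
  invFun x := rotv (-θ ‖x‖) x
  left_inv x := by simp only [norm_rotv, ← rotv_add, neg_add_cancel, rotv_zero]
  right_inv x := by simp only [norm_rotv, ← rotv_add, add_neg_cancel, rotv_zero]
  continuous_toFun := continuous_twist hθ
  continuous_invFun := continuous_twist hθ.neg
where
  continuous_twist {θ : ℝ → ℝ} (hθ : ContinuousOn θ {0}ᶜ) :
      Continuous fun x : ℂ => rotv (θ ‖x‖) x := by
    refine continuous_iff_continuousAt.2 fun x => ?_
    rcases eq_or_ne x 0 with rfl | hx
    · rw [ContinuousAt, show rotv (θ ‖(0:ℂ)‖) 0 = 0 by simp [rotv]]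
      refine squeeze_zero_norm (fun x => (norm_rotv _ x).le) ?_
      simpa using (continuous_norm (E := ℂ)).tendsto 0
    · have h1 := (hθ.continuousAt (isOpen_compl_singleton.mem_nhds (norm_ne_zero_iff.2 hx)))
      have h2 : ContinuousAt (fun x : ℂ => θ ‖x‖) x := h1.comp continuous_norm.continuousAt
      unfold rotv
      fun_prop

theorem exists_profiles : ∃ (h : ℕ → C(ℝ, ℝ)) (q : ℕ → ℕ), StrictMono q ∧
    (∀ k x, 1 / 2 ≤ x → h k x = 0) ∧
    (∀ k (x : ℝ), q (k + 1) * x ^ 2 ≤ 2 → |x| ≤ tol (q k) / 4) ∧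
    (∀ k (x : ℝ), 2 ≤ q (k + 1) * x ^ 2 → h (k + 1) x = h k x) ∧
    ∀ k, ∀ᶠ p in fine, mean (q (k + 1)) p.1 p.2 (rotH (h (k + 1))) ≤ -(q (k + 1) : ℝ) ^ 2 := by
  let S := {s : C(ℝ, ℝ) × ℕ // ∀ x, 1 / 2 ≤ x → s.1 x = 0}
  have step : ∀ s : S, ∃ s' : S, s.1.2 < s'.1.2 ∧ (∀ x : ℝ, s'.1.2 * x ^ 2 ≤ 2 → |x| ≤ tol s.1.2 / 4) ∧
      (∀ x : ℝ, 2 ≤ s'.1.2 * x ^ 2 → s'.1.1 x = s.1.1 x) ∧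
      ∀ᶠ p in fine, mean s'.1.2 p.1 p.2 (rotH s'.1.1) ≤ -(s'.1.2 : ℝ) ^ 2 := fun s => by
    obtain ⟨Q', h1, h2, h', h3, h4, h5⟩ := exists_twisted s.2 s.1.2
    exact ⟨⟨(h', Q'), h3⟩, h1, h2, h4, h5⟩
  choose next h1 h2 h3 h4 using step
  let s : ℕ → S := fun k => next^[k] ⟨(0, 0), fun _ _ => rfl⟩
  have hs : ∀ k, s (k + 1) = next (s k) := fun k => Function.iterate_succ_apply' _ _ _
  refine ⟨fun k => (s k).1.1, fun k => (s k).1.2, strictMono_nat_of_lt_succ fun k => ?_,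
    fun k => (s k).2, fun k => ?_, fun k => ?_, fun k => ?_⟩ <;> simp only [hs]
  exacts [h1 _, h2 _, h3 _, h4 _]

theorem exists_wild : ∃ g : ℂ ≃ₜ ℂ, IsArea g ∧ (∀ x, 1 / 2 ≤ ‖x‖ → g x = x) ∧ ¬ Tame g := by
  obtain ⟨h, q, hq, hh, htol, hagree, hmean⟩ := exists_profiles
  have hst : ∀ k j, k ≤ j → ∀ x : ℝ, 2 ≤ q (k + 1) * x ^ 2 → h j x = h k x := by
    intro k j hkj x hx
    induction j, hkj using Nat.le_induction with
    | base => rfl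
    | succ j hkj ih =>
      have h1 : (q (k + 1) : ℝ) ≤ q (j + 1) := by exact_mod_cast hq.monotone (by omega)
      rw [← ih, hagree j x (hx.trans (by gcongr))]
  let θ : ℝ → ℝ := fun x => h ⌈2 / x ^ 2⌉₊ x
  have hθ : ∀ k (x : ℝ), 2 ≤ q (k + 1) * x ^ 2 → θ x = h k x := by
    intro k x hx
    have hx0 : 0 < x ^ 2 := by
      by_contra h0
      have : x ^ 2 = 0 := le_antisymm (not_lt.1 h0) (sq_nonneg x)
      rw [this] at hx; norm_num at hx
    set K := ⌈2 / x ^ 2⌉₊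
    have h1 : 2 / x ^ 2 ≤ q (K + 1) := (Nat.le_ceil _).trans (by
      exact_mod_cast (Nat.le_succ K).trans (hq.le_apply (x := K + 1)))
    rw [div_le_iff₀ hx0] at h1
    exact (hst K _ (le_max_right k K) x h1).symm.trans (hst k _ (le_max_left k K) x hx)
  have hcont : ContinuousOn θ {0}ᶜ := fun x hx => by
    have hx0 : 0 < x ^ 2 := by have : x ≠ 0 := hx; positivity
    obtain ⟨k, hk⟩ := exists_nat_gt (2 / x ^ 2)
    have h1 : 2 < q (k + 1) * x ^ 2 := by
      rw [div_lt_iff₀ hx0] at hk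
      refine hk.trans_le ?_
      gcongr
      exact (Nat.le_succ k).trans (hq.le_apply (x := k + 1))
    refine ContinuousAt.continuousWithinAt (((h k).continuous.continuousAt (x := x)).congr ?_)
    have h2 : ∀ᶠ y : ℝ in 𝓝 x, 2 < q (k + 1) * y ^ 2 :=
      (by fun_prop : Continuous fun y : ℝ => (q (k + 1) : ℝ) * y ^ 2).continuousAt.eventually
        (lt_mem_nhds h1)
    filter_upwards [h2] with y hy using (hθ k y hy.le).symm
  obtain ⟨g, hgx⟩ : ∃ g : ℂ ≃ₜ ℂ, ∀ x, g x = rotv (θ ‖x‖) x := ⟨rotG θ hcont, fun x => rfl⟩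
  have hsupp : ∀ x, 1 / 2 ≤ ‖x‖ → g x = x := fun x hx => by
    rw [hgx, show θ ‖x‖ = 0 from hh _ _ hx, rotv_zero]
  have hA : IsArea g := ⟨fun x hx => hsupp x (by linarith),
    (funext hgx : ⇑g = _) ▸
      measurePreserving_twist (measurable_of_continuousOn_compl_singleton 0 hcont)⟩
  refine ⟨g, hA, hsupp, fun ⟨m, hm⟩ => ?_⟩
  obtain ⟨k, hk⟩ := exists_nat_gt (34 + m)
  have hqk : k + 1 ≤ q (k + 1) := hq.le_apply
  have hq1 : 1 ≤ q (k + 1) := by omega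
  have hAk : IsArea (rotH (h (k + 1))) := isArea_rotH fun x hx => hh _ x (by linarith)
  obtain ⟨t, ht⟩ : ∃ t, t = g.trans (rotH (h (k + 1))).symm := ⟨_, rfl⟩
  have htx : ∀ x, rotH (h (k + 1)) (t x) = g x := fun x =>
    ht ▸ (rotH (h (k + 1))).apply_symm_apply _
  have hAt : IsArea t := ht ▸ hA.trans hAk.symm
  have hts : ∀ x, ‖t x - x‖ ≤ tol (q (k + 1)) / 2 := fun x => by
    rcases le_total 2 (q (k + 2) * ‖x‖ ^ 2) with h2 | h2
    · have : t x = x := by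
        rw [← (rotH (h (k + 1))).injective.eq_iff, htx, hgx, rotH_apply, hθ _ _ h2]
      rw [this, sub_self, norm_zero]
      exact (half_pos (tol_pos _)).le
    · have h3 : ‖x‖ ≤ tol (q (k + 1)) / 4 := by simpa using htol _ _ h2
      have h4 : ‖t x‖ = ‖x‖ := by
        rw [← norm_rotv (θ ‖x‖) x, ← hgx, ← htx, rotH_apply, norm_rotv]
      linarith [norm_sub_le (t x) x]
  have e : g = t.trans (rotH (h (k + 1))) := Homeomorph.ext fun x => (htx x).symm
  obtain ⟨p, h1, h2, h3, h4⟩ := ((hm _ hq1).and ((eventually_mean_small hAt hq1 hts).and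
    ((eventually_mean_trans hAt hAk hq1).and (hmean k)))).exists
  rw [← e] at h3
  have h5 : (k:ℝ) + 1 ≤ q (k + 1) := by exact_mod_cast hqk
  rw [abs_le] at h1 h2 h3
  nlinarith

theorem exists_not_comm : ∃ a b : ℂ ≃ₜ ℂ, IsArea a ∧ IsArea b ∧
    (∀ x, 15 / 16 ≤ ‖x‖ → a x = x ∧ b x = x) ∧ ∃ y, b (a y) ≠ a (b y) := by
  set θ : C(ℝ, ℝ) := (1 / 2 : ℝ) • bump 8
  have h0 : ∀ x : ℂ, 7 / 16 ≤ ‖x‖ → rotH θ x = x := fun x hx => by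
    have : θ ‖x‖ = 0 := by
      simp only [θ, ContinuousMap.smul_apply]
      rw [bump_eq_zero, smul_zero]
      norm_num
      nlinarith
    rw [rotH_apply, this, rotv_zero]
  have h1 : ∀ x : ℂ, ‖x‖ = 1 / 4 → rotH θ x = -x := fun x hx => by
    have : θ ‖x‖ = 1 / 2 := by
      simp only [θ, ContinuousMap.smul_apply]
      rw [bump_eq_one, smul_eq_mul, mul_one]
      rw [hx]; norm_num
    rw [rotH_apply, this, rotv]
    have : (2 * Real.pi * ((1 / 2 : ℝ) : ℂ) * Complex.I) = Real.pi * Complex.I := by push_cast; ring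
    rw [this, Complex.exp_pi_mul_I, neg_one_mul]
  have hA : IsArea (rotH θ) := isArea_rotH fun x hx => by
    simp [θ, bump_eq_zero_of_one_le le_rfl (by linarith : 1 / 2 ≤ x)]
  set b : ℂ ≃ₜ ℂ := ((Homeomorph.addRight (-(1 / 2))).trans (rotH θ)).trans (Homeomorph.addRight (1 / 2))
  have hb : ∀ x, b x = rotH θ (x + -(1 / 2)) + 1 / 2 := fun x => rfl
  have hb0 : ∀ x : ℂ, 15 / 16 ≤ ‖x‖ → b x = x := fun x hx => by
    have := norm_sub_norm_le x (1 / 2)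
    norm_num at this
    rw [hb, h0 _ (by rw [← sub_eq_add_neg]; norm_num; linarith)]
    ring
  refine ⟨rotH θ, b, hA, ⟨fun x hx => hb0 x (by linarith), ?_⟩,
    fun x hx => ⟨h0 x (by linarith), hb0 x hx⟩, 1 / 4, ?_⟩
  · exact (measurePreserving_add_right volume _).comp
      (hA.vol.comp (measurePreserving_add_right volume _))
  · rw [h1 _ (by norm_num), hb, hb, h0 (-(1 / 4) + -(1 / 2)) (by norm_num),
      h1 (1 / 4 + -(1 / 2)) (by norm_num), h0 _ (by norm_num)]
    norm_num

end Wild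

section Disc

/-- The disc inside the complex plane. -/
noncomputable def toC (x : ↥Disc) : ℂ := Complex.orthonormalBasisOneI.repr.symm x

theorem norm_toC_lt (x : ↥Disc) : ‖toC x‖ < 1 := by
  rw [toC, LinearIsometryEquiv.norm_map]; exact mem_ball_zero_iff.1 x.2

theorem isOpenEmbedding_toC : IsOpenEmbedding toC :=
  Complex.orthonormalBasisOneI.repr.symm.toHomeomorph.isOpenEmbedding.comp
    Metric.isOpen_ball.isOpenEmbedding_subtypeVal

theorem range_toC : Set.range toC = Metric.ball 0 1 := by
  ext z
  refine ⟨?_, fun hz => ⟨⟨Complex.orthonormalBasisOneI.repr z, ?_⟩, ?_⟩⟩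
  · rintro ⟨x, rfl⟩; exact mem_ball_zero_iff.2 (norm_toC_lt x)
  · rw [Disc, mem_ball_zero_iff, LinearIsometryEquiv.norm_map]; exact mem_ball_zero_iff.1 hz
  · exact LinearIsometryEquiv.symm_apply_apply _ _

theorem map_toC : discMeasure.map toC = volume.restrict (Metric.ball 0 1) := by
  have he := Complex.orthonormalBasisOneI.measurePreserving_repr_symm
  have hD : MeasurableSet Disc := measurableSet_ball
  have h1 : discMeasure.map Subtype.val = volume.restrict Disc := by
    rw [discMeasure, (MeasurableEmbedding.subtype_coe hD).map_comap, Subtype.range_coe]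
  have h2 := he.restrict_preimage (measurableSet_ball (x := (0:ℂ)) (ε := 1))
  have h3 : toC = Complex.orthonormalBasisOneI.repr.symm ∘ Subtype.val := rfl
  rw [h3, ← Measure.map_map he.measurable measurable_subtype_coe, h1, ← h2.map_eq]
  congr 2
  ext x
  simp [Disc]

/-- The disc as a subtype of the complex plane. -/
noncomputable def discEquiv : ↥Disc ≃ {z : ℂ // z ∈ Set.range toC} :=
  Equiv.ofInjective toC isOpenEmbedding_toC.injective

noncomputable instance : DecidablePred fun z : ℂ => z ∈ Set.range toC := Classical.decPred _

/-- Extension by the identity. -/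
noncomputable def extend (f : Equiv.Perm ↥Disc) : Equiv.Perm ℂ :=
  f.extendDomain discEquiv

theorem extend_toC (f : Equiv.Perm ↥Disc) (x : ↥Disc) : extend f (toC x) = toC (f x) :=
  Equiv.Perm.extendDomain_apply_image _ _ _

theorem extend_of_le (f : Equiv.Perm ↥Disc) {z : ℂ} (h : 1 ≤ ‖z‖) : extend f z = z :=
  Equiv.Perm.extendDomain_apply_not_subtype _ _ fun hz => by
    rw [range_toC, mem_ball_zero_iff] at hz; exact hz.not_ge h

theorem measurePreserving_iff {f : ↥Disc → ↥Disc} {a : ℂ → ℂ} (hf : Measurable f)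
    (ha : Measurable a) (h : ∀ x, a (toC x) = toC (f x)) (hs : ∀ z, 1 ≤ ‖z‖ → a z = z) :
    MeasurePreserving f discMeasure discMeasure ↔ MeasurePreserving a := by
  have hm := isOpenEmbedding_toC.measurableEmbedding
  have hB : MeasurableSet (Metric.ball (0:ℂ) 1) := measurableSet_ball
  have hc : (volume.restrict (Metric.ball (0:ℂ) 1)).map a = (discMeasure.map f).map toC := by
    rw [← map_toC, Measure.map_map ha hm.measurable, Measure.map_map hm.measurable hf]
    exact congrArg (Measure.map · _) (funext h)
  have hpre : a ⁻¹' Metric.ball 0 1 = Metric.ball 0 1 := by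
    ext z
    by_cases hz : z ∈ Set.range toC
    · obtain ⟨x, rfl⟩ := hz
      simp [h, norm_toC_lt]
    · rw [range_toC, mem_ball_zero_iff, not_lt] at hz
      simp [hs z hz]
  constructor
  · intro hf'
    refine ⟨ha, ?_⟩
    have h1 : (volume.restrict (Metric.ball (0:ℂ) 1)ᶜ).map a =
        volume.restrict (Metric.ball (0:ℂ) 1)ᶜ := by
      rw [Measure.map_congr (g := id), Measure.map_id]
      filter_upwards [ae_restrict_mem hB.compl] with z hz
      exact hs z (by simpa using hz)
    rw [← Measure.restrict_add_restrict_compl (μ := volume) hB, Measure.map_add _ _ ha, hc, h1,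
      hf'.map_eq, map_toC]
  · intro ha'
    refine ⟨hf, ?_⟩
    have h1 := (ha'.restrict_preimage hB).map_eq
    rw [hpre, hc, ← map_toC] at h1
    rw [← hm.comap_map (discMeasure.map f), h1, hm.comap_map]

theorem continuous_extend {f : Equiv.Perm ↥Disc} (hf : Continuous f) {K : Set ↥Disc}
    (hK : IsCompact K) (hfK : ∀ x ∉ K, f x = x) : Continuous (extend f) := by
  refine continuous_iff_continuousAt.2 fun z => ?_
  by_cases hz : z ∈ Set.range toC
  · obtain ⟨x, rfl⟩ := hz
    rw [← isOpenEmbedding_toC.continuousAt_iff,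
      show extend f ∘ toC = toC ∘ f from funext fun x => extend_toC f x]
    exact (isOpenEmbedding_toC.continuous.comp hf).continuousAt
  · have hcl := (hK.image isOpenEmbedding_toC.continuous).isClosed
    refine continuousAt_id.congr ?_
    filter_upwards [hcl.isOpen_compl.mem_nhds fun ⟨x, _, hx⟩ => hz ⟨x, hx⟩] with w hw
    by_cases hw' : w ∈ Set.range toC
    · obtain ⟨x, rfl⟩ := hw'
      rw [extend_toC, hfK x fun hx => hw ⟨x, hx, rfl⟩, id]
    · rw [range_toC, mem_ball_zero_iff, not_lt] at hw'
      rw [extend_of_le f hw', id]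

theorem exists_extension {f : Equiv.Perm ↥Disc} (h : IsCptAreaPresHomeo f) :
    ∃ a : ℂ ≃ₜ ℂ, IsArea a ∧ a.toEquiv = extend f := by
  obtain ⟨h1, h2, h3, K, hK, hfK⟩ := h
  have hc := continuous_extend h1 hK hfK
  refine ⟨⟨extend f, hc, continuous_extend (f := f⁻¹) h2 hK fun x hx => ?_⟩,
    ⟨fun z hz => extend_of_le f hz, ?_⟩, rfl⟩
  · exact f.symm_apply_eq.2 (hfK x hx).symm
  · exact (measurePreserving_iff h1.measurable hc.measurable (extend_toC f)
      fun z hz => extend_of_le f hz).1 h3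

theorem exists_restriction {a : ℂ ≃ₜ ℂ} (ha : IsArea a) {r : ℝ} (hr : r < 1)
    (h : ∀ x, r ≤ ‖x‖ → a x = x) : ∃ f, IsCptAreaPresHomeo f ∧ a.toEquiv = extend f := by
  have hmem : ∀ z, z ∈ Set.range toC ↔ a z ∈ Set.range toC := fun z => by
    simp only [range_toC, mem_ball_zero_iff]
    refine ⟨(isFam_const (E := ℝ) ha.supp).norm_lt (k := 0), fun hz => ?_⟩
    by_contra hn
    rw [ha.supp z (not_lt.1 hn)] at hz
    exact hn hz
  set f : Equiv.Perm ↥Disc := discEquiv.symm.permCongr (a.toEquiv.subtypeEquiv hmem)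
  have hf : ∀ x, toC (f x) = a (toC x) := fun x =>
    congrArg Subtype.val (discEquiv.apply_symm_apply (a.toEquiv.subtypeEquiv hmem (discEquiv x)))
  have hf' : ∀ x, toC (f.symm x) = a.symm (toC x) := fun x => by
    rw [Homeomorph.eq_symm_apply, ← hf, f.apply_symm_apply]
  have hc : Continuous f := isOpenEmbedding_toC.isInducing.continuous_iff.2 (by
    rw [show toC ∘ f = a ∘ toC from funext hf]
    exact a.continuous.comp isOpenEmbedding_toC.continuous)
  refine ⟨f, ⟨hc, isOpenEmbedding_toC.isInducing.continuous_iff.2 ?_,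
    (measurePreserving_iff hc.measurable a.continuous.measurable (fun x => (hf x).symm) ha.supp).2
      ha.vol, toC ⁻¹' Metric.closedBall 0 r, ?_, fun x hx => ?_⟩, Equiv.ext fun z => ?_⟩
  · rw [show toC ∘ f.symm = a.symm ∘ toC from funext hf']
    exact a.symm.continuous.comp isOpenEmbedding_toC.continuous
  · refine isOpenEmbedding_toC.isInducing.isCompact_preimage' (isCompact_closedBall _ _) ?_
    rw [range_toC]
    exact Metric.closedBall_subset_ball hr
  · rw [Set.mem_preimage, mem_closedBall_zero_iff, not_le] at hx
    exact isOpenEmbedding_toC.injective (by rw [hf, h _ hx.le])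
  · by_cases hz : z ∈ Set.range toC
    · obtain ⟨x, rfl⟩ := hz
      rw [extend_toC, hf]; rfl
    · rw [range_toC, mem_ball_zero_iff, not_lt] at hz
      rw [extend_of_le f hz]; exact ha.supp z hz

theorem _root_.IsCptAreaPresHomeo.mul {f g : Equiv.Perm ↥Disc} (hf : IsCptAreaPresHomeo f)
    (hg : IsCptAreaPresHomeo g) : IsCptAreaPresHomeo (f * g) := by
  obtain ⟨h1, h2, h3, K, hK, hfK⟩ := hf
  obtain ⟨h1', h2', h3', K', hK', hfK'⟩ := hg
  refine ⟨h1.comp h1', h2'.comp h2, h3.comp h3', K ∪ K', hK.union hK', fun x hx => ?_⟩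
  rw [Set.mem_union, not_or] at hx
  rw [Equiv.Perm.mul_apply, hfK' x hx.2, hfK x hx.1]

theorem _root_.IsCptAreaPresHomeo.inv {f : Equiv.Perm ↥Disc} (hf : IsCptAreaPresHomeo f) :
    IsCptAreaPresHomeo f⁻¹ := by
  obtain ⟨h1, h2, h3, K, hK, hfK⟩ := hf
  exact ⟨h2, h1, h3.symm (Homeomorph.mk f h1 h2).toMeasurableEquiv, K, hK, fun x hx =>
    f.symm_apply_eq.2 (hfK x hx).symm⟩

theorem extend_mul (f g : Equiv.Perm ↥Disc) : extend (f * g) = extend f * extend g :=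
  (Equiv.Perm.extendDomain_mul _ _ _).symm

theorem extend_inv (f : Equiv.Perm ↥Disc) : extend f⁻¹ = (extend f)⁻¹ := rfl

theorem extend_one : extend 1 = 1 := Equiv.Perm.extendDomain_one _

end Disc

end Braid

/-- The Simplicity Conjecture: the group of compactly supported area-preserving
homeomorphisms of the open unit disc is not simple.  There is a subset `N` of this group,
containing the identity, closed under composition, inverses, and conjugation by group
elements (i.e. a normal subgroup), which is neither the trivial subgroup nor the whole
group. -/
theorem simplicity_conjecture :
    ∃ N : Set (Equiv.Perm ↥Disc),
      N ⊆ {f | IsCptAreaPresHomeo f} ∧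
      (1 : Equiv.Perm ↥Disc) ∈ N ∧
      (∀ a ∈ N, ∀ b ∈ N, a * b ∈ N) ∧
      (∀ a ∈ N, a⁻¹ ∈ N) ∧
      (∀ g, IsCptAreaPresHomeo g → ∀ n ∈ N, g * n * g⁻¹ ∈ N) ∧
      N ≠ {1} ∧
      N ≠ {f | IsCptAreaPresHomeo f} := by
  obtain ⟨a, b, ha, hb, hab, y, hy⟩ := Braid.exists_not_comm
  obtain ⟨g, hg, hgs, hwild⟩ := Braid.exists_wild
  refine ⟨{f | IsCptAreaPresHomeo f ∧ ∃ a : ℂ ≃ₜ ℂ, Braid.IsArea a ∧ Braid.Tame a ∧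
    a.toEquiv = Braid.extend f}, fun f hf => hf.1, ⟨?_, Homeomorph.refl ℂ, Braid.IsArea.refl,
      Braid.tame_refl, Braid.extend_one.symm⟩, ?_, ?_, ?_, fun h => ?_, fun h => ?_⟩
  · exact ⟨continuous_id, continuous_id, MeasurePreserving.id _, ∅, isCompact_empty, fun _ _ => rfl⟩
  · rintro f ⟨hf, a, ha, hat, haf⟩ f' ⟨hf', b, hb, hbt, hbf⟩
    exact ⟨hf.mul hf', b.trans a, hb.trans ha, hbt.trans hb ha hat, by
      rw [Braid.extend_mul, ← haf, ← hbf]; rfl⟩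
  · rintro f ⟨hf, a, ha, hat, haf⟩
    exact ⟨hf.inv, a.symm, ha.symm, hat.symm ha, by rw [Braid.extend_inv, ← haf]; rfl⟩
  · rintro f hf f' ⟨hf', a, ha, hat, haf⟩
    obtain ⟨b, hb, hbf⟩ := Braid.exists_extension hf
    exact ⟨(hf.mul hf').mul hf.inv, (b.symm.trans a).trans b, (hb.symm.trans ha).trans hb,
      hat.conj ha hb, by
        rw [Braid.extend_mul, Braid.extend_mul, Braid.extend_inv, ← haf, ← hbf]; rfl⟩
  · have hc := (ha.trans hb).trans (ha.symm.trans hb.symm)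
    obtain ⟨f, hf, hcf⟩ := Braid.exists_restriction hc (r := 15 / 16) (by norm_num) fun x hx => by
      simp only [Homeomorph.trans_apply]
      rw [(hab x hx).1, (hab x hx).2, Homeomorph.symm_apply_eq, Homeomorph.symm_apply_eq,
        (hab x hx).2, (hab x hx).1]
    have h1 : f = 1 := h.subset ⟨hf, _, hc, Braid.tame_commutator ha hb, hcf⟩
    rw [h1, Braid.extend_one] at hcf
    have h2 : b.symm (a.symm (b (a y))) = y := Equiv.congr_fun hcf y
    rw [Homeomorph.symm_apply_eq, Homeomorph.symm_apply_eq] at h2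
    exact hy h2
  · obtain ⟨f, hf, hgf⟩ := Braid.exists_restriction hg (r := 1 / 2) (by norm_num) hgs
    obtain ⟨-, a, -, hat, haf⟩ := h.superset hf
    rw [← hgf] at haf
    have : a = g := Homeomorph.ext fun x => Equiv.congr_fun haf x
    exact hwild (this ▸ hat)
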